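/- Let n ≥ 2 be an integer, α ∈ (0,n), β > 0 and A > 0, and assume α = β. Then either there exists a mass m_* = m_*(n,α,β,A) > 0 such that B[m] is an L¹-local minimizer at mass m of E_{α,β,A} for every 0 < m < m_* and B[m] is not an L¹-local minimizer at mass m for every m > m_*, or else B[m] is an L¹-local minimizer at mass m of E_{α,β,A} for every m > 0. -/

import Mathlib

open MeasureTheory Metric Filter ENNReal

noncomputable section

/-- The Lebesgue density of `E` at `x` equals `d`. -/
def HasDensity {n : ℕ} (E : Set (EuclideanSpace ℝ (Fin n)))
    (x : EuclideanSpace ℝ (Fin n)) (d : ℝ) : Prop :=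
  Filter.Tendsto
    (fun r : ℝ => (volume (E ∩ Metric.ball x r)).toReal / (volume (Metric.ball x r)).toReal)
    (nhdsWithin 0 (Set.Ioi 0)) (nhds d)

/-- The essential boundary of `E`: points where `E` has neither density 0 nor density 1. -/
def essBoundary {n : ℕ} (E : Set (EuclideanSpace ℝ (Fin n))) :
    Set (EuclideanSpace ℝ (Fin n)) :=
  {x | ¬ HasDensity E x 0 ∧ ¬ HasDensity E x 1}

/-- The perimeter of `E`: the `(n-1)`-dimensional Hausdorff measure of the essential
boundary of `E`. -/
def perimeter {n : ℕ} (E : Set (EuclideanSpace ℝ (Fin n))) : ℝ≥0∞ :=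
  μH[(n : ℝ) - 1] (essBoundary E)

/-- The Riesz energy `V_α(E) = ∫_{E×E} |x-y|^(α-n) dx dy`. -/
def rieszEnergy {n : ℕ} (α : ℝ) (E : Set (EuclideanSpace ℝ (Fin n))) : ℝ≥0∞ :=
  ∫⁻ x in E, ∫⁻ y in E, ENNReal.ofReal (‖x - y‖ ^ (α - (n : ℝ)))

/-- The potential energy `U_{β,A}(E) = A ∫_E |x|^β dx`. -/
def potEnergy {n : ℕ} (β A : ℝ) (E : Set (EuclideanSpace ℝ (Fin n))) : ℝ≥0∞ :=
  ∫⁻ x in E, ENNReal.ofReal (A * ‖x‖ ^ β)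

/-- The total energy `E_{α,β,A} = P + V_α + U_{β,A}`. -/
def totalEnergy {n : ℕ} (α β A : ℝ) (E : Set (EuclideanSpace ℝ (Fin n))) : ℝ≥0∞ :=
  perimeter E + rieszEnergy α E + potEnergy β A E

/-- `E` is a minimizer of `E_{α,β,A}` at mass `m`. -/
def IsMinimizer {n : ℕ} (α β A m : ℝ) (E : Set (EuclideanSpace ℝ (Fin n))) : Prop :=
  MeasurableSet E ∧ volume E = ENNReal.ofReal m ∧
    ∀ F : Set (EuclideanSpace ℝ (Fin n)), MeasurableSet F → volume F = ENNReal.ofReal m →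
      totalEnergy α β A E ≤ totalEnergy α β A F

/-- The unit ball of `ℝⁿ` centered at the origin. -/
def unitBall (n : ℕ) : Set (EuclideanSpace ℝ (Fin n)) := Metric.ball 0 1

/-- `B[m]`: the open ball centered at `0` with volume `m`. -/
def ballOfVolume (n : ℕ) (m : ℝ) : Set (EuclideanSpace ℝ (Fin n)) :=
  Metric.ball 0 ((m / (volume (unitBall n)).toReal) ^ (1 / (n : ℝ)))

/-- `E` is an `L¹`-local minimizer of `E_{α,β,A}` at mass `m`: there is `ε > 0` such that
`E` minimizes the energy among sets of the same mass within symmetric difference `< ε`. -/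
def IsL1LocalMin {n : ℕ} (α β A m : ℝ) (E : Set (EuclideanSpace ℝ (Fin n))) : Prop :=
  MeasurableSet E ∧ volume E = ENNReal.ofReal m ∧
    ∃ ε : ℝ, 0 < ε ∧ ∀ F : Set (EuclideanSpace ℝ (Fin n)), MeasurableSet F →
      volume F = ENNReal.ofReal m → volume (symmDiff E F) < ENNReal.ofReal ε →
        totalEnergy α β A E ≤ totalEnergy α β A F

section
open scoped Pointwise

/-- Euclidean space. -/
abbrev Eu (n : ℕ) := EuclideanSpace ℝ (Fin n)

/-! ### Module L : scaling -/

theorem HasDensity_smul {n : ℕ} (F : Set (Eu n)) (x : Eu n)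
    (d : ℝ) {R : ℝ} (hR : 0 < R) (h : HasDensity F x d) : HasDensity (R • F) (R • x) d := by
  unfold HasDensity at *
  have hmul : Tendsto (fun r : ℝ => R⁻¹ * r) (nhdsWithin 0 (Set.Ioi 0)) (nhdsWithin 0 (Set.Ioi 0)) := by
    apply tendsto_nhdsWithin_of_tendsto_nhds_of_eventually_within
    · have : Tendsto (fun r : ℝ => R⁻¹ * r) (nhds 0) (nhds (R⁻¹ * 0)) := (continuous_const.mul continuous_id).tendsto 0
      rw [mul_zero] at this
      exact this.mono_left nhdsWithin_le_nhds
    · filter_upwards [self_mem_nhdsWithin] with r hr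
      exact mul_pos (inv_pos.2 hR) hr
  refine (h.comp hmul).congr' ?_
  filter_upwards [self_mem_nhdsWithin] with r hr
  have hb : Metric.ball (R • x) r = R • Metric.ball x (R⁻¹ * r) := by
    rw [_root_.smul_ball hR.ne', Real.norm_of_nonneg hR.le, mul_inv_cancel_left₀ hR.ne']
  simp only [Function.comp]
  rw [hb, ← Set.smul_set_inter₀ hR.ne', Measure.addHaar_smul, Measure.addHaar_smul,
    ENNReal.toReal_mul, ENNReal.toReal_mul, mul_div_mul_left]
  rw [ENNReal.toReal_ofReal (abs_nonneg _)]
  positivity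

theorem HasDensity_smul_iff {n : ℕ} (F : Set (Eu n)) (x : Eu n)
    (d : ℝ) {R : ℝ} (hR : 0 < R) : HasDensity (R • F) (R • x) d ↔ HasDensity F x d := by
  refine ⟨fun h => ?_, HasDensity_smul F x d hR⟩
  have := HasDensity_smul _ _ d (inv_pos.2 hR) h
  rwa [inv_smul_smul₀ hR.ne', inv_smul_smul₀ hR.ne'] at this

theorem essBoundary_smul {n : ℕ} (F : Set (Eu n)) {R : ℝ} (hR : 0 < R) :
    essBoundary (R • F) = R • essBoundary F := by
  ext x
  obtain ⟨y, rfl⟩ : ∃ y, x = R • y := ⟨R⁻¹ • x, (smul_inv_smul₀ hR.ne' x).symm⟩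
  rw [Set.smul_mem_smul_set_iff₀ hR.ne']
  simp only [essBoundary, Set.mem_ofPred_eq, HasDensity_smul_iff F y _ hR]

theorem perimeter_smul {n : ℕ} (hn : 2 ≤ n) (F : Set (Eu n)) {R : ℝ} (hR : 0 < R) :
    perimeter (R • F) = ENNReal.ofReal (R ^ ((n:ℝ) - 1)) * perimeter F := by
  have h1 : (0:ℝ) ≤ (n:ℝ) - 1 := by
    have : (2:ℝ) ≤ n := by exact_mod_cast hn
    linarith
  unfold perimeter
  rw [essBoundary_smul F hR, Measure.hausdorffMeasure_smul₀ h1 hR.ne', ENNReal.smul_def, smul_eq_mul]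
  congr 1
  rw [ENNReal.coe_rpow_of_nonneg _ h1, ← ENNReal.ofReal_rpow_of_pos hR]
  congr 1
  rw [← ENNReal.ofReal_coe_nnreal]
  simp [abs_of_pos hR]

theorem setLIntegral_smul_set {n : ℕ} (F : Set (Eu n)) {R : ℝ} (hR : 0 < R)
    (f : Eu n → ℝ≥0∞) :
    ∫⁻ x in R • F, f x = ENNReal.ofReal (R ^ n) * ∫⁻ x in F, f (R • x) := by
  have he : MeasurableEmbedding (fun x : Eu n => R • x) :=
    (Homeomorph.smulOfNeZero R hR.ne').measurableEmbedding
  have hmap : Measure.map (fun x : Eu n => R • x) volume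
      = ENNReal.ofReal (|(R ^ n)⁻¹|) • volume := by
    have := Measure.map_addHaar_smul (volume : Measure (Eu n)) hR.ne'
    simpa using this
  have h1 : ∫⁻ x in F, f (R • x) = ∫⁻ x in R • F, f x ∂(Measure.map (fun x : Eu n => R • x) volume) := by
    rw [he.restrict_map, he.lintegral_map]
    congr 2
    ext x
    simp [Set.smul_mem_smul_set_iff₀ hR.ne']
  rw [h1, hmap, Measure.restrict_smul, lintegral_smul_measure, smul_eq_mul, ← mul_assoc,
    ← ENNReal.ofReal_mul (by positivity), abs_of_pos (by positivity), mul_inv_cancel₀ (by positivity)]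
  simp

theorem rieszEnergy_smul {n : ℕ} (α : ℝ) (F : Set (Eu n)) {R : ℝ} (hR : 0 < R) :
    rieszEnergy α (R • F) = ENNReal.ofReal (R ^ ((n:ℝ) + α)) * rieszEnergy α F := by
  unfold rieszEnergy
  rw [setLIntegral_smul_set F hR]
  have : ∀ x : Eu n, ∫⁻ y in R • F, ENNReal.ofReal (‖R • x - y‖ ^ (α - (n:ℝ)))
      = ENNReal.ofReal (R ^ α) * ∫⁻ y in F, ENNReal.ofReal (‖x - y‖ ^ (α - (n:ℝ))) := by
    intro x
    rw [setLIntegral_smul_set F hR]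
    have : ∀ y : Eu n, ENNReal.ofReal (‖R • x - R • y‖ ^ (α - (n:ℝ)))
        = ENNReal.ofReal (R ^ (α - n)) * ENNReal.ofReal (‖x - y‖ ^ (α - (n:ℝ))) := by
      intro y
      rw [← ENNReal.ofReal_mul (by positivity), ← smul_sub, norm_smul, Real.norm_of_nonneg hR.le,
        Real.mul_rpow hR.le (norm_nonneg _)]
    simp_rw [this]
    rw [lintegral_const_mul' _ _ ENNReal.ofReal_ne_top, ← mul_assoc, ← ENNReal.ofReal_mul (by positivity)]
    congr 2
    rw [← Real.rpow_natCast, ← Real.rpow_add hR]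
    congr 1; ring
  simp_rw [this]
  rw [lintegral_const_mul' _ _ ENNReal.ofReal_ne_top, ← mul_assoc, ← ENNReal.ofReal_mul (by positivity)]
  congr 2
  rw [← Real.rpow_natCast, ← Real.rpow_add hR]

theorem potEnergy_smul {n : ℕ} (β A : ℝ) (F : Set (Eu n)) {R : ℝ} (hR : 0 < R) :
    potEnergy β A (R • F) = ENNReal.ofReal (R ^ ((n:ℝ) + β)) * potEnergy β A F := by
  unfold potEnergy
  rw [setLIntegral_smul_set F hR]
  have : ∀ y : Eu n, ENNReal.ofReal (A * ‖R • y‖ ^ β)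
        = ENNReal.ofReal (R ^ β) * ENNReal.ofReal (A * ‖y‖ ^ β) := by
    intro y
    rw [← ENNReal.ofReal_mul (by positivity), norm_smul, Real.norm_of_nonneg hR.le,
      Real.mul_rpow hR.le (norm_nonneg _)]
    congr 1; ring
  simp_rw [this]
  rw [lintegral_const_mul' _ _ ENNReal.ofReal_ne_top, ← mul_assoc, ← ENNReal.ofReal_mul (by positivity)]
  congr 2
  rw [← Real.rpow_natCast, ← Real.rpow_add hR]

/-- Bulk energy. -/
def bulk {n : ℕ} (α A : ℝ) (F : Set (Eu n)) : ℝ≥0∞ :=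
  rieszEnergy α F + potEnergy α A F

theorem totalEnergy_smul {n : ℕ} (hn : 2 ≤ n) (α A : ℝ) (F : Set (Eu n)) {R : ℝ} (hR : 0 < R) :
    totalEnergy α α A (R • F) = ENNReal.ofReal (R ^ ((n:ℝ) - 1)) *
      (perimeter F + ENNReal.ofReal (R ^ (1 + α)) * bulk α A F) := by
  unfold totalEnergy bulk
  rw [perimeter_smul hn F hR, rieszEnergy_smul α F hR, potEnergy_smul α A F hR, mul_add, ← mul_assoc,
    ← ENNReal.ofReal_mul (by positivity), ← Real.rpow_add hR, mul_add, add_assoc]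
  ring_nf

/-- rescaled local minimality of the unit ball. -/
def LM (n : ℕ) (α A t : ℝ) : Prop :=
  ∃ ε : ℝ, 0 < ε ∧ ∀ F : Set (Eu n), MeasurableSet F →
    volume F = volume (unitBall n) → volume (symmDiff (unitBall n) F) < ENNReal.ofReal ε →
    perimeter (unitBall n) + ENNReal.ofReal t * bulk α A (unitBall n)
      ≤ perimeter F + ENNReal.ofReal t * bulk α A F

def massRadius (n : ℕ) (m : ℝ) : ℝ := (m / (volume (unitBall n)).toReal) ^ (1 / (n : ℝ))

theorem unitBall_vol_pos (n : ℕ) : 0 < (volume (unitBall n)).toReal := by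
  apply ENNReal.toReal_pos
  · exact (Metric.measure_ball_pos volume _ one_pos).ne'
  · exact measure_ball_lt_top.ne

theorem unitBall_vol_ne_top (n : ℕ) : volume (unitBall n) ≠ ⊤ := measure_ball_lt_top.ne

theorem massRadius_pos (n : ℕ) {m : ℝ} (hm : 0 < m) : 0 < massRadius n m :=
  Real.rpow_pos_of_pos (div_pos hm (unitBall_vol_pos n)) _

theorem massRadius_pow {n : ℕ} (hn : 2 ≤ n) {m : ℝ} (hm : 0 < m) :
    massRadius n m ^ n * (volume (unitBall n)).toReal = m := by
  unfold massRadius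
  have hn0 : (n:ℝ) ≠ 0 := by positivity
  have hv := unitBall_vol_pos n
  rw [← Real.rpow_natCast, ← Real.rpow_mul (by positivity), one_div, inv_mul_cancel₀ hn0, Real.rpow_one]
  field_simp

theorem ballOfVolume_eq (n : ℕ) {m : ℝ} (hm : 0 < m) : ballOfVolume n m = massRadius n m • unitBall n := by
  have h := massRadius_pos n hm
  unfold ballOfVolume unitBall
  rw [_root_.smul_ball h.ne', smul_zero, Real.norm_of_nonneg h.le, mul_one]
  rfl

theorem symmDiff_smul₀ {n : ℕ} (F G : Set (Eu n)) {R : ℝ} (hR : 0 < R) :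
    symmDiff (R • F) (R • G) = R • symmDiff F G := by
  exact (Set.smul_set_symmDiff₀ hR.ne').symm

theorem volume_smul_set {n : ℕ} (F : Set (Eu n)) {R : ℝ} (hR : 0 < R) :
    volume (R • F) = ENNReal.ofReal (R ^ n) * volume F := by
  rw [Measure.addHaar_smul]
  simp [abs_of_pos hR]

theorem isL1LocalMin_iff {n : ℕ} (hn : 2 ≤ n) (α A : ℝ) {m : ℝ} (hm : 0 < m) :
    IsL1LocalMin α α A m (ballOfVolume n m) ↔ LM n α A (massRadius n m ^ (1 + α)) := by
  have hR := massRadius_pos n hm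
  have hRm := massRadius_pow hn hm
  rw [ballOfVolume_eq n hm]
  set R := massRadius n m
  have hRn : 0 < R ^ n := by positivity
  have hm' : ENNReal.ofReal m = ENNReal.ofReal (R ^ n) * volume (unitBall n) := by
    rw [← hRm, ENNReal.ofReal_mul hRn.le, ENNReal.ofReal_toReal (unitBall_vol_ne_top n)]
  have hRn0 : ENNReal.ofReal (R ^ n) ≠ 0 := by simpa using hRn
  have hRp : ENNReal.ofReal (R ^ ((n:ℝ) - 1)) ≠ 0 := by
    have : 0 < R ^ ((n:ℝ) - 1) := by positivity
    simpa using this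
  unfold IsL1LocalMin LM
  constructor
  · rintro ⟨-, -, ε, hε, H⟩
    refine ⟨ε / R ^ n, by positivity, fun F hF hFv hFs => ?_⟩
    have := H (R • F) (hF.const_smul₀ R) ?_ ?_
    · rw [totalEnergy_smul hn _ _ _ hR, totalEnergy_smul hn _ _ _ hR] at this
      exact (ENNReal.mul_le_mul_iff_right hRp ENNReal.ofReal_ne_top).1 this
    · rw [volume_smul_set F hR, hFv, hm']
    · rw [symmDiff_smul₀ _ _ hR, volume_smul_set _ hR]
      calc _ < ENNReal.ofReal (R ^ n) * ENNReal.ofReal (ε / R ^ n) :=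
            (ENNReal.mul_lt_mul_iff_right hRn0 ENNReal.ofReal_ne_top).2 hFs
        _ = _ := by rw [← ENNReal.ofReal_mul hRn.le, mul_div_cancel₀ _ hRn.ne']
  · rintro ⟨ε, hε, H⟩
    refine ⟨(measurableSet_ball).const_smul₀ R, ?_, R ^ n * ε, by positivity, fun F hF hFv hFs => ?_⟩
    · rw [volume_smul_set _ hR, hm']
    · obtain ⟨G, rfl⟩ : ∃ G, F = R • G := ⟨R⁻¹ • F, (smul_inv_smul₀ hR.ne' F).symm⟩
      have hG : MeasurableSet G := by
        have := hF.const_smul₀ R⁻¹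
        rwa [inv_smul_smul₀ hR.ne'] at this
      rw [totalEnergy_smul hn _ _ _ hR, totalEnergy_smul hn _ _ _ hR]
      refine mul_le_mul_right (H G hG ?_ ?_) _
      · rw [volume_smul_set _ hR, hm'] at hFv
        exact (ENNReal.mul_right_inj hRn0 ENNReal.ofReal_ne_top).1 hFv
      · rw [symmDiff_smul₀ _ _ hR, volume_smul_set _ hR, ENNReal.ofReal_mul hRn.le] at hFs
        exact (ENNReal.mul_lt_mul_iff_right hRn0 ENNReal.ofReal_ne_top).1 hFs

theorem LM_convex {n : ℕ} {α A t₀ t₁ t : ℝ} (h0 : LM n α A t₀) (h1 : LM n α A t₁)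
    (ht0 : 0 ≤ t₀) (h0t : t₀ ≤ t) (ht1 : t ≤ t₁) : LM n α A t := by
  rcases eq_or_lt_of_le (h0t.trans ht1) with h | h
  · have : t = t₀ := by linarith
    rwa [this]
  obtain ⟨ε, hε, H⟩ := h0
  obtain ⟨ε', hε', H'⟩ := h1
  refine ⟨min ε ε', lt_min hε hε', fun F hF hFv hFs => ?_⟩
  have a := H F hF hFv (hFs.trans_le (ENNReal.ofReal_le_ofReal (min_le_left _ _)))
  have b := H' F hF hFv (hFs.trans_le (ENNReal.ofReal_le_ofReal (min_le_right _ _)))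
  obtain ⟨s, hs0, hs1, hs⟩ : ∃ s : ℝ, 0 ≤ s ∧ s ≤ 1 ∧ t = (1 - s) * t₀ + s * t₁ := by
    refine ⟨(t - t₀) / (t₁ - t₀), div_nonneg (by linarith) (by linarith), ?_, ?_⟩
    · rw [div_le_one (by linarith)]; linarith
    · have : t₁ - t₀ ≠ 0 := by linarith
      field_simp; ring
  have key : ∀ p q : ℝ≥0∞, p + ENNReal.ofReal t * q
      = ENNReal.ofReal (1 - s) * (p + ENNReal.ofReal t₀ * q) + ENNReal.ofReal s * (p + ENNReal.ofReal t₁ * q) := by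
    intro p q
    rw [hs, ENNReal.ofReal_add (mul_nonneg (by linarith) ht0) (mul_nonneg hs0 (by linarith)),
      ENNReal.ofReal_mul (by linarith), ENNReal.ofReal_mul hs0]
    have : p = ENNReal.ofReal (1 - s) * p + ENNReal.ofReal s * p := by
      rw [← add_mul, ← ENNReal.ofReal_add (by linarith) hs0]; simp
    nth_rewrite 1 [this]
    ring
  rw [key, key]
  gcongr

theorem potEnergy_unitBall_le {n : ℕ} {α A : ℝ} (hα : 0 < α) (hA : 0 < A)
    (F : Set (Eu n)) (hF : MeasurableSet F) (hFv : volume F = volume (unitBall n)) :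
    potEnergy α A (unitBall n) ≤ potEnergy α A F := by
  unfold potEnergy
  have hB : MeasurableSet (unitBall n) := measurableSet_ball
  set f := fun x : Eu n => ENNReal.ofReal (A * ‖x‖ ^ α) with hf
  rw [← lintegral_inter_add_sdiff f (unitBall n) hF, ← lintegral_inter_add_sdiff f F hB, Set.inter_comm F]
  refine add_le_add le_rfl ?_
  have hd : volume (unitBall n \ F) = volume (F \ unitBall n) := by
    have h1 := measure_inter_add_sdiff (μ := volume) (unitBall n) hF
    have h2 := measure_inter_add_sdiff (μ := volume) F hB
    rw [Set.inter_comm, hFv, ← h1] at h2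
    have hfin : volume (unitBall n ∩ F) ≠ ⊤ :=
      ((measure_mono Set.inter_subset_left).trans_lt (unitBall_vol_ne_top n).lt_top).ne
    exact ((ENNReal.add_right_inj hfin).1 h2).symm
  calc ∫⁻ x in unitBall n \ F, f x ≤ ∫⁻ x in unitBall n \ F, ENNReal.ofReal A := by
        apply setLIntegral_mono' (hB.diff hF)
        intro x hx
        apply ENNReal.ofReal_le_ofReal
        have : ‖x‖ ≤ 1 := by
          have := hx.1
          simp only [unitBall, mem_ball_zero_iff] at this
          exact this.le
        have := Real.rpow_le_one (norm_nonneg x) this hα.le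
        nlinarith
    _ = ∫⁻ x in F \ unitBall n, ENNReal.ofReal A := by simp [hd]
    _ ≤ _ := by
        apply setLIntegral_mono' (hF.diff hB)
        intro x hx
        apply ENNReal.ofReal_le_ofReal
        have : 1 ≤ ‖x‖ := by
          have := hx.2
          simp only [unitBall, mem_ball_zero_iff, not_lt] at this
          exact this
        have := Real.one_le_rpow this hα.le
        nlinarith

/-- The core local isoperimetric statement. -/
def CoreStatement (n : ℕ) (α : ℝ) : Prop :=
  ∃ ε : ℝ, 0 < ε ∧ ∃ c : ℝ, 0 < c ∧ ∀ F : Set (Eu n), MeasurableSet F →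
    volume F = volume (unitBall n) → volume (symmDiff (unitBall n) F) < ENNReal.ofReal ε →
    perimeter (unitBall n) ≤ perimeter F ∧
    perimeter (unitBall n) + ENNReal.ofReal c * rieszEnergy α (unitBall n)
      ≤ perimeter F + ENNReal.ofReal c * rieszEnergy α F

theorem final_of_core {n : ℕ} (hn : 2 ≤ n) {α A : ℝ} (hα : 0 < α) (hA : 0 < A) (hc : CoreStatement n α) :
    (∃ mstar : ℝ, 0 < mstar ∧
      (∀ m, 0 < m → m < mstar → IsL1LocalMin α α A m (ballOfVolume n m)) ∧
      (∀ m, mstar < m → ¬ IsL1LocalMin α α A m (ballOfVolume n m))) ∨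
    (∀ m : ℝ, 0 < m → IsL1LocalMin α α A m (ballOfVolume n m)) := by
  obtain ⟨ε, hε, c, hc, H⟩ := hc
  have hLM0 : LM n α A 0 := by
    refine ⟨ε, hε, fun F hF hFv hFs => ?_⟩
    simpa using (H F hF hFv hFs).1
  have hLMc : LM n α A c := by
    refine ⟨ε, hε, fun F hF hFv hFs => ?_⟩
    have h1 := (H F hF hFv hFs).2
    have h2 := potEnergy_unitBall_le hα hA F hF hFv
    unfold bulk
    rw [mul_add, mul_add, ← add_assoc, ← add_assoc]
    gcongr
  set T : ℝ → ℝ := fun m => massRadius n m ^ (1 + α) with hT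
  have hn0 : (0:ℝ) < n := by positivity
  have hTmono : ∀ m m', 0 < m → m ≤ m' → T m ≤ T m' := by
    intro m m' hm hmm
    have := unitBall_vol_pos n
    simp only [hT, massRadius]
    gcongr
  have hdown : ∀ m m', 0 < m → m ≤ m' → IsL1LocalMin α α A m' (ballOfVolume n m') →
      IsL1LocalMin α α A m (ballOfVolume n m) := by
    intro m m' hm hmm h
    rw [isL1LocalMin_iff hn α A (hm.trans_le hmm)] at h
    rw [isL1LocalMin_iff hn α A hm]
    exact LM_convex hLM0 h le_rfl (by have := massRadius_pos n hm; positivity) (hTmono m m' hm hmm)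
  have hsmall : ∃ m, 0 < m ∧ IsL1LocalMin α α A m (ballOfVolume n m) := by
    set R : ℝ := c ^ (1 / (1 + α)) with hRdef
    have hR : 0 < R := by positivity
    have hv := unitBall_vol_pos n
    have hm : 0 < R ^ n * (volume (unitBall n)).toReal := by positivity
    refine ⟨_, hm, (isL1LocalMin_iff hn α A hm).2 ?_⟩
    have : massRadius n (R ^ n * (volume (unitBall n)).toReal) = R := by
      unfold massRadius
      rw [mul_div_cancel_right₀ _ hv.ne', ← Real.rpow_natCast, ← Real.rpow_mul hR.le,
        mul_one_div_cancel hn0.ne', Real.rpow_one]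
    rw [this, hRdef, ← Real.rpow_mul hc.le, one_div, inv_mul_cancel₀ (by positivity), Real.rpow_one]
    exact hLMc
  obtain ⟨m0, hm0, hm0L⟩ := hsmall
  by_cases hall : ∀ m : ℝ, 0 < m → IsL1LocalMin α α A m (ballOfVolume n m)
  · exact Or.inr hall
  left
  push Not at hall
  obtain ⟨m1, hm1, hm1L⟩ := hall
  set S : Set ℝ := {m | 0 < m ∧ IsL1LocalMin α α A m (ballOfVolume n m)} with hS
  have hbdd : BddAbove S := by
    refine ⟨m1, fun m hm => ?_⟩
    by_contra hlt
    exact hm1L (hdown m1 m hm1 (not_le.1 hlt).le hm.2)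
  refine ⟨sSup S, hm0.trans_le (le_csSup hbdd ⟨hm0, hm0L⟩), ?_, ?_⟩
  · intro m hm hms
    obtain ⟨m', hm', hlt⟩ := exists_lt_of_lt_csSup (s := S) ⟨m0, hm0, hm0L⟩ hms
    exact hdown m m' hm hlt.le hm'.2
  · intro m hms hL
    have hmpos : 0 < m := (hm0.trans_le (le_csSup hbdd ⟨hm0, hm0L⟩)).trans hms
    exact absurd (le_csSup hbdd ⟨hmpos, hL⟩) (not_le.2 hms)

/-! ### Module A : the constant kappa and orthonormal frames -/

/-- The constant relating Hausdorff and Lebesgue measure on `ℝᵏ`. -/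
def kap (k : ℕ) : NNReal :=
  Measure.addHaarScalarFactor (μH[(k:ℝ)] : Measure (Eu k)) volume

theorem kap_pos (k : ℕ) : 0 < kap k := Measure.addHaarScalarFactor_pos_of_isAddHaarMeasure _ _

theorem hausdorff_eq_kap (k : ℕ) (s : Set (Eu k)) :
    (μH[(k:ℝ)] : Measure (Eu k)) s = (kap k : ℝ≥0∞) * volume s := by
  have h := Measure.isAddLeftInvariant_eq_smul (μH[(k:ℝ)] : Measure (Eu k)) volume
  rw [h]; rfl

/-- frames -/
abbrev Frame (k : ℕ) := WithLp 2 (ℝ × Eu k) ≃ₗᵢ[ℝ] Eu (k+1)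

def Frame.dir {k : ℕ} (Ψ : Frame k) : Eu (k+1) := Ψ (WithLp.toLp 2 (1, 0))

/-- coordinates map of a frame -/
def Frame.map {k : ℕ} (Ψ : Frame k) (p : ℝ × Eu k) : Eu (k+1) :=
  Ψ (WithLp.toLp 2 p)

def Frame.fst {k : ℕ} (Ψ : Frame k) (x : Eu (k+1)) : ℝ := (Ψ.symm x).fst
def Frame.snd {k : ℕ} (Ψ : Frame k) (x : Eu (k+1)) : Eu k := (Ψ.symm x).snd

theorem exists_frame {k : ℕ} (e : Eu (k+1)) (he : ‖e‖ = 1) :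
    ∃ Ψ : Frame k, Ψ.dir = e := by
  have hd : Module.finrank ℝ (WithLp 2 (ℝ × Eu k)) = Module.finrank ℝ (Eu (k+1)) := by
    rw [(WithLp.linearEquiv 2 ℝ (ℝ × Eu k)).finrank_eq]
    simp [add_comm]
  let Ψ₀ : Frame k := (stdOrthonormalBasis ℝ _).equiv (stdOrthonormalBasis ℝ _) (finCongr hd)
  set v := Ψ₀ (WithLp.toLp 2 (1, 0)) with hv
  have hvn : ‖v‖ = 1 := by
    rw [hv, LinearIsometryEquiv.norm_map, WithLp.prod_norm_eq_of_L2]; simp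
  refine ⟨Ψ₀.trans (Submodule.reflection (Submodule.span ℝ {v - e})ᗮ), ?_⟩
  unfold Frame.dir
  rw [LinearIsometryEquiv.trans_apply]
  exact Submodule.reflection_sub (hvn.trans he.symm)

section frame
variable {k : ℕ} (Ψ : Frame k)

theorem Frame.map_fst_snd (x) : Ψ.map (Ψ.fst x, Ψ.snd x) = x := by
  unfold Frame.map Frame.fst Frame.snd
  exact Ψ.apply_symm_apply x

@[simp] theorem Frame.fst_map (p) : Ψ.fst (Ψ.map p) = p.1 := by simp [Frame.map, Frame.fst]
@[simp] theorem Frame.snd_map (p) : Ψ.snd (Ψ.map p) = p.2 := by simp [Frame.map, Frame.snd]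

theorem Frame.measurePreserving : MeasurePreserving Ψ.map := by
  have h1 : MeasurePreserving (@WithLp.toLp 2 (ℝ × Eu k)) := WithLp.volume_preserving_toLp _ _
  have h2 : MeasurePreserving Ψ := LinearIsometryEquiv.measurePreserving Ψ
  exact h2.comp h1

theorem Frame.continuous_map : Continuous Ψ.map :=
  Ψ.continuous.comp (WithLp.prod_continuous_toLp 2 _ _)

theorem Frame.continuous_fst : Continuous Ψ.fst :=
  _root_.continuous_fst.comp ((WithLp.prod_continuous_ofLp 2 _ _).comp (LinearIsometryEquiv.symm Ψ).continuous)
theorem Frame.continuous_snd : Continuous Ψ.snd :=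
  _root_.continuous_snd.comp ((WithLp.prod_continuous_ofLp 2 _ _).comp (LinearIsometryEquiv.symm Ψ).continuous)

def Frame.homeo : (ℝ × Eu k) ≃ₜ Eu (k+1) where
  toFun := Ψ.map
  invFun x := (Ψ.fst x, Ψ.snd x)
  left_inv p := by simp
  right_inv x := Ψ.map_fst_snd x
  continuous_toFun := Ψ.continuous_map
  continuous_invFun := Ψ.continuous_fst.prodMk Ψ.continuous_snd

theorem Frame.measurableEmbedding : MeasurableEmbedding Ψ.map := Ψ.homeo.measurableEmbedding

theorem Frame.map_add (p q) : Ψ.map (p + q) = Ψ.map p + Ψ.map q := by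
  simp [Frame.map, WithLp.toLp_add]
theorem Frame.map_sub (p q) : Ψ.map (p - q) = Ψ.map p - Ψ.map q := by
  simp [Frame.map, WithLp.toLp_sub]
theorem Frame.map_smul (c : ℝ) (p) : Ψ.map (c • p) = c • Ψ.map p := by
  simp [Frame.map, WithLp.toLp_smul]

theorem Frame.norm_map (p) : ‖Ψ.map p‖ = Real.sqrt (p.1 ^ 2 + ‖p.2‖ ^ 2) := by
  unfold Frame.map
  rw [LinearIsometryEquiv.norm_map, WithLp.prod_norm_eq_of_L2]; simp

theorem Frame.norm_sq_map (p) : ‖Ψ.map p‖ ^ 2 = p.1 ^ 2 + ‖p.2‖ ^ 2 := by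
  rw [Frame.norm_map, Real.sq_sqrt (by positivity)]

theorem Frame.dir_eq : Ψ.map (1, 0) = Ψ.dir := rfl

theorem Frame.map_eq (t : ℝ) (y) : Ψ.map (t, y) = t • Ψ.dir + Ψ.map (0, y) := by
  rw [← Frame.dir_eq, ← Frame.map_smul, ← Frame.map_add]; simp

theorem Frame.abs_fst_le (p : ℝ × Eu k) : |p.1| ≤ ‖Ψ.map p‖ := by
  apply abs_le_of_sq_le_sq _ (norm_nonneg _)
  rw [Frame.norm_sq_map]; nlinarith [sq_nonneg ‖p.2‖]

theorem Frame.norm_snd_le (p : ℝ × Eu k) : ‖p.2‖ ≤ ‖Ψ.map p‖ := by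
  apply le_of_sq_le_sq _ (norm_nonneg _)
  rw [Frame.norm_sq_map]; nlinarith [sq_nonneg p.1]

theorem Frame.norm_map_le (p : ℝ × Eu k) : ‖Ψ.map p‖ ≤ |p.1| + ‖p.2‖ := by
  apply le_of_sq_le_sq _ (by positivity)
  rw [Frame.norm_sq_map]; nlinarith [sq_abs p.1, mul_nonneg (abs_nonneg p.1) (norm_nonneg p.2)]

theorem Frame.lipschitz_snd : LipschitzWith 1 Ψ.snd := by
  apply LipschitzWith.of_dist_le_mul
  intro x y
  rw [NNReal.coe_one, one_mul, dist_eq_norm, dist_eq_norm]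
  have := Ψ.norm_snd_le ((Ψ.fst x, Ψ.snd x) - (Ψ.fst y, Ψ.snd y))
  rwa [Ψ.map_sub, Ψ.map_fst_snd, Ψ.map_fst_snd] at this

/-- Projection to the hyperplane decreases the measure. -/
theorem Frame.kap_volume_snd_image_le (s : Set (Eu (k+1))) :
    (kap k : ℝ≥0∞) * volume (Ψ.snd '' s) ≤ μH[(k:ℝ)] s := by
  rw [← hausdorff_eq_kap]
  simpa using Ψ.lipschitz_snd.hausdorffMeasure_image_le (d := (k:ℝ)) (by positivity) s

theorem Frame.isometry_plane (t : ℝ) : Isometry (fun y => Ψ.map (t, y)) := by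
  apply Isometry.of_dist_eq
  intro x y
  rw [dist_eq_norm, dist_eq_norm, ← Ψ.map_sub, Ψ.norm_map]
  simp

theorem Frame.hausdorff_plane (t : ℝ) (s : Set (Eu k)) :
    μH[(k:ℝ)] ((fun y => Ψ.map (t, y)) '' s) = (kap k : ℝ≥0∞) * volume s := by
  rw [(Ψ.isometry_plane t).hausdorffMeasure_image (Or.inl (by positivity)), hausdorff_eq_kap]

end frame

/-! ### Module B : perimeter of the ball -/

theorem hasDensity_one_of_mem_ball {n : ℕ} {x : Eu n} (hx : ‖x‖ < 1) :
    HasDensity (unitBall n) x 1 := by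
  unfold HasDensity
  refine tendsto_const_nhds.congr' ?_
  have : ∀ᶠ r : ℝ in nhdsWithin 0 (Set.Ioi 0), r < 1 - ‖x‖ :=
    nhdsWithin_le_nhds (eventually_lt_nhds (by linarith))
  filter_upwards [this, self_mem_nhdsWithin] with r hr hr0
  have h1 : unitBall n ∩ ball x r = ball x r := by
    apply Set.inter_eq_right.2
    apply Metric.ball_subset_ball'
    rw [dist_zero_right]; linarith
  rw [h1, div_self]
  exact (ENNReal.toReal_pos (measure_ball_pos volume x hr0).ne' measure_ball_lt_top.ne).ne'

theorem hasDensity_zero_of_not_mem {n : ℕ} {x : Eu n} (hx : 1 < ‖x‖) :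
    HasDensity (unitBall n) x 0 := by
  unfold HasDensity
  refine tendsto_const_nhds.congr' ?_
  have : ∀ᶠ r : ℝ in nhdsWithin 0 (Set.Ioi 0), r < ‖x‖ - 1 :=
    nhdsWithin_le_nhds (eventually_lt_nhds (by linarith))
  filter_upwards [this, self_mem_nhdsWithin] with r hr hr0
  have h1 : unitBall n ∩ ball x r = ∅ := by
    apply Set.disjoint_iff_inter_eq_empty.1
    apply Metric.ball_disjoint_ball
    rw [dist_zero_left]; linarith
  rw [h1]; simp

theorem essBoundary_unitBall_subset (n : ℕ) : essBoundary (unitBall n) ⊆ sphere 0 1 := by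
  intro x hx
  rw [mem_sphere_zero_iff_norm]
  rcases lt_trichotomy ‖x‖ 1 with h | h | h
  · exact absurd (hasDensity_one_of_mem_ball h) hx.2
  · exact h
  · exact absurd (hasDensity_zero_of_not_mem h) hx.1

/-- normalization is nonexpansive outside the unit ball. -/
theorem normalize_lipschitz {V : Type*} [NormedAddCommGroup V] [InnerProductSpace ℝ V] :
    LipschitzOnWith 1 (fun x : V => ‖x‖⁻¹ • x) {x | 1 ≤ ‖x‖} := by
  apply LipschitzOnWith.of_dist_le_mul
  intro x hx y hy
  rw [NNReal.coe_one, one_mul, dist_eq_norm, dist_eq_norm]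
  simp only [Set.mem_ofPred_eq] at hx hy
  have hx0 : 0 < ‖x‖ := by linarith
  have hy0 : 0 < ‖y‖ := by linarith
  apply le_of_sq_le_sq _ (norm_nonneg _)
  rw [norm_sub_sq_real, norm_sub_sq_real, norm_smul, norm_smul, inner_smul_left, inner_smul_right]
  simp only [norm_inv, norm_norm, map_inv₀, conj_trivial]
  rw [inv_mul_cancel₀ hx0.ne', inv_mul_cancel₀ hy0.ne']
  set c := inner ℝ x y
  have hc : c ≤ ‖x‖ * ‖y‖ := real_inner_le_norm x y
  have e1 : ‖x‖⁻¹ * (‖y‖⁻¹ * c) = c / (‖x‖ * ‖y‖) := by field_simp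
  rw [e1]
  set p := ‖x‖ * ‖y‖ with hp
  have hp1 : 1 ≤ p := by nlinarith
  have h2 : c / p ≤ 1 := by rw [div_le_one (by linarith)]; exact hc
  have h3 : c = c / p * p := by field_simp
  nlinarith [sq_nonneg (‖x‖ - ‖y‖), mul_nonneg (sub_nonneg.2 h2) (sub_nonneg.2 hp1)]

/-- open sector over a subset of the sphere -/
def sector {n : ℕ} (A : Set (Eu n)) : Set (Eu n) :=
  {x | 0 < ‖x‖ ∧ ‖x‖ < 1 ∧ ‖x‖⁻¹ • x ∈ A}

theorem measurable_normalize {n : ℕ} : Measurable (fun x : Eu n => ‖x‖⁻¹ • x) :=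
  (measurable_norm.inv).smul measurable_id

theorem measurableSet_sector {n : ℕ} {A : Set (Eu n)} (hA : MeasurableSet A) :
    MeasurableSet (sector A) := by
  unfold sector
  exact (measurableSet_lt measurable_const measurable_norm).inter
    ((measurableSet_lt measurable_norm measurable_const).inter (measurable_normalize hA))

theorem volume_cone {k : ℕ} (Ψ : Frame k) (s : Set (Eu k)) (hs : MeasurableSet s)
    {c : ℝ} (hc : 0 < c) :
    volume (Ψ.map '' {p | p.1 ∈ Set.Ioo 0 c ∧ p.1⁻¹ • p.2 ∈ s}) =
      ENNReal.ofReal (c ^ (k+1) / (k+1)) * volume s := by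
  have hm : MeasurableSet {p : ℝ × Eu k | p.1 ∈ Set.Ioo 0 c ∧ p.1⁻¹ • p.2 ∈ s} := by
    apply MeasurableSet.inter
    · exact measurable_fst measurableSet_Ioo
    · exact (measurable_fst.inv.smul measurable_snd) hs
  have h1 : volume (Ψ.map '' {p | p.1 ∈ Set.Ioo 0 c ∧ p.1⁻¹ • p.2 ∈ s}) =
      volume {p : ℝ × Eu k | p.1 ∈ Set.Ioo 0 c ∧ p.1⁻¹ • p.2 ∈ s} := by
    rw [← Ψ.measurePreserving.measure_preimage_emb Ψ.measurableEmbedding,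
      Set.preimage_image_eq _ Ψ.measurableEmbedding.injective]
  rw [h1, Measure.volume_eq_prod, Measure.prod_apply hm]
  have h2 : ∀ t : ℝ, volume (Prod.mk t ⁻¹' {p : ℝ × Eu k | p.1 ∈ Set.Ioo 0 c ∧ p.1⁻¹ • p.2 ∈ s})
      = (Set.Ioo 0 c).indicator (fun t => ENNReal.ofReal (t ^ k) * volume s) t := by
    intro t
    by_cases ht : t ∈ Set.Ioo 0 c
    · rw [Set.indicator_of_mem ht, ← volume_smul_set s ht.1]
      congr 1
      ext y
      simp [Set.mem_smul_set_iff_inv_smul_mem₀ ht.1.ne', ht.1, ht.2]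
    · rw [Set.indicator_of_notMem ht]
      convert measure_empty
      · ext y; simp only [Set.mem_preimage, Set.mem_ofPred_eq, Set.mem_empty_iff_false, iff_false, not_and]
        intro h; exact absurd h ht
      · infer_instance
  simp_rw [h2]
  rw [lintegral_indicator measurableSet_Ioo, lintegral_mul_const _ (by fun_prop)]
  congr 1
  rw [← ofReal_integral_eq_lintegral_ofReal]
  · congr 1
    rw [← integral_Ioc_eq_integral_Ioo, ← intervalIntegral.integral_of_le hc.le, integral_pow]
    simp
  · have : IntegrableOn (fun t : ℝ => t ^ k) (Set.Icc 0 c) := (continuous_pow k).continuousOn.integrableOn_Icc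
    exact this.mono_set Set.Ioo_subset_Icc_self
  · filter_upwards [ae_restrict_mem measurableSet_Ioo] with t ht
    exact pow_nonneg ht.1.le k

theorem hausdorff_patch_le {k : ℕ} {A : Set (Eu (k+1))} (hA : MeasurableSet A)
    (hAS : A ⊆ sphere 0 1) {e : Eu (k+1)} (he : ‖e‖ = 1) {c : ℝ} (hc0 : 0 < c) (hc1 : c < 1)
    (hAe : ∀ x ∈ A, ‖x - e‖ ^ 2 ≤ 2 - 2 * c) :
    ENNReal.ofReal (c ^ (k+1) / (k+1)) * μH[(k:ℝ)] A ≤ kap k * volume (sector A) := by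
  obtain ⟨Ψ, hΨ⟩ := exists_frame e he
  have hfst : ∀ x ∈ A, c ≤ Ψ.fst x := by
    intro x hx
    have h1 := hAe x hx
    have hx1 : ‖x‖ = 1 := by simpa using hAS hx
    have h2 : x - e = Ψ.map (Ψ.fst x - 1, Ψ.snd x) := by
      rw [← hΨ, ← Ψ.dir_eq]
      nth_rewrite 1 [← Ψ.map_fst_snd x]
      rw [← Ψ.map_sub]; simp
    have h3 : (Ψ.fst x) ^ 2 + ‖Ψ.snd x‖ ^ 2 = 1 := by
      have := Ψ.norm_sq_map (Ψ.fst x, Ψ.snd x)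
      rw [Ψ.map_fst_snd, hx1] at this
      linarith
    rw [h2, Ψ.norm_sq_map] at h1
    simp only at h1
    nlinarith
  set s : Set (Eu k) := {y | ‖Ψ.map (1, y)‖⁻¹ • Ψ.map (1, y) ∈ A} with hs
  have hsm : MeasurableSet s := by
    have : Continuous (fun y => Ψ.map (1, y)) := Ψ.continuous_map.comp (by fun_prop)
    exact (measurable_normalize.comp this.measurable) hA
  have hnorm : ∀ y, 1 ≤ ‖Ψ.map (1, y)‖ := by
    intro y
    have := Ψ.abs_fst_le (1, y)
    simpa using this
  have hsub : A ⊆ (fun x => ‖x‖⁻¹ • x) '' ((fun y => Ψ.map (1, y)) '' s) := by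
    intro x hx
    have hf := hfst x hx
    have hx1 : ‖x‖ = 1 := by simpa using hAS hx
    have hpos : 0 < Ψ.fst x := by linarith
    have h1 : Ψ.map (1, (Ψ.fst x)⁻¹ • Ψ.snd x) = (Ψ.fst x)⁻¹ • x := by
      nth_rewrite 4 [← Ψ.map_fst_snd x]
      rw [← Ψ.map_smul]
      simp [hpos.ne']
    have h2 : ‖Ψ.map (1, (Ψ.fst x)⁻¹ • Ψ.snd x)‖⁻¹ • Ψ.map (1, (Ψ.fst x)⁻¹ • Ψ.snd x) = x := by
      rw [h1, norm_smul, hx1, smul_smul]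
      simp [abs_of_pos hpos, hpos.ne']
    refine ⟨_, ⟨(Ψ.fst x)⁻¹ • Ψ.snd x, ?_, rfl⟩, h2⟩
    change _ ∈ A
    rwa [h2]
  have hH : μH[(k:ℝ)] A ≤ kap k * volume s := by
    rw [← Ψ.hausdorff_plane 1 s]
    refine (measure_mono hsub).trans ?_
    have := (normalize_lipschitz.mono (s := (fun y => Ψ.map (1, y)) '' s) ?_).hausdorffMeasure_image_le (d := (k:ℝ)) (by positivity)
    · simpa using this
    · rintro _ ⟨y, -, rfl⟩
      exact hnorm y
  have hcone : Ψ.map '' {p | p.1 ∈ Set.Ioo 0 c ∧ p.1⁻¹ • p.2 ∈ s} ⊆ sector A := by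
    rintro _ ⟨⟨t, z⟩, ⟨ht, hz⟩, rfl⟩
    simp only at ht hz
    set y := t⁻¹ • z with hy
    have h1 : Ψ.map (t, z) = t • Ψ.map (1, y) := by
      rw [← Ψ.map_smul]; simp [hy, ht.1.ne']
    have hy1 := hnorm y
    have hzA : ‖Ψ.map (1, y)‖⁻¹ • Ψ.map (1, y) ∈ A := hz
    have hf := hfst _ hzA
    have h2 : Ψ.fst (‖Ψ.map (1, y)‖⁻¹ • Ψ.map (1, y)) = ‖Ψ.map (1, y)‖⁻¹ := by
      rw [← Ψ.map_smul]; simp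
    rw [h2] at hf
    have hN : 0 < ‖Ψ.map (1, y)‖ := by linarith
    refine ⟨?_, ?_, ?_⟩
    · rw [h1, norm_smul]; exact mul_pos (by simpa using ht.1.ne') hN
    · rw [h1, norm_smul, Real.norm_of_nonneg ht.1.le]
      have : t < ‖Ψ.map (1, y)‖⁻¹ := ht.2.trans_le hf
      calc _ < ‖Ψ.map (1, y)‖⁻¹ * ‖Ψ.map (1, y)‖ := by gcongr
        _ = 1 := inv_mul_cancel₀ hN.ne'
    · rw [h1, norm_smul, Real.norm_of_nonneg ht.1.le, smul_smul]
      have : (t * ‖Ψ.map (1, y)‖)⁻¹ * t = ‖Ψ.map (1, y)‖⁻¹ := by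
        have := ht.1.ne'
        field_simp
      rwa [this]
  calc _ ≤ ENNReal.ofReal (c ^ (k+1) / (k+1)) * (kap k * volume s) := by gcongr
    _ = kap k * (ENNReal.ofReal (c ^ (k+1) / (k+1)) * volume s) := by ring
    _ ≤ _ := by
      rw [← volume_cone Ψ s hsm hc0]
      gcongr

theorem hausdorff_sphere_le_aux (k : ℕ) {c : ℝ} (hc0 : 0 < c) (hc1 : c < 1) :
    ENNReal.ofReal (c ^ (k+1) / (k+1)) * μH[(k:ℝ)] (sphere (0 : Eu (k+1)) 1)
      ≤ kap k * volume (unitBall (k+1)) := by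
  set S := sphere (0 : Eu (k+1)) 1 with hS
  haveI : Nonempty S := by
    refine ⟨⟨EuclideanSpace.single 0 1, ?_⟩⟩
    simp [hS]
  set u := TopologicalSpace.denseSeq S
  set D : ℕ → Set (Eu (k+1)) :=
    disjointed (fun i => S ∩ ball (u i : Eu (k+1)) (Real.sqrt (2 - 2 * c))) with hD
  have hsq : 0 < Real.sqrt (2 - 2 * c) := Real.sqrt_pos.2 (by linarith)
  have hDm : ∀ i, MeasurableSet (D i) := by
    apply MeasurableSet.disjointed
    intro i
    exact isClosed_sphere.measurableSet.inter measurableSet_ball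
  have hDsub : ∀ i, D i ⊆ S ∩ ball (u i : Eu (k+1)) (Real.sqrt (2 - 2 * c)) :=
    fun i => disjointed_subset _ i
  have hDdis : Pairwise (Function.onFun Disjoint D) := disjoint_disjointed _
  have hcover : S ⊆ ⋃ i, D i := by
    intro x hx
    rw [hD, iUnion_disjointed]
    obtain ⟨i, hi⟩ := (TopologicalSpace.denseRange_denseSeq S).exists_dist_lt ⟨x, hx⟩ hsq
    exact Set.mem_iUnion.2 ⟨i, hx, hi⟩
  have hpatch : ∀ i, ENNReal.ofReal (c ^ (k+1) / (k+1)) * μH[(k:ℝ)] (D i) ≤ kap k * volume (sector (D i)) := by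
    intro i
    apply hausdorff_patch_le (hDm i) (fun x hx => (hDsub i hx).1) (e := u i) _ hc0 hc1
    · intro x hx
      have h1 := (hDsub i hx).2
      rw [mem_ball, dist_eq_norm] at h1
      have := Real.sq_sqrt (show 0 ≤ 2 - 2 * c by linarith)
      nlinarith [norm_nonneg (x - u i)]
    · have := (u i).2
      simpa [hS] using this
  calc _ ≤ ENNReal.ofReal (c ^ (k+1) / (k+1)) * ∑' i, μH[(k:ℝ)] (D i) := by
        gcongr
        exact (measure_mono hcover).trans (measure_iUnion_le _)
    _ = ∑' i, ENNReal.ofReal (c ^ (k+1) / (k+1)) * μH[(k:ℝ)] (D i) := ENNReal.tsum_mul_left.symm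
    _ ≤ ∑' i, kap k * volume (sector (D i)) := ENNReal.tsum_le_tsum hpatch
    _ = kap k * ∑' i, volume (sector (D i)) := ENNReal.tsum_mul_left
    _ = kap k * volume (⋃ i, sector (D i)) := by
        rw [measure_iUnion _ (fun i => measurableSet_sector (hDm i))]
        intro i j hij
        apply Set.disjoint_left.2
        intro x hx hx'
        exact Set.disjoint_left.1 (hDdis hij) hx.2.2 hx'.2.2
    _ ≤ _ := by
        gcongr
        apply Set.iUnion_subset
        intro i x hx
        simpa [unitBall] using hx.2.1

theorem perimeter_unitBall_le (k : ℕ) :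
    perimeter (unitBall (k+1)) ≤ (kap k : ℝ≥0∞) * ((k+1 : ℕ) * volume (unitBall (k+1))) := by
  unfold perimeter
  have e : (((k+1:ℕ):ℝ) - 1) = k := by push_cast; ring
  rw [e]
  refine (measure_mono (essBoundary_unitBall_subset (k+1))).trans ?_
  set H := μH[(k:ℝ)] (sphere (0 : Eu (k+1)) 1)
  have hlim : Tendsto (fun c : ℝ => ENNReal.ofReal (c ^ (k+1) / (k+1)) * H) (nhdsWithin 1 (Set.Iio 1))
      (nhds (ENNReal.ofReal ((1:ℝ) ^ (k+1) / (k+1)) * H)) := by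
    apply ENNReal.Tendsto.mul_const
    · apply ENNReal.tendsto_ofReal
      have : Continuous (fun c : ℝ => c ^ (k+1) / (k+1)) := by fun_prop
      exact (this.tendsto 1).mono_left nhdsWithin_le_nhds
    · left
      simp only [one_pow, ne_eq, ENNReal.ofReal_eq_zero, not_le]
      positivity
  have hle := le_of_tendsto hlim (b := kap k * volume (unitBall (k+1))) (by
    have : ∀ᶠ c : ℝ in nhdsWithin 1 (Set.Iio 1), 0 < c := nhdsWithin_le_nhds (eventually_gt_nhds one_pos)
    filter_upwards [this, self_mem_nhdsWithin] with c h0 h1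
    exact hausdorff_sphere_le_aux k h0 h1)
  have hk : ((k+1:ℕ):ℝ≥0∞) * ENNReal.ofReal ((1:ℝ) ^ (k+1) / (k+1)) = 1 := by
    rw [← ENNReal.ofReal_natCast, ← ENNReal.ofReal_mul (by positivity)]
    rw [one_pow]
    push_cast
    rw [mul_one_div_cancel (by positivity)]; simp
  calc H = ((k+1:ℕ):ℝ≥0∞) * ENNReal.ofReal ((1:ℝ) ^ (k+1) / (k+1)) * H := by rw [hk, one_mul]
    _ = ((k+1:ℕ):ℝ≥0∞) * (ENNReal.ofReal ((1:ℝ) ^ (k+1) / (k+1)) * H) := by rw [mul_assoc]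
    _ ≤ ((k+1:ℕ):ℝ≥0∞) * (kap k * volume (unitBall (k+1))) := by gcongr
    _ = _ := by ring

/-! ### Module C1 : null sets of bad lines -/

theorem ae_hasDensity {k : ℕ} {F : Set (Eu (k+1))} (hF : MeasurableSet F) :
    ∀ᵐ x, HasDensity F x (F.indicator 1 x) := by
  filter_upwards [Besicovitch.ae_tendsto_measure_inter_div_of_measurableSet volume hF] with x hx
  unfold HasDensity
  have h2 : Tendsto ENNReal.toReal (nhds (F.indicator (1 : Eu (k+1) → ℝ≥0∞) x))
      (nhds (F.indicator (1 : Eu (k+1) → ℝ) x)) := by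
    have : (F.indicator (1 : Eu (k+1) → ℝ≥0∞) x).toReal
        = F.indicator (1 : Eu (k+1) → ℝ) x := by
      by_cases h : x ∈ F <;> simp [h]
    rw [← this]
    apply ENNReal.tendsto_toReal
    by_cases h : x ∈ F <;> simp [h]
  refine (h2.comp hx).congr ?_
  intro r
  simp only [Function.comp, ENNReal.toReal_div]
  rw [Measure.addHaar_closedBall_eq_addHaar_ball]
  congr 2
  apply measure_congr
  have : closedBall x r =ᵐ[volume] ball x r := by
    rw [← ball_union_sphere]
    exact union_ae_eq_left_of_ae_eq_empty (ae_eq_empty.2 (Measure.addHaar_sphere volume x r))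
  exact (ae_eq_refl F).inter this

theorem hasDensity_compl {k : ℕ} {F : Set (Eu (k+1))} (hF : MeasurableSet F)
    {x : Eu (k+1)} {d : ℝ} (h : HasDensity F x d) : HasDensity Fᶜ x (1 - d) := by
  unfold HasDensity at *
  refine (h.const_sub 1).congr' ?_
  filter_upwards [self_mem_nhdsWithin] with r hr
  have hb : 0 < (volume (ball x r)).toReal :=
    ENNReal.toReal_pos (measure_ball_pos volume x hr).ne' measure_ball_lt_top.ne
  have h1 : (volume (ball x r)).toReal = (volume (F ∩ ball x r)).toReal + (volume (Fᶜ ∩ ball x r)).toReal := by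
    have h0 := measure_inter_add_sdiff (μ := volume) (ball x r) hF
    rw [← h0, ENNReal.toReal_add, Set.inter_comm, Set.sdiff_eq, Set.inter_comm (ball x r) Fᶜ]
    · exact ((measure_mono Set.inter_subset_left).trans_lt measure_ball_lt_top).ne
    · exact ((measure_mono Set.sdiff_subset).trans_lt measure_ball_lt_top).ne
  rw [eq_div_iff hb.ne', sub_mul, div_mul_cancel₀ _ hb.ne']
  linarith

theorem hasDensity_compl_iff {k : ℕ} {F : Set (Eu (k+1))} (hF : MeasurableSet F)
    {x : Eu (k+1)} {d : ℝ} : HasDensity Fᶜ x (1 - d) ↔ HasDensity F x d := by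
  refine ⟨fun h => ?_, hasDensity_compl hF⟩
  have := hasDensity_compl hF.compl h
  simpa using this

/-- the small constant -/
def cGMT (k : ℕ) : ℝ := min ((volume (ball (0 : Eu k) 1)).toReal / (4 * 5 ^ (k+1)))
  ((volume (ball (0 : Eu (k+1)) 1)).toReal / 2)

theorem cGMT_pos (k : ℕ) : 0 < cGMT k := by
  unfold cGMT
  have : 0 < (volume (ball (0 : Eu k) 1)).toReal :=
    ENNReal.toReal_pos (measure_ball_pos volume _ one_pos).ne' measure_ball_lt_top.ne
  have : 0 < (volume (ball (0 : Eu (k+1)) 1)).toReal :=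
    ENNReal.toReal_pos (measure_ball_pos volume _ one_pos).ne' measure_ball_lt_top.ne
  positivity

/-- points with small density at scales below `ρ` -/
def smallDens {k : ℕ} (F : Set (Eu (k+1))) (ρ : ℝ) : Set (Eu (k+1)) :=
  {x | ∀ r ∈ Set.Ioo 0 ρ, volume (F ∩ ball x r) ≤ ENNReal.ofReal (cGMT k * r ^ (k+1))}

def badLines {k : ℕ} (F : Set (Eu (k+1))) (Ψ : Frame k) (ρ s a : ℝ) :
    Set (Eu k) :=
  {y | ∃ t ∈ Set.Icc a (a + s/3), Ψ.map (t, y) ∈ smallDens F ρ ∧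
    ∀ t' ∈ Set.Ioo t (t + s), HasDensity F (Ψ.map (t', y)) 1}

theorem volume_badLines {k : ℕ} {F : Set (Eu (k+1))} (hF : MeasurableSet F)
    (Ψ : Frame k) {ρ s : ℝ} (hρ : 0 < ρ) (hs : 0 < s) (a : ℝ) : volume (badLines F Ψ ρ s a) = 0 := by
  set Z := badLines F Ψ ρ s a with hZ
  by_contra hne
  have hB := Besicovitch.ae_tendsto_measure_inter_div (volume : Measure (Eu k)) Z
  have hex : ∃ z0, Tendsto (fun r => volume (Z ∩ closedBall z0 r) / volume (closedBall z0 r))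
      (nhdsWithin 0 (Set.Ioi 0)) (nhds 1) := by
    by_contra hcon
    push Not at hcon
    apply hne
    have : ∀ᵐ x ∂(volume.restrict Z), False := by
      filter_upwards [hB] with x hx using hcon x hx
    rw [ae_iff] at this
    simpa using this
  obtain ⟨z0, hz0⟩ := hex
  -- choose small r
  have hev : ∀ᶠ r in nhdsWithin (0:ℝ) (Set.Ioi 0), (1/2 : ℝ≥0∞) < volume (Z ∩ closedBall z0 r) / volume (closedBall z0 r) :=
    hz0.eventually_const_lt (by simp)
  have hev2 : ∀ᶠ r in nhdsWithin (0:ℝ) (Set.Ioi 0), r < min (ρ/5) (s/3) :=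
    nhdsWithin_le_nhds (eventually_lt_nhds (by positivity))
  obtain ⟨r, hr1, hr2, hr0⟩ := (hev.and (hev2.and self_mem_nhdsWithin)).exists
  have hr0 : 0 < r := hr0
  have hrρ : r < ρ/5 := hr2.trans_le (min_le_left _ _)
  have hrs : r < s/3 := hr2.trans_le (min_le_right _ _)
  set Bk := closedBall z0 r with hBk
  set ω := volume (ball (0 : Eu k) 1) with hω
  have hBvol : volume Bk = ENNReal.ofReal (r ^ k) * ω := by
    rw [hBk, Measure.addHaar_closedBall volume z0 hr0.le]; simp [hω]
  have hBpos : volume Bk ≠ 0 := (measure_closedBall_pos volume z0 hr0).ne'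
  have hBfin : volume Bk ≠ ⊤ := measure_closedBall_lt_top.ne
  have hhalf : (1/2 : ℝ≥0∞) * volume Bk ≤ volume (Z ∩ Bk) := by
    have := (ENNReal.lt_div_iff_mul_lt (Or.inl hBpos) (Or.inl hBfin)).1 hr1
    exact this.le
  -- the set of heights
  set H : Set ℝ := {t | t ∈ Set.Icc a (a + s/3) ∧ ∃ y ∈ Bk, Ψ.map (t, y) ∈ smallDens F ρ ∧
    ∀ t' ∈ Set.Ioo t (t + s), HasDensity F (Ψ.map (t', y)) 1} with hH
  have hHne : H.Nonempty := by
    have : (Z ∩ Bk).Nonempty := by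
      by_contra hem
      rw [Set.not_nonempty_iff_eq_empty] at hem
      rw [hem, measure_empty] at hhalf
      simp [hBpos] at hhalf
    obtain ⟨y, ⟨t, ht, h1, h2⟩, hy⟩ := this
    exact ⟨t, ht, y, hy, h1, h2⟩
  have hHbdd : BddAbove H := ⟨a + s/3, fun t ht => ht.1.2⟩
  set T := sSup H with hT
  obtain ⟨t1, ht1, hlt1⟩ := exists_lt_of_lt_csSup hHne (show T - r < sSup H by linarith)
  have ht1T : t1 ≤ T := le_csSup hHbdd ht1
  obtain ⟨hat1, y1, hy1, hsd1, -⟩ := ht1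
  have hTa : T ≤ a + s/3 := csSup_le hHne (fun t ht => ht.1.2)
  -- F' measurable containing density one points
  obtain ⟨N, hNsub, hNm, hN0⟩ := exists_measurable_superset_of_null
    (show volume {x | ¬ HasDensity F x (F.indicator 1 x)} = 0 from ae_hasDensity hF)
  have hF' : ∀ x, HasDensity F x 1 → x ∈ F ∪ N := by
    intro x hx
    by_contra hxn
    rw [Set.mem_union, not_or] at hxn
    have h1 : HasDensity F x (F.indicator 1 x) := by
      by_contra h; exact hxn.2 (hNsub h)
    rw [Set.indicator_of_notMem hxn.1] at h1
    have := tendsto_nhds_unique hx h1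
    norm_num at this
  set cyl : Set (ℝ × Eu k) := Set.Ioo T (T + r) ×ˢ Bk with hcyl
  have hcylball : Ψ.map '' cyl ⊆ ball (Ψ.map (t1, y1)) (5 * r) := by
    rintro _ ⟨⟨t, z⟩, ⟨ht, hz⟩, rfl⟩
    rw [mem_ball, dist_eq_norm, ← Ψ.map_sub]
    refine (Ψ.norm_map_le _).trans_lt ?_
    simp only at ht hz
    have h1 : |t - t1| < 2 * r := by rw [abs_lt]; constructor <;> linarith [ht.1, ht.2]
    have h2 : ‖z - y1‖ ≤ 2 * r := by
      rw [← dist_eq_norm]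
      have h3 := dist_triangle_right z y1 z0
      rw [hBk, mem_closedBall] at hz hy1
      linarith
    simp only [Prod.mk_sub_mk]
    linarith
  have hslice : ENNReal.ofReal r * ((1/2 : ℝ≥0∞) * volume Bk) ≤ volume (Ψ.map ⁻¹' (F ∪ N) ∩ cyl) := by
    have hm : MeasurableSet (Ψ.map ⁻¹' (F ∪ N) ∩ cyl) :=
      (Ψ.continuous_map.measurable (hF.union hNm)).inter (measurableSet_Ioo.prod measurableSet_closedBall)
    rw [Measure.volume_eq_prod, Measure.prod_apply hm]
    calc ENNReal.ofReal r * ((1/2 : ℝ≥0∞) * volume Bk)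
        = ∫⁻ t in Set.Ioo T (T + r), ((1/2 : ℝ≥0∞) * volume Bk) := by
          rw [setLIntegral_const, Real.volume_Ioo, mul_comm]; simp
      _ ≤ ∫⁻ t in Set.Ioo T (T + r), volume (Prod.mk t ⁻¹' (Ψ.map ⁻¹' (F ∪ N) ∩ cyl)) := by
          apply setLIntegral_mono' measurableSet_Ioo
          intro t ht
          refine hhalf.trans (measure_mono ?_)
          rintro z ⟨⟨tz, htz, hz1, hz2⟩, hzB⟩
          refine ⟨hF' _ (hz2 t ⟨?_, ?_⟩), ht, hzB⟩
          · have : tz ≤ T := le_csSup hHbdd ⟨htz, z, hzB, hz1, hz2⟩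
            linarith [ht.1]
          · linarith [ht.2, htz.1]
      _ ≤ _ := setLIntegral_le_lintegral _ _
  have hupper : volume (Ψ.map ⁻¹' (F ∪ N) ∩ cyl) ≤ ENNReal.ofReal (cGMT k * (5 * r) ^ (k+1)) := by
    refine le_trans ?_ (hsd1 (5 * r) ⟨by positivity, by linarith⟩)
    rw [← Ψ.measurePreserving.measure_preimage_emb Ψ.measurableEmbedding]
    have hN' : volume (Ψ.map ⁻¹' N) = 0 := by
      rw [Ψ.measurePreserving.measure_preimage_emb Ψ.measurableEmbedding, hN0]
    refine (measure_mono (t := Ψ.map ⁻¹' (F ∩ ball (Ψ.map (t1, y1)) (5 * r)) ∪ Ψ.map ⁻¹' N) ?_).trans ?_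
    · rintro p ⟨hp, hpc⟩
      rcases hp with hp | hp
      · exact Or.inl ⟨hp, hcylball ⟨p, hpc, rfl⟩⟩
      · exact Or.inr hp
    · refine (measure_union_le _ _).trans ?_
      rw [hN', add_zero]
  have hfinal := hslice.trans hupper
  have hωfin : ω ≠ ⊤ := measure_ball_lt_top.ne
  have hωpos : 0 < ω.toReal := ENNReal.toReal_pos (measure_ball_pos volume _ one_pos).ne' hωfin
  have e1 : ENNReal.ofReal r * ((1/2 : ℝ≥0∞) * volume Bk) = ENNReal.ofReal (r * (1/2 * (r ^ k * ω.toReal))) := by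
    rw [ENNReal.ofReal_mul hr0.le, ENNReal.ofReal_mul (by norm_num), ENNReal.ofReal_mul (by positivity),
      ENNReal.ofReal_toReal hωfin, hBvol]
    congr 2
    rw [ENNReal.ofReal_div_of_pos (by norm_num)]; simp
  rw [e1, ENNReal.ofReal_le_ofReal_iff (by have := cGMT_pos k; positivity)] at hfinal
  have e2 : cGMT k * (5 * r) ^ (k+1) ≤ r * (1/4 * (r ^ k * ω.toReal)) := by
    have : cGMT k ≤ ω.toReal / (4 * 5 ^ (k+1)) := min_le_left _ _
    calc _ ≤ ω.toReal / (4 * 5 ^ (k+1)) * (5 * r) ^ (k+1) := by gcongr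
      _ = _ := by
        rw [mul_pow]
        field_simp
        ring
  replace hfinal := hfinal.trans e2
  have : 0 < r * (r ^ k * ω.toReal) := by positivity
  nlinarith

/-! ### Module C2 : a.e. line structure -/

theorem exists_neg_frame {k : ℕ} (Ψ : Frame k) : ∃ Ψ' : Frame k, ∀ t y, Ψ'.map (t, y) = Ψ.map (-t, y) := by
  refine ⟨LinearIsometryEquiv.trans Ψ (Submodule.reflection (Submodule.span ℝ {Ψ.dir})ᗮ), fun t y => ?_⟩
  have h1 : Submodule.reflection (Submodule.span ℝ {Ψ.dir})ᗮ Ψ.dir = - Ψ.dir :=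
    Submodule.reflection_orthogonalComplement_singleton_eq_neg _
  have h2 : Submodule.reflection (Submodule.span ℝ {Ψ.dir})ᗮ (Ψ.map (0, y)) = Ψ.map (0, y) := by
    apply Submodule.reflection_mem_subspace_eq_self
    rw [Submodule.mem_orthogonal_singleton_iff_inner_right]
    have := LinearIsometryEquiv.inner_map_map Ψ (WithLp.toLp 2 (1, 0)) (WithLp.toLp 2 (0, y))
    unfold Frame.dir Frame.map
    rw [this]; simp
  have h3 : Frame.map (LinearIsometryEquiv.trans Ψ (Submodule.reflection (Submodule.span ℝ {Ψ.dir})ᗮ)) (t, y)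
      = Submodule.reflection (Submodule.span ℝ {Ψ.dir})ᗮ (Ψ.map (t, y)) := rfl
  rw [h3, Ψ.map_eq t y, Ψ.map_eq (-t) y, _root_.map_add, _root_.map_smul, h1, h2]
  simp

theorem volBall_real {k : ℕ} (x : Eu (k+1)) {r : ℝ} (hr : 0 < r) :
    volume (ball x r) = ENNReal.ofReal (r ^ (k+1)) * volume (ball (0 : Eu (k+1)) 1) := by
  rw [Measure.addHaar_ball_of_pos volume x hr]; simp

theorem smallDens_of_density_zero {k : ℕ} {F : Set (Eu (k+1))}
    {x : Eu (k+1)} (h : HasDensity F x 0) : ∃ m : ℕ, x ∈ smallDens F (1 / ((m:ℝ)+1)) := by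
  set ω := volume (ball (0 : Eu (k+1)) 1) with hω
  have hωfin : ω ≠ ⊤ := measure_ball_lt_top.ne
  have hωpos : 0 < ω.toReal := ENNReal.toReal_pos (measure_ball_pos volume _ one_pos).ne' hωfin
  have hc := cGMT_pos k
  have hev := h.eventually_lt_const (show 0 < cGMT k / ω.toReal by positivity)
  rw [eventually_nhdsWithin_iff, Metric.eventually_nhds_iff] at hev
  obtain ⟨δ, hδ, hev⟩ := hev
  obtain ⟨m, hm⟩ := exists_nat_one_div_lt hδ
  refine ⟨m, fun r hr => ?_⟩
  have h1 := hev (y := r) (by rw [Real.dist_eq, sub_zero, abs_of_pos hr.1]; exact hr.2.trans hm) hr.1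
  rw [volBall_real x hr.1, ENNReal.toReal_mul, ENNReal.toReal_ofReal (pow_nonneg hr.1.le _)] at h1
  have hr1 : 0 < r ^ (k+1) := pow_pos hr.1 _
  rw [div_lt_div_iff₀ (by positivity) hωpos] at h1
  have h2 : (volume (F ∩ ball x r)).toReal < cGMT k * r ^ (k+1) := by
    have : (volume (F ∩ ball x r)).toReal * ω.toReal < (cGMT k * r ^ (k+1)) * ω.toReal := by linarith
    exact lt_of_mul_lt_mul_right this hωpos.le
  rw [← ENNReal.ofReal_toReal (a := volume (F ∩ ball x r))]
  · exact ENNReal.ofReal_le_ofReal h2.le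
  · exact ((measure_mono Set.inter_subset_right).trans_lt measure_ball_lt_top).ne

theorem not_smallDens_of_density_one {k : ℕ} {F : Set (Eu (k+1))}
    {x : Eu (k+1)} (h : HasDensity F x 1) {ρ : ℝ} (hρ : 0 < ρ) : x ∉ smallDens F ρ := by
  intro hx
  set ω := volume (ball (0 : Eu (k+1)) 1) with hω
  have hωfin : ω ≠ ⊤ := measure_ball_lt_top.ne
  have hωpos : 0 < ω.toReal := ENNReal.toReal_pos (measure_ball_pos volume _ one_pos).ne' hωfin
  have hle : cGMT k ≤ ω.toReal / 2 := min_le_right _ _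
  have := le_of_tendsto h (b := 1/2) (by
    filter_upwards [Ioo_mem_nhdsGT hρ] with r hr
    have h1 := hx r hr
    have hr1 : 0 < r ^ (k+1) := pow_pos hr.1 _
    have h2 : (volume (F ∩ ball x r)).toReal ≤ cGMT k * r ^ (k+1) := by
      apply ENNReal.toReal_le_of_le_ofReal _ h1
      have := cGMT_pos k
      positivity
    rw [volBall_real x hr.1, ENNReal.toReal_mul, ENNReal.toReal_ofReal hr1.le,
      div_le_div_iff₀ (by positivity) (by norm_num)]
    nlinarith)
  norm_num at this

theorem isClosed_smallDens {k : ℕ} (F : Set (Eu (k+1))) (ρ : ℝ) :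
    IsClosed (smallDens F ρ) := by
  rw [← isOpen_compl_iff, Metric.isOpen_iff]
  intro x hx
  simp only [smallDens, Set.mem_compl_iff, Set.mem_ofPred_eq, not_forall, not_le] at hx
  obtain ⟨r, hr, hlt⟩ := hx
  -- find smaller radius
  have hmono : Monotone (fun j : ℕ => F ∩ ball x (r - 1/((j:ℝ)+1))) := by
    intro i j hij
    apply Set.inter_subset_inter_right
    apply ball_subset_ball
    have : 1/((j:ℝ)+1) ≤ 1/((i:ℝ)+1) := by
      apply one_div_le_one_div_of_le (by positivity)
      have : (i:ℝ) ≤ j := by exact_mod_cast hij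
      linarith
    linarith
  have hU : ⋃ j : ℕ, F ∩ ball x (r - 1/((j:ℝ)+1)) = F ∩ ball x r := by
    rw [← Set.inter_iUnion]
    congr 1
    ext y
    simp only [Set.mem_iUnion, mem_ball]
    constructor
    · rintro ⟨j, hj⟩
      have : 0 < 1/((j:ℝ)+1) := by positivity
      linarith
    · intro hy
      obtain ⟨j, hj⟩ := exists_nat_one_div_lt (show 0 < r - dist y x by linarith)
      exact ⟨j, by linarith⟩
  have htend := tendsto_measure_iUnion_atTop (μ := volume) hmono
  rw [hU] at htend
  obtain ⟨j, hj⟩ := (htend.eventually_const_lt hlt).exists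
  refine ⟨1/((j:ℝ)+1), by positivity, fun z hz hzs => ?_⟩
  have h1 := hzs r hr
  refine absurd (hj.trans_le ((measure_mono ?_).trans h1)) (lt_irrefl _)
  apply Set.inter_subset_inter_right
  apply ball_subset_ball'
  rw [mem_ball, dist_comm] at hz
  linarith

/-- one-dimensional topological lemma -/
theorem preconn_inter_frontier {s t : Set ℝ} (hs : IsPreconnected s) (h1 : (s ∩ t).Nonempty)
    (h2 : (s ∩ tᶜ).Nonempty) : (s ∩ frontier t).Nonempty := by
  by_contra hne
  rw [Set.not_nonempty_iff_eq_empty] at hne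
  have hf : ∀ x ∈ s, x ∉ frontier t := fun x hx hxt => by
    have : x ∈ s ∩ frontier t := ⟨hx, hxt⟩
    rw [hne] at this; exact this
  have key := hs (interior t) (closure t)ᶜ isOpen_interior isClosed_closure.isOpen_compl
    (fun x hx => by
      by_cases h : x ∈ closure t
      · left; by_contra hi; exact hf x hx ⟨h, hi⟩
      · right; exact h)
    (by obtain ⟨x, hx, hxt⟩ := h1
        refine ⟨x, hx, ?_⟩
        by_contra hi; exact hf x hx ⟨subset_closure hxt, hi⟩)
    (by obtain ⟨x, hx, hxt⟩ := h2
        refine ⟨x, hx, fun hc => hf x hx ⟨hc, fun hi => hxt (interior_subset hi)⟩⟩)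
  obtain ⟨x, _, hx1, hx2⟩ := key
  exact hx2 (subset_closure (interior_subset hx1))

theorem line_topology {I U G : Set ℝ} (hU : IsOpen U) {b : ℝ} (hb : b ∈ U ∩ frontier I)
    (hsub : U ∩ frontier I ⊆ G) (hdis : Disjoint G I) :
    ∃ t ∈ G, ∃ s > 0, Set.Ioo t (t+s) ⊆ I ∩ U ∨ Set.Ioo (t-s) t ⊆ I ∩ U := by
  obtain ⟨δ, hδ, hball⟩ := Metric.isOpen_iff.1 hU b hb.1
  rw [Real.ball_eq_Ioo] at hball
  have hbG : b ∈ G := hsub hb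
  have hbcl : b ∈ closure I := frontier_subset_closure hb.2
  obtain ⟨p, hpI, hp⟩ := Metric.mem_closure_iff.1 hbcl δ hδ
  rw [Real.dist_eq, abs_lt] at hp
  have hpb : p ≠ b := fun h => Set.disjoint_left.1 hdis hbG (h ▸ hpI)
  rcases lt_or_gt_of_ne hpb with hlt | hgt
  · set K := Set.Icc p b ∩ frontier I with hK
    have hKc : IsCompact K := isCompact_Icc.inter_right isClosed_frontier
    have hKne : K.Nonempty := ⟨b, ⟨hlt.le, le_rfl⟩, hb.2⟩
    have htK := hKc.sInf_mem hKne
    set t := sInf K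
    have htG : t ∈ G := hsub ⟨hball ⟨by linarith [htK.1.1], by linarith [htK.1.2]⟩, htK.2⟩
    have htp : p < t := by
      rcases eq_or_lt_of_le htK.1.1 with h | h
      · exact absurd hpI (Set.disjoint_left.1 hdis (h ▸ htG))
      · exact h
    refine ⟨t, htG, t - p, by linarith, Or.inr ?_⟩
    have hsI : Set.Ico p t ⊆ I := by
      by_contra hns
      obtain ⟨q, hq, hqI⟩ := Set.not_subset.1 hns
      obtain ⟨z, hz, hzf⟩ := preconn_inter_frontier (s := Set.Ico p t) (t := I) isPreconnected_Ico
        ⟨p, ⟨le_rfl, htp⟩, hpI⟩ ⟨q, hq, hqI⟩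
      have := csInf_le hKc.bddBelow ⟨⟨hz.1, by linarith [hz.2, htK.1.2]⟩, hzf⟩
      exact absurd hz.2 (not_lt.2 this)
    intro x hx
    exact ⟨hsI ⟨by linarith [hx.1], hx.2⟩, hball ⟨by linarith [hx.1], by linarith [hx.2, htK.1.2]⟩⟩
  · set K := Set.Icc b p ∩ frontier I with hK
    have hKc : IsCompact K := isCompact_Icc.inter_right isClosed_frontier
    have hKne : K.Nonempty := ⟨b, ⟨le_rfl, hgt.le⟩, hb.2⟩
    have htK := hKc.sSup_mem hKne
    set t := sSup K
    have htG : t ∈ G := hsub ⟨hball ⟨by linarith [htK.1.1], by linarith [htK.1.2]⟩, htK.2⟩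
    have htp : t < p := by
      rcases eq_or_lt_of_le htK.1.2 with h | h
      · exact absurd hpI (Set.disjoint_left.1 hdis (h ▸ htG))
      · exact h
    refine ⟨t, htG, p - t, by linarith, Or.inl ?_⟩
    have hsI : Set.Ioc t p ⊆ I := by
      by_contra hns
      obtain ⟨q, hq, hqI⟩ := Set.not_subset.1 hns
      obtain ⟨z, hz, hzf⟩ := preconn_inter_frontier (s := Set.Ioc t p) (t := I) isPreconnected_Ioc
        ⟨p, ⟨htp, le_rfl⟩, hpI⟩ ⟨q, hq, hqI⟩
      have := le_csSup hKc.bddAbove ⟨⟨by linarith [hz.1, htK.1.1], hz.2⟩, hzf⟩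
      exact absurd hz.1 (not_lt.2 this)
    intro x hx
    exact ⟨hsI ⟨hx.1, by linarith [hx.2]⟩, hball ⟨by linarith [hx.1, htK.1.1], by linarith [hx.2]⟩⟩

theorem line_baire {I O : Set ℝ} {G H : ℕ → Set ℝ} (hG : ∀ m, IsClosed (G m)) (hH : ∀ m, IsClosed (H m))
    (hOI : Disjoint I O) (hOG : O ⊆ ⋃ m, G m) (hIH : I ⊆ ⋃ m, H m) (hGI : ∀ m, Disjoint (G m) I)
    (hHO : ∀ m, Disjoint (H m) O) {a b : ℝ} (hJ : Set.Ioo a b ⊆ I ∪ O)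
    (hI : (Set.Ioo a b ∩ I).Nonempty) (hO : (Set.Ioo a b ∩ O).Nonempty) :
    ∃ m, ∃ t, ∃ s > 0, (t ∈ G m ∧ (Set.Ioo t (t+s) ⊆ I ∨ Set.Ioo (t-s) t ⊆ I)) ∨
      (t ∈ H m ∧ (Set.Ioo t (t+s) ⊆ O ∨ Set.Ioo (t-s) t ⊆ O)) := by
  set J := Set.Ioo a b
  set Bd := J ∩ frontier I with hBd
  have hBdne : Bd.Nonempty := by
    apply preconn_inter_frontier isPreconnected_Ioo hI
    obtain ⟨q, hq, hqO⟩ := hO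
    exact ⟨q, hq, fun h => Set.disjoint_left.1 hOI h hqO⟩
  have hlc : IsLocallyClosed Bd := isOpen_Ioo.isLocallyClosed.inter isClosed_frontier.isLocallyClosed
  have : LocallyCompactSpace Bd := hlc.locallyCompactSpace
  have : Nonempty Bd := hBdne.to_subtype
  set C : ℕ × Bool → Set Bd := fun p => if p.2 then Subtype.val ⁻¹' (G p.1) else Subtype.val ⁻¹' (H p.1) with hC
  have hCc : ∀ p, IsClosed (C p) := by
    rintro ⟨m, _ | _⟩
    · exact (hH m).preimage continuous_subtype_val
    · exact (hG m).preimage continuous_subtype_val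
  have hCU : ⋃ p, C p = Set.univ := by
    rw [Set.eq_univ_iff_forall]
    intro x
    rcases hJ x.2.1 with h | h
    · obtain ⟨m, hm⟩ := Set.mem_iUnion.1 (hIH h)
      exact Set.mem_iUnion.2 ⟨(m, false), hm⟩
    · obtain ⟨m, hm⟩ := Set.mem_iUnion.1 (hOG h)
      exact Set.mem_iUnion.2 ⟨(m, true), hm⟩
  obtain ⟨⟨m, bb⟩, x, hx⟩ := nonempty_interior_of_iUnion_of_closed hCc hCU
  obtain ⟨V, hVsub, hVo, hxV⟩ := mem_interior.1 hx
  obtain ⟨U, hU, hUV⟩ := isOpen_induced_iff.1 hVo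
  have hxU : (x : ℝ) ∈ U := by rw [← hUV] at hxV; exact hxV
  refine ⟨m, ?_⟩
  cases bb
  · have hsub : (U ∩ J) ∩ frontier Iᶜ ⊆ H m := by
      rintro z ⟨⟨hzU, hzJ⟩, hzf⟩
      rw [frontier_compl] at hzf
      have : (⟨z, hzJ, hzf⟩ : Bd) ∈ V := by rw [← hUV]; exact hzU
      exact hVsub this
    have hdis : Disjoint ((U ∩ J) ∩ frontier Iᶜ) Iᶜ := by
      apply Set.disjoint_left.2
      intro z hz hzI
      rcases hJ hz.1.2 with h | h
      · exact hzI h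
      · exact Set.disjoint_left.1 (hHO m) (hsub hz) h
    obtain ⟨t, ht, s, hs, h⟩ := line_topology (I := Iᶜ) (hU.inter isOpen_Ioo) (b := x)
      ⟨⟨hxU, x.2.1⟩, by rw [frontier_compl]; exact x.2.2⟩ subset_rfl hdis
    have hOI' : Iᶜ ∩ (U ∩ J) ⊆ O := by
      rintro z ⟨hz, hz2⟩
      exact (hJ hz2.2).resolve_left hz
    exact ⟨t, s, hs, Or.inr ⟨hsub ht, h.imp (fun h => h.trans hOI') (fun h => h.trans hOI')⟩⟩
  · have hsub : (U ∩ J) ∩ frontier I ⊆ G m := by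
      rintro z ⟨⟨hzU, hzJ⟩, hzf⟩
      have : (⟨z, hzJ, hzf⟩ : Bd) ∈ V := by rw [← hUV]; exact hzU
      exact hVsub this
    obtain ⟨t, ht, s, hs, h⟩ := line_topology (I := I) (hU.inter isOpen_Ioo) (b := x)
      ⟨⟨hxU, x.2.1⟩, x.2.2⟩ hsub (hGI m)
    exact ⟨t, s, hs, Or.inl ⟨ht, h.imp (fun h => h.trans Set.inter_subset_left) (fun h => h.trans Set.inter_subset_left)⟩⟩

/-- union of all bad lines -/
def allBad {k : ℕ} (F : Set (Eu (k+1))) (Ψ : Frame k) : Set (Eu k) :=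
  ⋃ m : ℕ, ⋃ l : ℕ, ⋃ q : ℚ, badLines F Ψ (1 / ((m:ℝ)+1)) (1 / ((l:ℝ)+1)) q

theorem volume_allBad {k : ℕ} {F : Set (Eu (k+1))} (hF : MeasurableSet F)
    (Ψ : Frame k) : volume (allBad F Ψ) = 0 := by
  unfold allBad
  simp only [measure_iUnion_null_iff]
  intro m l q
  exact volume_badLines hF Ψ (by positivity) (by positivity) _

theorem mem_allBad {k : ℕ} {F : Set (Eu (k+1))} (Ψ : Frame k) {y} {m : ℕ} {t s : ℝ}
    (hs : 0 < s) (h1 : Ψ.map (t, y) ∈ smallDens F (1 / ((m:ℝ)+1)))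
    (h2 : ∀ t' ∈ Set.Ioo t (t + s), HasDensity F (Ψ.map (t', y)) 1) : y ∈ allBad F Ψ := by
  obtain ⟨l, hl⟩ := exists_nat_one_div_lt hs
  have hl0 : 0 < 1 / ((l:ℝ)+1) := by positivity
  obtain ⟨q, hq1, hq2⟩ := exists_rat_btwn (show t - 1 / ((l:ℝ)+1) / 3 < t by linarith)
  unfold allBad
  simp only [Set.mem_iUnion]
  exact ⟨m, l, q, t, ⟨hq2.le, by linarith⟩, h1, fun t' ht' => h2 t' ⟨ht'.1, by linarith [ht'.2]⟩⟩

theorem line_dichotomy {k : ℕ} {F : Set (Eu (k+1))} (hF : MeasurableSet F) (Ψ : Frame k) :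
    ∀ᵐ y, ∀ a b : ℝ, (∀ t ∈ Set.Ioo a b, Ψ.map (t, y) ∉ essBoundary F) →
      (∀ t ∈ Set.Ioo a b, HasDensity F (Ψ.map (t, y)) 1) ∨ (∀ t ∈ Set.Ioo a b, HasDensity F (Ψ.map (t, y)) 0) := by
  obtain ⟨Ψ', hΨ'⟩ := exists_neg_frame Ψ
  have n1 := measure_eq_zero_iff_ae_notMem.1 (volume_allBad hF Ψ)
  have n2 := measure_eq_zero_iff_ae_notMem.1 (volume_allBad hF Ψ')
  have n3 := measure_eq_zero_iff_ae_notMem.1 (volume_allBad hF.compl Ψ)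
  have n4 := measure_eq_zero_iff_ae_notMem.1 (volume_allBad hF.compl Ψ')
  filter_upwards [n1, n2, n3, n4] with y h1 h2 h3 h4 a b hab
  by_contra hcon
  rw [not_or] at hcon
  obtain ⟨hc1, hc2⟩ := hcon
  push Not at hc1 hc2
  have hdens : ∀ t ∈ Set.Ioo a b, HasDensity F (Ψ.map (t, y)) 0 ∨ HasDensity F (Ψ.map (t, y)) 1 := by
    intro t ht
    have := hab t ht
    simp only [essBoundary, Set.mem_ofPred_eq] at this
    tauto
  have hc : Continuous (fun t : ℝ => Ψ.map (t, y)) := Ψ.continuous_map.comp (by fun_prop)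
  have hcompl : ∀ x, HasDensity F x 0 ↔ HasDensity Fᶜ x 1 := by
    intro x
    have := hasDensity_compl_iff hF (x := x) (d := 0)
    rw [sub_zero] at this
    exact this.symm
  have hcompl' : ∀ x, HasDensity F x 1 ↔ HasDensity Fᶜ x 0 := by
    intro x
    have := hasDensity_compl_iff hF (x := x) (d := 1)
    rw [sub_self] at this
    exact this.symm
  obtain ⟨m, t, s, hs, h⟩ := line_baire (I := {t | HasDensity F (Ψ.map (t, y)) 1}) (O := {t | HasDensity F (Ψ.map (t, y)) 0})
    (G := fun m : ℕ => {t | Ψ.map (t, y) ∈ smallDens F (1 / ((m:ℝ)+1))})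
    (H := fun m : ℕ => {t | Ψ.map (t, y) ∈ smallDens Fᶜ (1 / ((m:ℝ)+1))}) (a := a) (b := b)
    (fun m => (isClosed_smallDens F _).preimage hc) (fun m => (isClosed_smallDens Fᶜ _).preimage hc)
    (Set.disjoint_left.2 fun t h h' => by
      have := tendsto_nhds_unique h h'
      norm_num at this)
    (fun t ht => Set.mem_iUnion.2 (smallDens_of_density_zero ht))
    (fun t ht => Set.mem_iUnion.2 (smallDens_of_density_zero ((hcompl' _).1 ht)))
    (fun m => Set.disjoint_left.2 fun t h h' => not_smallDens_of_density_one h' (by positivity) h)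
    (fun m => Set.disjoint_left.2 fun t h h' => not_smallDens_of_density_one ((hcompl _).1 h') (by positivity) h)
    (fun t ht => (hdens t ht).symm)
    (by
      obtain ⟨t, ht, hn⟩ := hc2
      exact ⟨t, ht, (hdens t ht).resolve_left hn⟩)
    (by
      obtain ⟨t, ht, hn⟩ := hc1
      exact ⟨t, ht, (hdens t ht).resolve_right hn⟩)
  rcases h with ⟨ht, h | h⟩ | ⟨ht, h | h⟩
  · exact h1 (mem_allBad Ψ hs ht (fun t' ht' => h ht'))
  · refine h2 (mem_allBad Ψ' (t := -t) hs (m := m) ?_ (fun t' ht' => ?_))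
    · rw [hΨ']; simpa using ht
    · rw [hΨ']; exact h ⟨by linarith [ht'.2], by linarith [ht'.1]⟩
  · exact h3 (mem_allBad Ψ hs ht (fun t' ht' => (hcompl _).1 (h ht')))
  · refine h4 (mem_allBad Ψ' (t := -t) hs (m := m) ?_ (fun t' ht' => ?_))
    · rw [hΨ']; simpa using ht
    · rw [hΨ']; exact (hcompl _).1 (h ⟨by linarith [ht'.2], by linarith [ht'.1]⟩)

/-- The line restriction is a.e. constant on intervals free of essential boundary. -/
theorem line_ae_const {k : ℕ} {F : Set (Eu (k+1))} (hF : MeasurableSet F) (Ψ : Frame k) :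
    ∀ᵐ y, ∀ a b : ℝ, (∀ t ∈ Set.Ioo a b, Ψ.map (t, y) ∉ essBoundary F) →
      (∃ c : ℝ, (c = 0 ∨ c = 1) ∧ ∀ᵐ t, t ∈ Set.Ioo a b → F.indicator (fun _ => (1:ℝ)) (Ψ.map (t, y)) = c) := by
  have hd : ∀ᵐ p : ℝ × Eu k, HasDensity F (Ψ.map p) (F.indicator 1 (Ψ.map p)) :=
    Ψ.measurePreserving.quasiMeasurePreserving.ae (ae_hasDensity hF)
  have hd2 : ∀ᵐ y : Eu k, ∀ᵐ t : ℝ, HasDensity F (Ψ.map (t, y)) (F.indicator 1 (Ψ.map (t, y))) := by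
    have h1 : ∀ᵐ q : Eu k × ℝ, HasDensity F (Ψ.map q.swap) (F.indicator 1 (Ψ.map q.swap)) :=
      (Measure.measurePreserving_swap (μ := (volume : Measure (Eu k)))
        (ν := (volume : Measure ℝ))).quasiMeasurePreserving.ae hd
    exact Measure.ae_ae_of_ae_prod h1
  filter_upwards [line_dichotomy hF Ψ, hd2] with y h1 h2 a b hab
  rcases h1 a b hab with h | h
  · refine ⟨1, Or.inr rfl, ?_⟩
    filter_upwards [h2] with t ht hmem
    exact tendsto_nhds_unique ht (h t hmem)
  · refine ⟨0, Or.inl rfl, ?_⟩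
    filter_upwards [h2] with t ht hmem
    exact tendsto_nhds_unique ht (h t hmem)

theorem count_lemma {k : ℕ} (Ψ : Frame k) (D : Set (Eu (k+1)))
    (ψ : Eu (k+1) → ℝ≥0∞) (hψ : Continuous ψ) :
    ∃ g : Eu k → ℝ≥0∞, Measurable g ∧
      (kap k : ℝ≥0∞) * ∫⁻ y, g y ≤ ∫⁻ x, ψ x ∂((μH[(k:ℝ)]).restrict D) ∧
      ∀ y, ∀ T : Finset ℝ, (∀ t ∈ T, Ψ.map (t, y) ∈ D) → ∑ t ∈ T, ψ (Ψ.map (t, y)) ≤ g y := by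
  set u : ℕ → (Eu (k+1)) := TopologicalSpace.denseSeq (Eu (k+1))
  set r : ℕ → ℝ := fun j => 1 / ((j:ℝ) + 1) with hr
  have hrpos : ∀ j, 0 < r j := fun j => by simp only [hr]; positivity
  set Q : ℕ → ℕ → Set (Eu (k+1)) := fun j => disjointed (fun i => ball (u i) (r j)) with hQ
  have hQm : ∀ j i, MeasurableSet (Q j i) := fun j i => MeasurableSet.disjointed (fun i => measurableSet_ball) i
  have hQsub : ∀ j i, Q j i ⊆ ball (u i) (r j) := fun j i => disjointed_subset _ i
  have hQdis : ∀ j, Pairwise (Function.onFun Disjoint (Q j)) := fun j => disjoint_disjointed _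
  have hcover : ∀ j (x : (Eu (k+1))), ∃ i, x ∈ Q j i := by
    intro j x
    obtain ⟨i, hi⟩ := (TopologicalSpace.denseRange_denseSeq (Eu (k+1))).exists_dist_lt x (hrpos j)
    have : x ∈ ⋃ i, Q j i := by
      rw [hQ, iUnion_disjointed]; exact Set.mem_iUnion.2 ⟨i, hi⟩
    exact Set.mem_iUnion.1 this
  choose ix hix using hcover
  set w : ℕ → ℕ → ℝ≥0∞ := fun j i => ⨅ z ∈ Q j i, ψ z with hw
  set Z : ℕ → ℕ → Set (Eu k) := fun j i => toMeasurable volume (Ψ.snd '' (D ∩ Q j i)) with hZ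
  have hZm : ∀ j i, MeasurableSet (Z j i) := fun j i => measurableSet_toMeasurable _ _
  set g : ℕ → Eu k → ℝ≥0∞ := fun j y => ∑' i, (Z j i).indicator (fun _ => w j i) y with hg
  have hgm : ∀ j, Measurable (g j) := fun j => Measurable.tsum (fun i => measurable_const.indicator (hZm j i))
  refine ⟨fun y => liminf (fun j => g j y) atTop, Measurable.liminf hgm, ?_, ?_⟩
  · have h1 : ∀ j, (kap k : ℝ≥0∞) * ∫⁻ y, g j y ≤ ∫⁻ x, ψ x ∂((μH[(k:ℝ)]).restrict D) := by
      intro j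
      simp only [hg]
      rw [lintegral_tsum (fun i => (measurable_const.indicator (hZm j i)).aemeasurable), ← ENNReal.tsum_mul_left]
      have hun : (⋃ i, Q j i) = Set.univ := Set.eq_univ_of_forall (fun x => Set.mem_iUnion.2 ⟨_, hix j x⟩)
      rw [← setLIntegral_univ (μ := (μH[(k:ℝ)]).restrict D), ← hun, lintegral_iUnion (hQm j) (hQdis j)]
      refine ENNReal.tsum_le_tsum (fun i => ?_)
      rw [lintegral_indicator (hZm j i), setLIntegral_const, hZ, measure_toMeasurable]
      calc (kap k : ℝ≥0∞) * (w j i * volume (Ψ.snd '' (D ∩ Q j i)))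
          = w j i * ((kap k : ℝ≥0∞) * volume (Ψ.snd '' (D ∩ Q j i))) := by ring
        _ ≤ w j i * μH[(k:ℝ)] (D ∩ Q j i) := by gcongr; exact Ψ.kap_volume_snd_image_le _
        _ = w j i * (μH[(k:ℝ)]).restrict D (Q j i) := by
            rw [Measure.restrict_apply (hQm j i), Set.inter_comm]
        _ = ∫⁻ x in Q j i, w j i ∂((μH[(k:ℝ)]).restrict D) := by rw [setLIntegral_const]
        _ ≤ _ := by
            apply setLIntegral_mono' (hQm j i)
            intro x hx
            exact iInf₂_le x hx
    calc (kap k : ℝ≥0∞) * ∫⁻ y, liminf (fun j => g j y) atTop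
        ≤ (kap k : ℝ≥0∞) * liminf (fun j => ∫⁻ y, g j y) atTop := by
          gcongr; exact lintegral_liminf_le hgm
      _ ≤ ∫⁻ x, ψ x ∂((μH[(k:ℝ)]).restrict D) := by
          have hk0 : (kap k : ℝ≥0∞) ≠ 0 := by simpa using (kap_pos k).ne'
          have hk1 : (kap k : ℝ≥0∞) ≠ ⊤ := ENNReal.coe_ne_top
          rw [mul_comm, ← ENNReal.le_div_iff_mul_le (Or.inl hk0) (Or.inl hk1)]
          apply liminf_le_of_le (by isBoundedDefault)
          intro b hb
          obtain ⟨j, hj⟩ := hb.exists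
          refine hj.trans ?_
          rw [ENNReal.le_div_iff_mul_le (Or.inl hk0) (Or.inl hk1), mul_comm]
          exact h1 j
  · intro y T hT
    set W : ℕ → (Eu (k+1)) → ℝ≥0∞ := fun j x => ⨅ z ∈ ball x (2 * r j), ψ z with hW
    have hrmono : Antitone r := fun a b hab => by
      simp only [hr]; gcongr
    have hWmono : ∀ x, Monotone (fun j => W j x) := by
      intro x a b hab
      apply le_iInf₂
      intro z hz
      exact iInf₂_le z (ball_subset_ball (by linarith [hrmono hab]) hz)
    have hrt : Tendsto r atTop (nhds 0) := tendsto_one_div_add_atTop_nhds_zero_nat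
    have hWsup : ∀ x, ψ x ≤ ⨆ j, W j x := by
      intro x
      apply le_of_forall_lt
      intro a ha
      obtain ⟨a', haa', ha'⟩ := exists_between ha
      have h2 : ∀ᶠ z in nhds x, a' < ψ z := hψ.continuousAt.eventually_const_lt ha'
      obtain ⟨δ, hδ, hball⟩ := Metric.eventually_nhds_iff_ball.1 h2
      obtain ⟨j, hj⟩ := (hrt.eventually (gt_mem_nhds (show (0:ℝ) < δ/2 by linarith))).exists
      refine haa'.trans_le (le_trans ?_ (le_iSup _ j))
      apply le_iInf₂
      intro z hz
      exact (hball z (ball_subset_ball (by linarith) hz)).le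
    have hWw : ∀ j x, W j x ≤ w j (ix j x) := by
      intro j x
      apply le_iInf₂
      intro z hz
      apply iInf₂_le z
      have h1 := hQsub _ _ hz
      have h2 := hQsub _ _ (hix j x)
      rw [mem_ball] at *
      linarith [dist_triangle_right z x (u (ix j x))]
    -- separation
    have hsep : ∀ᶠ j in atTop, ∀ t ∈ T, ∀ t' ∈ T, t ≠ t' → 2 * r j ≤ |t - t'| := by
      rw [eventually_all_finset]
      intro t ht
      rw [eventually_all_finset]
      intro t' ht'
      by_cases h : t = t'
      · simp [h]
      · have : 0 < |t - t'| := abs_pos.2 (sub_ne_zero.2 h)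
        filter_upwards [hrt.eventually (gt_mem_nhds (show (0:ℝ) < |t-t'|/2 by linarith))] with j hj _
        linarith
    have hlow : ∀ᶠ j in atTop, ∑ t ∈ T, W j (Ψ.map (t, y)) ≤ g j y := by
      filter_upwards [hsep] with j hj
      have hinj : Set.InjOn (fun t => ix j (Ψ.map (t, y))) (T : Set ℝ) := by
        intro t ht t' ht' he
        by_contra hne
        have h1 := hj t ht t' ht' hne
        have h2 := hQsub _ _ (hix j (Ψ.map (t, y)))
        have h3 := hQsub _ _ (hix j (Ψ.map (t', y)))
        simp only at he
        rw [he] at h2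
        rw [mem_ball] at h2 h3
        have h4 := dist_triangle_right (Ψ.map (t, y)) (Ψ.map (t', y)) (u (ix j (Ψ.map (t', y))))
        rw [dist_eq_norm, ← Ψ.map_sub] at h4
        have h5 := Ψ.abs_fst_le ((t, y) - (t', y))
        simp only [Prod.fst_sub] at h5
        linarith
      calc ∑ t ∈ T, W j (Ψ.map (t, y)) ≤ ∑ t ∈ T, w j (ix j (Ψ.map (t, y))) := Finset.sum_le_sum (fun t _ => hWw _ _)
        _ = ∑ t ∈ T, (Z j (ix j (Ψ.map (t,y)))).indicator (fun _ => w j (ix j (Ψ.map (t, y)))) y := by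
            apply Finset.sum_congr rfl
            intro t ht
            rw [Set.indicator_of_mem]
            apply subset_toMeasurable
            exact ⟨Ψ.map (t, y), ⟨hT t ht, hix _ _⟩, by simp⟩
        _ = ∑ i ∈ T.image (fun t => ix j (Ψ.map (t, y))), (Z j i).indicator (fun _ => w j i) y := by
            rw [Finset.sum_image hinj]
        _ ≤ g j y := ENNReal.sum_le_tsum _
    calc ∑ t ∈ T, ψ (Ψ.map (t, y)) ≤ ∑ t ∈ T, ⨆ j, W j (Ψ.map (t, y)) := Finset.sum_le_sum (fun t _ => hWsup _)
      _ = ⨆ j, ∑ t ∈ T, W j (Ψ.map (t, y)) := ENNReal.finsetSum_iSup_of_monotone (fun t => hWmono _)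
      _ ≤ _ := by
        apply iSup_le
        intro j
        apply le_liminf_of_le (by isBoundedDefault)
        filter_upwards [hlow, eventually_ge_atTop j] with j' h1 h2
        exact (Finset.sum_le_sum (fun t _ => hWmono _ h2)).trans h1

theorem telescoping (p : ℝ → ℝ) (hp : ContDiff ℝ 1 p) (hp0 : ∀ t, 0 ≤ p t) (χ : ℝ → ℝ) (hχ : Measurable χ)
    (hχb : ∀ t, ‖χ t‖ ≤ 1) (a : ℝ) (hpa : p a = 0) (T : Finset ℝ) :
    ∀ b, a < b → (∀ t ∈ T, a < t ∧ t < b) → (∀ s t, Set.Ioo s t ⊆ Set.Ioo a b → (∀ x ∈ Set.Ioo s t, x ∉ T) →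
      ∃ c : ℝ, (c = 0 ∨ c = 1) ∧ ∀ᵐ x, x ∈ Set.Ioo s t → χ x = c) →
      ∃ c : ℝ, (c = 0 ∨ c = 1) ∧ |(∫ t in a..b, deriv p t * χ t) - c * p b| ≤ ∑ t ∈ T, p t := by
  have hdc : Continuous (deriv p) := hp.continuous_deriv le_rfl
  have hitg : ∀ s t, IntervalIntegrable (fun t => deriv p t * χ t) volume s t := by
    intro s t
    have := (hdc.intervalIntegrable (μ := volume) s t)
    rw [intervalIntegrable_iff] at *
    exact Integrable.mul_bdd (c := 1) this hχ.aestronglyMeasurable (Eventually.of_forall hχb)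
  have hconst : ∀ s t c, s ≤ t → (∀ᵐ x, x ∈ Set.Ioo s t → χ x = c) →
      ∫ x in s..t, deriv p x * χ x = c * (p t - p s) := by
    intro s t c hst h
    have h1 : ∫ x in s..t, deriv p x * χ x = ∫ x in s..t, deriv p x * c := by
      rw [intervalIntegral.integral_of_le hst, intervalIntegral.integral_of_le hst,
        integral_Ioc_eq_integral_Ioo, integral_Ioc_eq_integral_Ioo]
      apply setIntegral_congr_ae measurableSet_Ioo
      filter_upwards [h] with x hx hxs
      rw [hx hxs]
    rw [h1, intervalIntegral.integral_mul_const, intervalIntegral.integral_deriv_eq_sub'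
      p rfl (fun x _ => (hp.differentiable (by norm_num)) x) hdc.continuousOn]
    ring
  induction T using Finset.induction_on_max with
  | empty =>
    intro b hab _ hst
    obtain ⟨c, hc, hc'⟩ := hst a b subset_rfl (by simp)
    refine ⟨c, hc, ?_⟩
    rw [hconst a b c hab.le hc', hpa]; simp
  | insert m T hm ih =>
    intro b hab hT hst
    have hmT := hT m (Finset.mem_insert_self _ _)
    have hnot : m ∉ T := fun h => lt_irrefl _ (hm m h)
    obtain ⟨c', hc', h1⟩ := ih m hmT.1 (fun t ht => ⟨(hT t (Finset.mem_insert_of_mem ht)).1, hm t ht⟩)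
      (by
        intro s t hs hx
        apply hst s t (hs.trans (Set.Ioo_subset_Ioo_right hmT.2.le))
        intro x hxs hxT
        rcases Finset.mem_insert.1 hxT with rfl | h
        · exact lt_irrefl _ (hs hxs).2
        · exact hx x hxs h)
    obtain ⟨c, hc, h2⟩ := hst m b (Set.Ioo_subset_Ioo_left hmT.1.le) (by
        intro x hx hxT
        rcases Finset.mem_insert.1 hxT with rfl | h
        · exact lt_irrefl _ hx.1
        · exact lt_asymm hx.1 (hm x h))
    refine ⟨c, hc, ?_⟩
    rw [← intervalIntegral.integral_add_adjacent_intervals (hitg a m) (hitg m b), hconst m b c hmT.2.le h2,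
      Finset.sum_insert hnot]
    have h3 := hp0 m
    rw [abs_le] at *
    rcases hc with rfl | rfl <;> rcases hc' with rfl | rfl <;> constructor <;> linarith [h1.1, h1.2]

theorem finite_of_card_le {S : Set ℝ} {M : ℝ≥0∞} (hM : M ≠ ⊤)
    (h : ∀ T : Finset ℝ, (∀ t ∈ T, t ∈ S) → ((T.card : ℕ) : ℝ≥0∞) ≤ M) : S.Finite := by
  by_contra hinf
  obtain ⟨N, hN⟩ := ENNReal.exists_nat_gt hM
  obtain ⟨T, hT, hTc⟩ := Set.Infinite.exists_subset_card_eq hinf N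
  have := h T (fun t ht => hT ht)
  rw [hTc] at this
  exact absurd this (not_le.2 hN)

theorem Frame.hasDerivAt_slice {k : ℕ} (Ψ : Frame k) {ψ : Eu (k+1) → ℝ} (hψ : Differentiable ℝ ψ) (y : Eu k) (t : ℝ) :
    HasDerivAt (fun t => ψ (Ψ.map (t, y))) (fderiv ℝ ψ (Ψ.map (t, y)) Ψ.dir) t := by
  have h1 : HasDerivAt (fun t : ℝ => Ψ.map (t, y)) Ψ.dir t := by
    have : (fun t : ℝ => Ψ.map (t, y)) = fun t => t • Ψ.dir + Ψ.map (0, y) := by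
      funext t; exact Ψ.map_eq t y
    rw [this]
    simpa using ((hasDerivAt_id t).smul_const Ψ.dir).add_const (Ψ.map (0, y))
  exact (hψ _).hasFDerivAt.comp_hasDerivAt t h1

theorem Frame.contDiff_line {k : ℕ} (Ψ : Frame k) (y : Eu k) : ContDiff ℝ 1 (fun t : ℝ => Ψ.map (t, y)) := by
  have : (fun t : ℝ => Ψ.map (t, y)) = fun t => t • Ψ.dir + Ψ.map (0, y) := by
    funext t; exact Ψ.map_eq t y
  rw [this]; fun_prop

theorem slice_bound {k : ℕ} {F : Set (Eu (k+1))} (hF : MeasurableSet F) (Ψ : Frame k)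
    {ψ : Eu (k+1) → ℝ} (hψ : ContDiff ℝ 1 ψ) (hψ0 : ∀ x, 0 ≤ ψ x) {R : ℝ} (hR : ∀ x, R ≤ ‖x‖ → ψ x = 0)
    (y : Eu k) (hy : ∀ a b : ℝ, (∀ t ∈ Set.Ioo a b, Ψ.map (t, y) ∉ essBoundary F) →
      (∃ c : ℝ, (c = 0 ∨ c = 1) ∧ ∀ᵐ t, t ∈ Set.Ioo a b → F.indicator (fun _ => (1:ℝ)) (Ψ.map (t, y)) = c))
    (T : Finset ℝ) (hT : ∀ t, t ∈ T ↔ Ψ.map (t, y) ∈ essBoundary F) :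
    |∫ t, fderiv ℝ ψ (Ψ.map (t, y)) Ψ.dir * F.indicator (fun _ => (1:ℝ)) (Ψ.map (t, y))| ≤ ∑ t ∈ T, ψ (Ψ.map (t, y)) := by
  set p : ℝ → ℝ := fun t => ψ (Ψ.map (t, y)) with hp
  set χ : ℝ → ℝ := fun t => F.indicator (fun _ => (1:ℝ)) (Ψ.map (t, y)) with hχ
  have hpc : ContDiff ℝ 1 p := hψ.comp (Ψ.contDiff_line y)
  have hder : ∀ t, deriv p t = fderiv ℝ ψ (Ψ.map (t, y)) Ψ.dir :=
    fun t => (Ψ.hasDerivAt_slice (hψ.differentiable (by norm_num)) y t).deriv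
  have hχm : Measurable χ := (measurable_const.indicator hF).comp
    (Ψ.continuous_map.measurable.comp measurable_prodMk_right)
  obtain ⟨M, hM⟩ : ∃ M, ∀ t ∈ T, |t| < M := by
    obtain ⟨M, hM⟩ := (T.image (fun t => |t|)).bddAbove
    refine ⟨M + 1, fun t ht => ?_⟩
    have := hM (Finset.mem_coe.2 (Finset.mem_image_of_mem (fun t => |t|) ht))
    linarith
  set b := max (max M R) 0 + 1 with hb
  have hbM : M < b := by have := le_max_left (max M R) 0; have := le_max_left M R; linarith
  have hbR : R < b := by have := le_max_left (max M R) 0; have := le_max_right M R; linarith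
  have hb0 : 0 < b := by have := le_max_right (max M R) 0; linarith
  have hp0 : ∀ t, R ≤ |t| → p t = 0 := fun t ht => hR _ (ht.trans (Ψ.abs_fst_le (t, y)))
  have hd0 : ∀ t, b ≤ |t| → deriv p t = 0 := by
    intro t ht
    have : p =ᶠ[nhds t] fun _ => 0 := by
      have h1 : ∀ᶠ s in nhds t, R < |s| := continuous_abs.continuousAt.eventually_const_lt (by linarith)
      filter_upwards [h1] with s hs
      exact hp0 s hs.le
    rw [this.deriv_eq]; simp
  obtain ⟨c, hc, h1⟩ := telescoping p hpc (fun t => hψ0 _) χ hχm (by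
      intro t; simp only [hχ, Set.indicator]; split_ifs <;> simp) (-b) (hp0 _ (by rw [abs_neg, abs_of_pos hb0]; exact hbR.le)) T b
    (by linarith) (fun t ht => by have := hM t ht; rw [abs_lt] at this; constructor <;> linarith)
    (fun s t _ hx => hy s t (fun x hxs => by rw [← hT]; exact hx x hxs))
  rw [hp0 b (by rw [abs_of_pos hb0]; exact hbR.le), mul_zero, sub_zero] at h1
  rw [intervalIntegral.integral_eq_integral_of_support_subset] at h1
  · simpa only [hder] using h1
  · intro t ht
    simp only [Function.mem_support] at ht
    by_contra hnot
    apply ht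
    rw [hd0 t, zero_mul]
    by_contra hlt
    push Not at hlt
    rw [abs_lt] at hlt
    exact hnot ⟨hlt.1, hlt.2.le⟩

theorem div_ineq {k : ℕ} {F : Set (Eu (k+1))} (hF : MeasurableSet F) (hP : μH[(k:ℝ)] (essBoundary F) ≠ ⊤) (Ψ : Frame k)
    {ψ : Eu (k+1) → ℝ} (hψ : ContDiff ℝ 1 ψ) (hcs : HasCompactSupport ψ) (hψ0 : ∀ x, 0 ≤ ψ x) :
    (kap k : ℝ≥0∞) * ‖∫ x in F, fderiv ℝ ψ x Ψ.dir‖ₑ ≤ ∫⁻ x, ENNReal.ofReal (ψ x) ∂((μH[(k:ℝ)]).restrict (essBoundary F)) := by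
  obtain ⟨g, hgm, hg1, hg2⟩ := count_lemma Ψ (essBoundary F) (fun x => ENNReal.ofReal (ψ x))
    (ENNReal.continuous_ofReal.comp hψ.continuous)
  obtain ⟨g', hgm', hg1', hg2'⟩ := count_lemma Ψ (essBoundary F) (fun x => 1) continuous_const
  have hfin : ∀ᵐ y, g' y ≠ ⊤ := by
    have h1 : ∫⁻ y, g' y ≠ ⊤ := by
      intro h
      rw [h, ENNReal.mul_top (by simpa using (kap_pos k).ne')] at hg1'
      simp at hg1'
      exact hP hg1'
    filter_upwards [ae_lt_top hgm' h1] with y hy using hy.ne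
  obtain ⟨R, hR⟩ : ∃ R : ℝ, ∀ x, R ≤ ‖x‖ → ψ x = 0 := by
    obtain ⟨R, hR⟩ := hcs.isCompact.isBounded.subset_ball 0
    refine ⟨R, fun x hx => ?_⟩
    by_contra hne
    have := hR (subset_tsupport _ (Function.mem_support.2 hne))
    rw [mem_ball_zero_iff] at this
    linarith
  set f : Eu (k+1) → ℝ := fun x => fderiv ℝ ψ x Ψ.dir * F.indicator (fun _ => (1:ℝ)) x with hf
  have hfint : Integrable f := by
    have h0 : Continuous (fun x => fderiv ℝ ψ x Ψ.dir) := by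
      exact (hψ.continuous_fderiv (by norm_num)).clm_apply continuous_const
    have h1 : Integrable (fun x => fderiv ℝ ψ x Ψ.dir) :=
      h0.integrable_of_hasCompactSupport ((hcs.fderiv ℝ).comp_left (g := fun L : Eu (k+1) →L[ℝ] ℝ => L Ψ.dir) (by simp))
    exact Integrable.mul_bdd (c := 1) h1 (measurable_const.indicator hF).aestronglyMeasurable
      (Eventually.of_forall (fun x => by simp only [Set.indicator]; split_ifs <;> simp))
  have e1 : ∫ x in F, fderiv ℝ ψ x Ψ.dir = ∫ y, ∫ t, f (Ψ.map (t, y)) := by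
    rw [← integral_indicator hF]
    have : F.indicator (fun x => fderiv ℝ ψ x Ψ.dir) = f := by
      funext x; simp only [hf, Set.indicator]; split_ifs <;> simp
    rw [this, ← Ψ.measurePreserving.integral_comp Ψ.measurableEmbedding f]
    rw [Measure.volume_eq_prod, integral_prod_symm]
    rw [← Measure.volume_eq_prod]
    exact (Ψ.measurePreserving.integrable_comp_emb Ψ.measurableEmbedding).2 hfint
  have e2 : ‖∫ x in F, fderiv ℝ ψ x Ψ.dir‖ₑ ≤ ∫⁻ y, g y := by
    rw [e1]
    refine (enorm_integral_le_lintegral_enorm _).trans ?_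
    apply lintegral_mono_ae
    filter_upwards [hfin, line_ae_const hF Ψ] with y hy1 hy2
    have hS : {t | Ψ.map (t, y) ∈ essBoundary F}.Finite := by
      apply finite_of_card_le hy1
      intro T hT
      simpa using hg2' y T hT
    have := slice_bound hF Ψ hψ hψ0 hR y hy2 hS.toFinset (by simp)
    calc ‖∫ t, f (Ψ.map (t, y))‖ₑ = ENNReal.ofReal |∫ t, f (Ψ.map (t, y))| := Real.enorm_eq_ofReal_abs _
      _ ≤ ENNReal.ofReal (∑ t ∈ hS.toFinset, ψ (Ψ.map (t, y))) := ENNReal.ofReal_le_ofReal this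
      _ = ∑ t ∈ hS.toFinset, ENNReal.ofReal (ψ (Ψ.map (t, y))) := ENNReal.ofReal_sum_of_nonneg (fun t _ => hψ0 _)
      _ ≤ g y := hg2 y _ (by simp)
  calc _ ≤ (kap k : ℝ≥0∞) * ∫⁻ y, g y := by gcongr
    _ ≤ _ := hg1

theorem clm_norm_le_of_frames {k : ℕ} (L : Eu (k+1) →L[ℝ] ℝ) (M : ℝ) (hM : 0 ≤ M)
    (h : ∀ Ψ : Frame k, |L Ψ.dir| ≤ M) : ‖L‖ ≤ M := by
  apply ContinuousLinearMap.opNorm_le_of_unit_norm hM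
  intro x hx
  obtain ⟨Ψ, hΨ⟩ := exists_frame x hx
  rw [← hΨ]; exact h Ψ

theorem moll_grad {k : ℕ} {F : Set (Eu (k+1))} (hF : MeasurableSet F) (hFv : volume F ≠ ⊤)
    (hP : μH[(k:ℝ)] (essBoundary F) ≠ ⊤) (ρ : Eu (k+1) → ℝ) (hρ : ContDiff ℝ 1 ρ) (hcs : HasCompactSupport ρ)
    (hρ0 : ∀ x, 0 ≤ ρ x) (hρ1 : ∫ x, ρ x = 1) :
    ContDiff ℝ 1 (fun x => ∫ y in F, ρ (x - y)) ∧
    (kap k : ℝ≥0∞) * ∫⁻ x, ‖fderiv ℝ (fun x => ∫ y in F, ρ (x - y)) x‖ₑ ≤ μH[(k:ℝ)] (essBoundary F) := by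
  set χ : Eu (k+1) → ℝ := F.indicator (fun _ => (1:ℝ)) with hχ
  have hχi : Integrable χ := (integrable_indicator_iff hF).2 (integrableOn_const hFv)
  have hu : (fun x => ∫ y in F, ρ (x - y)) = convolution χ ρ (ContinuousLinearMap.mul ℝ ℝ) volume := by
    funext x
    rw [convolution_def, ← integral_indicator hF]
    congr 1; funext y
    simp only [hχ, Set.indicator, ContinuousLinearMap.mul_apply']
    split_ifs <;> simp
  have hcd : ContDiff ℝ 1 (fun x => ∫ y in F, ρ (x - y)) := by
    rw [hu]
    exact hcs.contDiff_convolution_right _ hχi.locallyIntegrable hρ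
  refine ⟨hcd, ?_⟩
  set μ := (μH[(k:ℝ)] : Measure (Eu (k+1))).restrict (essBoundary F) with hμ
  have : IsFiniteMeasure μ := ⟨by rw [hμ, Measure.restrict_apply_univ]; exact hP.lt_top⟩
  have hpt : ∀ x, (kap k : ℝ≥0∞) * ‖fderiv ℝ (fun x => ∫ y in F, ρ (x - y)) x‖ₑ ≤ ∫⁻ y, ENNReal.ofReal (ρ (x - y)) ∂μ := by
    intro x
    set I := ∫⁻ y, ENNReal.ofReal (ρ (x - y)) ∂μ with hI
    have hIfin : I ≠ ⊤ := by
      obtain ⟨C, hC⟩ := hρ.continuous.bounded_above_of_compact_support hcs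
      refine ne_of_lt ((lintegral_mono (g := fun _ => ENNReal.ofReal C) (fun y => ENNReal.ofReal_le_ofReal ((le_abs_self _).trans (hC _)))).trans_lt ?_)
      rw [lintegral_const]
      exact ENNReal.mul_lt_top ENNReal.ofReal_lt_top (measure_lt_top _ _)
    have hk0 : (kap k : ℝ≥0∞) ≠ 0 := by simpa using (kap_pos k).ne'
    have hk1 : (kap k : ℝ≥0∞) ≠ ⊤ := ENNReal.coe_ne_top
    have hfr : ∀ Ψ : Frame k, |fderiv ℝ (fun x => ∫ y in F, ρ (x - y)) x Ψ.dir| ≤ (I / kap k).toReal := by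
      intro Ψ
      have h1 := div_ineq hF hP Ψ (ψ := fun y => ρ (x - y)) (hρ.comp (contDiff_const.sub contDiff_id))
        (hcs.comp_homeomorph (Homeomorph.subLeft x)) (fun y => hρ0 _)
      have h2 : ∫ y in F, fderiv ℝ (fun y => ρ (x - y)) y Ψ.dir = - fderiv ℝ (fun x => ∫ y in F, ρ (x - y)) x Ψ.dir := by
        rw [hu, (hcs.hasFDerivAt_convolution_right (ContinuousLinearMap.mul ℝ ℝ) hχi.locallyIntegrable hρ x).fderiv,
          convolution_precompR_apply _ hχi.locallyIntegrable (hcs.fderiv ℝ) (hρ.continuous_fderiv (by norm_num)),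
          convolution_def, ← integral_indicator hF, ← integral_neg]
        congr 1; funext y
        have : fderiv ℝ (fun y => ρ (x - y)) y = -fderiv ℝ ρ (x - y) := by
          have h := ((hρ.differentiable (by norm_num)) (x - y)).hasFDerivAt.comp y ((hasFDerivAt_id y).const_sub x)
          have h' := h.fderiv
          simp only [Function.comp_def, id] at h'
          rw [h']; ext; simp
        simp only [hχ, Set.indicator, ContinuousLinearMap.mul_apply', this]
        split_ifs <;> simp
      rw [h2, enorm_neg, mul_comm, ← ENNReal.le_div_iff_mul_le (Or.inl hk0) (Or.inl hk1)] at h1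
      have h3 := ENNReal.toReal_mono (ENNReal.div_ne_top hIfin hk0) h1
      simpa using h3
    have h4 := clm_norm_le_of_frames _ _ ENNReal.toReal_nonneg hfr
    rw [mul_comm, ← ENNReal.le_div_iff_mul_le (Or.inl hk0) (Or.inl hk1), ← ENNReal.ofReal_toReal (ENNReal.div_ne_top hIfin hk0),
      ← ofReal_norm]
    exact ENNReal.ofReal_le_ofReal h4
  calc (kap k : ℝ≥0∞) * ∫⁻ x, ‖fderiv ℝ (fun x => ∫ y in F, ρ (x - y)) x‖ₑ
      = ∫⁻ x, (kap k : ℝ≥0∞) * ‖fderiv ℝ (fun x => ∫ y in F, ρ (x - y)) x‖ₑ := by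
        rw [lintegral_const_mul']; exact ENNReal.coe_ne_top
    _ ≤ ∫⁻ x, ∫⁻ y, ENNReal.ofReal (ρ (x - y)) ∂μ := lintegral_mono hpt
    _ = ∫⁻ y, (∫⁻ x, ENNReal.ofReal (ρ (x - y))) ∂μ := by
        rw [lintegral_lintegral_swap]
        apply Measurable.aemeasurable
        have := hρ.continuous.measurable
        fun_prop
    _ = ∫⁻ y, 1 ∂μ := by
        congr 1; funext y
        rw [lintegral_sub_right_eq_self (fun x => ENNReal.ofReal (ρ x)) y,
          ← ofReal_integral_eq_lintegral_ofReal (hρ.continuous.integrable_of_hasCompactSupport hcs) (Eventually.of_forall hρ0), hρ1]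
        simp
    _ = _ := by simp [hμ]

theorem transl_small {k : ℕ} {F : Set (Eu (k+1))} (hF : MeasurableSet F) (hFv : volume F ≠ ⊤) {η : ℝ} (hη : 0 < η) :
    ∃ δ > 0, ∀ z : Eu (k+1), ‖z‖ < δ → volume (symmDiff ((fun x => x - z) ⁻¹' F) F) ≤ ENNReal.ofReal η := by
  have h := tendsto_measure_symmDiff_preimage_nhds_zero (μ := (volume : Measure (Eu (k+1)))) (ν := (volume : Measure (Eu (k+1))))
    (l := nhds (0 : Eu (k+1)))
    (f := fun z => (⟨fun x => x - z, by fun_prop⟩ : C(Eu (k+1), Eu (k+1)))) (g := ⟨fun x => x - 0, by fun_prop⟩) (s := F)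
    (by
      have : Continuous (fun z : Eu (k+1) => (⟨fun x => x - z, by fun_prop⟩ : C(Eu (k+1), Eu (k+1)))) := by
        apply ContinuousMap.continuous_of_continuous_uncurry
        simp only [Function.uncurry_def, ContinuousMap.coe_mk]
        fun_prop
      exact this.tendsto 0)
    (Eventually.of_forall (fun z => measurePreserving_sub_right volume z))
    (measurePreserving_sub_right volume 0) hF.nullMeasurableSet hFv
  have h2 := (ENNReal.tendsto_nhds_zero.1 h) (ENNReal.ofReal η) (by simpa using hη)
  obtain ⟨δ, hδ, hb⟩ := Metric.eventually_nhds_iff.1 h2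
  refine ⟨δ, hδ, fun z hz => ?_⟩
  simpa using hb (y := z) (by simpa using hz)

/-- mollified approximations -/
theorem moll_exists {k : ℕ} {F : Set (Eu (k+1))} (hF : MeasurableSet F) (hFv : volume F ≠ ⊤)
    (hP : μH[(k:ℝ)] (essBoundary F) ≠ ⊤) {η : ℝ} (hη : 0 < η) :
    ∃ u : Eu (k+1) → ℝ, ContDiff ℝ 1 u ∧ (∀ x, 0 ≤ u x ∧ u x ≤ 1) ∧
      (kap k : ℝ≥0∞) * ∫⁻ x, ‖fderiv ℝ u x‖ₑ ≤ μH[(k:ℝ)] (essBoundary F) ∧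
      ∫⁻ x, ‖u x - F.indicator (fun _ => (1:ℝ)) x‖ₑ ≤ ENNReal.ofReal η := by
  obtain ⟨δ, hδ, hsm⟩ := transl_small hF hFv hη
  set φ : ContDiffBump (0 : Eu (k+1)) := ⟨δ/2, δ, by linarith, by linarith⟩
  set ρ := φ.normed volume with hρd
  have hρ : ContDiff ℝ 1 ρ := φ.contDiff_normed (n := 1)
  have hcs : HasCompactSupport ρ := φ.hasCompactSupport_normed
  have hρ0 : ∀ x, 0 ≤ ρ x := φ.nonneg_normed
  have hρ1 : ∫ x, ρ x = 1 := φ.integral_normed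
  have hρi : Integrable ρ := hρ.continuous.integrable_of_hasCompactSupport hcs
  have hρi' : ∀ x, Integrable (fun y => ρ (x - y)) := fun x => hρi.comp_sub_left x
  have hρ1' : ∀ x, ∫ y, ρ (x - y) = 1 := fun x => by rw [integral_sub_left_eq_self ρ volume x, hρ1]
  obtain ⟨h1, h2⟩ := moll_grad hF hFv hP ρ hρ hcs hρ0 hρ1
  set χ : Eu (k+1) → ℝ := F.indicator (fun _ => (1:ℝ)) with hχ
  have hχm : Measurable χ := measurable_const.indicator hF
  refine ⟨_, h1, fun x => ⟨?_, ?_⟩, h2, ?_⟩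
  · exact integral_nonneg (fun y => hρ0 _)
  · rw [← hρ1' x]
    exact setIntegral_le_integral (hρi' x) (Eventually.of_forall (fun y => hρ0 _))
  · have hpt : ∀ x, ‖(∫ y in F, ρ (x - y)) - χ x‖ₑ ≤ ∫⁻ z, ENNReal.ofReal (ρ z) * ‖χ (x - z) - χ x‖ₑ := by
      intro x
      have e1 : (∫ y in F, ρ (x - y)) - χ x = ∫ z, ρ z * (χ (x - z) - χ x) := by
        have : ∀ z, ρ z * (χ (x - z) - χ x) = ρ z * χ (x - z) - ρ z * χ x := fun z => by ring
        simp_rw [this]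
        rw [integral_sub, integral_mul_const, hρ1, one_mul]
        · congr 1
          rw [← integral_indicator hF, ← integral_sub_left_eq_self _ volume x]
          congr 1; funext z
          simp only [hχ, Set.indicator]
          split_ifs <;> simp
        · exact Integrable.mul_bdd (c := 1) hρi (hχm.comp (measurable_const.sub measurable_id)).aestronglyMeasurable
            (Eventually.of_forall (fun z => by simp only [hχ, Set.indicator]; split_ifs <;> simp))
        · exact hρi.mul_const _
      rw [e1]
      refine (enorm_integral_le_lintegral_enorm _).trans (le_of_eq ?_)
      congr 1; funext z
      rw [enorm_mul, Real.enorm_of_nonneg (hρ0 z)]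
    calc ∫⁻ x, ‖(∫ y in F, ρ (x - y)) - χ x‖ₑ ≤ ∫⁻ x, ∫⁻ z, ENNReal.ofReal (ρ z) * ‖χ (x - z) - χ x‖ₑ := lintegral_mono hpt
      _ = ∫⁻ z, ∫⁻ x, ENNReal.ofReal (ρ z) * ‖χ (x - z) - χ x‖ₑ := by
          rw [lintegral_lintegral_swap]
          apply Measurable.aemeasurable
          have := hρ.continuous.measurable
          fun_prop
      _ ≤ ∫⁻ z, ENNReal.ofReal (ρ z) * ENNReal.ofReal η := by
          apply lintegral_mono
          intro z
          simp only
          rw [lintegral_const_mul' _ _ ENNReal.ofReal_ne_top]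
          by_cases hz : ‖z‖ < δ
          · gcongr
            refine le_trans (le_of_eq ?_) (hsm z hz)
            have hms : MeasurableSet (symmDiff ((fun x => x - z) ⁻¹' F) F) :=
              ((measurable_id.sub_const z) hF).symmDiff hF
            rw [← lintegral_indicator_one hms]
            congr 1; funext x
            by_cases c1 : x - z ∈ F <;> by_cases c2 : x ∈ F <;> simp [hχ, Set.indicator, Set.mem_symmDiff, c1, c2]
          · have : ρ z = 0 := by
              have hs := φ.support_normed_eq (μ := volume)
              by_contra hne
              have : z ∈ Function.support ρ := hne
              rw [hρd, hs, mem_ball_zero_iff] at this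
              exact hz this
            simp [this]
      _ = ENNReal.ofReal η := by
          rw [lintegral_mul_const _ (by have := hρ.continuous.measurable; fun_prop),
            ← ofReal_integral_eq_lintegral_ofReal hρi (Eventually.of_forall hρ0), hρ1]
          simp

/-- universal bound for the derivative of the smooth step -/
theorem smoothStep_bound : ∃ C : ℝ, 0 < C ∧ ∀ t, |deriv Real.smoothTransition t| ≤ C := by
  have hc : Continuous (deriv Real.smoothTransition) :=
    (Real.smoothTransition.contDiff (n := 1)).continuous_deriv le_rfl
  obtain ⟨C, hC⟩ := (isCompact_Icc (a := (0:ℝ)) (b := 1)).exists_bound_of_continuousOn hc.continuousOn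
  refine ⟨|C| + 1, by positivity, fun t => ?_⟩
  have h0 : 0 ≤ |C| + 1 := by positivity
  rcases lt_or_ge t 0 with h | h
  · have : Real.smoothTransition =ᶠ[nhds t] fun _ => 0 := by
      filter_upwards [gt_mem_nhds h] with s hs using Real.smoothTransition.zero_of_nonpos (le_of_lt hs)
    rw [this.deriv_eq]; simpa using h0
  rcases lt_or_ge 1 t with h1 | h1
  · have : Real.smoothTransition =ᶠ[nhds t] fun _ => 1 := by
      filter_upwards [lt_mem_nhds h1] with s hs using Real.smoothTransition.one_of_one_le (le_of_lt hs)
    rw [this.deriv_eq]; simpa using h0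
  · have := hC t ⟨h, h1⟩
    rw [Real.norm_eq_abs] at this
    linarith [le_abs_self C]

theorem smoothStep_deriv_zero {t : ℝ} (ht : t ≤ 0 ∨ 1 ≤ t) : deriv Real.smoothTransition t = 0 := by
  rcases ht with h | h
  · apply IsLocalMin.deriv_eq_zero
    filter_upwards with s
    rw [Real.smoothTransition.zero_of_nonpos h]; exact Real.smoothTransition.nonneg s
  · apply IsLocalMax.deriv_eq_zero
    filter_upwards with s
    rw [Real.smoothTransition.one_of_one_le h]; exact Real.smoothTransition.le_one s

def cutf {n : ℕ} (s : Eu n → ℝ) (ξ h : ℝ) (x : Eu n) : ℝ := Real.smoothTransition ((s x - ξ) / h)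

section
variable {n : ℕ} {s : Eu n → ℝ} {ξ h : ℝ}

theorem cutf_contDiff (hs : ContDiff ℝ 1 s) : ContDiff ℝ 1 (cutf s ξ h) :=
  (Real.smoothTransition.contDiff (n := 1)).comp ((hs.sub contDiff_const).div_const h)
theorem cutf_nonneg (x : Eu n) : 0 ≤ cutf s ξ h x := Real.smoothTransition.nonneg _
theorem cutf_le_one (x : Eu n) : cutf s ξ h x ≤ 1 := Real.smoothTransition.le_one _
theorem cutf_zero (hh : 0 < h) {x : Eu n} (hx : s x ≤ ξ) : cutf s ξ h x = 0 :=
  Real.smoothTransition.zero_of_nonpos (div_nonpos_of_nonpos_of_nonneg (by linarith) hh.le)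
theorem cutf_one (hh : 0 < h) {x : Eu n} (hx : ξ + h ≤ s x) : cutf s ξ h x = 1 :=
  Real.smoothTransition.one_of_one_le ((one_le_div hh).2 (by linarith))

theorem cutf_fderiv (hs : ContDiff ℝ 1 s) (x : Eu n) :
    fderiv ℝ (cutf s ξ h) x = (deriv Real.smoothTransition ((s x - ξ) / h) / h) • fderiv ℝ s x := by
  have h1 : HasDerivAt Real.smoothTransition (deriv Real.smoothTransition ((s x - ξ) / h)) ((s x - ξ) / h) :=
    ((Real.smoothTransition.contDiff (n := 1)).differentiable (by norm_num) _).hasDerivAt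
  have h2 : HasFDerivAt (fun x => (s x - ξ) / h) ((1/h) • fderiv ℝ s x) x := by
    have := ((hs.differentiable (by norm_num) x).hasFDerivAt.sub_const ξ).const_smul (1/h)
    refine this.congr_of_eventuallyEq (Eventually.of_forall fun y => ?_)
    simp; ring
  have := (h1.comp_hasFDerivAt x h2).fderiv
  rw [show cutf s ξ h = Real.smoothTransition ∘ (fun x => (s x - ξ) / h) from rfl, this, smul_smul]
  congr 1; ring

theorem cutf_fderiv_zero (hs : ContDiff ℝ 1 s) (hh : 0 < h) {x : Eu n} (hx : s x ≤ ξ ∨ ξ + h ≤ s x) :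
    fderiv ℝ (cutf s ξ h) x = 0 := by
  rw [cutf_fderiv hs, smoothStep_deriv_zero]
  · simp
  · rcases hx with hx | hx
    · left; exact div_nonpos_of_nonpos_of_nonneg (by linarith) hh.le
    · right; exact (one_le_div hh).2 (by linarith)

theorem cutf_fderiv_le (hs : ContDiff ℝ 1 s) (hh : 0 < h) {C : ℝ} (hC : ∀ t, |deriv Real.smoothTransition t| ≤ C) (x : Eu n) :
    ‖fderiv ℝ (cutf s ξ h) x‖ ≤ C / h * ‖fderiv ℝ s x‖ := by
  rw [cutf_fderiv hs, norm_smul, norm_div, Real.norm_eq_abs, Real.norm_eq_abs, abs_of_pos hh]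
  gcongr
  exact hC _
end

theorem split_pointwise {n : ℕ} {w ζ : Eu n → ℝ} (hw : ContDiff ℝ 1 w) (hζ : ContDiff ℝ 1 ζ)
    (hw0 : ∀ x, 0 ≤ w x) (hζ0 : ∀ x, 0 ≤ ζ x) (hζ1 : ∀ x, ζ x ≤ 1) (x : Eu n) :
    ‖fderiv ℝ (fun x => (1 - ζ x) * w x) x‖ + ‖fderiv ℝ (fun x => ζ x * w x) x‖ ≤
      ‖fderiv ℝ w x‖ + 2 * (‖fderiv ℝ ζ x‖ * w x) := by
  have hwd := hw.differentiable (by norm_num) x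
  have hζd := hζ.differentiable (by norm_num) x
  have e1 : fderiv ℝ (fun x => ζ x * w x) x = ζ x • fderiv ℝ w x + w x • fderiv ℝ ζ x := fderiv_mul hζd hwd
  have e2 : fderiv ℝ (fun x => (1 - ζ x) * w x) x = (1 - ζ x) • fderiv ℝ w x - w x • fderiv ℝ ζ x := by
    rw [show (fun x => (1 - ζ x) * w x) = (fun x => 1 - ζ x) * w from rfl, fderiv_mul (hζd.const_sub 1) hwd, fderiv_const_sub]
    simp; abel
  rw [e1, e2]
  have h1 := norm_sub_le ((1 - ζ x) • fderiv ℝ w x) (w x • fderiv ℝ ζ x)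
  have h2 := norm_add_le (ζ x • fderiv ℝ w x) (w x • fderiv ℝ ζ x)
  rw [norm_smul, norm_smul, Real.norm_of_nonneg (hw0 x)] at h1 h2
  rw [Real.norm_of_nonneg (by linarith [hζ1 x])] at h1
  rw [Real.norm_of_nonneg (hζ0 x)] at h2
  nlinarith

/-- Sobolev inequality for functions with values in `[0,1]`. -/
theorem sobolev01 (k : ℕ) (hk : 1 ≤ k) : ∃ c : ℝ, 0 < c ∧ ∀ W : Eu (k+1) → ℝ, ContDiff ℝ 1 W → HasCompactSupport W →
    (∀ x, 0 ≤ W x ∧ W x ≤ 1) → c * (∫ x, W x ^ 2) ^ ((k:ℝ)/(k+1)) ≤ ∫ x, ‖fderiv ℝ W x‖ := by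
  have hk' : (1:ℝ) ≤ k := by exact_mod_cast hk
  set p : NNReal := ((k:NNReal)+1)/k with hp
  have hpc : NNReal.HolderConjugate (Module.finrank ℝ (Eu (k+1))) p := by
    have h0 : (k:NNReal) ≠ 0 := by positivity
    rw [NNReal.holderConjugate_iff]
    rw [finrank_euclideanSpace_fin]
    constructor
    · push_cast
      have : (0:NNReal) < k := by positivity
      exact lt_add_of_pos_left _ this
    · rw [hp]; push_cast; field_simp; ring
  set C := eLpNormLESNormFDerivOneConst (volume : Measure (Eu (k+1))) p with hC
  refine ⟨1 / ((C:ℝ) + 1), by positivity, fun W hW hcs h01 => ?_⟩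
  have hS := eLpNorm_le_eLpNorm_fderiv_one (F := ℝ) (volume : Measure (Eu (k+1))) hW hcs hpc
  have hgi : Integrable (fderiv ℝ W) := (hW.continuous_fderiv (by norm_num)).integrable_of_hasCompactSupport (hcs.fderiv ℝ)
  have hpR : ((p:NNReal):ℝ) = (k+1)/k := by rw [hp]; push_cast; rfl
  have hp1 : (1:ℝ) ≤ p := by rw [hpR, one_le_div (by linarith)]; linarith
  have hp2 : ((p:NNReal):ℝ) ≤ 2 := by rw [hpR, div_le_iff₀ (by linarith)]; linarith
  have hp0 : (p:ℝ≥0∞) ≠ 0 := by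
    have : (0:ℝ) < p := by linarith
    simpa using (by exact_mod_cast this.ne' : p ≠ 0)
  rw [eLpNorm_one_eq_lintegral_enorm, eLpNorm_eq_lintegral_rpow_enorm_toReal hp0 ENNReal.coe_ne_top] at hS
  rw [← hC] at hS
  simp only [ENNReal.coe_toReal, hpR] at hS
  have hSq : Integrable (fun x => W x ^ 2) := by
    have hc2 : HasCompactSupport (fun x => W x ^ 2) := by
      have : (fun x => W x ^ 2) = fun x => W x * W x := by funext x; ring
      rw [this]
      exact hcs.mul_right
    have hcc : Continuous (fun x => W x ^ 2) := hW.continuous.pow 2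
    exact hcc.integrable_of_hasCompactSupport hc2
  have h1 : ENNReal.ofReal (∫ x, W x ^ 2) ≤ ∫⁻ x, ‖W x‖ₑ ^ (((k:ℝ)+1)/k) := by
    rw [ofReal_integral_eq_lintegral_ofReal hSq (Eventually.of_forall (fun x => by positivity))]
    apply lintegral_mono
    intro x
    simp only
    rw [Real.enorm_of_nonneg (h01 x).1, ENNReal.ofReal_rpow_of_nonneg (h01 x).1 (by positivity)]
    apply ENNReal.ofReal_le_ofReal
    rw [← Real.rpow_natCast]
    apply Real.rpow_le_rpow_of_exponent_ge_of_imp (h01 x).1 (h01 x).2 (by rw [← hpR]; exact_mod_cast hp2)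
    intro _ h; norm_num at h
  have h2 : ENNReal.ofReal ((∫ x, W x ^ 2) ^ ((k:ℝ)/(k+1))) ≤ C * ENNReal.ofReal (∫ x, ‖fderiv ℝ W x‖) := by
    rw [ofReal_integral_norm_eq_lintegral_enorm hgi, ← ENNReal.ofReal_rpow_of_nonneg (integral_nonneg (fun x => by positivity)) (by positivity)]
    refine le_trans ?_ hS
    rw [one_div_div]
    gcongr
  have hI0 : 0 ≤ ∫ x, ‖fderiv ℝ W x‖ := integral_nonneg (fun x => norm_nonneg _)
  rw [show (C:ℝ≥0∞) = ENNReal.ofReal (C:ℝ) by simp, ← ENNReal.ofReal_mul (by positivity)] at h2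
  rw [ENNReal.ofReal_le_ofReal_iff (by positivity)] at h2
  rw [div_mul_eq_mul_div, one_mul, div_le_iff₀ (by positivity)]
  nlinarith

structure CutData {n : ℕ} (w s : Eu n → ℝ) (ξ₀ δ R : ℝ) : Prop where
  hw : ContDiff ℝ 1 w
  hs : ContDiff ℝ 1 s
  h01 : ∀ x, 0 ≤ w x ∧ w x ≤ 1
  hgi : Integrable (fun x => ‖fderiv ℝ w x‖)
  hsl : ∀ x, ξ₀ ≤ s x → s x ≤ ξ₀ + δ → ‖fderiv ℝ s x‖ ≤ 4
  hR : ∀ x, ξ₀ < s x → w x ≠ 0 → ‖x‖ ≤ R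

section
variable {n : ℕ} {w s : Eu n → ℝ} {ξ₀ δ R : ℝ}

theorem CutData.meas (D : CutData w s ξ₀ δ R) (ξ : ℝ) : MeasurableSet {x | ξ < s x} :=
  measurableSet_lt measurable_const D.hs.continuous.measurable

theorem CutData.intOn (D : CutData w s ξ₀ δ R) {ξ : ℝ} (hξ : ξ₀ ≤ ξ) (g : ℝ → ℝ) (hg : Continuous g) (hg0 : g 0 = 0)
    (hgb : ∀ t, 0 ≤ t → t ≤ 1 → |g t| ≤ 1) :
    IntegrableOn (fun x => g (w x)) {x | ξ < s x} := by
  rw [← integrable_indicator_iff (D.meas ξ)]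
  have h1 : Integrable ((closedBall (0 : Eu n) R).indicator (fun _ => (1:ℝ))) :=
    (integrable_indicator_iff measurableSet_closedBall).2 (integrableOn_const measure_closedBall_lt_top.ne)
  refine h1.mono ((hg.comp D.hw.continuous).measurable.indicator (D.meas ξ)).aestronglyMeasurable (Eventually.of_forall fun x => ?_)
  simp only [Set.indicator, Set.mem_ofPred_eq]
  split_ifs with ha hb hb
  · simpa using hgb _ (D.h01 x).1 (D.h01 x).2
  · have : w x = 0 := by
      by_contra hne
      exact hb (by simpa using D.hR x (by linarith) hne)
    simp [this, hg0]
  · simp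
  · simp

theorem CutData.intW (D : CutData w s ξ₀ δ R) {ξ : ℝ} (hξ : ξ₀ ≤ ξ) : IntegrableOn w {x | ξ < s x} :=
  D.intOn hξ (fun t => t) continuous_id rfl (fun t h0 h1 => by rw [abs_of_nonneg h0]; exact h1)

theorem CutData.intP (D : CutData w s ξ₀ δ R) {ξ : ℝ} (hξ : ξ₀ ≤ ξ) : IntegrableOn (fun x => w x * (1 - w x)) {x | ξ < s x} :=
  D.intOn hξ (fun t => t * (1 - t)) (by fun_prop) (by simp)
    (fun t h0 h1 => by rw [abs_of_nonneg (by nlinarith)]; nlinarith)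

theorem CutData.cutIntegrable (D : CutData w s ξ₀ δ R) {C : ℝ} (hC : ∀ t, |deriv Real.smoothTransition t| ≤ C)
    {ξ h : ℝ} (hξ : ξ₀ ≤ ξ) (hh : 0 < h) (hξh : ξ + h ≤ ξ₀ + δ) (x : Eu n) :
    ‖fderiv ℝ (cutf s ξ h) x‖ * w x ≤ {x | ξ < s x}.indicator (fun x => 4 * C / h * w x) x := by
  have hC0 : 0 ≤ C := (abs_nonneg _).trans (hC 0)
  simp only [Set.indicator, Set.mem_ofPred_eq]
  split_ifs with hx
  · apply mul_le_mul_of_nonneg_right _ (D.h01 x).1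
    by_cases h2 : s x ≤ ξ + h
    · refine (cutf_fderiv_le D.hs hh hC x).trans ?_
      have := D.hsl x (by linarith) (by linarith)
      have h3 : 0 ≤ C / h := by positivity
      calc C / h * ‖fderiv ℝ s x‖ ≤ C / h * 4 := by gcongr
        _ = _ := by ring
    · rw [cutf_fderiv_zero D.hs hh (Or.inr (by linarith))]; simp; positivity
  · rw [cutf_fderiv_zero D.hs hh (Or.inl (by linarith))]; simp
end

theorem cut_step {k : ℕ} {w s : Eu (k+1) → ℝ} {ξ₀ δ R : ℝ} (D : CutData w s ξ₀ δ R) {C c : ℝ}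
    (hC : ∀ t, |deriv Real.smoothTransition t| ≤ C)
    (hc : 0 < c) (hsob : ∀ W : Eu (k+1) → ℝ, ContDiff ℝ 1 W → HasCompactSupport W →
    (∀ x, 0 ≤ W x ∧ W x ≤ 1) → c * (∫ x, W x ^ 2) ^ ((k:ℝ)/(k+1)) ≤ ∫ x, ‖fderiv ℝ W x‖)
    {ξ h : ℝ} (hξ : ξ₀ ≤ ξ) (hh : 0 < h) (hξh : ξ + h ≤ ξ₀ + δ) {π : ℝ}
    (hπ : ∫ x in {x | ξ₀ < s x}, w x * (1 - w x) ≤ π) :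
    Integrable (fun x => ‖fderiv ℝ (fun x => (1 - cutf s ξ h x) * w x) x‖) ∧
    (∫ x, ‖fderiv ℝ (fun x => (1 - cutf s ξ h x) * w x) x‖) +
      c * (max 0 ((∫ x in {x | ξ + h < s x}, w x) - π)) ^ ((k:ℝ)/(k+1)) ≤
    (∫ x, ‖fderiv ℝ w x‖) + 8 * C / h * ∫ x in {x | ξ < s x}, w x := by
  set ζ := cutf s ξ h with hζd
  have hζ : ContDiff ℝ 1 ζ := cutf_contDiff D.hs
  have hζ0 : ∀ x, 0 ≤ ζ x := cutf_nonneg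
  have hζ1 : ∀ x, ζ x ≤ 1 := cutf_le_one
  have hsp := split_pointwise D.hw hζ (fun x => (D.h01 x).1) hζ0 hζ1
  have hci := D.cutIntegrable hC hξ hh hξh
  have hind : Integrable ({x | ξ < s x}.indicator (fun x => 4 * C / h * w x)) :=
    (integrable_indicator_iff (D.meas ξ)).2 ((D.intW hξ).const_mul _)
  have hdom : Integrable (fun x => ‖fderiv ℝ w x‖ + 2 * {x | ξ < s x}.indicator (fun x => 4 * C / h * w x) x) :=
    D.hgi.add (hind.const_mul 2)
  have hcd1 : ContDiff ℝ 1 (fun x => (1 - ζ x) * w x) := (contDiff_const.sub hζ).mul D.hw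
  have hcd2 : ContDiff ℝ 1 (fun x => ζ x * w x) := hζ.mul D.hw
  have hcs : HasCompactSupport (fun x => ζ x * w x) := by
    apply HasCompactSupport.of_support_subset_isCompact (isCompact_closedBall (0 : Eu (k+1)) R)
    intro x hx
    have hx' : ζ x * w x ≠ 0 := hx
    have h1 : ξ < s x := by
      by_contra hn
      exact hx' (by rw [hζd, cutf_zero hh (not_lt.1 hn), zero_mul])
    simpa using D.hR x (by linarith) (right_ne_zero_of_mul hx')
  have i1 : Integrable (fun x => ‖fderiv ℝ (fun x => (1 - ζ x) * w x) x‖) := by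
    refine hdom.mono (hcd1.continuous_fderiv (by norm_num)).norm.aestronglyMeasurable (Eventually.of_forall fun x => ?_)
    rw [norm_norm, Real.norm_eq_abs]
    refine le_trans ?_ (le_abs_self _)
    linarith [hsp x, hci x, norm_nonneg (fderiv ℝ (fun x => ζ x * w x) x)]
  have i2 : Integrable (fun x => ‖fderiv ℝ (fun x => ζ x * w x) x‖) :=
    ((hcd2.continuous_fderiv (by norm_num)).integrable_of_hasCompactSupport (hcs.fderiv ℝ)).norm
  refine ⟨i1, ?_⟩
  have h1 : (∫ x, ‖fderiv ℝ (fun x => (1 - ζ x) * w x) x‖) + (∫ x, ‖fderiv ℝ (fun x => ζ x * w x) x‖) ≤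
      (∫ x, ‖fderiv ℝ w x‖) + 8 * C / h * ∫ x in {x | ξ < s x}, w x := by
    rw [← integral_add i1 i2]
    calc _ ≤ ∫ x, (‖fderiv ℝ w x‖ + 2 * {x | ξ < s x}.indicator (fun x => 4 * C / h * w x) x) :=
          integral_mono (i1.add i2) hdom (fun x => by simp only [Pi.add_apply]; linarith [hsp x, hci x])
      _ = _ := by
          rw [integral_add D.hgi (hind.const_mul 2), integral_const_mul, integral_indicator (D.meas ξ), integral_const_mul]
          ring
  have h2 := hsob _ hcd2 hcs (fun x => ⟨mul_nonneg (hζ0 x) (D.h01 x).1, mul_le_one₀ (hζ1 x) (D.h01 x).1 (D.h01 x).2⟩)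
  have h3 : max 0 ((∫ x in {x | ξ + h < s x}, w x) - π) ≤ ∫ x, (ζ x * w x) ^ 2 := by
    apply max_le
    · exact integral_nonneg (fun x => by positivity)
    · have hsq : Integrable (fun x => (ζ x * w x) ^ 2) := by
        have hc2 : HasCompactSupport (fun x => (ζ x * w x) ^ 2) := by
          have : (fun x => (ζ x * w x) ^ 2) = fun x => (ζ x * w x) * (ζ x * w x) := by funext x; ring
          rw [this]
          exact hcs.mul_right
        have hcc : Continuous (fun x => (ζ x * w x) ^ 2) := hcd2.continuous.pow 2
        exact hcc.integrable_of_hasCompactSupport hc2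
      have h4 : ∫ x in {x | ξ + h < s x}, (w x - w x * (1 - w x)) ≤ ∫ x, (ζ x * w x) ^ 2 := by
        calc ∫ x in {x | ξ + h < s x}, (w x - w x * (1 - w x)) = ∫ x in {x | ξ + h < s x}, (ζ x * w x) ^ 2 := by
              apply setIntegral_congr_fun (D.meas _)
              intro x hx
              have hx' : ξ + h < s x := hx
              simp only [hζd, cutf_one hh hx'.le]; ring
          _ ≤ _ := setIntegral_le_integral hsq (Eventually.of_forall (fun x => by positivity))
      rw [integral_sub (D.intW (by linarith)) (D.intP (by linarith))] at h4
      have h5 : ∫ x in {x | ξ + h < s x}, w x * (1 - w x) ≤ ∫ x in {x | ξ₀ < s x}, w x * (1 - w x) := by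
        apply setIntegral_mono_set (D.intP le_rfl)
        · exact Eventually.of_forall (fun x => mul_nonneg (D.h01 x).1 (by linarith [(D.h01 x).2]))
        · apply Eventually.of_forall
          intro x hx
          have hx' : ξ + h < s x := hx
          show ξ₀ < s x
          linarith
      linarith
  have h6 : c * (max 0 ((∫ x in {x | ξ + h < s x}, w x) - π)) ^ ((k:ℝ)/(k+1)) ≤ c * (∫ x, (ζ x * w x) ^ 2) ^ ((k:ℝ)/(k+1)) := by
    gcongr
  linarith

theorem cut_main (k : ℕ) (hk : 1 ≤ k) (K δ : ℝ) (hK : 0 ≤ K) (hδ : 0 < δ) : ∃ ε : ℝ, 0 < ε ∧ ∀ e : ℝ, 0 < e → ∃ π : ℝ, 0 < π ∧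
    ∀ (w s : Eu (k+1) → ℝ) (ξ₀ R : ℝ), CutData w s ξ₀ δ R → ∫ x in {x | ξ₀ < s x}, w x ≤ ε →
      ∫ x in {x | ξ₀ < s x}, w x * (1 - w x) ≤ π →
      ∃ ζ : Eu (k+1) → ℝ, ContDiff ℝ 1 ζ ∧ (∀ x, 0 ≤ ζ x ∧ ζ x ≤ 1) ∧ (∀ x, s x ≤ ξ₀ → ζ x = 0) ∧
        (∀ x, ξ₀ + δ ≤ s x → ζ x = 1) ∧ Integrable (fun x => ‖fderiv ℝ (fun x => (1 - ζ x) * w x) x‖) ∧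
        (∫ x, ‖fderiv ℝ (fun x => (1 - ζ x) * w x) x‖) + K * (∫ x, ζ x * w x) ≤ (∫ x, ‖fderiv ℝ w x‖) + e := by
  obtain ⟨C, hC0, hC⟩ := smoothStep_bound
  obtain ⟨c, hc, hsob⟩ := sobolev01 k hk
  set n : ℝ := (k:ℝ) + 1 with hn
  have hk' : (1:ℝ) ≤ k := by exact_mod_cast hk
  have hn0 : 0 < n := by positivity
  set q : ℝ := (1/2:ℝ) ^ (1/n) with hq
  have hq0 : 0 < q := by positivity
  have hq1 : q < 1 := Real.rpow_lt_one (by norm_num) (by norm_num) (by positivity)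
  have hqn : ∀ i : ℕ, (q ^ i) = ((1/2:ℝ) ^ i) ^ (1/n) := by
    intro i
    rw [hq, ← Real.rpow_natCast, ← Real.rpow_mul (by norm_num), ← Real.rpow_natCast, ← Real.rpow_mul (by norm_num), mul_comm]
  set A1 : ℝ := 8 * C / (δ * (1 - q)) with hA1
  have h1q : 0 < 1 - q := by linarith
  have hA10 : 0 < A1 := by positivity
  set ε : ℝ := (c / (4 * (A1 + K))) ^ n with hε
  have hε0 : 0 < ε := by positivity
  have hεn : ε ^ (1/n) = c / (4 * (A1 + K)) := by
    rw [hε, ← Real.rpow_mul (by positivity), mul_one_div_cancel hn0.ne', Real.rpow_one]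
  refine ⟨ε, hε0, fun e he => ?_⟩
  set M : ℝ := (A1 + K) * ε ^ (1/n) with hM
  have hMc : M = c / 4 := by rw [hM, hεn]; field_simp
  set θ : ℝ := (k:ℝ)/(k+1) with hθ
  have hθ0 : 0 < θ := by positivity
  have hθ1 : θ ≤ 1 := by rw [hθ, div_le_one (by positivity)]; linarith
  have hθn : θ + 1/n = 1 := by rw [hθ, hn]; field_simp
  set π : ℝ := (e / M) ^ (1/θ) / 4 with hπd
  have hM0 : 0 < M := by positivity
  have hπ0 : 0 < π := by positivity
  refine ⟨π, hπ0, fun w s ξ₀ R D hε1 hπ1 => ?_⟩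
  set ξ : ℕ → ℝ := fun i => ξ₀ + δ * (1 - q ^ i) with hξ
  set h : ℕ → ℝ := fun i => δ * (1 - q) * q ^ i with hh
  have hξs : ∀ i, ξ i + h i = ξ (i+1) := fun i => by simp only [hξ, hh]; ring
  have hξ0 : ∀ i, ξ₀ ≤ ξ i := fun i => by
    simp only [hξ]
    have : q ^ i ≤ 1 := pow_le_one₀ hq0.le hq1.le
    nlinarith
  have hξ1 : ∀ i, ξ i ≤ ξ₀ + δ := fun i => by
    simp only [hξ]
    have : 0 ≤ q ^ i := by positivity
    nlinarith
  have hhp : ∀ i, 0 < h i := fun i => by simp only [hh]; positivity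
  set f : ℕ → ℝ := fun i => ∫ x in {x | ξ i < s x}, w x with hf
  have hf0 : ∀ i, 0 ≤ f i := fun i => setIntegral_nonneg (D.meas _) (fun x _ => (D.h01 x).1)
  have hf00 : f 0 ≤ ε := by simpa [hf, hξ] using hε1
  have hstep : ∀ i, Integrable (fun x => ‖fderiv ℝ (fun x => (1 - cutf s (ξ i) (h i) x) * w x) x‖) ∧
    (∫ x, ‖fderiv ℝ (fun x => (1 - cutf s (ξ i) (h i) x) * w x) x‖) +
      c * (max 0 (f (i+1) - π)) ^ θ ≤ (∫ x, ‖fderiv ℝ w x‖) + 8 * C / h i * f i := by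
    intro i
    have := cut_step D hC hc hsob (hξ0 i) (hhp i) (by rw [hξs]; exact hξ1 _) hπ1
    rw [hξs] at this
    exact this
  -- loss bound
  have hloss : ∀ i, f i ≤ (1/2:ℝ)^i * ε → 8 * C / h i * f i + K * f i ≤ M * f i ^ θ := by
    intro i hi
    have hfi := hf0 i
    have e1 : f i = f i ^ θ * f i ^ (1/n) := by
      rcases eq_or_lt_of_le hfi with h0 | h0
      · rw [← h0, Real.zero_rpow hθ0.ne', zero_mul]
      · rw [← Real.rpow_add h0, hθn, Real.rpow_one]
    have e2 : f i ^ (1/n) ≤ q ^ i * ε ^ (1/n) := by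
      rw [hqn, ← Real.mul_rpow (by positivity) hε0.le]
      exact Real.rpow_le_rpow hfi hi (by positivity)
    have e3 : q ^ i ≤ 1 := pow_le_one₀ hq0.le hq1.le
    have hqi : 0 < q ^ i := by positivity
    have e4 : 8 * C / h i = A1 / q ^ i := by simp only [hA1, hh]; field_simp
    have hft : 0 ≤ f i ^ θ := by positivity
    have hεp : 0 ≤ ε ^ (1/n) := by positivity
    calc 8 * C / h i * f i + K * f i = (A1 / q^i + K) * (f i ^ θ * f i ^ (1/n)) := by rw [e4, ← e1]; ring
      _ ≤ (A1 / q^i + K) * (f i ^ θ * (q ^ i * ε ^ (1/n))) := by gcongr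
      _ = A1 * (f i ^ θ * ε ^ (1/n)) + K * (f i ^ θ * ε ^ (1/n)) * q ^ i := by field_simp
      _ ≤ A1 * (f i ^ θ * ε ^ (1/n)) + K * (f i ^ θ * ε ^ (1/n)) * 1 := by gcongr
      _ = M * f i ^ θ := by rw [hM]; ring
  -- conclusion from a good index
  have hconc : ∀ i, f i ≤ (1/2:ℝ)^i * ε → M * f i ^ θ ≤ c * (max 0 (f (i+1) - π)) ^ θ + e →
      ∃ ζ : Eu (k+1) → ℝ, ContDiff ℝ 1 ζ ∧ (∀ x, 0 ≤ ζ x ∧ ζ x ≤ 1) ∧ (∀ x, s x ≤ ξ₀ → ζ x = 0) ∧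
        (∀ x, ξ₀ + δ ≤ s x → ζ x = 1) ∧ Integrable (fun x => ‖fderiv ℝ (fun x => (1 - ζ x) * w x) x‖) ∧
        (∫ x, ‖fderiv ℝ (fun x => (1 - ζ x) * w x) x‖) + K * (∫ x, ζ x * w x) ≤ (∫ x, ‖fderiv ℝ w x‖) + e := by
    intro i hi hg
    refine ⟨cutf s (ξ i) (h i), cutf_contDiff D.hs, fun x => ⟨cutf_nonneg x, cutf_le_one x⟩,
      fun x hx => cutf_zero (hhp i) (hx.trans (hξ0 i)), fun x hx => cutf_one (hhp i) (by rw [hξs]; exact (hξ1 _).trans hx), (hstep i).1, ?_⟩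
    have h1 : ∫ x, cutf s (ξ i) (h i) x * w x ≤ f i := by
      simp only [hf]
      rw [← integral_indicator (D.meas _)]
      apply integral_mono_of_nonneg
      · exact Eventually.of_forall (fun x => mul_nonneg (cutf_nonneg x) (D.h01 x).1)
      · exact (integrable_indicator_iff (D.meas _)).2 (D.intW (hξ0 i))
      · apply Eventually.of_forall
        intro x
        simp only [Set.indicator, Set.mem_ofPred_eq]
        split_ifs with hx
        · exact mul_le_of_le_one_left (D.h01 x).1 (cutf_le_one x)
        · rw [cutf_zero (hhp i) (not_lt.1 hx), zero_mul]
    have h2 := (hstep i).2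
    have h3 := hloss i hi
    have h4 := mul_le_mul_of_nonneg_left h1 hK
    linarith
  by_cases hex : ∃ i, f i ≤ (1/2:ℝ)^i * ε ∧ f i / 2 ≤ f (i+1)
  · obtain ⟨i, hi, hi2⟩ := hex
    apply hconc i hi
    have hfi := hf0 i
    by_cases h4 : 4 * π ≤ f i
    · have h5 : f i / 4 ≤ max 0 (f (i+1) - π) := le_max_of_le_right (by linarith)
      have h6 : (f i / 4) ^ θ ≤ (max 0 (f (i+1) - π)) ^ θ := Real.rpow_le_rpow (by positivity) h5 hθ0.le
      rw [Real.div_rpow hfi (by norm_num)] at h6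
      have h7 : (4:ℝ) ^ θ ≤ 4 := by
        calc (4:ℝ) ^ θ ≤ 4 ^ (1:ℝ) := Real.rpow_le_rpow_of_exponent_le (by norm_num) hθ1
          _ = 4 := by simp
      have h8 : f i ^ θ / 4 ≤ f i ^ θ / 4 ^ θ := by gcongr
      rw [hMc]
      have := mul_le_mul_of_nonneg_left (h8.trans h6) hc.le
      linarith
    · push Not at h4
      have h5 : f i ^ θ ≤ e / M := by
        calc f i ^ θ ≤ (4 * π) ^ θ := Real.rpow_le_rpow hfi h4.le hθ0.le
          _ = e / M := by
            rw [hπd, mul_div_cancel₀ _ (by norm_num), ← Real.rpow_mul (by positivity), one_div_mul_cancel hθ0.ne', Real.rpow_one]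
      have h6 : M * f i ^ θ ≤ e := by
        rw [le_div_iff₀ hM0] at h5; linarith
      have h7 : 0 ≤ c * (max 0 (f (i+1) - π)) ^ θ := by positivity
      linarith
  · push Not at hex
    have hall : ∀ i, f i ≤ (1/2:ℝ)^i * ε := by
      intro i
      induction i with
      | zero => simpa using hf00
      | succ i ih =>
        have := hex i ih
        rw [pow_succ]; linarith
    have ht : Tendsto (fun i : ℕ => M * ((1/2:ℝ)^i * ε) ^ θ) atTop (nhds 0) := by
      have h1 : Tendsto (fun i : ℕ => (1/2:ℝ)^i * ε) atTop (nhds (0 * ε)) :=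
        (tendsto_pow_atTop_nhds_zero_of_lt_one (r := (1/2:ℝ)) (by norm_num) (by norm_num)).mul_const _
      rw [zero_mul] at h1
      have h2 := (h1.rpow_const (p := θ) (Or.inr hθ0.le)).const_mul M
      rwa [Real.zero_rpow hθ0.ne', mul_zero] at h2
    obtain ⟨i, hi⟩ := (ht.eventually (gt_mem_nhds he)).exists
    apply hconc i (hall i)
    have h5 : f i ^ θ ≤ ((1/2:ℝ)^i * ε) ^ θ := Real.rpow_le_rpow (hf0 i) (hall i) hθ0.le
    have h7 : 0 ≤ c * (max 0 (f (i+1) - π)) ^ θ := by positivity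
    have := mul_le_mul_of_nonneg_left h5 hM0.le
    linarith

theorem normsq_contDiff {n : ℕ} : ContDiff ℝ 1 (fun x : Eu n => ‖x‖ ^ 2) := contDiff_norm_sq ℝ

theorem normsq_fderiv_le {n : ℕ} (x : Eu n) : ‖fderiv ℝ (fun x : Eu n => ‖x‖ ^ 2) x‖ ≤ 2 * ‖x‖ := by
  rw [fderiv_norm_sq, Pi.smul_apply, two_nsmul, two_mul]
  exact (norm_add_le _ _).trans (by simp)

theorem moll_cs {k : ℕ} {F : Set (Eu (k+1))} (hF : MeasurableSet F) (hFv : volume F ≠ ⊤)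
    (hP : μH[(k:ℝ)] (essBoundary F) ≠ ⊤) {η : ℝ} (hη : 0 < η) :
    ∃ u : Eu (k+1) → ℝ, ContDiff ℝ 1 u ∧ HasCompactSupport u ∧ (∀ x, 0 ≤ u x ∧ u x ≤ 1) ∧
      (kap k : ℝ≥0∞).toReal * (∫ x, ‖fderiv ℝ u x‖) ≤ (μH[(k:ℝ)] (essBoundary F)).toReal + η ∧
      ∫ x, |u x - F.indicator (fun _ => (1:ℝ)) x| ≤ η := by
  obtain ⟨u, hu, h01, hg, hd⟩ := moll_exists hF hFv hP (half_pos hη)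
  have hκ0 := kap_pos k
  have hgr : Continuous (fun x => fderiv ℝ u x) := hu.continuous_fderiv (by norm_num)
  have hgi : Integrable (fun x => ‖fderiv ℝ u x‖) := by
    refine ⟨hgr.norm.aestronglyMeasurable, ?_⟩
    rw [hasFiniteIntegral_iff_enorm]
    simp only [enorm_norm]
    by_contra hc
    rw [not_lt, top_le_iff] at hc
    rw [hc, ENNReal.mul_top (by simpa using hκ0.ne')] at hg
    exact hP (top_le_iff.1 hg)
  have hFi : Integrable (F.indicator (fun _ => (1:ℝ))) :=
    (integrable_indicator_iff hF).2 (integrableOn_const hFv)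
  have hdi : Integrable (fun x => u x - F.indicator (fun _ => (1:ℝ)) x) :=
    ⟨hu.continuous.aestronglyMeasurable.sub hFi.1, by
      rw [hasFiniteIntegral_iff_enorm]; exact hd.trans_lt ofReal_lt_top⟩
  have hui : Integrable u := by
    have := hdi.add hFi
    refine this.congr (Eventually.of_forall fun x => by simp)
  have hd' : ∫ x, |u x - F.indicator (fun _ => (1:ℝ)) x| ≤ η/2 := by
    have := integral_norm_eq_lintegral_enorm hdi.1
    simp only [Real.norm_eq_abs] at this
    rw [this]
    exact ENNReal.toReal_le_of_le_ofReal (half_pos hη).le hd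
  have hg' : (kap k : ℝ≥0∞).toReal * (∫ x, ‖fderiv ℝ u x‖) ≤ (μH[(k:ℝ)] (essBoundary F)).toReal := by
    have h1 := integral_norm_eq_lintegral_enorm (μ := volume) hgr.aestronglyMeasurable
    rw [h1, ← ENNReal.toReal_mul]
    exact ENNReal.toReal_mono hP hg
  obtain ⟨C, hC0, hC⟩ := smoothStep_bound
  set κ := (kap k : ℝ≥0∞).toReal with hκ
  have hκ0' : 0 ≤ κ := ENNReal.toReal_nonneg
  let ζ : ℕ → Eu (k+1) → ℝ := fun N => cutf (fun x => ‖x‖^2) (((N:ℝ)+1)^2) (3*((N:ℝ)+1)^2)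
  have hR (N : ℕ) : (0:ℝ) < 3*((N:ℝ)+1)^2 := by positivity
  have hζg (N : ℕ) (x : Eu (k+1)) : ‖fderiv ℝ (ζ N) x‖ ≤ 4 * C / (3*((N:ℝ)+1)) := by
    by_cases hx : ((N:ℝ)+1)^2 + 3*((N:ℝ)+1)^2 ≤ ‖x‖^2
    · simp only [ζ]
      rw [cutf_fderiv_zero normsq_contDiff (hR N) (Or.inr hx), norm_zero]; positivity
    · have hx' : ‖x‖ ≤ 2 * ((N:ℝ)+1) := by
        by_contra hh
        push Not at hh hx
        nlinarith [norm_nonneg x]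
      calc _ ≤ C / (3*((N:ℝ)+1)^2) * ‖fderiv ℝ (fun x : Eu (k+1) => ‖x‖ ^ 2) x‖ := cutf_fderiv_le normsq_contDiff (hR N) hC x
        _ ≤ C / (3*((N:ℝ)+1)^2) * (2 * (2 * ((N:ℝ)+1))) := by
            gcongr; exact (normsq_fderiv_le x).trans (by linarith)
        _ = _ := by field_simp; ring
  have ht1 : Tendsto (fun N : ℕ => ∫ x, ζ N x * u x) atTop (nhds (∫ x : Eu (k+1), (0:ℝ))) := by
    refine tendsto_integral_of_dominated_convergence u
      (fun N => ((cutf_contDiff normsq_contDiff).continuous.mul hu.continuous).aestronglyMeasurable) hui ?_ ?_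
    · intro N
      refine Eventually.of_forall fun x => ?_
      rw [Real.norm_eq_abs, abs_of_nonneg (mul_nonneg (cutf_nonneg x) (h01 x).1)]
      exact mul_le_of_le_one_left (h01 x).1 (cutf_le_one x)
    · refine Eventually.of_forall fun x => ?_
      obtain ⟨M, hM⟩ := exists_nat_ge ‖x‖
      refine tendsto_const_nhds.congr' ?_
      filter_upwards [eventually_ge_atTop M] with N hN
      have hN' : (M:ℝ) ≤ N := by exact_mod_cast hN
      have : ζ N x = 0 := cutf_zero (hR N) (by
        have := norm_nonneg x
        gcongr; linarith)
      rw [this, zero_mul]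
  have ht2 : Tendsto (fun N : ℕ => κ * (2 * (4 * C / (3*((N:ℝ)+1)) * ∫ x, u x))) atTop (nhds (κ * (2 * (0 * ∫ x, u x)))) := by
    refine ((Filter.Tendsto.mul_const _ ?_).const_mul 2).const_mul κ
    have h1 := (tendsto_one_div_add_atTop_nhds_zero_nat (𝕜 := ℝ)).const_mul (4*C/3)
    rw [mul_zero] at h1
    refine h1.congr (fun N => ?_)
    field_simp
  rw [integral_zero] at ht1
  simp only [zero_mul, mul_zero] at ht2
  obtain ⟨N, hN1, hN2⟩ := ((ht1.eventually (gt_mem_nhds (half_pos hη))).and (ht2.eventually (gt_mem_nhds (half_pos hη)))).exists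
  have hζc : ContDiff ℝ 1 (ζ N) := cutf_contDiff normsq_contDiff
  have hζi : Integrable (fun x => ζ N x * u x) := by
    refine hui.mono (hζc.continuous.mul hu.continuous).aestronglyMeasurable (Eventually.of_forall fun x => ?_)
    rw [Real.norm_eq_abs, Real.norm_eq_abs, abs_of_nonneg (mul_nonneg (cutf_nonneg x) (h01 x).1), abs_of_nonneg (h01 x).1]
    exact mul_le_of_le_one_left (h01 x).1 (cutf_le_one x)
  have hcd : ContDiff ℝ 1 (fun x => (1 - ζ N x) * u x) := (contDiff_const.sub hζc).mul hu
  have hcs : HasCompactSupport (fun x => (1 - ζ N x) * u x) := by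
    refine HasCompactSupport.intro (isCompact_closedBall (0 : Eu (k+1)) (2*((N:ℝ)+1))) (fun x hx => ?_)
    have : ζ N x = 1 := cutf_one (hR N) (by
      simp only [mem_closedBall, dist_zero_right, not_le] at hx
      have : (0:ℝ) ≤ 2*((N:ℝ)+1) := by positivity
      nlinarith)
    rw [this]; ring
  refine ⟨_, hcd, hcs, fun x => ?_, ?_, ?_⟩
  · have h0 : 0 ≤ ζ N x := cutf_nonneg x
    have h1 : ζ N x ≤ 1 := cutf_le_one x
    exact ⟨mul_nonneg (by linarith) (h01 x).1, mul_le_one₀ (by linarith) (h01 x).1 (h01 x).2⟩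
  · have h1 : (∫ x, ‖fderiv ℝ (fun x => (1 - ζ N x) * u x) x‖) ≤ (∫ x, ‖fderiv ℝ u x‖) + 2 * (4 * C / (3*((N:ℝ)+1)) * ∫ x, u x) := by
      have hi2 : Integrable (fun x => 2 * (4 * C / (3*((N:ℝ)+1)) * u x)) := (hui.const_mul _).const_mul _
      rw [← integral_const_mul (4 * C / (3*((N:ℝ)+1))), ← integral_const_mul 2, ← integral_add hgi hi2]
      refine integral_mono ((hcd.continuous_fderiv (by norm_num)).integrable_of_hasCompactSupport (hcs.fderiv ℝ)).norm
        (hgi.add hi2) (fun x => ?_)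
      simp only [Pi.add_apply]
      have := split_pointwise hu hζc (fun x => (h01 x).1) (fun x => cutf_nonneg x) (fun x => cutf_le_one x) x
      have h2 := mul_le_mul_of_nonneg_right (hζg N x) (h01 x).1
      linarith [norm_nonneg (fderiv ℝ (fun x => ζ N x * u x) x)]
    have := mul_le_mul_of_nonneg_left h1 hκ0'
    rw [mul_add] at this
    linarith
  · have : ∫ x, |(1 - ζ N x) * u x - F.indicator (fun _ => (1:ℝ)) x| ≤
      (∫ x, |u x - F.indicator (fun _ => (1:ℝ)) x|) + ∫ x, ζ N x * u x := by
      rw [← integral_add hdi.abs hζi]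
      have hi : Integrable (fun x => (1 - ζ N x) * u x - F.indicator (fun _ => (1:ℝ)) x) := by
        refine (hdi.sub hζi).congr (Eventually.of_forall fun x => ?_)
        simp only [Pi.sub_apply]; ring
      refine integral_mono hi.abs (hdi.abs.add hζi) (fun x => ?_)
      simp only [Pi.add_apply]
      have h0 : 0 ≤ ζ N x * u x := mul_nonneg (cutf_nonneg x) (h01 x).1
      calc _ = |(u x - F.indicator (fun _ => (1:ℝ)) x) - ζ N x * u x| := by congr 1; ring
        _ ≤ _ := (abs_sub _ _).trans (by rw [abs_of_nonneg h0])
    linarith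

theorem two_cut (k : ℕ) (hk : 1 ≤ k) (K τ : ℝ) (hK : 0 ≤ K) (hτ : 0 < τ) (hτ1 : τ ≤ 1/2) :
    ∃ ε : ℝ, 0 < ε ∧ ∀ e : ℝ, 0 < e → ∃ π : ℝ, 0 < π ∧
    ∀ (F : Set (Eu (k+1))) (u : Eu (k+1) → ℝ), MeasurableSet F → volume F ≠ ⊤ → ContDiff ℝ 1 u → HasCompactSupport u →
      (∀ x, 0 ≤ u x ∧ u x ≤ 1) → volume (symmDiff (unitBall (k+1)) F) ≤ ENNReal.ofReal ε →
      ∫ x, |u x - F.indicator (fun _ => (1:ℝ)) x| ≤ π →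
      ∃ u1 : Eu (k+1) → ℝ, ContDiff ℝ 1 u1 ∧ (∀ x, 0 ≤ u1 x ∧ u1 x ≤ 1) ∧ (∀ x, ‖x‖ ≤ 1 - τ → u1 x = 1) ∧
        (∀ x, 1 + τ ≤ ‖x‖ → u1 x = 0) ∧
        (∫ x, ‖fderiv ℝ u1 x‖) + K * (∫ x, |u x - u1 x|) ≤ (∫ x, ‖fderiv ℝ u x‖) + e := by
  obtain ⟨ε, hε, hcut⟩ := cut_main k hk K (τ/2) hK (by linarith)
  refine ⟨ε/2, by linarith, fun e he => ?_⟩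
  obtain ⟨π, hπ, hcut⟩ := hcut (e/2) (by linarith)
  refine ⟨min π (ε/2), by positivity, fun F u hF hFv hu hcs h01 hsd hd => ?_⟩
  have hd1 := hd.trans (min_le_left _ _)
  have hd2 := hd.trans (min_le_right _ _)
  have hFi : Integrable (F.indicator (fun _ => (1:ℝ))) :=
    (integrable_indicator_iff hF).2 (integrableOn_const hFv)
  have hui : Integrable u := hu.continuous.integrable_of_hasCompactSupport hcs
  have hdi := (hui.sub hFi).abs
  simp only [Pi.sub_apply] at hdi
  have hsdr : (volume (symmDiff (unitBall (k+1)) F)).toReal ≤ ε/2 :=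
    ENNReal.toReal_le_of_le_ofReal (by linarith) hsd
  have hsdf : volume (symmDiff (unitBall (k+1)) F) ≠ ⊤ := (hsd.trans_lt ofReal_lt_top).ne
  have hmB : MeasurableSet (unitBall (k+1)) := measurableSet_ball
  have hsm : MeasurableSet (symmDiff (unitBall (k+1)) F) := hmB.symmDiff hF
  have hsi : Integrable ((symmDiff (unitBall (k+1)) F).indicator (fun _ => (1:ℝ))) :=
    (integrable_indicator_iff hsm).2 (integrableOn_const hsdf)
  -- general bounds
  have key (G : Set (Eu (k+1))) (hG : MeasurableSet G) (w : Eu (k+1) → ℝ)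
      (hle : ∀ x ∈ G, w x ≤ |u x - F.indicator (fun _ => (1:ℝ)) x| + (symmDiff (unitBall (k+1)) F).indicator (fun _ => (1:ℝ)) x)
      (hwi : IntegrableOn w G) : ∫ x in G, w x ≤ ε := by
    calc _ ≤ ∫ x in G, (|u x - F.indicator (fun _ => (1:ℝ)) x| + (symmDiff (unitBall (k+1)) F).indicator (fun _ => (1:ℝ)) x) :=
          setIntegral_mono_on hwi (hdi.add hsi).integrableOn hG hle
      _ ≤ ∫ x, (|u x - F.indicator (fun _ => (1:ℝ)) x| + (symmDiff (unitBall (k+1)) F).indicator (fun _ => (1:ℝ)) x) := by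
          refine setIntegral_le_integral (hdi.add hsi) (Eventually.of_forall fun x => ?_)
          have : 0 ≤ (symmDiff (unitBall (k+1)) F).indicator (fun _ => (1:ℝ)) x := Set.indicator_nonneg (fun _ _ => zero_le_one) _
          simp only [Pi.zero_apply]; positivity
      _ ≤ ε := by
          rw [integral_add hdi hsi, integral_indicator hsm, setIntegral_const]
          simp only [smul_eq_mul, mul_one, Measure.real]
          linarith
  have pen (G : Set (Eu (k+1))) (hG : MeasurableSet G) (w : Eu (k+1) → ℝ)
      (hle : ∀ x ∈ G, w x = u x * (1 - u x)) (hwi : IntegrableOn w G) : ∫ x in G, w x ≤ π := by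
    refine le_trans ?_ hd1
    refine le_trans (setIntegral_mono_on hwi hdi.integrableOn hG (fun x hx => ?_))
      (setIntegral_le_integral hdi (Eventually.of_forall fun x => abs_nonneg _))
    rw [hle x hx]
    have := h01 x
    by_cases hxF : x ∈ F
    · simp only [Set.indicator_of_mem hxF]
      rw [abs_sub_comm, abs_of_nonneg (by linarith)]; nlinarith
    · simp only [Set.indicator_of_notMem hxF, sub_zero]
      rw [abs_of_nonneg this.1]; nlinarith
  obtain ⟨R, hR⟩ := hcs.isCompact.isBounded.subset_closedBall (0 : Eu (k+1))
  have hgi : Integrable (fun x => ‖fderiv ℝ u x‖) :=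
    ((hu.continuous_fderiv (by norm_num)).integrable_of_hasCompactSupport (hcs.fderiv ℝ)).norm
  have D1 : CutData u (fun x => ‖x‖^2) (1 + τ/2) (τ/2) R := by
    refine ⟨hu, normsq_contDiff, h01, hgi, fun x _ hx => ?_, fun x _ hx => ?_⟩
    · refine (normsq_fderiv_le x).trans ?_
      nlinarith [norm_nonneg x]
    · simpa using hR (subset_closure hx)
  obtain ⟨ζ, hζ, hζ01, hζ0, hζ1, hi1, hc1⟩ := hcut u _ _ R D1
    (key _ (D1.meas _) _ (fun x hx => by
      simp only [Set.mem_ofPred_eq] at hx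
      have hxB : x ∉ unitBall (k+1) := by
        simp only [unitBall, mem_ball, dist_zero_right, not_lt]
        nlinarith [norm_nonneg x]
      by_cases hxF : x ∈ F
      · rw [Set.indicator_of_mem (show x ∈ symmDiff (unitBall (k+1)) F from Or.inr ⟨hxF, hxB⟩)]
        linarith [(h01 x).2, abs_nonneg (u x - F.indicator (fun _ => (1:ℝ)) x)]
      · rw [Set.indicator_of_notMem hxF, sub_zero]
        have : 0 ≤ (symmDiff (unitBall (k+1)) F).indicator (fun _ => (1:ℝ)) x := Set.indicator_nonneg (fun _ _ => zero_le_one) _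
        linarith [le_abs_self (u x)]) (D1.intW le_rfl))
    (pen _ (D1.meas _) _ (fun x hx => rfl) (D1.intP le_rfl))
  set u' : Eu (k+1) → ℝ := fun x => (1 - ζ x) * u x with hu'
  have hu'c : ContDiff ℝ 1 u' := (contDiff_const.sub hζ).mul hu
  have hu'01 (x) : 0 ≤ u' x ∧ u' x ≤ 1 :=
    ⟨mul_nonneg (by linarith [(hζ01 x).2]) (h01 x).1, mul_le_one₀ (by linarith [(hζ01 x).1]) (h01 x).1 (h01 x).2⟩
  have hfd (g : Eu (k+1) → ℝ) (x : Eu (k+1)) : ‖fderiv ℝ (fun x => 1 - g x) x‖ = ‖fderiv ℝ g x‖ := by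
    rw [fderiv_const_sub, norm_neg]
  have D2 : CutData (fun x => 1 - u' x) (fun x => -‖x‖^2) (-(1 - τ/2)) (τ/2) 1 := by
    refine ⟨contDiff_const.sub hu'c, normsq_contDiff.neg, fun x => ⟨by linarith [(hu'01 x).2], by linarith [(hu'01 x).1]⟩, ?_, fun x hx _ => ?_, fun x hx _ => ?_⟩
    · simp only [hfd]; exact hi1
    · rw [show (fun x : Eu (k+1) => -‖x‖^2) = -(fun x : Eu (k+1) => ‖x‖^2) from rfl, fderiv_neg, norm_neg]
      refine (normsq_fderiv_le x).trans ?_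
      nlinarith [norm_nonneg x]
    · nlinarith [norm_nonneg x]
  have hin (x : Eu (k+1)) (hx : x ∈ {x : Eu (k+1) | -(1 - τ/2) < -‖x‖^2}) : u' x = u x := by
    simp only [Set.mem_ofPred_eq] at hx
    simp only [hu', hζ0 x (by linarith)]; ring
  obtain ⟨ζ', hζ', hζ'01, hζ'0, hζ'1, hi2, hc2⟩ := hcut _ _ _ 1 D2
    (key _ (D2.meas _) _ (fun x hx => by
      rw [hin x hx]
      simp only [Set.mem_ofPred_eq] at hx
      have hxB : x ∈ unitBall (k+1) := by
        simp only [unitBall, mem_ball, dist_zero_right]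
        nlinarith [norm_nonneg x]
      by_cases hxF : x ∈ F
      · rw [Set.indicator_of_mem hxF]
        have : 0 ≤ (symmDiff (unitBall (k+1)) F).indicator (fun _ => (1:ℝ)) x := Set.indicator_nonneg (fun _ _ => zero_le_one) _
        linarith [neg_le_abs (u x - 1)]
      · rw [Set.indicator_of_mem (show x ∈ symmDiff (unitBall (k+1)) F from Or.inl ⟨hxB, hxF⟩)]
        linarith [(h01 x).1, abs_nonneg (u x - F.indicator (fun _ => (1:ℝ)) x)]) (D2.intW le_rfl))
    (pen _ (D2.meas _) _ (fun x hx => by rw [hin x hx]; ring) (D2.intP le_rfl))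
  set u1 : Eu (k+1) → ℝ := fun x => 1 - (1 - ζ' x) * (1 - u' x) with hu1
  have hu1c : ContDiff ℝ 1 u1 := contDiff_const.sub ((contDiff_const.sub hζ').mul (contDiff_const.sub hu'c))
  refine ⟨u1, hu1c, fun x => ?_, fun x hx => ?_, fun x hx => ?_, ?_⟩
  · have a := hζ'01 x; have b := hu'01 x
    have c1 : 0 ≤ (1 - ζ' x) * (1 - u' x) := mul_nonneg (by linarith) (by linarith)
    have c2 : (1 - ζ' x) * (1 - u' x) ≤ 1 := mul_le_one₀ (by linarith) (by linarith) (by linarith)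
    exact ⟨by simp only [hu1]; linarith, by simp only [hu1]; linarith⟩
  · have := hζ'1 x (by nlinarith [norm_nonneg x])
    simp only [hu1, this]; ring
  · have h1 := hζ'0 x (by nlinarith [norm_nonneg x])
    have h2 := hζ1 x (by nlinarith [norm_nonneg x])
    simp only [hu1, h1, hu', h2]; ring
  · have e1 : ∫ x, ‖fderiv ℝ u1 x‖ = ∫ x, ‖fderiv ℝ (fun x => (1 - ζ' x) * (1 - u' x)) x‖ := by
      simp only [hu1, hfd]
    have e2 : ∫ x, ‖fderiv ℝ (fun x => 1 - u' x) x‖ = ∫ x, ‖fderiv ℝ u' x‖ := by simp only [hfd]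
    rw [e2] at hc2
    have j1 : Integrable (fun x => ζ x * u x) :=
      (hζ.continuous.mul hu.continuous).integrable_of_hasCompactSupport hcs.mul_left
    have j2 : Integrable (fun x => ζ' x * (1 - u' x)) := by
      refine (hζ'.continuous.mul (continuous_const.sub hu'c.continuous)).integrable_of_hasCompactSupport ?_
      refine HasCompactSupport.intro (isCompact_closedBall (0 : Eu (k+1)) 1) (fun x hx => ?_)
      simp only [mem_closedBall, dist_zero_right, not_le] at hx
      change ζ' x * (1 - u' x) = 0
      rw [hζ'0 x (by nlinarith), zero_mul]
    have h3 : ∫ x, |u x - u1 x| ≤ (∫ x, ζ x * u x) + ∫ x, ζ' x * (1 - u' x) := by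
      rw [← integral_add j1 j2]
      refine integral_mono_of_nonneg (Eventually.of_forall fun x => abs_nonneg _) (j1.add j2) (Eventually.of_forall fun x => ?_)
      simp only
      have a1 : 0 ≤ ζ x * u x := mul_nonneg (hζ01 x).1 (h01 x).1
      have a2 : 0 ≤ ζ' x * (1 - u' x) := mul_nonneg (hζ'01 x).1 (by linarith [(hu'01 x).2])
      have a3 : u x - u1 x = ζ x * u x - ζ' x * (1 - u' x) := by
        simp only [hu1, hu']; ring
      rw [a3]
      refine (abs_sub _ _).trans (by rw [abs_of_nonneg a1, abs_of_nonneg a2])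
    have := mul_le_mul_of_nonneg_left h3 hK
    rw [mul_add] at this
    rw [e1]; linarith

def rk {n : ℕ} (α : ℝ) (x y : Eu n) : ℝ≥0∞ := ENNReal.ofReal (‖x - y‖ ^ (α - (n : ℝ)))

theorem rk_comm {n : ℕ} (α : ℝ) (x y : Eu n) : rk α x y = rk α y x := by
  simp only [rk, norm_sub_rev]

theorem measurable_rk {n : ℕ} (α : ℝ) : Measurable (fun p : Eu n × Eu n => rk α p.1 p.2) := by
  unfold rk
  exact ((measurable_fst.sub measurable_snd).norm.pow_const _).ennreal_ofReal

theorem measurable_rk_left {n : ℕ} (α : ℝ) (w : Eu n) : Measurable (fun z : Eu n => rk α w z) := by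
  unfold rk
  exact ((measurable_const.sub measurable_id).norm.pow_const _).ennreal_ofReal

theorem pw_int {n : ℕ} (hn : 1 ≤ n) {α : ℝ} (hα : 0 < α) (R : ℝ) :
    ∫⁻ z in ball (0 : Eu n) R, ENNReal.ofReal (‖z‖ ^ (α - (n : ℝ))) < ⊤ := by
  haveI : Nontrivial (Eu n) := by
    haveI : Nonempty (Fin n) := ⟨⟨0, hn⟩⟩
    infer_instance
  have h1 : IntegrableOn (fun z : Eu n => (fun r : ℝ => r ^ (α - (n:ℝ))) ‖z‖) (ball 0 R) := by
    refine (integrableOn_fun_norm_addHaar volume (f := fun r : ℝ => r ^ (α - (n:ℝ)))).2 ?_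
    simp only [finrank_euclideanSpace, Fintype.card_fin, smul_eq_mul]
    rcases le_or_gt R 0 with hR | hR
    · rw [Set.Ioo_eq_empty (by linarith)]; exact integrableOn_empty
    have h2 : IntegrableOn (fun r : ℝ => r ^ (α - 1)) (Set.Ioo 0 R) :=
      (intervalIntegral.integrableOn_Ioo_rpow_iff hR).2 (by linarith)
    refine h2.congr_fun (fun r hr => ?_) measurableSet_Ioo
    simp only
    rw [← Real.rpow_natCast, ← Real.rpow_add hr.1]
    congr 1
    push_cast [Nat.cast_sub hn]; ring
  have h2 := h1.lintegral_lt_top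
  exact h2

theorem pot_bound {n : ℕ} (hn : 1 ≤ n) {α : ℝ} (hα : 0 < α) (hαn : α < n) :
    ∃ C : NNReal, ∀ (x : Eu n) (A : Set (Eu n)), ∫⁻ y in A, rk α x y ≤ C + volume A := by
  have h1 := pw_int hn hα 1
  refine ⟨(∫⁻ z in ball (0 : Eu n) 1, ENNReal.ofReal (‖z‖ ^ (α - (n : ℝ)))).toNNReal, fun x A => ?_⟩
  rw [ENNReal.coe_toNNReal h1.ne]
  set g : Eu n → ℝ≥0∞ := (ball (0 : Eu n) 1).indicator (fun z => ENNReal.ofReal (‖z‖ ^ (α - (n : ℝ)))) with hg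
  have hle (y : Eu n) : rk α x y ≤ g (x - y) + 1 := by
    simp only [rk, hg, Set.indicator, mem_ball, dist_zero_right]
    split_ifs with h
    · exact le_self_add
    · rw [zero_add]
      rw [ENNReal.ofReal_le_one]
      exact Real.rpow_le_one_of_one_le_of_nonpos (not_lt.1 h) (by linarith)
  calc ∫⁻ y in A, rk α x y ≤ ∫⁻ y in A, (g (x - y) + 1) := lintegral_mono hle
    _ = (∫⁻ y in A, g (x - y)) + ∫⁻ y in A, 1 := lintegral_add_right _ measurable_const
    _ ≤ (∫⁻ y, g (x - y)) + volume A := by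
        gcongr
        · exact Measure.restrict_le_self
        · simp
    _ = _ := by
        rw [lintegral_sub_left_eq_self g x, hg, lintegral_indicator measurableSet_ball]

theorem riesz_sub {n : ℕ} {α : ℝ} {C : NNReal}
    (hC : ∀ (x : Eu n) (A : Set (Eu n)), ∫⁻ y in A, rk α x y ≤ C + volume A)
    {A F : Set (Eu n)} (hA : MeasurableSet A) (hF : MeasurableSet F) :
    rieszEnergy α A ≤ rieszEnergy α F + 2 * (volume (A \ F) * (C + volume A)) := by
  have hm := measurable_rk (n := n) α
  have hb (D : Set (Eu n)) : Measurable (fun x => ∫⁻ y in D, rk α x y) := hm.lintegral_prod_right'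
  have e0 (G : Set (Eu n)) : rieszEnergy α G = ∫⁻ x in G, ∫⁻ y in G, rk α x y := rfl
  have e1 : ∫⁻ x in A \ F, ∫⁻ y in A, rk α x y ≤ volume (A \ F) * (C + volume A) := by
    calc _ ≤ ∫⁻ x in A \ F, ((C:ℝ≥0∞) + volume A) := lintegral_mono (fun x => hC x A)
      _ = _ := by rw [setLIntegral_const, mul_comm]
  have e2 : ∫⁻ x in A ∩ F, ∫⁻ y in A \ F, rk α x y ≤ volume (A \ F) * (C + volume A) := by
    calc _ ≤ ∫⁻ x in A, ∫⁻ y in A \ F, rk α x y := lintegral_mono_set Set.inter_subset_left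
      _ = ∫⁻ y in A \ F, ∫⁻ x in A, rk α x y := by
          rw [lintegral_lintegral_swap]
          exact hm.aemeasurable
      _ = ∫⁻ y in A \ F, ∫⁻ x in A, rk α y x := by simp_rw [rk_comm]
      _ ≤ _ := e1
  have e3 : ∫⁻ x in A ∩ F, ∫⁻ y in A ∩ F, rk α x y ≤ rieszEnergy α F := by
    rw [e0]
    refine (lintegral_mono_set Set.inter_subset_right).trans (lintegral_mono fun x => lintegral_mono_set Set.inter_subset_right)
  rw [e0 A, ← lintegral_inter_add_sdiff (fun x => ∫⁻ y in A, rk α x y) A hF]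
  have e4 : ∫⁻ x in A ∩ F, ∫⁻ y in A, rk α x y =
      (∫⁻ x in A ∩ F, ∫⁻ y in A ∩ F, rk α x y) + ∫⁻ x in A ∩ F, ∫⁻ y in A \ F, rk α x y := by
    rw [← lintegral_add_left (hb _)]
    refine lintegral_congr fun x => ?_
    rw [lintegral_inter_add_sdiff _ A hF]
  rw [e4, two_mul, ← add_assoc]
  exact add_le_add (add_le_add e3 e2) e1

theorem riesz_translate {n : ℕ} (α : ℝ) {A : Set (Eu n)} (hA : MeasurableSet A) (y : Eu n) :
    rieszEnergy α ((fun x => x - y) ⁻¹' A) = rieszEnergy α A := by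
  have hmp : MeasurePreserving (fun x : Eu n => x - y) volume volume := measurePreserving_sub_right volume y
  have hb : Measurable (fun x => ∫⁻ z in A, rk α x z) := (measurable_rk (n := n) α).lintegral_prod_right'
  have h1 : ∫⁻ x in (fun x => x - y) ⁻¹' A, (∫⁻ z in A, rk α (x - y) z) = ∫⁻ x in A, ∫⁻ z in A, rk α x z :=
    hmp.setLIntegral_comp_preimage hA hb
  have h2 (x : Eu n) : ∫⁻ z in (fun x => x - y) ⁻¹' A, rk α (x - y) (z - y) = ∫⁻ z in A, rk α (x - y) z := by
    exact hmp.setLIntegral_comp_preimage hA (measurable_rk_left α (x - y))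
  calc rieszEnergy α ((fun x => x - y) ⁻¹' A) = ∫⁻ x in (fun x => x - y) ⁻¹' A, (∫⁻ z in (fun x => x - y) ⁻¹' A, rk α (x - y) (z - y)) := by
        unfold rieszEnergy rk; simp only [sub_sub_sub_cancel_right]
    _ = ∫⁻ x in (fun x => x - y) ⁻¹' A, (∫⁻ z in A, rk α (x - y) z) := lintegral_congr h2
    _ = ∫⁻ x in A, ∫⁻ z in A, rk α x z := h1
    _ = _ := by unfold rieszEnergy rk; rfl

theorem riesz_ne_top {n : ℕ} {α : ℝ} {C : NNReal}
    (hC : ∀ (x : Eu n) (A : Set (Eu n)), ∫⁻ y in A, rk α x y ≤ C + volume A)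
    {A : Set (Eu n)} (hA : volume A ≠ ⊤) : rieszEnergy α A ≠ ⊤ := by
  have : rieszEnergy α A ≤ ∫⁻ x in A, ((C:ℝ≥0∞) + volume A) := lintegral_mono (fun x => hC x A)
  refine (this.trans_lt ?_).ne
  rw [setLIntegral_const]
  exact ENNReal.mul_lt_top (ENNReal.add_lt_top.2 ⟨coe_lt_top, hA.lt_top⟩) hA.lt_top

/-- The analytic core. -/
def AnaCore (k : ℕ) (α : ℝ) : Prop :=
  ∃ δ : ℝ, 0 < δ ∧ δ ≤ 1/2 ∧ ∃ c₀ : ℝ, 0 < c₀ ∧ ∃ C : ℝ, 0 ≤ C ∧ ∀ u : Eu (k+1) → ℝ, ContDiff ℝ 1 u →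
    (∀ x, 0 ≤ u x ∧ u x ≤ 1) → (∀ x, ‖x‖ ≤ 1 - δ → u x = 1) → (∀ x, 1 + δ ≤ ‖x‖ → u x = 0) →
    (∫ x, u x • x = 0) → ∃ A : Set (Eu (k+1)), MeasurableSet A ∧ A ⊆ ball 0 2 ∧ ∀ t : ℝ, 0 ≤ t → t ≤ c₀ →
      ((k:ℝ)+1) * (volume (unitBall (k+1))).toReal + t * (rieszEnergy α (unitBall (k+1))).toReal
        + (∫ x, |u x - A.indicator (fun _ => (1:ℝ)) x|) ≤
      (∫ x, ‖fderiv ℝ u x‖) + t * (rieszEnergy α A).toReal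
        + C * (|(∫ x, u x) - (volume (unitBall (k+1))).toReal| + ∫ x, u x * (1 - u x))

theorem vol_ball_real {k : ℕ} {r : ℝ} (hr : 0 ≤ r) :
    (volume (ball (0 : Eu (k+1)) r)).toReal = r ^ (k+1) * (volume (unitBall (k+1))).toReal := by
  rw [Measure.addHaar_ball volume (0 : Eu (k+1)) hr, ENNReal.toReal_mul, ENNReal.toReal_ofReal (by positivity)]
  simp [unitBall]

theorem bary {k : ℕ} {δ : ℝ} (hδ : 0 < δ) : ∃ τ : ℝ, 0 < τ ∧ τ ≤ 1/2 ∧ ∀ u : Eu (k+1) → ℝ, Continuous u →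
    (∀ x, 0 ≤ u x ∧ u x ≤ 1) → (∀ x, ‖x‖ ≤ 1 - τ → u x = 1) → (∀ x, 1 + τ ≤ ‖x‖ → u x = 0) →
    ∃ y : Eu (k+1), (∀ x, ‖x‖ ≤ 1 - δ → u (x + y) = 1) ∧ (∀ x, 1 + δ ≤ ‖x‖ → u (x + y) = 0) ∧ ∫ x, u (x + y) • x = 0 := by
  have hcont : Tendsto (fun τ : ℝ => τ + 2 ^ (k+2) * ((1+τ)^(k+1) - (1-τ)^(k+1))) (nhdsWithin 0 (Set.Ioi 0)) (nhds 0) := by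
    have : Continuous (fun τ : ℝ => τ + 2 ^ (k+2) * ((1+τ)^(k+1) - (1-τ)^(k+1))) := by fun_prop
    have h := this.tendsto 0
    simp only [add_zero, sub_zero, one_pow, sub_self, mul_zero] at h
    exact h.mono_left nhdsWithin_le_nhds
  have hsm : ∀ᶠ τ : ℝ in nhdsWithin 0 (Set.Ioi 0), τ < 1/2 := nhdsWithin_le_nhds (gt_mem_nhds (by norm_num))
  obtain ⟨τ, ⟨hτ1, hτ2⟩, hτ0⟩ := (((hcont.eventually (gt_mem_nhds hδ)).and hsm).and self_mem_nhdsWithin).exists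
  refine ⟨τ, hτ0, hτ2.le, fun u hu h01 h1 h0 => ?_⟩
  have hτ0' : 0 < τ := hτ0
  set ω := (volume (unitBall (k+1))).toReal with hω
  have hω0 : 0 < ω := unitBall_vol_pos _
  have hcs : HasCompactSupport u := HasCompactSupport.intro (isCompact_closedBall (0 : Eu (k+1)) (1+τ))
    (fun x hx => h0 x (by simp only [mem_closedBall, dist_zero_right, not_le] at hx; exact hx.le))
  have hui : Integrable u := hu.integrable_of_hasCompactSupport hcs
  have huxi : Integrable (fun x => u x • x) := (hu.smul continuous_id).integrable_of_hasCompactSupport hcs.smul_right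
  set M := ∫ x, u x with hM
  have hbi (r : ℝ) : Integrable ((ball (0 : Eu (k+1)) r).indicator (fun _ => (1:ℝ))) :=
    (integrable_indicator_iff measurableSet_ball).2 (integrableOn_const measure_ball_lt_top.ne)
  have hbv (r : ℝ) (hr : 0 ≤ r) : ∫ x, (ball (0 : Eu (k+1)) r).indicator (fun _ => (1:ℝ)) x = r^(k+1) * ω := by
    rw [integral_indicator measurableSet_ball, setIntegral_const, Measure.real, vol_ball_real hr, smul_eq_mul, mul_one]
  have hM1 : (1/2:ℝ)^(k+1) * ω ≤ M := by
    rw [← hbv _ (by norm_num)]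
    refine integral_mono (hbi _) hui (fun x => ?_)
    simp only [Set.indicator, mem_ball, dist_zero_right]
    split_ifs with h
    · rw [h1 x (by linarith)]
    · exact (h01 x).1
  have hM0 : 0 < M := lt_of_lt_of_le (by positivity) hM1
  have hbx : Integrable (fun x : Eu (k+1) => (ball (0 : Eu (k+1)) (1-τ)).indicator (fun _ => (1:ℝ)) x • x) := by
    have : (fun x : Eu (k+1) => (ball (0 : Eu (k+1)) (1-τ)).indicator (fun _ => (1:ℝ)) x • x) = (ball (0 : Eu (k+1)) (1-τ)).indicator (fun x => x) := by
      funext x; simp only [Set.indicator]; split_ifs <;> simp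
    rw [this, integrable_indicator_iff measurableSet_ball]
    exact (continuous_id.continuousOn.integrableOn_compact (isCompact_closedBall (0 : Eu (k+1)) (1-τ))).mono_set ball_subset_closedBall
  have hodd : ∫ x : Eu (k+1), (ball (0 : Eu (k+1)) (1-τ)).indicator (fun _ => (1:ℝ)) x • x = 0 := by
    have h := integral_neg_eq_self (fun x : Eu (k+1) => (ball (0 : Eu (k+1)) (1-τ)).indicator (fun _ => (1:ℝ)) x • x) volume
    have h2 : ∀ x : Eu (k+1), (ball (0 : Eu (k+1)) (1-τ)).indicator (fun _ => (1:ℝ)) (-x) • (-x) = -((ball (0 : Eu (k+1)) (1-τ)).indicator (fun _ => (1:ℝ)) x • x) := by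
      intro x
      simp only [Set.indicator, mem_ball, dist_zero_right, norm_neg, smul_neg]
    simp only [h2] at h
    rw [integral_neg] at h
    have h5 := add_eq_zero_iff_eq_neg.2 h.symm
    rw [← two_smul ℝ] at h5
    exact (smul_eq_zero.1 h5).resolve_left two_ne_zero
  have hnorm : ‖∫ x, u x • x‖ ≤ 2 * (((1+τ)^(k+1) - (1-τ)^(k+1)) * ω) := by
    have e1 : ∫ x, u x • x = ∫ x, (u x • x - (ball (0 : Eu (k+1)) (1-τ)).indicator (fun _ => (1:ℝ)) x • x) := by
      rw [integral_sub huxi hbx, hodd, sub_zero]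
    rw [e1]
    have e2 : 2 * (((1+τ)^(k+1) - (1-τ)^(k+1)) * ω) = ∫ x, 2 * ((ball (0 : Eu (k+1)) (1+τ)).indicator (fun _ => (1:ℝ)) x - (ball (0 : Eu (k+1)) (1-τ)).indicator (fun _ => (1:ℝ)) x) := by
      rw [integral_const_mul, integral_sub (hbi _) (hbi _), hbv _ (by linarith), hbv _ (by linarith)]; ring
    rw [e2]
    refine norm_integral_le_of_norm_le (((hbi _).sub (hbi _)).const_mul 2) (Eventually.of_forall fun x => ?_)
    rw [← sub_smul, norm_smul]
    simp only [Set.indicator, mem_ball, dist_zero_right]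
    split_ifs with ha hb hb
    · rw [h1 x ha.le]; simp
    · linarith
    · rw [sub_zero, Real.norm_eq_abs, abs_of_nonneg (h01 x).1]
      have := h01 x
      nlinarith [norm_nonneg x]
    · rw [h0 x (by linarith)]; simp
  set y := M⁻¹ • ∫ x, u x • x with hy
  have hyn : τ + ‖y‖ ≤ δ := by
    have h3 : ‖y‖ ≤ 2 ^ (k+2) * ((1+τ)^(k+1) - (1-τ)^(k+1)) := by
      rw [hy, norm_smul, norm_inv, Real.norm_eq_abs, abs_of_pos hM0, inv_mul_le_iff₀ hM0]
      refine hnorm.trans ?_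
      have hD : 0 ≤ (1+τ)^(k+1) - (1-τ)^(k+1) := by
        rw [sub_nonneg]; gcongr <;> linarith
      have : 2 ^ (k+2) * ((1+τ)^(k+1) - (1-τ)^(k+1)) * ((1/2:ℝ)^(k+1) * ω) ≤ 2 ^ (k+2) * ((1+τ)^(k+1) - (1-τ)^(k+1)) * M := by gcongr
      have e : (2:ℝ) ^ (k+2) * (1/2:ℝ)^(k+1) = 2 := by
        rw [pow_succ, mul_assoc, mul_comm (2:ℝ), ← mul_assoc, ← mul_pow]; norm_num
      calc _ = (2:ℝ) ^ (k+2) * (1/2:ℝ)^(k+1) * (((1+τ)^(k+1) - (1-τ)^(k+1)) * ω) := by rw [e]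
        _ = 2 ^ (k+2) * ((1+τ)^(k+1) - (1-τ)^(k+1)) * ((1/2:ℝ)^(k+1) * ω) := by ring
        _ ≤ _ := by linarith
    linarith
  refine ⟨y, fun x hx => h1 _ ?_, fun x hx => h0 _ ?_, ?_⟩
  · linarith [norm_add_le x y]
  · have := norm_sub_le (x + y) y
    rw [add_sub_cancel_right] at this; linarith
  · have e := integral_add_right_eq_self (μ := volume) (fun z : Eu (k+1) => u z • (z - y)) y
    simp only [add_sub_cancel_right] at e
    rw [e]
    simp only [smul_sub]
    rw [integral_sub huxi (hui.smul_const y), integral_smul_const, ← hM, hy, smul_smul, mul_inv_cancel₀ hM0.ne', one_smul, sub_self]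

set_option maxHeartbeats 2000000 in
theorem core_real {k : ℕ} (hk : 1 ≤ k) {α : ℝ} (hα : 0 < α) (hαn : α < k + 1) (h : AnaCore k α) :
    ∃ ε : ℝ, 0 < ε ∧ ∃ t₀ : ℝ, 0 < t₀ ∧ ∀ F : Set (Eu (k+1)), MeasurableSet F →
      volume F = volume (unitBall (k+1)) → volume (symmDiff (unitBall (k+1)) F) ≤ ENNReal.ofReal ε →
      μH[(k:ℝ)] (essBoundary F) ≠ ⊤ → ∀ t : ℝ, 0 ≤ t → t ≤ t₀ →
      (kap k : ℝ≥0∞).toReal * (((k:ℝ)+1) * (volume (unitBall (k+1))).toReal + t * (rieszEnergy α (unitBall (k+1))).toReal) ≤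
        (μH[(k:ℝ)] (essBoundary F)).toReal + (kap k : ℝ≥0∞).toReal * (t * (rieszEnergy α F).toReal) := by
  obtain ⟨δ, hδ, hδ2, c₀, hc₀, C, hC, H⟩ := h
  obtain ⟨Cp, hCp⟩ := pot_bound (n := k+1) (by omega) hα (by push_cast; exact hαn)
  have hv2 : volume (ball (0 : Eu (k+1)) 2) ≠ ⊤ := measure_ball_lt_top.ne
  set D : ℝ := 2 * ((Cp:ℝ) + (volume (ball (0 : Eu (k+1)) 2)).toReal) with hD
  have hD0 : 0 ≤ D := by positivity
  obtain ⟨τ, hτ0, hτ1, hbary⟩ := bary (k := k) hδ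
  obtain ⟨ε, hε, hcut⟩ := two_cut k hk (2*C+1) τ (by positivity) hτ0 hτ1
  refine ⟨ε, hε, min c₀ (1/(D+1)), by positivity, fun F hF hFvol hsd hP t ht0 ht1 => ?_⟩
  have htc : t ≤ c₀ := ht1.trans (min_le_left _ _)
  have htD : t * D ≤ 1 := by
    have h1 := ht1.trans (min_le_right _ _)
    rw [le_div_iff₀ (by positivity)] at h1
    nlinarith
  have hFv : volume F ≠ ⊤ := by rw [hFvol]; exact unitBall_vol_ne_top _
  set κ := (kap k : ℝ≥0∞).toReal with hκ
  have hκ0 : 0 ≤ κ := ENNReal.toReal_nonneg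
  set P := (μH[(k:ℝ)] (essBoundary F)).toReal with hPd
  set ω := (volume (unitBall (k+1))).toReal with hω
  set VB := (rieszEnergy α (unitBall (k+1))).toReal
  set VF := (rieszEnergy α F).toReal with hVF
  have main : ∀ e : ℝ, 0 < e → κ * (((k:ℝ)+1) * ω + t * VB) ≤ P + κ * (t * VF) + (e + κ * (e + (1 + 2 * C) * e)) := by
    intro e he
    obtain ⟨π, hπ, hcut⟩ := hcut e he
    obtain ⟨u, hu, hcs, h01, hgu, hdu⟩ := moll_cs hF hFv hP (η := min π e) (by positivity)
    have hdπ := hdu.trans (min_le_left _ _)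
    have hde := hdu.trans (min_le_right _ _)
    have hge : κ * (∫ x, ‖fderiv ℝ u x‖) ≤ P + e := hgu.trans (by linarith [min_le_right π e])
    obtain ⟨u1, hu1, h101, h11, h10, hI1⟩ := hcut F u hF hFv hu hcs h01 hsd hdπ
    obtain ⟨y, hy1, hy0, hyb⟩ := hbary u1 hu1.continuous h101 h11 h10
    obtain ⟨A, hAm, hA2, hA⟩ := H (fun x => u1 (x + y)) (hu1.comp (contDiff_id.add contDiff_const)) (fun x => h101 _) hy1 hy0 hyb
    have hA := hA t ht0 htc
    have hcs1 : HasCompactSupport u1 := HasCompactSupport.intro (isCompact_closedBall (0 : Eu (k+1)) (1+τ))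
      (fun x hx => h10 x (by simp only [mem_closedBall, dist_zero_right, not_le] at hx; exact hx.le))
    have hui : Integrable u := hu.continuous.integrable_of_hasCompactSupport hcs
    have hu1i : Integrable u1 := hu1.continuous.integrable_of_hasCompactSupport hcs1
    have hFi : Integrable (F.indicator (fun _ => (1:ℝ))) :=
      (integrable_indicator_iff hF).2 (integrableOn_const hFv)
    have hAv : volume A ≤ volume (ball (0 : Eu (k+1)) 2) := measure_mono hA2
    have hAf : volume A ≠ ⊤ := (hAv.trans_lt hv2.lt_top).ne
    set A' := (fun x => x - y) ⁻¹' A with hA'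
    have hmp : MeasurePreserving (fun x : Eu (k+1) => x - y) volume volume := measurePreserving_sub_right volume y
    have hA'm : MeasurableSet A' := hmp.measurable hAm
    have hA'v : volume A' = volume A := hmp.measure_preimage hAm.nullMeasurableSet
    have hA'i : Integrable (A'.indicator (fun _ => (1:ℝ))) :=
      (integrable_indicator_iff hA'm).2 (integrableOn_const (by rw [hA'v]; exact hAf))
    -- translations
    have T1 : ∫ x, ‖fderiv ℝ (fun x => u1 (x + y)) x‖ = ∫ x, ‖fderiv ℝ u1 x‖ := by
      simp only [fderiv_comp_add_right]
      exact integral_add_right_eq_self (μ := volume) (fun x => ‖fderiv ℝ u1 x‖) y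
    have T2 : ∫ x, u1 (x + y) = ∫ x, u1 x := integral_add_right_eq_self (μ := volume) (fun x => u1 x) y
    have T3 : ∫ x, u1 (x + y) * (1 - u1 (x + y)) = ∫ x, u1 x * (1 - u1 x) :=
      integral_add_right_eq_self (μ := volume) (fun x => u1 x * (1 - u1 x)) y
    have T4 : ∫ x, |u1 (x + y) - A.indicator (fun _ => (1:ℝ)) x| = ∫ x, |u1 x - A'.indicator (fun _ => (1:ℝ)) x| := by
      rw [← integral_add_right_eq_self (μ := volume) (fun x => |u1 x - A'.indicator (fun _ => (1:ℝ)) x|) y]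
      refine integral_congr_ae (Eventually.of_forall fun x => ?_)
      have hiff : x + y ∈ A' ↔ x ∈ A := by rw [hA', Set.mem_preimage, add_sub_cancel_right]
      by_cases hx : x ∈ A
      · simp only [Set.indicator_of_mem hx, Set.indicator_of_mem (hiff.2 hx)]
      · simp only [Set.indicator_of_notMem hx, Set.indicator_of_notMem (fun h => hx (hiff.1 h))]
    simp only [T1, T2, T3, T4] at hA
    set b := ∫ x, |u1 x - A'.indicator (fun _ => (1:ℝ)) x| with hb
    set d := ∫ x, |u x - u1 x| with hd
    have i1 : Integrable (fun x => |u x - u1 x|) := (hui.sub hu1i).abs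
    have i2 : Integrable (fun x => |u x - F.indicator (fun _ => (1:ℝ)) x|) := (hui.sub hFi).abs
    have i3 : Integrable (fun x => |u1 x - A'.indicator (fun _ => (1:ℝ)) x|) := (hu1i.sub hA'i).abs
    have hd0 : 0 ≤ d := integral_nonneg fun x => abs_nonneg _
    have B1 : |(∫ x, u1 x) - ω| ≤ d + e := by
      have hF1 : ∫ x, F.indicator (fun _ => (1:ℝ)) x = ω := by
        rw [integral_indicator hF, setIntegral_const, Measure.real, hFvol, smul_eq_mul, mul_one]
      rw [← hF1, ← integral_sub hu1i hFi]
      calc _ ≤ ∫ x, |u1 x - F.indicator (fun _ => (1:ℝ)) x| := abs_integral_le_integral_abs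
        _ ≤ ∫ x, (|u x - u1 x| + |u x - F.indicator (fun _ => (1:ℝ)) x|) := by
            refine integral_mono (hu1i.sub hFi).abs (i1.add i2) (fun x => ?_)
            simp only [Pi.sub_apply]
            rw [abs_sub_comm (u x) (u1 x)]
            exact abs_sub_le _ _ _
        _ ≤ d + e := by rw [integral_add i1 i2]; linarith
    have B2 : ∫ x, u1 x * (1 - u1 x) ≤ d + e := by
      calc _ ≤ ∫ x, (|u x - u1 x| + |u x - F.indicator (fun _ => (1:ℝ)) x|) := by
            refine integral_mono_of_nonneg (Eventually.of_forall fun x => ?_) (i1.add i2) (Eventually.of_forall fun x => ?_)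
            · have := h101 x
              exact mul_nonneg this.1 (by linarith)
            simp only
            have h1 := h101 x; have h2 := h01 x
            have h3 : u x * (1 - u x) ≤ |u x - F.indicator (fun _ => (1:ℝ)) x| := by
              by_cases hxF : x ∈ F
              · simp only [Set.indicator_of_mem hxF]
                rw [abs_sub_comm, abs_of_nonneg (by linarith)]; nlinarith
              · simp only [Set.indicator_of_notMem hxF, sub_zero]
                rw [abs_of_nonneg h2.1]; nlinarith
            have h4 : u1 x * (1 - u1 x) - u x * (1 - u x) ≤ |u x - u1 x| := by
              have e1 : u1 x * (1 - u1 x) - u x * (1 - u x) = (u x - u1 x) * (u x + u1 x - 1) := by ring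
              rw [e1]
              refine (le_abs_self _).trans ?_
              rw [abs_mul]
              exact mul_le_of_le_one_right (abs_nonneg _) (abs_le.2 ⟨by linarith, by linarith⟩)
            linarith
        _ ≤ d + e := by rw [integral_add i1 i2]; linarith
    have B3 : (volume (A' \ F)).toReal ≤ b + d + e := by
      have hAF : (volume (A' \ F)).toReal = ∫ x, (A' \ F).indicator (fun _ => (1:ℝ)) x := by
        rw [integral_indicator (hA'm.diff hF), setIntegral_const, Measure.real, smul_eq_mul, mul_one]
      rw [hAF]
      calc _ ≤ ∫ x, (|u1 x - A'.indicator (fun _ => (1:ℝ)) x| + |u x - u1 x| + |u x - F.indicator (fun _ => (1:ℝ)) x|) := by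
            refine integral_mono_of_nonneg (Eventually.of_forall fun x => Set.indicator_nonneg (fun _ _ => zero_le_one) _) ((i3.add i1).add i2) (Eventually.of_forall fun x => ?_)
            by_cases hx : x ∈ A' \ F
            · simp only [Set.indicator_of_mem hx, Set.indicator_of_mem hx.1, Set.indicator_of_notMem hx.2]
              have := neg_le_abs (u1 x - 1)
              have := neg_le_abs (u x - u1 x)
              have := le_abs_self (u x - 0)
              linarith
            · simp only [Set.indicator_of_notMem hx]; positivity
        _ ≤ b + d + e := by
            have := integral_add (i3.add i1) i2
            have h5 := integral_add i3 i1
            simp only [Pi.add_apply] at this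
            rw [this, h5]; linarith
    have hFV := riesz_ne_top hCp hFv
    have B4 : (rieszEnergy α A).toReal ≤ VF + D * (b + d + e) := by
      have h1 := riesz_sub hCp hA'm hF
      rw [hA', riesz_translate α hAm y, ← hA', hA'v] at h1
      have hAFt : volume (A' \ F) ≠ ⊤ := by
        refine ((measure_mono Set.sdiff_subset).trans_lt (hA'v ▸ hAf.lt_top)).ne
      have hft : 2 * (volume (A' \ F) * ((Cp:ℝ≥0∞) + volume A)) ≠ ⊤ :=
        ENNReal.mul_ne_top (by norm_num) (ENNReal.mul_ne_top hAFt (ENNReal.add_ne_top.2 ⟨coe_ne_top, hAf⟩))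
      have h2 := ENNReal.toReal_mono (ENNReal.add_ne_top.2 ⟨hFV, hft⟩) h1
      rw [ENNReal.toReal_add hFV hft, ENNReal.toReal_mul, ENNReal.toReal_mul, ENNReal.toReal_add coe_ne_top hAf] at h2
      simp only [ENNReal.toReal_ofNat, ENNReal.coe_toReal] at h2
      have h3 : (volume A).toReal ≤ (volume (ball (0 : Eu (k+1)) 2)).toReal := ENNReal.toReal_mono hv2 hAv
      have h4 : 2 * ((volume (A' \ F)).toReal * ((Cp:ℝ) + (volume A).toReal)) ≤ D * (b + d + e) := by
        calc _ ≤ 2 * ((b + d + e) * ((Cp:ℝ) + (volume (ball (0 : Eu (k+1)) 2)).toReal)) := by gcongr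
          _ = _ := by rw [hD]; ring
      linarith
    have hb0 : 0 ≤ b := integral_nonneg fun x => abs_nonneg _
    have B5 : t * (rieszEnergy α A).toReal ≤ t * VF + (b + d + e) := by
      have h1 := mul_le_mul_of_nonneg_left B4 ht0
      have h2 := mul_le_mul_of_nonneg_right htD (show 0 ≤ b + d + e by positivity)
      nlinarith
    have B6 : C * (|(∫ x, u1 x) - ω| + ∫ x, u1 x * (1 - u1 x)) ≤ C * (2 * d + 2 * e) := by
      apply mul_le_mul_of_nonneg_left _ hC; linarith
    have fin : ((k:ℝ)+1) * ω + t * VB ≤ (∫ x, ‖fderiv ℝ u x‖) + t * VF + (e + (1 + 2 * C) * e) := by nlinarith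
    have := mul_le_mul_of_nonneg_left fin hκ0
    nlinarith
  refine le_of_forall_pos_le_add fun s hs => ?_
  have hpos : 0 < 1 + κ * (1 + (1 + 2*C)) := by positivity
  have := main (s / (1 + κ * (1 + (1 + 2*C)))) (by positivity)
  have e1 : s / (1 + κ * (1 + (1 + 2*C))) + κ * (s / (1 + κ * (1 + (1 + 2*C))) + (1 + 2 * C) * (s / (1 + κ * (1 + (1 + 2*C))))) = s := by
    field_simp
  linarith

theorem core_of_ana {k : ℕ} (hk : 1 ≤ k) {α : ℝ} (hα : 0 < α) (hαn : α < k + 1) (h : AnaCore k α) :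
    CoreStatement (k+1) α := by
  obtain ⟨ε, hε, t₀, ht₀, H⟩ := core_real hk hα hαn h
  obtain ⟨Cp, hCp⟩ := pot_bound (n := k+1) (by omega) hα (by push_cast; exact hαn)
  have hκ0 : (0:ℝ) < (kap k : ℝ≥0∞).toReal := by simpa using kap_pos k
  refine ⟨ε, hε, (kap k : ℝ≥0∞).toReal * t₀, by positivity, fun F hF hFvol hsd => ?_⟩
  have hper : perimeter F = μH[(k:ℝ)] (essBoundary F) := by
    unfold perimeter; congr 2; push_cast; ring
  rcases eq_or_ne (μH[(k:ℝ)] (essBoundary F)) ⊤ with hP | hP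
  · rw [hper, hP]; simp
  have hFv : volume F ≠ ⊤ := by rw [hFvol]; exact unitBall_vol_ne_top _
  have hVF := riesz_ne_top hCp hFv
  have hVB := riesz_ne_top hCp (unitBall_vol_ne_top (k+1))
  have hB : perimeter (unitBall (k+1)) ≤ ENNReal.ofReal ((kap k : ℝ≥0∞).toReal * (((k:ℝ)+1) * (volume (unitBall (k+1))).toReal)) := by
    refine (perimeter_unitBall_le k).trans (le_of_eq ?_)
    rw [ENNReal.ofReal_mul hκ0.le, ENNReal.ofReal_mul (by positivity), ENNReal.ofReal_toReal coe_ne_top,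
      ENNReal.ofReal_toReal (unitBall_vol_ne_top _)]
    congr 2
    rw [show ((k:ℝ)+1) = ((k+1:ℕ):ℝ) by push_cast; ring, ENNReal.ofReal_natCast]
  have h0 := H F hF hFvol hsd.le hP 0 le_rfl ht₀.le
  have h1 := H F hF hFvol hsd.le hP t₀ ht₀.le le_rfl
  rw [hper]
  constructor
  · refine hB.trans ?_
    rw [← ENNReal.ofReal_toReal hP]
    apply ENNReal.ofReal_le_ofReal
    simpa using h0
  · refine (add_le_add_left hB _).trans ?_
    rw [← ENNReal.ofReal_toReal hP, ← ENNReal.ofReal_toReal hVF, ← ENNReal.ofReal_toReal hVB,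
      ← ENNReal.ofReal_mul (by positivity), ← ENNReal.ofReal_mul (by positivity), ← ENNReal.ofReal_add (by positivity) (by positivity),
      ← ENNReal.ofReal_add (by positivity) (by positivity)]
    apply ENNReal.ofReal_le_ofReal
    rw [mul_add] at h1
    linarith

/-- Surface measure on the unit sphere, as a measure on the whole space. -/
def sg (k : ℕ) : Measure (Eu (k+1)) := Measure.map Subtype.val (volume : Measure (Eu (k+1))).toSphere

/-- Radial measure. -/
def rho (k : ℕ) : Measure ℝ := (volume.restrict (Set.Ioi 0)).withDensity (fun r => ENNReal.ofReal (r ^ k))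

instance (k : ℕ) : IsFiniteMeasure (sg k) := by unfold sg; infer_instance

instance (k : ℕ) : SFinite (rho k) := by unfold rho; infer_instance

theorem rho_eq (k : ℕ) : rho k = Measure.map Subtype.val (Measure.volumeIoiPow k) := by
  refine Measure.ext_of_lintegral _ (fun f hf => ?_)
  rw [lintegral_map hf measurable_subtype_coe, Measure.volumeIoiPow, rho,
    lintegral_withDensity_eq_lintegral_mul _ (by fun_prop) hf,
    lintegral_withDensity_eq_lintegral_mul _ (by fun_prop) (show Measurable (fun a : Set.Ioi (0:ℝ) => f a.1) from hf.comp measurable_subtype_coe)]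
  exact (lintegral_subtype_comap measurableSet_Ioi (fun r : ℝ => ENNReal.ofReal (r ^ k) * f r)).symm

theorem polar_map (k : ℕ) :
    MeasurePreserving (fun p : Eu (k+1) × ℝ => p.2 • p.1) ((sg k).prod (rho k)) volume := by
  refine ⟨by fun_prop, ?_⟩
  rw [rho_eq, sg, Measure.map_prod_map _ _ measurable_subtype_coe measurable_subtype_coe, Measure.map_map (by fun_prop) (by fun_prop)]
  have h := (volume : Measure (Eu (k+1))).measurePreserving_homeomorphUnitSphereProd
  have h1 : Module.finrank ℝ (Eu (k+1)) - 1 = k := by simp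
  rw [h1] at h
  rw [← h.map_eq, Measure.map_map (by fun_prop) (Homeomorph.measurable _)]
  have h2 : ((fun p : Eu (k+1) × ℝ => p.2 • p.1) ∘ Prod.map Subtype.val Subtype.val) ∘ (homeomorphUnitSphereProd (Eu (k+1))) = Subtype.val := by
    funext x
    have hx : ‖(x : Eu (k+1))‖ ≠ 0 := norm_ne_zero_iff.2 x.2
    simp [homeomorphUnitSphereProd, smul_smul, hx]
  rw [h2, map_comap_subtype_coe (measurableSet_singleton _).compl, restrict_compl_singleton]

theorem polar_lint {k : ℕ} {f : Eu (k+1) → ℝ≥0∞} (hf : Measurable f) :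
    ∫⁻ x, f x = ∫⁻ ω, (∫⁻ r, f (r • ω) ∂rho k) ∂sg k := by
  rw [← (polar_map k).lintegral_comp hf]
  exact lintegral_prod _ (hf.comp (polar_map k).measurable).aemeasurable

theorem polar_int {k : ℕ} {F : Type*} [NormedAddCommGroup F] [NormedSpace ℝ F] {f : Eu (k+1) → F} (hf : Integrable f) :
    ∫ x, f x = ∫ ω, (∫ r, f (r • ω) ∂rho k) ∂sg k := by
  have h1 : Integrable (fun p : Eu (k+1) × ℝ => f (p.2 • p.1)) ((sg k).prod (rho k)) :=
    ((polar_map k).integrable_comp hf.aestronglyMeasurable).2 hf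
  rw [← integral_prod _ h1, ← (polar_map k).map_eq, integral_map (polar_map k).aemeasurable]
  rw [(polar_map k).map_eq]; exact hf.aestronglyMeasurable

theorem polar_int_integrable {k : ℕ} {F : Type*} [NormedAddCommGroup F] [NormedSpace ℝ F] {f : Eu (k+1) → F} (hf : Integrable f) :
    Integrable (fun ω => ∫ r, f (r • ω) ∂rho k) (sg k) := by
  have h1 : Integrable (fun p : Eu (k+1) × ℝ => f (p.2 • p.1)) ((sg k).prod (rho k)) :=
    ((polar_map k).integrable_comp hf.aestronglyMeasurable).2 hf
  exact h1.integral_prod_left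

theorem rho_int {k : ℕ} {F : Type*} [NormedAddCommGroup F] [NormedSpace ℝ F] (g : ℝ → F) :
    ∫ r, g r ∂rho k = ∫ r in Set.Ioi 0, (r ^ k) • g r := by
  rw [rho, integral_withDensity_eq_integral_toReal_smul (by fun_prop) (by simp)]
  refine setIntegral_congr_fun measurableSet_Ioi (fun r hr => ?_)
  have hr' : (0:ℝ) < r := hr
  simp only [ENNReal.toReal_ofReal (show 0 ≤ r ^ k by positivity)]

theorem ae_sg (k : ℕ) : ∀ᵐ ω ∂sg k, ‖ω‖ = 1 := by
  rw [sg, ae_map_iff (by fun_prop) (measurableSet_eq_fun (by fun_prop) (by fun_prop))]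
  exact Eventually.of_forall fun x => by simpa using x.2

theorem sg_univ (k : ℕ) : sg k Set.univ = ((k+1 : ℕ) : ℝ≥0∞) * volume (unitBall (k+1)) := by
  rw [sg, Measure.map_apply (by fun_prop) MeasurableSet.univ, Set.preimage_univ, Measure.toSphere_apply_univ]
  simp [unitBall]

theorem sg_real (k : ℕ) : (sg k).real Set.univ = ((k:ℝ)+1) * (volume (unitBall (k+1))).toReal := by
  rw [Measure.real, sg_univ, ENNReal.toReal_mul, ENNReal.toReal_natCast]; push_cast; rfl

theorem rho_Ioc {k : ℕ} {g : ℝ → ℝ} {l b : ℝ} (hl : 0 ≤ l) (hlb : l ≤ b) (hg : ∀ r, r ≤ l → g r = 0) (hg2 : ∀ r, b < r → g r = 0) :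
    ∫ r, g r ∂rho k = ∫ r in l..b, g r * r ^ k := by
  rw [rho_int, intervalIntegral.integral_of_le hlb, ← integral_indicator measurableSet_Ioi, ← integral_indicator measurableSet_Ioc]
  congr 1; funext r
  simp only [Set.indicator, Set.mem_Ioi, Set.mem_Ioc, smul_eq_mul]
  rcases le_or_gt r l with h | h
  · simp [hg r h, not_lt.2 h]
  · rcases le_or_gt r b with h2 | h2
    · simp [h, h2, hl.trans_lt h, mul_comm]
    · simp [hg2 r h2]

/-- Indicator of `r < a`. -/
def chi (a r : ℝ) : ℝ := if r < a then 1 else 0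

theorem chi_nonneg (a r : ℝ) : 0 ≤ chi a r := by unfold chi; split_ifs <;> norm_num
theorem chi_le (a r : ℝ) : chi a r ≤ 1 := by unfold chi; split_ifs <;> norm_num

theorem measurable_chi (a : ℝ) : Measurable (chi a) :=
  Measurable.ite measurableSet_Iio measurable_const measurable_const

theorem bdd_ii {l b : ℝ} {g : ℝ → ℝ} (hg : Measurable g) {C : ℝ} (h : ∀ r, |g r| ≤ C) : IntervalIntegrable g volume l b := by
  refine (show IntervalIntegrable (fun _ => C) volume l b from continuous_const.intervalIntegrable _ _).mono_fun hg.aestronglyMeasurable (Eventually.of_forall fun r => ?_)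
  simp only [Real.norm_eq_abs]
  exact (h r).trans (le_abs_self C)

theorem chi_int {l a b : ℝ} (hla : l ≤ a) (hab : a ≤ b) {g : ℝ → ℝ} :
    ∫ r in l..b, chi a r * g r = ∫ r in l..a, g r := by
  rw [intervalIntegral.integral_of_le (hla.trans hab), intervalIntegral.integral_of_le hla]
  have : (fun r => chi a r * g r) = (Set.Iio a).indicator g := by
    funext r; simp [chi, Set.indicator]
  rw [this, setIntegral_indicator measurableSet_Iio, ← integral_Ioc_eq_integral_Ioo.symm]
  congr 2
  ext r; simp only [Set.mem_inter_iff, Set.mem_Ioc, Set.mem_Iio, Set.mem_Ioo]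
  constructor
  · rintro ⟨⟨h1, h2⟩, h3⟩; exact ⟨h1, h3⟩
  · rintro ⟨h1, h2⟩; exact ⟨⟨h1, by linarith⟩, h2⟩

/-- Per-ray data. -/
structure RayData (k : ℕ) (δ a : ℝ) (f : ℝ → ℝ) : Prop where
  hδ : 0 < δ
  hδ2 : δ ≤ 1/2
  hf : ContDiff ℝ 1 f
  h01 : ∀ r, 0 ≤ f r ∧ f r ≤ 1
  hl : f (1-δ) = 1
  hb : f (1+δ) = 0
  ha1 : 1 - δ ≤ a
  ha2 : a ≤ 1 + δ
  ha : a ^ (k+1) = (1-δ)^(k+1) + (k+1) * ∫ r in (1-δ)..(1+δ), f r * r ^ k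

namespace RayData
variable {k : ℕ} {δ a : ℝ} {f : ℝ → ℝ}

theorem fc (D : RayData k δ a f) : Continuous f := D.hf.continuous

theorem ii_f (D : RayData k δ a f) (j : ℕ) (x y : ℝ) : IntervalIntegrable (fun r => f r * r ^ j) volume x y :=
  (D.fc.mul (continuous_pow j)).intervalIntegrable _ _

theorem ii_chi (D : RayData k δ a f) (c : ℝ) (j : ℕ) (x y : ℝ) : IntervalIntegrable (fun r => chi c r * r ^ j) volume x y :=
  (bdd_ii (measurable_chi c) (C := 1) (fun r => abs_le.2 ⟨by linarith [chi_nonneg c r], chi_le c r⟩)).mul_continuousOn (continuous_pow j).continuousOn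

theorem ii_g (D : RayData k δ a f) (c : ℝ) (j : ℕ) (x y : ℝ) : IntervalIntegrable (fun r => (f r - chi c r) * r ^ j) volume x y := by
  simp only [sub_mul]
  exact (D.ii_f j x y).sub (D.ii_chi c j x y)

theorem ii_bad (D : RayData k δ a f) (c : ℝ) (j : ℕ) (x y : ℝ) : IntervalIntegrable (fun r => |f r - chi c r| * r ^ j) volume x y := by
  refine IntervalIntegrable.mul_continuousOn ?_ (continuous_pow j).continuousOn
  have := D.ii_g c 0 x y
  simp only [pow_zero, mul_one] at this
  exact this.abs

theorem ii_pen (D : RayData k δ a f) (x y : ℝ) : IntervalIntegrable (fun r => f r * (1 - f r) * r ^ k) volume x y :=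
  ((D.fc.mul (continuous_const.sub D.fc)).mul (continuous_pow k)).intervalIntegrable _ _

theorem ii_N (D : RayData k δ a f) (j : ℕ) (x y : ℝ) : IntervalIntegrable (fun r => |deriv f r| * r ^ j) volume x y :=
  ((D.hf.continuous_deriv le_rfl).abs.mul (continuous_pow j)).intervalIntegrable _ _

theorem g_zero (D : RayData k δ a f) : ∫ r in (1-δ)..(1+δ), (f r - chi a r) * r ^ k = 0 := by
  simp only [sub_mul]
  rw [intervalIntegral.integral_sub (D.ii_f k _ _) (D.ii_chi a k _ _), chi_int D.ha1 D.ha2, integral_pow]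
  have h := D.ha
  have hk : (0:ℝ) < (k:ℝ) + 1 := by positivity
  field_simp
  linarith

theorem first (D : RayData k δ a f) : a ^ k - 8 * k * δ * (∫ r in (1-δ)..(1+δ), |f r - chi a r| * r ^ k) ≤ ∫ r in (1-δ)..(1+δ), |deriv f r| * r ^ k := by
  have hδ := D.hδ; have hδ2 := D.hδ2; have ha1 := D.ha1; have ha2 := D.ha2
  have hlb : 1 - δ ≤ 1 + δ := by linarith
  rcases Nat.eq_zero_or_pos k with rfl | hk
  · simp only [pow_zero, mul_one, CharP.cast_eq_zero, mul_zero, zero_mul, sub_zero]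
    have h1 := intervalIntegral.norm_integral_le_integral_norm (f := deriv f) (μ := volume) hlb
    rw [intervalIntegral.integral_deriv_eq_sub (fun x _ => D.hf.differentiable one_ne_zero x)
      ((D.hf.continuous_deriv le_rfl).intervalIntegrable _ _), D.hl, D.hb] at h1
    simpa using h1
  obtain ⟨j, rfl⟩ : ∃ j, k = j + 1 := ⟨k-1, by omega⟩
  have hd : ∀ x, HasDerivAt f (deriv f x) x := fun x => (D.hf.differentiable one_ne_zero x).hasDerivAt
  have ibp := intervalIntegral.integral_deriv_mul_eq_sub (a := 1-δ) (b := 1+δ) (u := f) (v := fun r => r^(j+1)) (u' := deriv f) (v' := fun r => ((j+1:ℕ):ℝ) * r^j)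
    (fun x _ => hd x) (fun x _ => by simpa using hasDerivAt_pow (j+1) x) ((D.hf.continuous_deriv le_rfl).intervalIntegrable _ _)
    ((continuous_const.mul (continuous_pow j)).intervalIntegrable _ _)
  rw [D.hl, D.hb] at ibp
  have hpow : ∫ r in (1-δ)..a, r^j = (a^(j+1) - (1-δ)^(j+1)) / (j+1) := integral_pow j
  have hgj : ∫ r in (1-δ)..(1+δ), (f r - chi a r) * r ^ j = (∫ r in (1-δ)..(1+δ), f r * r^j) - (a^(j+1) - (1-δ)^(j+1)) / (j+1) := by
    simp only [sub_mul]
    rw [intervalIntegral.integral_sub (D.ii_f j _ _) (D.ii_chi a j _ _), chi_int D.ha1 D.ha2, hpow]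
  have hN : -(∫ r in (1-δ)..(1+δ), deriv f r * r^(j+1)) ≤ ∫ r in (1-δ)..(1+δ), |deriv f r| * r ^ (j+1) := by
    rw [← intervalIntegral.integral_neg]
    refine intervalIntegral.integral_mono_on hlb (((D.hf.continuous_deriv le_rfl).mul (continuous_pow _)).neg.intervalIntegrable _ _) (D.ii_N _ _ _) (fun r hr => ?_)
    have : 0 ≤ r^(j+1) := pow_nonneg (by linarith [hr.1]) _
    rw [← neg_mul]
    exact mul_le_mul_of_nonneg_right (neg_le_abs _) this
  have hsplit : ∫ r in (1-δ)..(1+δ), (deriv f r * r^(j+1) + f r * (((j+1:ℕ):ℝ) * r^j)) =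
      (∫ r in (1-δ)..(1+δ), deriv f r * r^(j+1)) + ((j:ℝ)+1) * ∫ r in (1-δ)..(1+δ), f r * r^j := by
    rw [← intervalIntegral.integral_const_mul, ← intervalIntegral.integral_add (show IntervalIntegrable (fun r => deriv f r * r^(j+1)) volume (1-δ) (1+δ) from
      ((D.hf.continuous_deriv le_rfl).mul (continuous_pow _)).intervalIntegrable _ _) ((D.ii_f j _ _).const_mul _)]
    congr 1; funext r; push_cast; ring
  rw [hsplit] at ibp
  have key : -(∫ r in (1-δ)..(1+δ), (f r - chi a r) * r ^ j) ≤ 8 * δ * (∫ r in (1-δ)..(1+δ), |f r - chi a r| * r ^ (j+1)) := by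
    have h0 := D.g_zero
    have e : 8 * δ * (∫ r in (1-δ)..(1+δ), |f r - chi a r| * r ^ (j+1)) =
        ∫ r in (1-δ)..(1+δ), (8 * δ * (|f r - chi a r| * r ^ (j+1)) - (1/a) * ((f r - chi a r) * r ^ (j+1))) := by
      rw [intervalIntegral.integral_sub ((D.ii_bad a _ _ _).const_mul _) ((D.ii_g a _ _ _).const_mul _),
        intervalIntegral.integral_const_mul, intervalIntegral.integral_const_mul, h0]; ring
    rw [e, ← intervalIntegral.integral_neg]
    refine intervalIntegral.integral_mono_on hlb (D.ii_g a _ _ _).neg (((D.ii_bad a _ _ _).const_mul _).sub ((D.ii_g a _ _ _).const_mul _)) (fun r hr => ?_)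
    have hr0 : 1/2 ≤ r := by linarith [hr.1]
    have ha0 : 1/2 ≤ a := by linarith
    have hp : 0 ≤ r^(j+1) := pow_nonneg (by linarith) _
    have h1 : |1/r - 1/a| ≤ 8 * δ := by
      have hra : (1/4:ℝ) ≤ r * a := by nlinarith
      have : 1/r - 1/a = (a - r) / (r * a) := by
        have : r ≠ 0 := by linarith
        have : a ≠ 0 := by linarith
        field_simp
      rw [this, abs_div, abs_of_pos (show 0 < r * a by linarith), div_le_iff₀ (by linarith)]
      have : |a - r| ≤ 2 * δ := abs_le.2 ⟨by linarith [hr.2], by linarith [hr.1]⟩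
      nlinarith
    have h2 : -((f r - chi a r) * (1/r - 1/a)) ≤ 8 * δ * |f r - chi a r| := by
      refine (neg_le_abs _).trans ?_
      rw [abs_mul, mul_comm]
      exact mul_le_mul_of_nonneg_right h1 (abs_nonneg _)
    have h3 := mul_le_mul_of_nonneg_right h2 hp
    have h4 : -((f r - chi a r) * (1/r - 1/a)) * r^(j+1) = -((f r - chi a r) * r^j) + (1/a) * ((f r - chi a r) * r ^ (j+1)) := by
      have : r ≠ 0 := by linarith
      have : a ≠ 0 := by linarith
      field_simp; ring
    linarith
  rw [hgj] at key
  have hj : (0:ℝ) < (j:ℝ) + 1 := by positivity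
  have key2 := mul_le_mul_of_nonneg_left key hj.le
  have e5 : ((j:ℝ)+1) * -((∫ r in (1-δ)..(1+δ), f r * r^j) - (a^(j+1) - (1-δ)^(j+1)) / (j+1)) = a^(j+1) - (1-δ)^(j+1) - ((j:ℝ)+1) * (∫ r in (1-δ)..(1+δ), f r * r^j) := by
    field_simp; ring
  rw [e5] at key2
  push_cast
  linarith

theorem nonexc (D : RayData k δ a f) (h : ∀ r1 ∈ Set.Icc (1-δ) (1+δ), ∀ r2 ∈ Set.Icc (1-δ) (1+δ), r1 < r2 → 3/4 ≤ f r2 → 1/4 < f r1) :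
    ∫ r in (1-δ)..(1+δ), |f r - chi a r| * r ^ k ≤ 8 * ∫ r in (1-δ)..(1+δ), f r * (1 - f r) * r ^ k := by
  have hδ := D.hδ; have hδ2 := D.hδ2; have ha1 := D.ha1; have ha2 := D.ha2
  have hlb : 1 - δ ≤ 1 + δ := by linarith
  set T := {r | r ∈ Set.Icc (1-δ) (1+δ) ∧ 3/4 ≤ f r} with hT
  have hTne : T.Nonempty := ⟨1-δ, ⟨le_rfl, hlb⟩, by rw [D.hl]; norm_num⟩
  have hTb : BddAbove T := ⟨1+δ, fun r hr => hr.1.2⟩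
  set c := sSup T with hc
  have hc1 : 1-δ ≤ c := le_csSup hTb ⟨⟨le_rfl, hlb⟩, by rw [D.hl]; norm_num⟩
  have hc2 : c ≤ 1+δ := csSup_le hTne fun r hr => hr.1.2
  have hpt : ∀ r ∈ Set.Icc (1-δ) (1+δ), r ≠ c → |f r - chi c r| ≤ 4 * (f r * (1 - f r)) := by
    intro r hr hrc
    have h01 := D.h01 r
    rcases lt_or_gt_of_ne hrc with hlt | hgt
    · obtain ⟨r2, hr2, hlt2⟩ := exists_lt_of_lt_csSup hTne hlt
      have := h r hr r2 hr2.1 hlt2 hr2.2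
      simp only [chi, hlt, if_true]
      rw [abs_sub_comm, abs_of_nonneg (by linarith)]
      nlinarith
    · have hf3 : f r < 3/4 := by
        by_contra hcon
        exact absurd (le_csSup hTb ⟨hr, not_lt.1 hcon⟩) (not_le.2 hgt)
      simp only [chi, not_lt.2 hgt.le, if_false, sub_zero]
      rw [abs_of_nonneg h01.1]
      nlinarith
  have hB : ∫ r in (1-δ)..(1+δ), |f r - chi c r| * r ^ k ≤ 4 * ∫ r in (1-δ)..(1+δ), f r * (1 - f r) * r ^ k := by
    rw [← intervalIntegral.integral_const_mul]
    refine intervalIntegral.integral_mono_ae_restrict hlb (D.ii_bad c k _ _) ((D.ii_pen _ _).const_mul _) ?_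
    have h1 : ∀ᵐ r : ℝ, r ≠ c := by simp [ae_iff]
    filter_upwards [ae_restrict_mem measurableSet_Icc, ae_restrict_of_ae h1] with r hr hrc
    have h2 := hpt r hr hrc
    have hp : 0 ≤ r^k := pow_nonneg (by linarith [hr.1]) _
    nlinarith
  have h3 : ∫ r in (1-δ)..(1+δ), |chi c r - chi a r| * r ^ k ≤ ∫ r in (1-δ)..(1+δ), |f r - chi c r| * r ^ k := by
    have hdiff : ∫ r in (1-δ)..(1+δ), (chi c r - chi a r) * r ^ k = - ∫ r in (1-δ)..(1+δ), (f r - chi c r) * r ^ k := by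
      have h0 := D.g_zero
      simp only [sub_mul] at h0 ⊢
      rw [intervalIntegral.integral_sub (D.ii_f k _ _) (D.ii_chi a k _ _)] at h0
      rw [intervalIntegral.integral_sub (D.ii_f k _ _) (D.ii_chi c k _ _), intervalIntegral.integral_sub (D.ii_chi c k _ _) (D.ii_chi a k _ _)]
      linarith
    have habs : |∫ r in (1-δ)..(1+δ), (chi c r - chi a r) * r ^ k| = ∫ r in (1-δ)..(1+δ), |chi c r - chi a r| * r ^ k := by
      rcases le_total a c with hac | hac
      · have hs : ∀ r, |chi c r - chi a r| = chi c r - chi a r := by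
          intro r; unfold chi; split_ifs <;> first | linarith | norm_num
        simp only [hs]
        refine abs_of_nonneg (intervalIntegral.integral_nonneg hlb fun r hr => ?_)
        rw [← hs]; exact mul_nonneg (abs_nonneg _) (pow_nonneg (by linarith [hr.1]) _)
      · have hs : ∀ r, |chi c r - chi a r| = -(chi c r - chi a r) := by
          intro r; unfold chi; split_ifs <;> first | linarith | norm_num
        simp only [hs, neg_mul]
        rw [intervalIntegral.integral_neg]
        refine abs_of_nonpos ?_
        rw [← neg_nonneg, ← intervalIntegral.integral_neg]
        refine intervalIntegral.integral_nonneg hlb fun r hr => ?_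
        rw [← neg_mul, ← hs]; exact mul_nonneg (abs_nonneg _) (pow_nonneg (by linarith [hr.1]) _)
    rw [← habs, hdiff, abs_neg]
    refine (intervalIntegral.abs_integral_le_integral_abs hlb).trans (le_of_eq ?_)
    refine intervalIntegral.integral_congr fun r hr => ?_
    rw [Set.uIcc_of_le hlb] at hr
    simp only [abs_mul, abs_of_nonneg (pow_nonneg (show 0 ≤ r by linarith [hr.1]) k)]
  have ii3 : IntervalIntegrable (fun r => |chi c r - chi a r| * r ^ k) volume (1-δ) (1+δ) := by
    refine IntervalIntegrable.mul_continuousOn ?_ (continuous_pow k).continuousOn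
    have := (D.ii_chi c 0 (1-δ) (1+δ)).sub (D.ii_chi a 0 (1-δ) (1+δ))
    simp only [pow_zero, mul_one] at this
    exact this.abs
  have h4 : ∫ r in (1-δ)..(1+δ), |f r - chi a r| * r ^ k ≤ (∫ r in (1-δ)..(1+δ), |f r - chi c r| * r ^ k) + ∫ r in (1-δ)..(1+δ), |chi c r - chi a r| * r ^ k := by
    rw [← intervalIntegral.integral_add (D.ii_bad c k _ _) ii3]
    refine intervalIntegral.integral_mono_on hlb (D.ii_bad a k _ _) ((D.ii_bad c k _ _).add ii3) (fun r hr => ?_)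
    rw [← add_mul]
    exact mul_le_mul_of_nonneg_right (abs_sub_le _ _ _) (pow_nonneg (by linarith [hr.1]) _)
  linarith

theorem exc (D : RayData k δ a f) {r1 r2 : ℝ} (h1 : r1 ∈ Set.Icc (1-δ) (1+δ)) (h2 : r2 ∈ Set.Icc (1-δ) (1+δ)) (h12 : r1 < r2) (hf1 : f r1 ≤ 1/4) (hf2 : 3/4 ≤ f r2) :
    2 * (1-δ)^k ≤ ∫ r in (1-δ)..(1+δ), |deriv f r| * r ^ k := by
  have hδ := D.hδ; have hδ2 := D.hδ2
  have hlb : 1 - δ ≤ 1 + δ := by linarith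
  have hii (x y : ℝ) : IntervalIntegrable (fun r => |deriv f r|) volume x y := (D.hf.continuous_deriv le_rfl).abs.intervalIntegrable _ _
  have htv (x y : ℝ) (hxy : x ≤ y) : |f y - f x| ≤ ∫ r in x..y, |deriv f r| := by
    rw [← intervalIntegral.integral_deriv_eq_sub (fun x _ => D.hf.differentiable one_ne_zero x) ((D.hf.continuous_deriv le_rfl).intervalIntegrable _ _)]
    exact intervalIntegral.abs_integral_le_integral_abs hxy
  have t1 := htv _ _ h1.1
  have t2 := htv _ _ h12.le
  have t3 := htv _ _ h2.2
  have hsum : (∫ r in (1-δ)..r1, |deriv f r|) + (∫ r in r1..r2, |deriv f r|) + (∫ r in r2..(1+δ), |deriv f r|) = ∫ r in (1-δ)..(1+δ), |deriv f r| := by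
    rw [intervalIntegral.integral_add_adjacent_intervals (hii _ _) (hii _ _), intervalIntegral.integral_add_adjacent_intervals (hii _ _) (hii _ _)]
  rw [D.hl] at t1; rw [D.hb] at t3
  have u1 := neg_le_abs (f r1 - 1); have u2 := le_abs_self (f r2 - f r1); have u3 := neg_le_abs (0 - f r2)
  have htot : 2 ≤ ∫ r in (1-δ)..(1+δ), |deriv f r| := by linarith
  have hp : 0 ≤ (1-δ)^k := pow_nonneg (by linarith) _
  calc 2 * (1-δ)^k ≤ (∫ r in (1-δ)..(1+δ), |deriv f r|) * (1-δ)^k := by gcongr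
    _ = ∫ r in (1-δ)..(1+δ), |deriv f r| * (1-δ)^k := by rw [intervalIntegral.integral_mul_const]
    _ ≤ _ := by
      refine intervalIntegral.integral_mono_on hlb ((hii _ _).mul_const _) (D.ii_N k _ _) (fun r hr => ?_)
      have : (1-δ)^k ≤ r^k := pow_le_pow_left₀ (by linarith) hr.1 k
      gcongr

theorem bad_le (D : RayData k δ a f) : ∫ r in (1-δ)..(1+δ), |f r - chi a r| * r ^ k ≤ 2 * δ * (1+δ)^k := by
  have hδ := D.hδ; have hδ2 := D.hδ2
  have hlb : 1 - δ ≤ 1 + δ := by linarith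
  have : 2 * δ * (1+δ)^k = ∫ r in (1-δ)..(1+δ), (1+δ)^k := by
    rw [intervalIntegral.integral_const, smul_eq_mul]; ring
  rw [this]
  refine intervalIntegral.integral_mono_on hlb (D.ii_bad a k _ _) (continuous_const.intervalIntegrable _ _) (fun r hr => ?_)
  have h1 : |f r - chi a r| ≤ 1 := by
    have := D.h01 r; have := chi_nonneg a r; have := chi_le a r
    exact abs_le.2 ⟨by linarith, by linarith⟩
  have h2 : r^k ≤ (1+δ)^k := pow_le_pow_left₀ (by linarith [hr.1]) hr.2 k
  have h3 : 0 ≤ r^k := pow_nonneg (by linarith [hr.1]) _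
  nlinarith

theorem bad_nonneg (D : RayData k δ a f) : 0 ≤ ∫ r in (1-δ)..(1+δ), |f r - chi a r| * r ^ k :=
  intervalIntegral.integral_nonneg (by linarith [D.hδ]) fun r hr => mul_nonneg (abs_nonneg _) (pow_nonneg (by linarith [hr.1, D.hδ2]) _)

theorem pen_nonneg (D : RayData k δ a f) : 0 ≤ ∫ r in (1-δ)..(1+δ), f r * (1 - f r) * r ^ k :=
  intervalIntegral.integral_nonneg (by linarith [D.hδ]) fun r hr => mul_nonneg (mul_nonneg (D.h01 r).1 (by linarith [(D.h01 r).2])) (pow_nonneg (by linarith [hr.1, D.hδ2]) _)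

theorem ray_main (D : RayData k δ a f) (hsm : (1 + 4 * δ) * (1+δ)^k ≤ 2 * (1-δ)^k) :
    a ^ k + 2 * (∫ r in (1-δ)..(1+δ), |f r - chi a r| * r ^ k) ≤
      (∫ r in (1-δ)..(1+δ), |deriv f r| * r ^ k) + (16 + 32 * k) * ∫ r in (1-δ)..(1+δ), f r * (1 - f r) * r ^ k := by
  have hδ := D.hδ; have hδ2 := D.hδ2; have hp := D.pen_nonneg
  by_cases h : ∀ r1 ∈ Set.Icc (1-δ) (1+δ), ∀ r2 ∈ Set.Icc (1-δ) (1+δ), r1 < r2 → 3/4 ≤ f r2 → 1/4 < f r1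
  · have h1 := D.nonexc h
    have h2 := D.first
    have h4 : 8 * (k:ℝ) * δ * (∫ r in (1-δ)..(1+δ), |f r - chi a r| * r ^ k) ≤ 8 * k * (1/2) * (8 * ∫ r in (1-δ)..(1+δ), f r * (1 - f r) * r ^ k) := by
      have := D.bad_nonneg
      gcongr
    linarith
  · push Not at h
    obtain ⟨r1, h1, r2, h2, h12, hf2, hf1⟩ := h
    have e1 := D.exc h1 h2 h12 hf1 hf2
    have e2 := D.bad_le
    have e3 : a ^ k ≤ (1+δ)^k := pow_le_pow_left₀ (by linarith [D.ha1]) D.ha2 k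
    have e4 : 0 ≤ (16 + 32 * (k:ℝ)) * ∫ r in (1-δ)..(1+δ), f r * (1 - f r) * r ^ k := by positivity
    linarith

end RayData

/-- Normalization. -/
def nrm {n : ℕ} (x : Eu n) : Eu n := ‖x‖⁻¹ • x

/-- The radial moment. -/
def Wf (k : ℕ) (δ : ℝ) (u : Eu (k+1) → ℝ) (x : Eu (k+1)) : ℝ := ∫ r in (1-δ)..(1+δ), u (r • x) * r ^ k

/-- The zero-homogeneous profile. -/
def vh (k : ℕ) (δ : ℝ) (u : Eu (k+1) → ℝ) (x : Eu (k+1)) : ℝ := Wf k δ u (nrm x) - (1 - (1-δ)^(k+1)) / (k+1)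

theorem nrm_smul {n : ℕ} {r : ℝ} (hr : 0 < r) (x : Eu n) : nrm (r • x) = nrm x := by
  unfold nrm
  rw [norm_smul, Real.norm_of_nonneg hr.le, mul_inv, smul_smul, mul_assoc, mul_comm ‖x‖⁻¹, ← mul_assoc, inv_mul_cancel₀ hr.ne', one_mul]

theorem nrm_unit {n : ℕ} {x : Eu n} (hx : ‖x‖ = 1) : nrm x = x := by simp [nrm, hx]

theorem norm_nrm {n : ℕ} {x : Eu n} (hx : x ≠ 0) : ‖nrm x‖ = 1 := by
  rw [nrm, norm_smul, norm_inv, norm_norm, inv_mul_cancel₀ (norm_ne_zero_iff.2 hx)]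

theorem norm_smul_nrm {n : ℕ} (x : Eu n) : ‖x‖ • nrm x = x := by
  by_cases hx : x = 0
  · simp [hx]
  · rw [nrm, smul_smul, mul_inv_cancel₀ (norm_ne_zero_iff.2 hx), one_smul]

theorem measurable_nrm {n : ℕ} : Measurable (nrm (n := n)) := by unfold nrm; fun_prop

theorem nrm_contDiffAt {n : ℕ} {x : Eu n} (hx : x ≠ 0) : ContDiffAt ℝ 1 (nrm (n := n)) x := by
  unfold nrm
  exact ((contDiffAt_norm ℝ hx).inv (norm_ne_zero_iff.2 hx)).smul contDiffAt_id

theorem nrm_fderiv {n : ℕ} {w e : Eu n} (hw : ‖w‖ = 1) (he : inner ℝ w e = 0) : fderiv ℝ (nrm (n := n)) w e = e := by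
  have hw0 : w ≠ 0 := by rintro rfl; simp at hw
  have hd : DifferentiableAt ℝ (fun x : Eu n => ‖x‖) w := (contDiffAt_norm (n := 1) ℝ hw0).differentiableAt one_ne_zero
  have hdi : DifferentiableAt ℝ (fun x : Eu n => ‖x‖⁻¹) w := hd.inv (norm_ne_zero_iff.2 hw0)
  have h0 : fderiv ℝ (fun x : Eu n => ‖x‖) w e = 0 := by
    have h1 : fderiv ℝ (fun x : Eu n => ‖x‖ ^ 2) w e = 2 * ‖w‖ * fderiv ℝ (fun x : Eu n => ‖x‖) w e := by
      rw [fderiv_fun_pow 2 hd]; simp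
    rw [fderiv_norm_sq_apply] at h1
    simp [he, hw] at h1
    exact h1
  have h2 : fderiv ℝ (fun x : Eu n => ‖x‖⁻¹) w e = 0 := by
    have := (hasDerivAt_inv (norm_ne_zero_iff.2 hw0)).comp_hasFDerivAt w hd.hasFDerivAt
    have h4 : HasFDerivAt (fun x : Eu n => ‖x‖⁻¹) (-(‖w‖ ^ 2)⁻¹ • fderiv ℝ (fun x : Eu n => ‖x‖) w) w := this
    rw [h4.fderiv]; simp [h0]
  have h3 : fderiv ℝ (fun x : Eu n => ‖x‖⁻¹ • x) w e = ‖w‖⁻¹ • e + (fderiv ℝ (fun x : Eu n => ‖x‖⁻¹) w e) • w := by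
    rw [fderiv_fun_smul hdi differentiableAt_fun_id]; simp
  show fderiv ℝ (fun x : Eu n => ‖x‖⁻¹ • x) w e = e
  rw [h3, h2, hw]; simp

/-- Standing hypotheses on `u`. -/
structure UData (k : ℕ) (δ : ℝ) (u : Eu (k+1) → ℝ) : Prop where
  hδ : 0 < δ
  hδ2 : δ ≤ 1/2
  hu : ContDiff ℝ 1 u
  h01 : ∀ x, 0 ≤ u x ∧ u x ≤ 1
  h1 : ∀ x, ‖x‖ ≤ 1 - δ → u x = 1
  h0 : ∀ x, 1 + δ ≤ ‖x‖ → u x = 0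

namespace UData
variable {k : ℕ} {δ : ℝ} {u : Eu (k+1) → ℝ}

theorem hcs (D : UData k δ u) : HasCompactSupport u := HasCompactSupport.intro (isCompact_closedBall (0 : Eu (k+1)) (1+δ))
      (fun x hx => D.h0 x (by simp only [mem_closedBall, dist_zero_right, not_le] at hx; exact hx.le))

theorem fd_cont (D : UData k δ u) : Continuous (fderiv ℝ u) := D.hu.continuous_fderiv one_ne_zero

theorem fd_bdd (D : UData k δ u) : ∃ M : ℝ, ∀ x, ‖fderiv ℝ u x‖ ≤ M := by
  obtain ⟨M, hM⟩ := (D.hcs.fderiv (𝕜 := ℝ)).exists_bound_of_continuous D.fd_cont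
  exact ⟨M, hM⟩

theorem W_hasFDeriv (D : UData k δ u) (x : Eu (k+1)) : HasFDerivAt (Wf k δ u) (∫ r in (1-δ)..(1+δ), (r ^ (k+1)) • fderiv ℝ u (r • x)) x := by
  obtain ⟨M, hM⟩ := D.fd_bdd
  have c1 (y : Eu (k+1)) : Continuous (fun r : ℝ => u (r • y) * r ^ k) := by
    have := D.hu.continuous; fun_prop
  have c2 : Continuous (fun r : ℝ => (r ^ (k+1)) • fderiv ℝ u (r • x)) := by
    have := D.fd_cont; fun_prop
  refine intervalIntegral.hasFDerivAt_integral_of_dominated_of_fderiv_le (F := fun x r => u (r • x) * r ^ k)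
    (F' := fun x r => (r ^ (k+1)) • fderiv ℝ u (r • x)) (bound := fun r => |r|^(k+1) * M) (s := Set.univ) Filter.univ_mem
    (Eventually.of_forall fun y => (c1 y).aestronglyMeasurable) ((c1 x).intervalIntegrable _ _) c2.aestronglyMeasurable
    (Eventually.of_forall fun r _ y _ => ?_) ((by fun_prop : Continuous (fun r : ℝ => |r|^(k+1) * M)).intervalIntegrable _ _) (Eventually.of_forall fun r _ y _ => ?_)
  · rw [norm_smul, norm_pow, Real.norm_eq_abs]
    exact mul_le_mul_of_nonneg_left (hM _) (by positivity)
  · have h1 : HasFDerivAt u (fderiv ℝ u (r • y)) (r • y) := (D.hu.differentiable one_ne_zero _).hasFDerivAt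
    have h2 : HasFDerivAt (fun z : Eu (k+1) => r • z) (r • ContinuousLinearMap.id ℝ (Eu (k+1))) y := (hasFDerivAt_id y).const_smul r
    have h3 : HasFDerivAt (fun z => u (r • z) * r ^ k) (r ^ k • ((fderiv ℝ u (r • y)).comp (r • ContinuousLinearMap.id ℝ (Eu (k+1))))) y :=
      (h1.comp y h2).mul_const (r ^ k)
    refine h3.congr_fderiv ?_
    ext z
    simp [pow_succ]; ring

theorem W_contDiff (D : UData k δ u) : ContDiff ℝ 1 (Wf k δ u) := by
  refine contDiff_one_iff_hasFDerivAt.2 ⟨fun x => ∫ r in (1-δ)..(1+δ), (r ^ (k+1)) • fderiv ℝ u (r • x), ?_, D.W_hasFDeriv⟩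
  refine intervalIntegral.continuous_parametric_intervalIntegral_of_continuous' ?_ _ _
  have := D.fd_cont
  simp only [Function.uncurry_def]
  fun_prop

theorem vh_contDiffAt (D : UData k δ u) {x : Eu (k+1)} (hx : x ≠ 0) : ContDiffAt ℝ 1 (vh k δ u) x := by
  unfold vh
  exact (D.W_contDiff.contDiffAt.comp x (nrm_contDiffAt hx)).sub contDiffAt_const

theorem vh_smul (D : UData k δ u) {r : ℝ} (hr : 0 < r) (x : Eu (k+1)) : vh k δ u (r • x) = vh k δ u x := by
  unfold vh; rw [nrm_smul hr]

theorem vh_fderiv_radial (D : UData k δ u) {x : Eu (k+1)} (hx : x ≠ 0) : fderiv ℝ (vh k δ u) x x = 0 := by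
  have h1 : HasDerivAt (fun t : ℝ => vh k δ u (t • x)) (fderiv ℝ (vh k δ u) ((1:ℝ) • x) x) 1 := by
    have hd : HasFDerivAt (vh k δ u) (fderiv ℝ (vh k δ u) ((1:ℝ) • x)) ((1:ℝ) • x) :=
      ((D.vh_contDiffAt (by simpa using hx)).differentiableAt one_ne_zero).hasFDerivAt
    have h2 : HasDerivAt (fun t : ℝ => t • x) x 1 := by simpa using (hasDerivAt_id (1:ℝ)).smul_const x
    exact hd.comp_hasDerivAt 1 h2
  have h3 : HasDerivAt (fun t : ℝ => vh k δ u (t • x)) 0 1 := by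
    refine (hasDerivAt_const (1:ℝ) (vh k δ u x)).congr_of_eventuallyEq ?_
    filter_upwards [lt_mem_nhds (show (0:ℝ) < 1 by norm_num)] with t ht
    exact D.vh_smul ht x
  rw [one_smul] at h1
  exact h1.unique h3

theorem vh_fderiv_tan (D : UData k δ u) {w e : Eu (k+1)} (hw : ‖w‖ = 1) (he : inner ℝ w e = 0) :
    fderiv ℝ (vh k δ u) w e = ∫ r in (1-δ)..(1+δ), r ^ (k+1) * fderiv ℝ u (r • w) e := by
  have hw0 : w ≠ 0 := by rintro rfl; simp at hw
  have h1 : HasFDerivAt (vh k δ u) ((fderiv ℝ (Wf k δ u) (nrm w)).comp (fderiv ℝ nrm w)) w := by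
    have := ((D.W_contDiff.differentiable one_ne_zero (nrm w)).hasFDerivAt.comp w
      ((nrm_contDiffAt hw0).differentiableAt one_ne_zero).hasFDerivAt).sub_const ((1 - (1-δ)^(k+1)) / (k+1))
    exact this
  rw [h1.fderiv, ContinuousLinearMap.comp_apply, nrm_fderiv hw he, nrm_unit hw, (D.W_hasFDeriv w).fderiv,
    ContinuousLinearMap.intervalIntegral_apply]
  · simp
  · have := D.fd_cont
    exact (by fun_prop : Continuous (fun r : ℝ => (r ^ (k+1)) • fderiv ℝ u (r • w))).intervalIntegrable _ _

theorem deriv_ray (D : UData k δ u) (w : Eu (k+1)) (r : ℝ) : deriv (fun r : ℝ => u (r • w)) r = fderiv ℝ u (r • w) w := by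
  have h1 : HasFDerivAt u (fderiv ℝ u (r • w)) (r • w) := (D.hu.differentiable one_ne_zero _).hasFDerivAt
  have h2 : HasDerivAt (fun t : ℝ => t • w) w r := by simpa using (hasDerivAt_id r).smul_const w
  exact (h1.comp_hasDerivAt r h2).deriv

theorem ray_cs (D : UData k δ u) {w e : Eu (k+1)} (hw : ‖w‖ = 1) (hwe : ‖e‖ = 1) (he : inner ℝ w e = 0) {c s : ℝ} (hc : 0 ≤ c) (hs : 0 ≤ s) (hcs : c^2 + s^2 ≤ 1) :
    c * (∫ r in (1-δ)..(1+δ), |fderiv ℝ u (r • w) w| * r ^ k) + s * (fderiv ℝ (vh k δ u) w e / (1+δ)) ≤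
      ∫ r in (1-δ)..(1+δ), ‖fderiv ℝ u (r • w)‖ * r ^ k := by
  have hδ := D.hδ; have hδ2 := D.hδ2
  have hfd := D.fd_cont
  rw [D.vh_fderiv_tan hw he, ← intervalIntegral.integral_div, ← intervalIntegral.integral_const_mul, ← intervalIntegral.integral_const_mul,
    ← intervalIntegral.integral_add (Continuous.intervalIntegrable (by fun_prop) _ _) (Continuous.intervalIntegrable (by fun_prop) _ _)]
  refine intervalIntegral.integral_mono_on (by linarith) (Continuous.intervalIntegrable (by fun_prop) _ _) (Continuous.intervalIntegrable (by fun_prop) _ _) (fun r hr => ?_)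
  set L := fderiv ℝ u (r • w)
  have hr0 : 0 ≤ r := by linarith [hr.1]
  have hp : 0 ≤ r ^ k := pow_nonneg hr0 _
  set t := s * (r / (1+δ)) with ht
  have ht0 : 0 ≤ t := by positivity
  have hts : t ≤ s := by
    rw [ht]; apply mul_le_of_le_one_right hs
    rw [div_le_one (by linarith)]; exact hr.2
  have key (c' : ℝ) (hc' : c'^2 = c^2) : c' * L w + t * L e ≤ ‖L‖ := by
    have h1 : c' * L w + t * L e = L (c' • w + t • e) := by simp
    have h2 : ‖c' • w + t • e‖ ^ 2 ≤ 1 := by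
      rw [norm_add_sq_real, norm_smul, norm_smul, inner_smul_left, inner_smul_right, he, hw, hwe]
      simp only [mul_one, mul_zero, add_zero, Real.norm_eq_abs, sq_abs]
      nlinarith
    have h3 : ‖c' • w + t • e‖ ≤ 1 := by
      nlinarith [norm_nonneg (c' • w + t • e)]
    rw [h1]
    refine (le_abs_self _).trans ((L.le_opNorm _).trans ?_)
    exact mul_le_of_le_one_right (norm_nonneg _) h3
  have key2 : c * |L w| + t * L e ≤ ‖L‖ := by
    rcases abs_choice (L w) with h | h
    · rw [h]; exact key c rfl
    · rw [h]; have := key (-c) (by ring); linarith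
  have := mul_le_mul_of_nonneg_right key2 hp
  calc _ = (c * |L w| + t * L e) * r ^ k := by rw [ht]; ring
    _ ≤ _ := this

theorem ray_grad (D : UData k δ u) {w : Eu (k+1)} (hw : ‖w‖ = 1) :
    (∫ r in (1-δ)..(1+δ), |fderiv ℝ u (r • w) w| * r ^ k)^2 + (‖fderiv ℝ (vh k δ u) w‖ / (1+δ))^2 ≤
      (∫ r in (1-δ)..(1+δ), ‖fderiv ℝ u (r • w)‖ * r ^ k)^2 := by
  have hδ := D.hδ; have hδ2 := D.hδ2
  have hw0 : w ≠ 0 := by rintro rfl; simp at hw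
  have hN0 : 0 ≤ ∫ r in (1-δ)..(1+δ), |fderiv ℝ u (r • w) w| * r ^ k :=
    intervalIntegral.integral_nonneg (by linarith) fun r hr => mul_nonneg (abs_nonneg _) (pow_nonneg (by linarith [hr.1]) _)
  have hP0 : 0 ≤ ∫ r in (1-δ)..(1+δ), ‖fderiv ℝ u (r • w)‖ * r ^ k :=
    intervalIntegral.integral_nonneg (by linarith) fun r hr => mul_nonneg (norm_nonneg _) (pow_nonneg (by linarith [hr.1]) _)
  have cs := fun e h1 h2 c s => D.ray_cs (w := w) (e := e) hw h1 h2 (c := c) (s := s)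
  set N := ∫ r in (1-δ)..(1+δ), |fderiv ℝ u (r • w) w| * r ^ k with hN
  set P := ∫ r in (1-δ)..(1+δ), ‖fderiv ℝ u (r • w)‖ * r ^ k with hP
  set L := fderiv ℝ (vh k δ u) w with hL
  -- for unit tangential e
  have h1 : ∀ e : Eu (k+1), ‖e‖ = 1 → inner ℝ w e = 0 → 0 ≤ L e → N^2 + (L e / (1+δ))^2 ≤ P^2 := by
    intro e he1 he2 hLe
    set q := L e / (1+δ) with hq
    have hq0 : 0 ≤ q := by positivity
    rcases eq_or_lt_of_le (show 0 ≤ N^2 + q^2 by positivity) with h | h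
    · rw [← h]; positivity
    have hS : 0 < Real.sqrt (N^2+q^2) := Real.sqrt_pos.2 h
    have hS2 : Real.sqrt (N^2+q^2) ^ 2 = N^2+q^2 := Real.sq_sqrt h.le
    set S := Real.sqrt (N^2+q^2)
    have h2 := cs e he1 he2 (N/S) (q/S) (by positivity) (by positivity) (by rw [div_pow, div_pow, ← add_div, hS2, div_self h.ne'])
    have h3 : N / S * N + q / S * q = S := by
      field_simp; linarith
    rw [h3] at h2
    rw [← hS2]
    exact pow_le_pow_left₀ hS.le h2 2
  have hNP : N^2 ≤ P^2 := by
    refine pow_le_pow_left₀ hN0 ?_ 2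
    refine intervalIntegral.integral_mono_on (by linarith) ?_ ?_ (fun r hr => ?_)
    · have := D.fd_cont; exact Continuous.intervalIntegrable (by fun_prop) _ _
    · have := D.fd_cont; exact Continuous.intervalIntegrable (by fun_prop) _ _
    · have h5 := (fderiv ℝ u (r • w)).le_opNorm w
      rw [hw, mul_one, Real.norm_eq_abs] at h5
      exact mul_le_mul_of_nonneg_right h5 (pow_nonneg (by linarith [hr.1]) _)
  have hop : ‖L‖ ≤ (1+δ) * Real.sqrt (P^2 - N^2) := by
    refine L.opNorm_le_bound (by positivity) (fun y => ?_)
    set e := y - (inner ℝ w y) • w with he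
    have hLe : L e = L y := by
      rw [he, map_sub, map_smul, hL, D.vh_fderiv_radial hw0]; simp
    have hwe : inner ℝ w e = 0 := by
      rw [he, inner_sub_right, inner_smul_right, real_inner_self_eq_norm_sq, hw]; ring
    have hey : ‖e‖ ≤ ‖y‖ := by
      have : ‖y‖^2 = ‖e‖^2 + (inner ℝ w y)^2 := by
        have hy : y = e + (inner ℝ w y) • w := by rw [he]; abel
        conv_lhs => rw [hy]
        rw [norm_add_sq_real, inner_smul_right, real_inner_comm w e, hwe, norm_smul, hw]; simp
      exact abs_le_of_sq_le_sq' (by nlinarith [sq_nonneg (inner ℝ w y)]) (norm_nonneg y) |>.2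
    have hbound : |L e| ≤ (1+δ) * Real.sqrt (P^2 - N^2) * ‖e‖ := by
      by_cases he0 : e = 0
      · simp [he0]
      have hen : 0 < ‖e‖ := norm_pos_iff.2 he0
      have gen : ∀ σ : ℝ, |σ| = 1 → 0 ≤ σ * L e → σ * L e ≤ (1+δ) * Real.sqrt (P^2 - N^2) * ‖e‖ := by
        intro σ hσ hpos
        have hLe' : L ((σ * ‖e‖⁻¹) • e) = σ * L e / ‖e‖ := by simp; ring
        have h2 := h1 ((σ * ‖e‖⁻¹) • e) (by rw [norm_smul, norm_mul, Real.norm_eq_abs, hσ, norm_inv, norm_norm, one_mul, inv_mul_cancel₀ hen.ne'])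
          (by rw [inner_smul_right, hwe, mul_zero]) (by rw [hLe']; positivity)
        rw [hLe'] at h2
        have h3 : σ * L e / ‖e‖ / (1+δ) ≤ Real.sqrt (P^2 - N^2) := Real.le_sqrt_of_sq_le (by linarith)
        rw [div_le_iff₀ (by linarith), div_le_iff₀ hen] at h3
        linarith
      rcases abs_cases (L e) with ⟨h, h'⟩ | ⟨h, h'⟩
      · rw [h]; simpa using gen 1 (by simp) (by simpa using h')
      · rw [h]; simpa using gen (-1) (by simp) (by linarith)
    rw [Real.norm_eq_abs, ← hLe]
    exact hbound.trans (by gcongr)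
  have h6 : ‖L‖ / (1+δ) ≤ Real.sqrt (P^2 - N^2) := by
    rw [div_le_iff₀ (by linarith)]; linarith
  have h7 := pow_le_pow_left₀ (by positivity) h6 2
  rw [Real.sq_sqrt (by linarith)] at h7
  linarith

end UData

/-- Standard Gaussian measure. -/
abbrev gm (n : ℕ) : Measure (Eu n) := ProbabilityTheory.stdGaussian (Eu n)

/-- Gaussian density. -/
def gden (n : ℕ) (r : ℝ) : ℝ := (2 * Real.pi) ^ (-(n:ℝ)/2) * Real.exp (-(r^2)/2)

theorem gden_pos (n : ℕ) (r : ℝ) : 0 < gden n r := by unfold gden; positivity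

theorem measurable_gden (n : ℕ) : Measurable (gden n) := by unfold gden; fun_prop

theorem gm_cexp (n : ℕ) (w : Eu n) : ∫ v : Eu n, (gden n ‖v‖) • Complex.exp (inner ℝ v w * Complex.I) = Complex.exp (-‖w‖^2/2) := by
  have h := GaussianFourier.integral_cexp_neg_mul_sq_norm_add (V := Eu n) (b := (1/2:ℂ)) (by norm_num) Complex.I w
  have h2 : ∀ v : Eu n, (gden n ‖v‖) • Complex.exp (inner ℝ v w * Complex.I) =
      ((2 * Real.pi) ^ (-(n:ℝ)/2) : ℝ) • Complex.exp (-(1/2:ℂ) * ‖v‖^2 + Complex.I * inner ℝ w v) := by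
    intro v
    unfold gden
    rw [mul_smul, real_inner_comm]
    congr 1
    rw [Complex.real_smul, Complex.ofReal_exp, ← Complex.exp_add]
    congr 1
    push_cast; ring
  simp_rw [h2]
  rw [integral_smul, h, Complex.real_smul]
  have h3 : (Real.pi / (1/2:ℂ)) ^ ((Module.finrank ℝ (Eu n) : ℂ) / 2) = (((2 * Real.pi) ^ ((n:ℝ)/2) : ℝ) : ℂ) := by
    rw [Complex.ofReal_cpow (by positivity)]
    simp [mul_comm]
  rw [h3, ← mul_assoc, ← Complex.ofReal_mul, ← Real.rpow_add (by positivity)]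
  have : -(n:ℝ)/2 + (n:ℝ)/2 = 0 := by ring
  rw [this, Real.rpow_zero]
  simp only [Complex.ofReal_one, one_mul, Complex.I_sq]
  congr 1; ring

theorem gm_eq (n : ℕ) : gm n = volume.withDensity (fun x : Eu n => ENNReal.ofReal (gden n ‖x‖)) := by
  have hitg : Integrable (fun x : Eu n => gden n ‖x‖) := by
    have h := gm_cexp n 0
    by_contra hc
    have h0 : ¬ Integrable (fun v : Eu n => (gden n ‖v‖) • Complex.exp (inner ℝ v (0:Eu n) * Complex.I)) := by
      intro h1; apply hc
      have := h1.norm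
      refine this.congr (Eventually.of_forall fun v => ?_)
      simp [abs_of_pos (gden_pos n _)]
    rw [integral_undef h0] at h
    simp at h
  have hm : Measurable (fun x : Eu n => ENNReal.ofReal (gden n ‖x‖)) := ((measurable_gden n).comp measurable_norm).ennreal_ofReal
  haveI : IsFiniteMeasure (volume.withDensity (fun x : Eu n => ENNReal.ofReal (gden n ‖x‖))) := isFiniteMeasure_withDensity_ofReal hitg.2
  refine Measure.ext_of_charFun ?_
  ext w
  rw [ProbabilityTheory.charFun_stdGaussian, charFun_apply, integral_withDensity_eq_integral_toReal_smul hm (by simp)]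
  simp_rw [ENNReal.toReal_ofReal (gden_pos n _).le]
  rw [gm_cexp]

theorem gm_rot (n : ℕ) (θ : ℝ) : MeasurePreserving (fun p : Eu n × Eu n => (Real.cos θ • p.1 + Real.sin θ • p.2, -Real.sin θ • p.1 + Real.cos θ • p.2))
    ((gm n).prod (gm n)) ((gm n).prod (gm n)) := by
  refine ⟨by fun_prop, ?_⟩
  have := ProbabilityTheory.IsGaussian.map_rotation_eq_self_of_forall_strongDual_eq_zero (μ := gm n) (fun L => by simp) θ
  conv_rhs => rw [← this]
  rfl

theorem gm_map (n : ℕ) (L : StrongDual ℝ (Eu n)) : (gm n).map L = ProbabilityTheory.gaussianReal 0 (‖L‖^2).toNNReal := by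
  rw [ProbabilityTheory.IsGaussian.map_eq_gaussianReal L, ProbabilityTheory.integral_strongDual_stdGaussian, ProbabilityTheory.variance_dual_stdGaussian]

theorem gm_exp_integrable (n : ℕ) (l : Eu n) : Integrable (fun x => Real.exp (inner ℝ l x)) (gm n) := by
  have h := ProbabilityTheory.integrable_exp_mul_gaussianReal (μ := 0) (v := (‖innerSL ℝ l‖^2).toNNReal) 1
  rw [← gm_map, integrable_map_measure (by fun_prop) (by fun_prop)] at h
  simpa [Function.comp_def] using h

theorem gm_exp (n : ℕ) (l : Eu n) : ∫ x, Real.exp (inner ℝ l x) ∂(gm n) = Real.exp (‖l‖^2/2) := by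
  have h := ProbabilityTheory.mgf_gaussianReal (gm_map n (innerSL ℝ l)) 1
  rw [ProbabilityTheory.mgf] at h
  simp at h
  exact h

theorem gm_sq_integrable (n : ℕ) (L : StrongDual ℝ (Eu n)) : Integrable (fun x => (L x)^2) (gm n) :=
  (ProbabilityTheory.IsGaussian.memLp_dual (gm n) L 2 (by norm_num)).integrable_sq

theorem gm_sq (n : ℕ) (L : StrongDual ℝ (Eu n)) : ∫ x, (L x)^2 ∂(gm n) = ‖L‖^2 := by
  rw [← ProbabilityTheory.variance_dual_stdGaussian, ProbabilityTheory.variance_eq_integral (by fun_prop)]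
  simp

theorem gm_norm_integrable (n : ℕ) (j : ℕ) : Integrable (fun x => ‖x‖^j) (gm n) := by
  by_cases hj : j = 0
  · simp [hj]
  exact (ProbabilityTheory.IsGaussian.memLp_id (gm n) j (by simp)).integrable_norm_pow hj

theorem gm_norm_sq (n : ℕ) : ∫ x, ‖x‖^2 ∂(gm n) = n := by
  simp_rw [EuclideanSpace.norm_sq_eq, Real.norm_eq_abs, sq_abs]
  have h (i : Fin n) : (fun x : Eu n => x i ^ 2) = fun x => (innerSL ℝ (EuclideanSpace.single i (1:ℝ)) x)^2 := by
    ext x; simp [EuclideanSpace.inner_single_left]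
  rw [integral_finset_sum _ (fun i _ => by rw [h]; exact gm_sq_integrable n _)]
  simp_rw [h, gm_sq]
  simp

/-- Radial moments. -/
def gmo (k j : ℕ) : ℝ := ∫ r, r ^ j * gden (k+1) r ∂(rho k)

theorem gm_polar {k : ℕ} {g : Eu (k+1) → ℝ} (hg : Measurable g) {M : ℝ} (hM : ∀ x, |g x| ≤ M) (h0 : ∀ r : ℝ, 0 < r → ∀ x, g (r • x) = g x) (j : ℕ) :
    Integrable (fun x => ‖x‖^j * g x) (gm (k+1)) ∧ ∫ x, ‖x‖^j * g x ∂(gm (k+1)) = gmo k j * ∫ w, g w ∂(sg k) := by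
  have hI : Integrable (fun x => ‖x‖^j * g x) (gm (k+1)) := by
    refine ((gm_norm_integrable (k+1) j).mul_const M).mono (by fun_prop) (Eventually.of_forall fun x => ?_)
    rw [norm_mul, norm_mul]
    exact mul_le_mul_of_nonneg_left ((hM x).trans (le_abs_self M)) (norm_nonneg _)
  refine ⟨hI, ?_⟩
  have hm : Measurable (fun x : Eu (k+1) => ENNReal.ofReal (gden (k+1) ‖x‖)) := ((measurable_gden _).comp measurable_norm).ennreal_ofReal
  rw [gm_eq] at hI ⊢
  rw [integrable_withDensity_iff_integrable_smul' hm (by simp)] at hI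
  rw [integral_withDensity_eq_integral_toReal_smul hm (by simp)]
  simp_rw [ENNReal.toReal_ofReal (gden_pos (k+1) _).le, smul_eq_mul] at hI ⊢
  rw [polar_int hI, ← integral_const_mul]
  refine integral_congr_ae ?_
  filter_upwards [ae_sg k] with w hw
  rw [gmo, ← integral_mul_const]
  rw [rho_int, rho_int]
  refine setIntegral_congr_fun measurableSet_Ioi (fun r hr => ?_)
  have hr' : 0 < r := hr
  simp only [smul_eq_mul]
  rw [h0 r hr', norm_smul, hw, Real.norm_of_nonneg hr'.le]; ring

theorem gmo_zero (k : ℕ) : gmo k 0 * (sg k).real Set.univ = 1 := by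
  have := (gm_polar (k := k) (g := fun _ => 1) measurable_const (M := 1) (by simp) (by simp) 0).2
  simp at this
  rw [mul_comm] at this ⊢; linarith

theorem gmo_two (k : ℕ) : gmo k 2 = (k+1) * gmo k 0 := by
  have := (gm_polar (k := k) (g := fun _ => 1) measurable_const (M := 1) (by simp) (by simp) 2).2
  simp only [mul_one, gm_norm_sq] at this
  have h0 := gmo_zero k
  have hs : (sg k).real Set.univ ≠ 0 := fun h => by rw [h, mul_zero] at h0; exact zero_ne_one h0
  have h3 : gmo k 2 * (sg k).real Set.univ = ((k+1 : ℕ):ℝ) := by rw [this]; simp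
  apply mul_right_cancel₀ hs
  rw [h3, mul_assoc, h0]; push_cast; ring

theorem gmo_nonneg (k j : ℕ) : 0 ≤ gmo k j := by
  rw [gmo, rho_int]
  refine setIntegral_nonneg measurableSet_Ioi (fun r hr => ?_)
  have hr' : 0 < r := hr
  have := gden_pos (k+1) r
  simp only [smul_eq_mul]; positivity

theorem gmo_zero_pos (k : ℕ) : 0 < gmo k 0 := by
  rcases (gmo_nonneg k 0).eq_or_lt with h | h
  · have := gmo_zero k; rw [← h] at this; simp at this
  · exact h

theorem gm_shift {n : ℕ} (g : Eu n → ℝ) (l : Eu n) : ∫ x, g x * Real.exp (inner ℝ l x) ∂(gm n) = Real.exp (‖l‖^2/2) * ∫ x, g (x + l) ∂(gm n) := by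
  have hm : Measurable (fun x : Eu n => ENNReal.ofReal (gden n ‖x‖)) := ((measurable_gden _).comp measurable_norm).ennreal_ofReal
  rw [gm_eq, integral_withDensity_eq_integral_toReal_smul hm (by simp), integral_withDensity_eq_integral_toReal_smul hm (by simp)]
  simp_rw [ENNReal.toReal_ofReal (gden_pos n _).le, smul_eq_mul]
  rw [← integral_add_right_eq_self (μ := volume) (fun x => gden n ‖x‖ * (g x * Real.exp (inner ℝ l x))) l, ← integral_const_mul]
  refine integral_congr_ae (Eventually.of_forall fun x => ?_)
  simp only
  have h : gden n ‖x + l‖ * Real.exp (inner ℝ l (x+l)) = Real.exp (‖l‖^2/2) * gden n ‖x‖ := by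
    unfold gden
    rw [mul_assoc, ← Real.exp_add, mul_left_comm, ← Real.exp_add, norm_add_sq_real, inner_add_right, real_inner_self_eq_norm_sq, real_inner_comm]
    congr 2; ring
  linear_combination g (x+l) * h

theorem gm_coord (n : ℕ) (l : Eu n) (i : Fin n) : ∫ x, x i * Real.exp (inner ℝ l x) ∂(gm n) = l i * Real.exp (‖l‖^2/2) := by
  rw [gm_shift (fun x => x i) l]
  have h (x : Eu n) : (x + l) i = innerSL ℝ (EuclideanSpace.single i (1:ℝ)) x + l i := by simp [EuclideanSpace.inner_single_left]
  simp_rw [h]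
  rw [integral_add (ProbabilityTheory.IsGaussian.integrable_dual _ _) (integrable_const _), ProbabilityTheory.integral_strongDual_stdGaussian]
  simp [mul_comm]

theorem gram_pow {n : ℕ} {ι : Type*} (s : Finset ι) (l : ι → Eu n) (j : ℕ) : ∀ d : ι → ℝ,
    0 ≤ ∑ a ∈ s, ∑ b ∈ s, d a * d b * (inner ℝ (l a) (l b)) ^ j := by
  induction j with
  | zero =>
    intro d
    simp only [pow_zero, mul_one]
    rw [← Finset.sum_mul_sum]
    exact mul_self_nonneg _
  | succ j ih =>
    intro d
    have h : ∑ a ∈ s, ∑ b ∈ s, d a * d b * (inner ℝ (l a) (l b)) ^ (j+1) =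
        ∑ m : Fin n, ∑ a ∈ s, ∑ b ∈ s, (d a * l a m) * (d b * l b m) * (inner ℝ (l a) (l b)) ^ j := by
      rw [Finset.sum_comm]
      rw [Finset.sum_comm (s := Finset.univ), Finset.sum_comm]
      refine Finset.sum_congr rfl fun a _ => ?_
      rw [Finset.sum_comm (s := Finset.univ)]
      refine Finset.sum_congr rfl fun b _ => ?_
      rw [pow_succ]
      conv_lhs => rw [PiLp.inner_apply (𝕜 := ℝ) (l a) (l b)]
      simp only [← mul_assoc, PiLp.inner_apply]
      rw [Finset.mul_sum]
      refine Finset.sum_congr rfl fun m _ => ?_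
      simp
      ring
    rw [h]
    exact Finset.sum_nonneg fun m _ => ih (fun a => d a * l a m)

theorem gfun_hasSum (s : ℝ) : HasSum (fun j : ℕ => ((1/4 - (1/2)^j + (if j = 0 then 3/4 else 0) + (if j = 1 then 1/4 else 0)) / (j.factorial : ℝ)) * s ^ j)
    (1/4 * Real.exp s - Real.exp (s/2) + 3/4 + s/4) := by
  have h1 : HasSum (fun j : ℕ => s ^ j / (j.factorial : ℝ)) (Real.exp s) := by
    rw [Real.exp_eq_exp_ℝ]; exact NormedSpace.expSeries_div_hasSum_exp s
  have h2 : HasSum (fun j : ℕ => (s/2) ^ j / (j.factorial : ℝ)) (Real.exp (s/2)) := by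
    rw [Real.exp_eq_exp_ℝ]; exact NormedSpace.expSeries_div_hasSum_exp (s/2)
  have h3 : HasSum (fun j : ℕ => if j = 0 then (3/4:ℝ) else 0) (3/4) := hasSum_ite_eq 0 _
  have h4 : HasSum (fun j : ℕ => if j = 1 then (s/4:ℝ) else 0) (s/4) := hasSum_ite_eq 1 _
  have h5 := (((h1.mul_left (1/4)).sub h2).add h3).add h4
  have h6 : ∀ j : ℕ, ((1/4 - (1/2)^j + (if j = 0 then 3/4 else 0) + (if j = 1 then 1/4 else 0)) / (j.factorial : ℝ)) * s ^ j =
      1/4 * (s ^ j / (j.factorial : ℝ)) - (s/2) ^ j / (j.factorial : ℝ) + (if j = 0 then (3/4:ℝ) else 0) + (if j = 1 then (s/4:ℝ) else 0) := by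
    intro j
    rcases j with _ | _ | j
    · norm_num
    · norm_num; ring
    · simp [div_pow]; ring
  simp_rw [h6]; exact h5

theorem gram_fun {n : ℕ} {ι : Type*} (s : Finset ι) (l : ι → Eu n) (d : ι → ℝ) :
    0 ≤ ∑ a ∈ s, ∑ b ∈ s, d a * d b * (1/4 * Real.exp (inner ℝ (l a) (l b)) - Real.exp (inner ℝ (l a) (l b)/2) + 3/4 + inner ℝ (l a) (l b)/4) := by
  have h := hasSum_sum (s := s) fun a _ => hasSum_sum (s := s) fun b _ => (gfun_hasSum (inner ℝ (l a) (l b))).mul_left (d a * d b)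
  refine h.nonneg fun j => ?_
  have hj : (0:ℝ) ≤ (1/4 - (1/2)^j + (if j = 0 then 3/4 else 0) + (if j = 1 then 1/4 else 0)) / (j.factorial : ℝ) := by
    apply div_nonneg _ (by positivity)
    rcases j with _ | _ | j
    · norm_num
    · norm_num
    · have : ((1/2:ℝ))^j ≤ 1 := pow_le_one₀ (by norm_num) (by norm_num)
      simp [pow_succ] at this ⊢
      linarith
  have := mul_nonneg hj (gram_pow s l j d)
  rw [Finset.mul_sum] at this
  refine this.trans_eq (Finset.sum_congr rfl fun a _ => ?_)
  rw [Finset.mul_sum]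
  exact Finset.sum_congr rfl fun b _ => by ring

theorem gm_exp_memLp (n : ℕ) (l : Eu n) : MemLp (fun x => Real.exp (inner ℝ l x)) 2 (gm n) := by
  rw [memLp_two_iff_integrable_sq (by fun_prop)]
  refine (gm_exp_integrable n ((2:ℝ) • l)).congr (Eventually.of_forall fun x => ?_)
  simp only
  rw [← Real.exp_nat_mul, inner_smul_left]; simp

theorem gm_dense {n : ℕ} {f : Eu n → ℝ} (hf : MemLp f 2 (gm n)) (h : ∀ l : Eu n, ∫ x, Real.exp (inner ℝ l x) * f x ∂(gm n) = 0) : f =ᵐ[gm n] 0 := by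
  have hfi : Integrable f (gm n) := hf.integrable (by norm_num)
  have hfm := hf.aestronglyMeasurable.aemeasurable
  have hei (l : Eu n) : Integrable (fun x => Real.exp (inner ℝ l x) * f x) (gm n) := (gm_exp_memLp n l).integrable_mul hf
  set μ1 := (gm n).withDensity (fun x => ENNReal.ofReal (f x)) with hμ1
  set μ2 := (gm n).withDensity (fun x => ENNReal.ofReal (-f x)) with hμ2
  haveI : IsFiniteMeasure μ1 := isFiniteMeasure_withDensity_ofReal hfi.2
  haveI : IsFiniteMeasure μ2 := isFiniteMeasure_withDensity_ofReal hfi.neg.2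
  have hm1 : AEMeasurable (fun x => ENNReal.ofReal (f x)) (gm n) := hfm.ennreal_ofReal
  have hm2 : AEMeasurable (fun x => ENNReal.ofReal (-f x)) (gm n) := hfm.neg.ennreal_ofReal
  have i1 (l : Eu n) : Integrable (fun x => (ENNReal.ofReal (f x)).toReal • Real.exp (inner ℝ l x)) (gm n) := by
    refine (hei l).mono (by fun_prop) (Eventually.of_forall fun x => ?_)
    rw [norm_smul, norm_mul, mul_comm]
    refine mul_le_mul_of_nonneg_left ?_ (norm_nonneg _)
    rw [Real.norm_of_nonneg ENNReal.toReal_nonneg, ENNReal.toReal_ofReal']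
    exact max_le (le_abs_self _) (norm_nonneg _)
  have i2 (l : Eu n) : Integrable (fun x => (ENNReal.ofReal (-f x)).toReal • Real.exp (inner ℝ l x)) (gm n) := by
    refine (hei l).mono (by fun_prop) (Eventually.of_forall fun x => ?_)
    rw [norm_smul, norm_mul, mul_comm]
    refine mul_le_mul_of_nonneg_left ?_ (norm_nonneg _)
    rw [Real.norm_of_nonneg ENNReal.toReal_nonneg, ENNReal.toReal_ofReal']
    exact max_le (neg_le_abs _) (norm_nonneg _)
  have eqm (l : Eu n) : ∫ x, Real.exp (inner ℝ l x) ∂μ1 = ∫ x, Real.exp (inner ℝ l x) ∂μ2 := by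
    rw [integral_withDensity_eq_integral_toReal_smul₀ hm1 (by simp), integral_withDensity_eq_integral_toReal_smul₀ hm2 (by simp),
      ← sub_eq_zero, ← integral_sub (i1 l) (i2 l), ← h l]
    refine integral_congr_ae (Eventually.of_forall fun x => ?_)
    simp only [ENNReal.toReal_ofReal', smul_eq_mul]
    rw [← sub_mul, mul_comm]
    congr 1
    rcases le_total 0 (f x) with h | h
    · rw [max_eq_left h, max_eq_right (by linarith), sub_zero]
    · rw [max_eq_right h, max_eq_left (by linarith)]; ring
  have hset (l : Eu n) : ProbabilityTheory.integrableExpSet (fun x => inner ℝ l x) μ1 = Set.univ := by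
    rw [Set.eq_univ_iff_forall]
    intro t
    show Integrable (fun x => Real.exp (t * inner ℝ l x)) μ1
    rw [integrable_withDensity_iff_integrable_smul₀' hm1 (by simp)]
    refine (i1 (t • l)).congr (Eventually.of_forall fun x => ?_)
    simp [inner_smul_left]
  have hz : μ1 = 0 ↔ μ2 = 0 := by
    have h0 := eqm 0
    simp at h0
    rw [← Measure.measure_univ_eq_zero, ← Measure.measure_univ_eq_zero, ← measureReal_eq_zero_iff, ← measureReal_eq_zero_iff, h0]
  have heq : μ1 = μ2 := by
    refine Measure.ext_of_charFun ?_
    ext l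
    have h1 := ProbabilityTheory.eqOn_complexMGF_of_mgf' (X := fun x => inner ℝ l x) (Y := fun x => inner ℝ l x) (μ := μ1) (μ' := μ2) (by
      ext t
      have := eqm (t • l)
      simp only [inner_smul_left] at this
      exact this) hz
    have h2 := h1 (x := Complex.I) (by rw [hset]; simp)
    rw [ProbabilityTheory.complexMGF, ProbabilityTheory.complexMGF] at h2
    rw [charFun_apply, charFun_apply]
    have h3 (x : Eu n) : ((inner ℝ x l : ℝ) : ℂ) * Complex.I = Complex.I * (inner ℝ l x : ℝ) := by rw [real_inner_comm, mul_comm]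
    simp_rw [h3]
    exact h2
  have hae := (withDensity_eq_iff hm1 hm2 (by
    have := measure_ne_top μ1 Set.univ
    rwa [hμ1, withDensity_apply _ MeasurableSet.univ, Measure.restrict_univ] at this)).1 heq
  filter_upwards [hae] with x hx
  rcases lt_trichotomy (f x) 0 with h | h | h
  · rw [ENNReal.ofReal_of_nonpos h.le, eq_comm, ENNReal.ofReal_eq_zero] at hx; linarith
  · exact h
  · rw [ENNReal.ofReal_of_nonpos (by linarith : -f x ≤ 0), ENNReal.ofReal_eq_zero] at hx; linarith

theorem gm_mix (n : ℕ) (θ : ℝ) : MeasurePreserving (fun p : Eu n × Eu n => Real.cos θ • p.1 + Real.sin θ • p.2) ((gm n).prod (gm n)) (gm n) :=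
  (measurePreserving_fst (μ := gm n) (ν := gm n)).comp (gm_rot n θ)

theorem gm_exp_mix {n : ℕ} (θ : ℝ) (l m : Eu n) :
    ∫ p, Real.exp (inner ℝ l p.1) * Real.exp (inner ℝ m (Real.cos θ • p.1 + Real.sin θ • p.2)) ∂((gm n).prod (gm n)) =
      Real.exp (‖l‖^2/2) * Real.exp (‖m‖^2/2) * Real.exp (Real.cos θ * inner ℝ l m) := by
  have h (p : Eu n × Eu n) : Real.exp (inner ℝ l p.1) * Real.exp (inner ℝ m (Real.cos θ • p.1 + Real.sin θ • p.2)) =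
      Real.exp (inner ℝ (l + Real.cos θ • m) p.1) * Real.exp (inner ℝ (Real.sin θ • m) p.2) := by
    rw [← Real.exp_add, ← Real.exp_add, inner_add_left, inner_add_right, inner_smul_left, inner_smul_left, inner_smul_right, inner_smul_right]
    congr 1; simp; ring
  simp_rw [h]
  rw [integral_prod_mul (fun x => Real.exp (inner ℝ (l + Real.cos θ • m) x)) (fun x => Real.exp (inner ℝ (Real.sin θ • m) x)), gm_exp, gm_exp,
    ← Real.exp_add, ← Real.exp_add, ← Real.exp_add, norm_add_sq_real, norm_smul, norm_smul, inner_smul_right]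
  congr 1
  simp only [Real.norm_eq_abs, mul_pow, sq_abs]
  linear_combination (‖m‖^2/2) * (Real.sin_sq_add_cos_sq θ)

/-- Real L2 space of the Gaussian. -/
abbrev HL (n : ℕ) := Lp ℝ 2 (gm n)

/-- Exponential in L2. -/
def eL {n : ℕ} (l : Eu n) : HL n := (gm_exp_memLp n l).toLp _

theorem coord_memLp (n : ℕ) (i : Fin n) : MemLp (fun x : Eu n => x i) 2 (gm n) := by
  have h := ProbabilityTheory.IsGaussian.memLp_dual (gm n) (innerSL ℝ (EuclideanSpace.single i (1:ℝ))) 2 (by norm_num)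
  refine (memLp_congr_ae (Eventually.of_forall fun x => ?_)).1 h
  simp [EuclideanSpace.inner_single_left]

/-- Constant one in L2. -/
def oL (n : ℕ) : HL n := (memLp_const (1:ℝ)).toLp (fun _ => (1:ℝ))

/-- Coordinates in L2. -/
def cL {n : ℕ} (i : Fin n) : HL n := (coord_memLp n i).toLp _

theorem inner_toLp {α : Type*} [MeasurableSpace α] {μ : Measure α} {f g : α → ℝ} (hf : MemLp f 2 μ) (hg : MemLp g 2 μ) :
    inner ℝ (hf.toLp f) (hg.toLp g) = ∫ x, f x * g x ∂μ := by
  rw [L2.inner_def]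
  refine integral_congr_ae ?_
  filter_upwards [hf.coeFn_toLp, hg.coeFn_toLp] with x h1 h2
  rw [h1, h2]; simp [mul_comm]

/-- First coordinate pullback. -/
def T1 (n : ℕ) : HL n →ₗᵢ[ℝ] Lp ℝ 2 ((gm n).prod (gm n)) := Lp.compMeasurePreservingₗᵢ ℝ _ (measurePreserving_fst (μ := gm n) (ν := gm n))
/-- Mixed pullback. -/
def T2 (n : ℕ) : HL n →ₗᵢ[ℝ] Lp ℝ 2 ((gm n).prod (gm n)) := Lp.compMeasurePreservingₗᵢ ℝ _ (gm_mix n (Real.pi/3))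

theorem T_inner {n : ℕ} {f g : Eu n → ℝ} (hf : MemLp f 2 (gm n)) (hg : MemLp g 2 (gm n)) :
    inner ℝ (T1 n (hf.toLp f)) (T2 n (hg.toLp g)) = ∫ p, f p.1 * g (Real.cos (Real.pi/3) • p.1 + Real.sin (Real.pi/3) • p.2) ∂((gm n).prod (gm n)) := by
  have h1 : T1 n (hf.toLp f) = (hf.comp_measurePreserving (measurePreserving_fst (μ := gm n) (ν := gm n))).toLp _ := Lp.toLp_compMeasurePreserving hf _
  have h2 : T2 n (hg.toLp g) = (hg.comp_measurePreserving (gm_mix n (Real.pi/3))).toLp _ := Lp.toLp_compMeasurePreserving hg _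
  rw [h1, h2, inner_toLp]
  rfl

/-- Bilinear form. -/
def Qb {n : ℕ} (f g : HL n) : ℝ := 1/4 * inner ℝ f g - inner ℝ (T1 n f) (T2 n g) + 3/4 * (inner ℝ (oL n) f * inner ℝ (oL n) g)
  + 1/4 * ∑ i, (inner ℝ (cL i) f * inner ℝ (cL i) g)

theorem Qb_exp {n : ℕ} (l m : Eu n) : Qb (eL l) (eL m) = Real.exp (‖l‖^2/2) * Real.exp (‖m‖^2/2) *
    (1/4 * Real.exp (inner ℝ l m) - Real.exp (inner ℝ l m/2) + 3/4 + inner ℝ l m/4) := by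
  have h1 : inner ℝ (eL l) (eL m) = Real.exp (‖l‖^2/2) * Real.exp (‖m‖^2/2) * Real.exp (inner ℝ l m) := by
    rw [eL, eL, inner_toLp]
    simp_rw [← Real.exp_add, ← inner_add_left]
    rw [gm_exp, norm_add_sq_real]; congr 1; ring
  have h2 (l : Eu n) : inner ℝ (oL n) (eL l) = Real.exp (‖l‖^2/2) := by
    rw [oL, eL, inner_toLp]; simp [gm_exp]
  have h3 (l : Eu n) (i : Fin n) : inner ℝ (cL i) (eL l) = l i * Real.exp (‖l‖^2/2) := by
    rw [cL, eL, inner_toLp, gm_coord]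
  have h4 : inner ℝ (T1 n (eL l)) (T2 n (eL m)) = Real.exp (‖l‖^2/2) * Real.exp (‖m‖^2/2) * Real.exp (inner ℝ l m/2) := by
    rw [eL, eL, T_inner, gm_exp_mix, Real.cos_pi_div_three]; congr 2; ring
  have h5 : ∑ i, (l i * Real.exp (‖l‖^2/2) * (m i * Real.exp (‖m‖^2/2))) = Real.exp (‖l‖^2/2) * Real.exp (‖m‖^2/2) * inner ℝ l m := by
    rw [PiLp.inner_apply, Finset.mul_sum]
    refine Finset.sum_congr rfl fun i _ => ?_
    simp; ring
  rw [Qb, h1, h4, h2, h2]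
  simp_rw [h3]
  rw [h5]; ring

theorem Qb_nonneg {n : ℕ} (f : HL n) : 0 ≤ Qb f f := by
  have hcl : IsClosed {f : HL n | 0 ≤ Qb f f} := by
    refine isClosed_le continuous_const ?_
    unfold Qb
    have c1 := (T1 n).continuous
    have c2 := (T2 n).continuous
    fun_prop
  have hK : (Submodule.span ℝ (Set.range (eL (n := n)))).topologicalClosure = ⊤ := by
    rw [Submodule.topologicalClosure_eq_top_iff, Submodule.eq_bot_iff]
    intro g hg
    rw [Submodule.mem_orthogonal] at hg
    have h0 := gm_dense (Lp.memLp g) (fun l => by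
      have := hg (eL l) (Submodule.subset_span ⟨l, rfl⟩)
      rw [← this, eL]
      conv_rhs => rw [← Lp.toLp_coeFn g (Lp.memLp g)]
      rw [inner_toLp])
    exact (Lp.eq_zero_iff_ae_eq_zero).2 h0
  have hmem : f ∈ (Submodule.span ℝ (Set.range (eL (n := n)))).topologicalClosure := by rw [hK]; trivial
  rw [← SetLike.mem_coe, Submodule.topologicalClosure_coe] at hmem
  refine closure_minimal ?_ hcl hmem
  intro g hg
  obtain ⟨c, rfl⟩ := Finsupp.mem_span_range_iff_exists_finsupp.1 hg
  have h := gram_fun c.support id (fun l => c l * Real.exp (‖l‖^2/2))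
  show 0 ≤ Qb _ _
  refine h.trans_eq ?_
  have hex : Qb (c.sum fun l a => a • eL l) (c.sum fun l a => a • eL l) = ∑ a ∈ c.support, ∑ b ∈ c.support, c a * c b * Qb (eL a) (eL b) := by
    unfold Qb
    simp only [Finsupp.sum, map_sum, map_smul, sum_inner, inner_sum, inner_smul_left, inner_smul_right, Finset.sum_mul, Finset.mul_sum]
    rw [Finset.sum_comm (s := Finset.univ)]
    conv_rhs => rw [Finset.sum_comm]
    rw [← Finset.sum_sub_distrib, ← Finset.sum_add_distrib, ← Finset.sum_add_distrib]
    refine Finset.sum_congr rfl fun a _ => ?_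
    rw [Finset.sum_comm (s := Finset.univ)]
    rw [← Finset.sum_sub_distrib, ← Finset.sum_add_distrib, ← Finset.sum_add_distrib]
    refine Finset.sum_congr rfl fun b _ => ?_
    rw [mul_add, mul_add, mul_sub, Finset.mul_sum]
    simp only [conj_trivial]
    congr 1
    · ring
    · exact Finset.sum_congr rfl fun i _ => by ring
  rw [hex]
  refine Finset.sum_congr rfl fun a _ => Finset.sum_congr rfl fun b _ => ?_
  rw [Qb_exp]; simp only [id]; ring

theorem hyper {n : ℕ} {f : Eu n → ℝ} (hf : MemLp f 2 (gm n)) :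
    ∫ p, f p.1 * f (Real.cos (Real.pi/3) • p.1 + Real.sin (Real.pi/3) • p.2) ∂((gm n).prod (gm n)) ≤
      1/4 * (∫ x, f x ^ 2 ∂(gm n)) + 3/4 * (∫ x, f x ∂(gm n))^2 + 1/4 * ∑ i, (∫ x, x i * f x ∂(gm n))^2 := by
  have h := Qb_nonneg (hf.toLp f)
  unfold Qb at h
  rw [T_inner, inner_toLp, oL, inner_toLp] at h
  simp_rw [cL, inner_toLp] at h
  simp only [one_mul, ← pow_two] at h
  linarith

/-- The area integrand. -/
def ph (p : ℝ) : ℝ := Real.sqrt (1 + p^2) - 1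

theorem ph_nonneg (p : ℝ) : 0 ≤ ph p := by
  unfold ph; rw [sub_nonneg, Real.one_le_sqrt]; nlinarith

theorem ph_cont : Continuous ph := by unfold ph; fun_prop

theorem ph_mono {p q : ℝ} (h : p^2 ≤ q^2) : ph p ≤ ph q := by
  unfold ph; gcongr

theorem ph_le_sq (p : ℝ) : ph p ≤ p^2/2 := by
  unfold ph
  rw [sub_le_iff_le_add, Real.sqrt_le_left (by positivity)]
  nlinarith [sq_nonneg (p^2)]

theorem ph_add {p w q : ℝ} (h : q^2 ≤ p^2 + w^2) : ph q ≤ ph p + w^2/2 := by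
  have h1 : 1 ≤ Real.sqrt (1+p^2) := by rw [Real.one_le_sqrt]; nlinarith
  unfold ph
  have h2 : Real.sqrt (1+q^2) ≤ Real.sqrt (1+p^2) + w^2/2 := by
    rw [Real.sqrt_le_left (by positivity)]
    have := Real.sq_sqrt (show 0 ≤ 1+p^2 by positivity)
    nlinarith [sq_nonneg w]
  linarith

theorem ph_ge (q : ℝ) : q^2/2 - q^4/8 ≤ ph q := by
  unfold ph
  rw [le_sub_iff_add_le]
  rcases le_total (q^2/2 - q^4/8 + 1) 0 with h | h
  · exact h.trans (Real.sqrt_nonneg _)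
  refine Real.le_sqrt_of_sq_le ?_
  have h1 : 0 ≤ q^2 := sq_nonneg q
  have h4 : q^4 = (q^2)^2 := by ring
  rw [h4] at h ⊢
  generalize q^2 = y at *
  have : 0 ≤ y^3 := by positivity
  have hy : y ≤ 8 := by nlinarith
  nlinarith [mul_nonneg this (sub_nonneg.2 hy)]

/-- Tangent line lower bound. -/
theorem ph_tan (m y : ℝ) : (1 + m * y) / Real.sqrt (1+m^2) - 1 ≤ ph y := by
  unfold ph
  have hs : 0 < Real.sqrt (1+m^2) := Real.sqrt_pos.2 (by positivity)
  gcongr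
  rw [div_le_iff₀ hs, ← Real.sqrt_mul (by positivity)]
  exact Real.le_sqrt_of_sq_le (by nlinarith [sq_nonneg (m - y)])

/-- Chord upper bound. -/
theorem ph_up (m y : ℝ) : ph y ≤ (Real.sqrt (1+m^2) + (1 + y^2) / Real.sqrt (1+m^2)) / 2 - 1 := by
  unfold ph
  have hs : 0 < Real.sqrt (1+m^2) := Real.sqrt_pos.2 (by positivity)
  have h2 := Real.sq_sqrt (show 0 ≤ 1+y^2 by positivity)
  gcongr
  rw [le_div_iff₀ (by norm_num), ← sub_nonneg]
  have : Real.sqrt (1+m^2) + (1 + y^2) / Real.sqrt (1+m^2) - Real.sqrt (1+y^2) * 2 = (Real.sqrt (1+m^2) - Real.sqrt (1+y^2))^2 / Real.sqrt (1+m^2) := by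
    field_simp; linear_combination -h2
  rw [this]; positivity

theorem ph_jensen {g : ℝ → ℝ} {t : ℝ} (ht : 0 < t) (hg : ContinuousOn g (Set.uIcc 0 t)) :
    ph ((∫ s in (0:ℝ)..t, g s) / t) ≤ (∫ s in (0:ℝ)..t, ph (g s)) / t := by
  set m := (∫ s in (0:ℝ)..t, g s) / t with hm
  have hmt : ∫ s in (0:ℝ)..t, g s = m * t := by rw [hm]; field_simp
  have hs : 0 < Real.sqrt (1+m^2) := Real.sqrt_pos.2 (by positivity)
  have h2 := Real.sq_sqrt (show 0 ≤ 1+m^2 by positivity)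
  have i1 : IntervalIntegrable g volume 0 t := hg.intervalIntegrable
  have i2 : IntervalIntegrable (fun s => ph (g s)) volume 0 t := (ph_cont.comp_continuousOn hg).intervalIntegrable
  have hc : ContinuousOn (fun s => (1 + m * g s) / Real.sqrt (1+m^2) - 1) (Set.uIcc 0 t) := by fun_prop
  have h3 : ∫ s in (0:ℝ)..t, ((1 + m * g s) / Real.sqrt (1+m^2) - 1) ≤ ∫ s in (0:ℝ)..t, ph (g s) :=
    intervalIntegral.integral_mono_on ht.le hc.intervalIntegrable i2 (fun s _ => ph_tan m (g s))
  have h4 : ∫ s in (0:ℝ)..t, ((1 + m * g s) / Real.sqrt (1+m^2) - 1) = ph m * t := by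
    rw [intervalIntegral.integral_sub (ContinuousOn.intervalIntegrable (by fun_prop)) (ContinuousOn.intervalIntegrable (by fun_prop)),
      intervalIntegral.integral_div, intervalIntegral.integral_add (ContinuousOn.intervalIntegrable (by fun_prop)) (ContinuousOn.intervalIntegrable (by fun_prop)),
      intervalIntegral.integral_const_mul, hmt]
    simp only [intervalIntegral.integral_const, smul_eq_mul, mul_one, sub_zero]
    unfold ph
    have h5 : Real.sqrt (1+m^2) = (1+m^2) / Real.sqrt (1+m^2) := by rw [eq_div_iff hs.ne']; linarith
    conv_rhs => rw [h5]
    ring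
  rw [le_div_iff₀ ht, ← h4]; exact h3

/-- Zero-homogeneous profiles. -/
structure VData (k : ℕ) (v : Eu (k+1) → ℝ) (M : ℝ) : Prop where
  hom : ∀ r : ℝ, 0 < r → ∀ x, v (r • x) = v x
  cd : ∀ x, x ≠ 0 → ContDiffAt ℝ 1 v x
  bdd : ∀ x, |v x| ≤ M
  meas : Measurable v

namespace VData
variable {k : ℕ} {v : Eu (k+1) → ℝ} {M : ℝ}

theorem M0 (D : VData k v M) : 0 ≤ M := (abs_nonneg _).trans (D.bdd 0)

theorem fd_smul (D : VData k v M) {r : ℝ} (hr : 0 < r) (x : Eu (k+1)) : fderiv ℝ v (r • x) = r⁻¹ • fderiv ℝ v x := by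
  have h := fderiv_comp_smul (𝕜 := ℝ) (f := v) (x := x) r
  have h2 : (fun z => v (r • z)) = v := by funext z; exact D.hom r hr z
  rw [h2] at h
  rw [h, smul_smul, inv_mul_cancel₀ hr.ne', one_smul]

theorem radial (D : VData k v M) {x : Eu (k+1)} (hx : x ≠ 0) : fderiv ℝ v x x = 0 := by
  have h1 : HasDerivAt (fun t : ℝ => v (t • x)) (fderiv ℝ v ((1:ℝ) • x) x) 1 := by
    have hd : HasFDerivAt v (fderiv ℝ v ((1:ℝ) • x)) ((1:ℝ) • x) :=
      ((D.cd _ (by simpa using hx)).differentiableAt one_ne_zero).hasFDerivAt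
    have h2 : HasDerivAt (fun t : ℝ => t • x) x 1 := by simpa using (hasDerivAt_id (1:ℝ)).smul_const x
    exact hd.comp_hasDerivAt 1 h2
  have h3 : HasDerivAt (fun t : ℝ => v (t • x)) 0 1 := by
    refine (hasDerivAt_const (1:ℝ) (v x)).congr_of_eventuallyEq ?_
    filter_upwards [lt_mem_nhds (show (0:ℝ) < 1 by norm_num)] with t ht
    exact D.hom t ht x
  rw [one_smul] at h1
  exact h1.unique h3

theorem fd_contAt (D : VData k v M) {x : Eu (k+1)} (hx : x ≠ 0) : ContinuousAt (fderiv ℝ v) x :=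
  ((D.cd x hx).fderiv_right (m := 0) (by simp)).continuousAt

/-- The scale invariant gradient. -/
def gr (v : Eu (k+1) → ℝ) (x : Eu (k+1)) : ℝ := ‖x‖ * ‖fderiv ℝ v x‖

theorem gr_hom (D : VData k v M) (r : ℝ) (hr : 0 < r) (x : Eu (k+1)) : gr v (r • x) = gr v x := by
  unfold gr
  rw [D.fd_smul hr, norm_smul, norm_smul, norm_inv, Real.norm_of_nonneg hr.le]; field_simp

theorem gr_meas (_D : VData k v M) : Measurable (gr v) := by
  unfold gr
  exact measurable_norm.mul (measurable_fderiv ℝ v).norm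

theorem gr_bdd (D : VData k v M) : ∃ G : ℝ, ∀ x, |gr v x| ≤ G := by
  have hc : ContinuousOn (fun x => ‖fderiv ℝ v x‖) (sphere (0:Eu (k+1)) 1) := by
    intro x hx
    have hx0 : x ≠ 0 := by rintro rfl; simp at hx
    exact (D.fd_contAt hx0).norm.continuousWithinAt
  obtain ⟨G, hG⟩ := (isCompact_sphere (0:Eu (k+1)) 1).exists_bound_of_continuousOn hc
  refine ⟨max G 0, fun x => ?_⟩
  by_cases hx : x = 0
  · simp [hx, gr]
  have h1 : gr v x = gr v (nrm x) := by
    conv_lhs => rw [← norm_smul_nrm x, D.gr_hom _ (norm_pos_iff.2 hx)]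
  have h2 := hG (nrm x) (by simp [norm_nrm hx])
  rw [h1, gr, norm_nrm hx, one_mul]
  simp only [norm_norm, abs_norm] at h2 ⊢
  exact h2.trans (le_max_left _ _)

theorem hh_fd (D : VData k v M) {x : Eu (k+1)} (hx : x ≠ 0) :
    HasFDerivAt (fun x => ‖x‖ * v x) (‖x‖ • fderiv ℝ v x + v x • fderiv ℝ (fun x : Eu (k+1) => ‖x‖) x) x :=
  ((contDiffAt_norm (n := 1) ℝ hx).differentiableAt one_ne_zero).hasFDerivAt.mul ((D.cd x hx).differentiableAt one_ne_zero).hasFDerivAt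

theorem hh_contAt (D : VData k v M) {x : Eu (k+1)} (hx : x ≠ 0) : ContinuousAt (fderiv ℝ (fun x => ‖x‖ * v x)) x :=
  ((((contDiffAt_norm (n := 1) ℝ hx).mul (D.cd x hx))).fderiv_right (m := 0) (by simp)).continuousAt

theorem norm_fd {x : Eu (k+1)} (hx : x ≠ 0) (y : Eu (k+1)) : ‖x‖ * fderiv ℝ (fun x : Eu (k+1) => ‖x‖) x y = inner ℝ x y := by
  have hd : DifferentiableAt ℝ (fun x : Eu (k+1) => ‖x‖) x := (contDiffAt_norm (n := 1) ℝ hx).differentiableAt one_ne_zero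
  have h1 : fderiv ℝ (fun x : Eu (k+1) => ‖x‖ ^ 2) x y = 2 * ‖x‖ * fderiv ℝ (fun x : Eu (k+1) => ‖x‖) x y := by
    rw [fderiv_fun_pow 2 hd]; simp
  rw [fderiv_norm_sq_apply] at h1
  simp at h1
  linarith

theorem hh_norm (D : VData k v M) {x : Eu (k+1)} (hx : x ≠ 0) : ‖fderiv ℝ (fun x => ‖x‖ * v x) x‖^2 ≤ gr v x ^ 2 + v x ^ 2 := by
  rw [(D.hh_fd hx).fderiv]
  have hx' : 0 < ‖x‖ := norm_pos_iff.2 hx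
  suffices h : ‖‖x‖ • fderiv ℝ v x + v x • fderiv ℝ (fun x : Eu (k+1) => ‖x‖) x‖ ≤ Real.sqrt (gr v x ^ 2 + v x ^ 2) by
    have := pow_le_pow_left₀ (norm_nonneg _) h 2
    rwa [Real.sq_sqrt (by positivity)] at this
  refine ContinuousLinearMap.opNorm_le_bound _ (by positivity) (fun y => ?_)
  set N := fderiv ℝ (fun x : Eu (k+1) => ‖x‖) x with hN
  set a := N y with ha
  have hay : ‖x‖ * a = inner ℝ x y := norm_fd hx y
  set e := y - (a / ‖x‖) • x with he
  have hxe : inner ℝ x e = 0 := by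
    rw [he, inner_sub_right, inner_smul_right, real_inner_self_eq_norm_sq, ← hay]; field_simp; ring
  have hy2 : ‖y‖^2 = ‖e‖^2 + a^2 := by
    have hy : y = e + (a/‖x‖) • x := by rw [he]; abel
    conv_lhs => rw [hy]
    rw [norm_add_sq_real, inner_smul_right, real_inner_comm x e, hxe, norm_smul, Real.norm_eq_abs, mul_pow, sq_abs]
    field_simp; ring
  have hfe : fderiv ℝ v x y = fderiv ℝ v x e := by
    rw [he, map_sub, map_smul, D.radial hx]; simp
  have h1 : (‖x‖ • fderiv ℝ v x + v x • N) y = ‖x‖ * fderiv ℝ v x e + v x * a := by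
    simp [hfe, ha]
  rw [h1, Real.norm_eq_abs]
  have h2 : |‖x‖ * fderiv ℝ v x e| ≤ gr v x * ‖e‖ := by
    rw [abs_mul, abs_norm, gr, mul_assoc]
    gcongr
    exact (fderiv ℝ v x).le_opNorm e
  have h3 : (|‖x‖ * fderiv ℝ v x e| + |v x * a|)^2 ≤ (gr v x ^ 2 + v x ^ 2) * ‖y‖^2 := by
    have hg : 0 ≤ gr v x := by unfold gr; positivity
    calc _ ≤ (gr v x * ‖e‖ + |v x| * |a|)^2 := by rw [abs_mul (v x)]; gcongr
      _ ≤ (gr v x ^2 + |v x|^2) * (‖e‖^2 + |a|^2) := by nlinarith [sq_nonneg (gr v x * |a| - |v x| * ‖e‖)]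
      _ = _ := by rw [sq_abs, sq_abs, hy2]
  refine (abs_add_le _ _).trans ?_
  rw [← Real.sqrt_sq (norm_nonneg y), ← Real.sqrt_mul (by positivity)]
  exact Real.le_sqrt_of_sq_le h3

end VData

theorem gm_ac (n : ℕ) : gm n ≪ (volume : Measure (Eu n)) := by
  rw [gm_eq]; exact withDensity_absolutelyContinuous _ _

theorem gm_ne_zero (k : ℕ) : ∀ᵐ x ∂(gm (k+1)), x ≠ 0 := by
  refine (gm_ac (k+1)).ae_le ?_
  show ∀ᵐ x ∂(volume : Measure (Eu (k+1))), x ≠ 0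
  rw [ae_iff]; simp

/-- almost surely the Gaussian pair is linearly independent -/
theorem ae_indep {k : ℕ} (hk : 1 ≤ k) : ∀ᵐ p : Eu (k+1) × Eu (k+1) ∂((gm (k+1)).prod (gm (k+1))), ∀ s : ℝ, Real.cos s • p.1 + Real.sin s • p.2 ≠ 0 := by
  have hms : MeasurableSet {p : Eu (k+1) × Eu (k+1) | ‖p.1‖^2 * ‖p.2‖^2 = (inner ℝ p.1 p.2)^2} := measurableSet_eq_fun (by fun_prop) (by fun_prop)
  have h : ∀ᵐ p : Eu (k+1) × Eu (k+1) ∂((gm (k+1)).prod (gm (k+1))), ¬ (‖p.1‖^2 * ‖p.2‖^2 = (inner ℝ p.1 p.2)^2) := by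
    refine (Measure.ae_prod_iff_ae_ae (p := fun p : Eu (k+1) × Eu (k+1) => ¬ (‖p.1‖^2 * ‖p.2‖^2 = (inner ℝ p.1 p.2)^2)) hms.compl).2 ?_
    filter_upwards [gm_ne_zero k] with x hx
    refine (gm_ac (k+1)).ae_le ?_
    show ∀ᵐ y ∂(volume : Measure (Eu (k+1))), ¬ (‖x‖^2 * ‖y‖^2 = (inner ℝ x y)^2)
    have hs : (volume : Measure (Eu (k+1))) (Submodule.span ℝ {x} : Submodule ℝ (Eu (k+1))) = 0 := by
      refine Measure.addHaar_submodule _ _ ?_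
      intro ht
      have h1 := finrank_span_singleton (K := ℝ) hx
      rw [ht, finrank_top] at h1
      simp at h1; omega
    rw [ae_iff]
    refine measure_mono_null ?_ hs
    intro z hz
    simp only [not_not, Set.mem_ofPred_eq] at hz
    rw [SetLike.mem_coe, Submodule.mem_span_singleton]
    refine ⟨inner ℝ x z / ‖x‖^2, ?_⟩
    have hx' : 0 < ‖x‖ := norm_pos_iff.2 hx
    rw [eq_comm, ← sub_eq_zero, ← norm_eq_zero, ← sq_eq_zero_iff, norm_sub_sq_real, inner_smul_right, norm_smul, real_inner_comm x z, Real.norm_eq_abs, mul_pow, sq_abs]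
    field_simp
    nlinarith
  filter_upwards [h] with p hp s hs
  apply hp
  have hcs := Real.sin_sq_add_cos_sq s
  by_cases hc : Real.cos s = 0
  · have hsn : Real.sin s ≠ 0 := fun h0 => by rw [hc, h0] at hcs; norm_num at hcs
    rw [hc, zero_smul, zero_add, smul_eq_zero] at hs
    rw [hs.resolve_left hsn]; simp
  · have h1 : p.1 = (-(Real.sin s / Real.cos s)) • p.2 := by
      have : Real.cos s • p.1 = -(Real.sin s • p.2) := eq_neg_of_add_eq_zero_left hs
      have h2 : p.1 = (Real.cos s)⁻¹ • (Real.cos s • p.1) := by rw [smul_smul, inv_mul_cancel₀ hc, one_smul]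
      rw [h2, this, smul_neg, smul_smul, neg_smul]; congr 2; ring
    rw [h1, norm_smul, inner_smul_left, real_inner_self_eq_norm_sq, Real.norm_eq_abs, mul_pow, sq_abs]
    simp; ring

namespace VData
variable {k : ℕ} {v : Eu (k+1) → ℝ} {M : ℝ}

theorem meas_fdz (h : Eu (k+1) → ℝ) : Measurable (fun p : Eu (k+1) × Eu (k+1) => fderiv ℝ h p.1 p.2) := by
  have h1 : Measurable (fun q : (Eu (k+1) →L[ℝ] ℝ) × Eu (k+1) => q.1 q.2) := isBoundedBilinearMap_apply.continuous.measurable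
  exact h1.comp (((measurable_fderiv ℝ h).comp measurable_fst).prodMk measurable_snd)

theorem gap1 (D : VData k v M) (hk : 1 ≤ k) {t : ℝ} (ht : 0 < t) :
    ∫⁻ p, ENNReal.ofReal (ph ((‖Real.cos t • p.1 + Real.sin t • p.2‖ * v (Real.cos t • p.1 + Real.sin t • p.2) - ‖p.1‖ * v p.1) / t)) ∂((gm (k+1)).prod (gm (k+1))) ≤
      ∫⁻ p, ENNReal.ofReal (ph (fderiv ℝ (fun x => ‖x‖ * v x) p.1 p.2)) ∂((gm (k+1)).prod (gm (k+1))) := by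
  set h : Eu (k+1) → ℝ := fun x => ‖x‖ * v x with hh
  set γ := (gm (k+1)).prod (gm (k+1)) with hγ
  set K := ∫⁻ p, ENNReal.ofReal (ph (fderiv ℝ h p.1 p.2)) ∂γ with hK
  have hmK : Measurable (fun p : Eu (k+1) × Eu (k+1) => ENNReal.ofReal (ph (fderiv ℝ h p.1 p.2))) :=
    (ph_cont.measurable.comp (meas_fdz h)).ennreal_ofReal
  let R : ℝ → Eu (k+1) × Eu (k+1) → Eu (k+1) × Eu (k+1) := fun s p => (Real.cos s • p.1 + Real.sin s • p.2, -Real.sin s • p.1 + Real.cos s • p.2)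
  have hR : Measurable (fun q : (Eu (k+1) × Eu (k+1)) × ℝ => R q.2 q.1) := by
    have : Continuous (fun q : (Eu (k+1) × Eu (k+1)) × ℝ => R q.2 q.1) := by
      show Continuous (fun q : (Eu (k+1) × Eu (k+1)) × ℝ => (Real.cos q.2 • q.1.1 + Real.sin q.2 • q.1.2, -Real.sin q.2 • q.1.1 + Real.cos q.2 • q.1.2))
      fun_prop
    exact this.measurable
  have hstep : ∀ᵐ p ∂γ, ENNReal.ofReal (ph ((h (Real.cos t • p.1 + Real.sin t • p.2) - h p.1) / t)) ≤
      ENNReal.ofReal t⁻¹ * ∫⁻ s in Set.Ioc 0 t, ENNReal.ofReal (ph (fderiv ℝ h (R s p).1 (R s p).2)) := by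
    filter_upwards [ae_indep hk] with p hp
    have hder (s : ℝ) : HasDerivAt (fun s => h (Real.cos s • p.1 + Real.sin s • p.2)) (fderiv ℝ h (R s p).1 (R s p).2) s := by
      have h1 : HasFDerivAt h (fderiv ℝ h (R s p).1) (R s p).1 := by
        have := D.hh_fd (hp s)
        exact this.differentiableAt.hasFDerivAt
      have h2 : HasDerivAt (fun s => Real.cos s • p.1 + Real.sin s • p.2) (R s p).2 s :=
        ((Real.hasDerivAt_cos s).smul_const p.1).add ((Real.hasDerivAt_sin s).smul_const p.2)
      exact h1.comp_hasDerivAt s h2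
    have hcont : Continuous (fun s => fderiv ℝ h (R s p).1 (R s p).2) := by
      rw [continuous_iff_continuousAt]
      intro s
      have c1 : ContinuousAt (fun s => fderiv ℝ h (R s p).1) s := by
        have := D.hh_contAt (hp s)
        have c0 : ContinuousAt (fun s => (R s p).1) s := by
          show ContinuousAt (fun s => Real.cos s • p.1 + Real.sin s • p.2) s
          fun_prop
        exact ContinuousAt.comp (f := fun s => (R s p).1) this c0
      have c2 : ContinuousAt (fun s => (R s p).2) s := by
        show ContinuousAt (fun s => -Real.sin s • p.1 + Real.cos s • p.2) s
        fun_prop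
      exact c1.clm_apply c2
    have hFTC : ∫ s in (0:ℝ)..t, fderiv ℝ h (R s p).1 (R s p).2 = h (Real.cos t • p.1 + Real.sin t • p.2) - h p.1 := by
      rw [intervalIntegral.integral_eq_sub_of_hasDerivAt (fun s _ => hder s) (hcont.intervalIntegrable _ _)]
      simp
    have hJ := ph_jensen ht (g := fun s => fderiv ℝ h (R s p).1 (R s p).2) hcont.continuousOn
    rw [hFTC] at hJ
    have hitg : IntegrableOn (fun s => ph (fderiv ℝ h (R s p).1 (R s p).2)) (Set.Ioc 0 t) := by
      have := (ph_cont.comp hcont).intervalIntegrable (μ := volume) 0 t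
      rwa [intervalIntegrable_iff_integrableOn_Ioc_of_le ht.le] at this
    rw [← ofReal_integral_eq_lintegral_ofReal hitg (Eventually.of_forall fun s => ph_nonneg _), ← ENNReal.ofReal_mul (by positivity)]
    apply ENNReal.ofReal_le_ofReal
    rw [intervalIntegral.integral_of_le ht.le] at hJ
    rw [inv_mul_eq_div]; exact hJ
  have hjm : Measurable (fun q : (Eu (k+1) × Eu (k+1)) × ℝ => ENNReal.ofReal (ph (fderiv ℝ h (R q.2 q.1).1 (R q.2 q.1).2))) := hmK.comp hR
  calc _ ≤ ∫⁻ p, (ENNReal.ofReal t⁻¹ * ∫⁻ s in Set.Ioc 0 t, ENNReal.ofReal (ph (fderiv ℝ h (R s p).1 (R s p).2))) ∂γ := lintegral_mono_ae hstep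
    _ = ENNReal.ofReal t⁻¹ * ∫⁻ p, (∫⁻ s in Set.Ioc 0 t, ENNReal.ofReal (ph (fderiv ℝ h (R s p).1 (R s p).2))) ∂γ :=
        lintegral_const_mul _ hjm.lintegral_prod_right'
    _ = ENNReal.ofReal t⁻¹ * ∫⁻ s in Set.Ioc 0 t, (∫⁻ p, ENNReal.ofReal (ph (fderiv ℝ h (R s p).1 (R s p).2)) ∂γ) := by
        rw [lintegral_lintegral_swap hjm.aemeasurable]
    _ = ENNReal.ofReal t⁻¹ * ∫⁻ s in Set.Ioc 0 t, K := by
        congr 1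
        refine lintegral_congr fun s => ?_
        exact (gm_rot (k+1) s).lintegral_comp hmK
    _ = K := by
        rw [setLIntegral_const, Real.volume_Ioc, sub_zero, mul_comm K, ← mul_assoc, ← ENNReal.ofReal_mul (by positivity), inv_mul_cancel₀ ht.ne']
        simp

theorem gap2 (D : VData k v M) :
    ∫⁻ p, ENNReal.ofReal (ph (fderiv ℝ (fun x => ‖x‖ * v x) p.1 p.2)) ∂((gm (k+1)).prod (gm (k+1))) ≤
      ENNReal.ofReal (gmo k 0 * ((∫ w, ph (gr v w) ∂(sg k)) + (∫ w, v w ^ 2 ∂(sg k)) / 2)) := by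
  set h : Eu (k+1) → ℝ := fun x => ‖x‖ * v x with hh
  have hmK : Measurable (fun p : Eu (k+1) × Eu (k+1) => ENNReal.ofReal (ph (fderiv ℝ h p.1 p.2))) :=
    (ph_cont.measurable.comp (meas_fdz h)).ennreal_ofReal
  obtain ⟨G, hG⟩ := D.gr_bdd
  have hM := D.M0
  have a1 := gm_polar (k := k) (g := fun x => ph (gr v x)) (ph_cont.measurable.comp D.gr_meas) (M := G^2/2) (fun x => by
    rw [abs_of_nonneg (ph_nonneg _)]
    refine (ph_le_sq _).trans ?_
    have := sq_le_sq' (by linarith [(abs_le.1 (hG x)).1]) (abs_le.1 (hG x)).2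
    linarith) (fun r hr x => by rw [D.gr_hom r hr]) 0
  have a2 := gm_polar (k := k) (g := fun x => v x ^ 2) (D.meas.pow_const 2) (M := M^2) (fun x => by
    rw [abs_of_nonneg (sq_nonneg _)]
    exact sq_le_sq' (by linarith [(abs_le.1 (D.bdd x)).1]) (abs_le.1 (D.bdd x)).2) (fun r hr x => by rw [D.hom r hr]) 0
  simp only [pow_zero, one_mul] at a1 a2
  rw [lintegral_prod _ hmK.aemeasurable]
  have hx0 := gm_ne_zero k
  have hb : ∀ᵐ x ∂(gm (k+1)), ∫⁻ z, ENNReal.ofReal (ph (fderiv ℝ h x z)) ∂(gm (k+1)) ≤ ENNReal.ofReal (ph (gr v x) + v x ^ 2 / 2) := by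
    filter_upwards [hx0] with x hx
    set L := fderiv ℝ h x with hL
    have hLn : ‖L‖^2 ≤ gr v x ^ 2 + v x ^ 2 := D.hh_norm hx
    refine le_trans ?_ (ENNReal.ofReal_le_ofReal (ph_add hLn))
    have hi : Integrable (fun z => (Real.sqrt (1+‖L‖^2) + (1 + (L z)^2) / Real.sqrt (1+‖L‖^2)) / 2 - 1) (gm (k+1)) :=
      (((integrable_const _).add (((integrable_const _).add (gm_sq_integrable _ L)).div_const _)).div_const _).sub (integrable_const _)
    calc _ ≤ ∫⁻ z, ENNReal.ofReal ((Real.sqrt (1+‖L‖^2) + (1 + (L z)^2) / Real.sqrt (1+‖L‖^2)) / 2 - 1) ∂(gm (k+1)) :=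
          lintegral_mono fun z => ENNReal.ofReal_le_ofReal (ph_up _ _)
      _ = ENNReal.ofReal (∫ z, ((Real.sqrt (1+‖L‖^2) + (1 + (L z)^2) / Real.sqrt (1+‖L‖^2)) / 2 - 1) ∂(gm (k+1))) :=
          (ofReal_integral_eq_lintegral_ofReal hi (Eventually.of_forall fun z => (ph_nonneg _).trans (ph_up _ _))).symm
      _ = _ := by
          congr 1
          have hs : 0 < Real.sqrt (1+‖L‖^2) := Real.sqrt_pos.2 (by positivity)
          have h2 := Real.sq_sqrt (show 0 ≤ 1+‖L‖^2 by positivity)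
          have i1 := gm_sq_integrable (k+1) L
          have i2 : Integrable (fun z => 1 + (L z)^2) (gm (k+1)) := (integrable_const _).add i1
          have i3 : Integrable (fun z => (1 + (L z)^2) / Real.sqrt (1+‖L‖^2)) (gm (k+1)) := i2.div_const _
          have i4 : Integrable (fun z => Real.sqrt (1+‖L‖^2) + (1 + (L z)^2) / Real.sqrt (1+‖L‖^2)) (gm (k+1)) := (integrable_const _).add i3
          rw [integral_sub (i4.div_const 2) (integrable_const _), integral_div, integral_add (integrable_const _) i3, integral_div,
            integral_add (integrable_const _) i1, gm_sq]
          simp only [integral_const, probReal_univ, one_smul]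
          unfold ph
          have h5 : (1+‖L‖^2) / Real.sqrt (1+‖L‖^2) = Real.sqrt (1+‖L‖^2) := by rw [div_eq_iff hs.ne']; linarith
          rw [h5]; ring
  refine (lintegral_mono_ae hb).trans ?_
  have i5 : Integrable (fun x => ph (gr v x) + v x ^ 2 / 2) (gm (k+1)) := a1.1.add (a2.1.div_const 2)
  rw [← ofReal_integral_eq_lintegral_ofReal i5 (Eventually.of_forall fun x => add_nonneg (ph_nonneg _) (by positivity)),
    integral_add a1.1 (a2.1.div_const 2), integral_div, a1.2, a2.2]
  apply ENNReal.ofReal_le_ofReal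
  exact le_of_eq (by ring)

end VData

theorem mp_int {X Y : Type*} [MeasurableSpace X] [MeasurableSpace Y] {μ : Measure X} {ν : Measure Y} {f : X → Y}
    (hf : MeasurePreserving f μ ν) {g : Y → ℝ} (hg : Measurable g) : ∫ x, g (f x) ∂μ = ∫ y, g y ∂ν := by
  rw [← hf.map_eq, integral_map hf.measurable.aemeasurable hg.aestronglyMeasurable]

theorem gap3_aux {t F H2 H4 X Y R : ℝ} (ht : 0 < t) (key : (H2 + H2 - 2 * F)/(2*t^2) - (H4+H4)/t^4 ≤ R)
    (hF2 : F ≤ 1/4 * H2 + X + Y) : 3/4 * H2/t^2 ≤ R + (X+Y)/t^2 + 2*H4/t^4 := by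
  have c1 : (H2 + H2 - 2 * F)/(2*t^2) = (H2 - F)/t^2 := by field_simp; ring
  rw [c1] at key
  have c2 : 3/4 * H2/t^2 - (X+Y)/t^2 ≤ (H2 - F)/t^2 := by
    rw [← sub_div]; exact div_le_div_of_nonneg_right (by linarith) (by positivity)
  have c3 : (H4+H4)/t^4 = 2*H4/t^4 := by ring
  linarith

theorem gap_aux {κ c0 c1 c2 c4 V Φ m S Q M : ℝ} (hk1 : 1 ≤ κ) (hc0 : 0 < c0) (hc4 : 0 ≤ c4) (hM0 : 0 ≤ M) (hM1 : M ≤ 1) (hV0 : 0 ≤ V) (hQ0 : 0 ≤ Q) (hS0 : 0 ≤ S)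
    (hM2 : M * (20*(c4+1)) ≤ c0) (h4 : Q ≤ M^2 * V)
    (g3 : 3/4 * ((κ+1) * c0 * V) / (Real.pi/3)^2 ≤ c0 * (Φ + V/2) + (3/4 * (c1 * m)^2 + 1/4 * (c2^2 * S)) / (Real.pi/3)^2 + 2 * (c4 * Q) / (Real.pi/3)^4) :
    (κ/2+1/4) * V ≤ Φ + ((c1^2 + c2^2)/c0) * (m^2+S) := by
  have ht1 : 1 ≤ Real.pi/3 := by linarith [Real.pi_gt_three]
  have ht2 : (Real.pi/3)^2 ≤ 1.1 := by nlinarith [Real.pi_lt_d4, Real.pi_gt_three]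
  have ht3 : 1 ≤ (Real.pi/3)^2 := one_le_pow₀ ht1
  have ht4 : 1 ≤ (Real.pi/3)^4 := one_le_pow₀ ht1
  have b1 : 0.68 * ((κ+1) * c0 * V) ≤ 3/4 * ((κ+1) * c0 * V) / (Real.pi/3)^2 := by
    rw [le_div_iff₀ (by positivity)]
    have : 0 ≤ (κ+1) * c0 * V := by positivity
    nlinarith
  have b2 : (3/4 * (c1 * m)^2 + 1/4 * (c2^2 * S)) / (Real.pi/3)^2 ≤ (c1^2 + c2^2) * (m^2 + S) := by
    refine (div_le_self (by positivity) ht3).trans ?_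
    have := mul_nonneg (sq_nonneg c1) hS0
    have := mul_nonneg (sq_nonneg c2) hS0
    have := mul_nonneg (sq_nonneg c2) (sq_nonneg m)
    nlinarith [sq_nonneg (c1*m)]
  have b3 : 2 * (c4 * Q) / (Real.pi/3)^4 ≤ 0.1 * (c0 * V) := by
    refine (div_le_self (by positivity) ht4).trans ?_
    have d1 : c4 * Q ≤ c4 * (M^2 * V) := mul_le_mul_of_nonneg_left h4 hc4
    have d2 : M^2 * V ≤ M * V := by nlinarith [mul_nonneg hM0 hV0]
    have d3 : M * (20*(c4+1)) * V ≤ c0 * V := mul_le_mul_of_nonneg_right hM2 hV0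
    nlinarith [mul_nonneg hM0 hV0, mul_le_mul_of_nonneg_left d2 hc4]
  have fin : c0 * ((κ/2 + 1/4) * V) ≤ c0 * (Φ + ((c1^2 + c2^2)/c0) * (m^2+S)) := by
    have : c0 * (Φ + ((c1^2 + c2^2)/c0) * (m^2+S)) = c0 * Φ + (c1^2+c2^2)*(m^2+S) := by field_simp
    rw [this]
    have : 0 ≤ (κ-1) * (c0*V) := mul_nonneg (by linarith) (by positivity)
    nlinarith [mul_nonneg hc0.le hV0]
  exact le_of_mul_le_mul_left fin hc0

namespace VData
variable {k : ℕ} {v : Eu (k+1) → ℝ} {M : ℝ}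

theorem hpow (D : VData k v M) (j : ℕ) : Integrable (fun x => (‖x‖ * v x)^j) (gm (k+1)) ∧
    ∫ x, (‖x‖ * v x)^j ∂(gm (k+1)) = gmo k j * ∫ w, v w ^ j ∂(sg k) := by
  have := gm_polar (k := k) (g := fun x => v x ^ j) (D.meas.pow_const j) (M := M^j) (fun x => by
    rw [abs_pow]; exact pow_le_pow_left₀ (abs_nonneg _) (D.bdd x) j) (fun r hr x => by rw [D.hom r hr]) j
  simpa only [mul_pow] using this

theorem hmom (D : VData k v M) (i : Fin (k+1)) :
    ∫ x, x i * (‖x‖ * v x) ∂(gm (k+1)) = gmo k 2 * ∫ w, w i * v w ∂(sg k) := by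
  have hc (x : Eu (k+1)) : |(nrm x) i| ≤ 1 := by
    by_cases hx : x = 0
    · simp [hx, nrm]
    · have := PiLp.norm_apply_le (nrm x) i
      rw [norm_nrm hx] at this; exact this
  have hmi : Measurable (fun x : Eu (k+1) => x i) := (EuclideanSpace.proj (𝕜 := ℝ) i).continuous.measurable
  have := gm_polar (k := k) (g := fun x => (nrm x) i * v x) ((hmi.comp measurable_nrm).mul D.meas) (M := M) (fun x => by
    rw [abs_mul]
    calc _ ≤ 1 * M := mul_le_mul (hc x) (D.bdd x) (abs_nonneg _) zero_le_one
      _ = M := one_mul _) (fun r hr x => by rw [D.hom r hr, nrm_smul hr]) 2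
  have e1 : (fun x : Eu (k+1) => x i * (‖x‖ * v x)) = fun x => ‖x‖^2 * ((nrm x) i * v x) := by
    funext x
    have : x i = ‖x‖ * (nrm x) i := by
      conv_lhs => rw [← norm_smul_nrm x]
      simp
    rw [this]; ring
  rw [e1, this.2]
  congr 1
  refine integral_congr_ae ?_
  filter_upwards [ae_sg (k := k)] with w hw
  rw [nrm_unit hw]

theorem gap3 (D : VData k v M) (hk : 1 ≤ k) :
    3/4 * (gmo k 2 * ∫ w, v w ^ 2 ∂(sg k)) / (Real.pi/3)^2 ≤ gmo k 0 * ((∫ w, ph (gr v w) ∂(sg k)) + (∫ w, v w ^ 2 ∂(sg k)) / 2)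
      + (3/4 * (gmo k 1 * ∫ w, v w ∂(sg k))^2 + 1/4 * ∑ i, (gmo k 2 * ∫ w, w i * v w ∂(sg k))^2) / (Real.pi/3)^2
      + 2 * (gmo k 4 * ∫ w, v w ^ 4 ∂(sg k)) / (Real.pi/3)^4 := by
  set t := Real.pi/3 with ht'
  have ht : 0 < t := by positivity
  set h : Eu (k+1) → ℝ := fun x => ‖x‖ * v x with hh
  have hm : Measurable h := measurable_norm.mul D.meas
  have hL2 : MemLp h 2 (gm (k+1)) := (memLp_two_iff_integrable_sq hm.aestronglyMeasurable).2 (D.hpow 2).1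
  have hF := hyper hL2
  rw [← ht'] at hF
  have hmix := gm_mix (k+1) t
  have hfst : MeasurePreserving (Prod.fst : Eu (k+1) × Eu (k+1) → Eu (k+1)) ((gm (k+1)).prod (gm (k+1))) (gm (k+1)) := measurePreserving_fst
  set γ := (gm (k+1)).prod (gm (k+1)) with hγ
  let T : Eu (k+1) × Eu (k+1) → Eu (k+1) := fun p => Real.cos t • p.1 + Real.sin t • p.2
  have i1 (j : ℕ) : Integrable (fun p : Eu (k+1) × Eu (k+1) => h p.1 ^ j) γ := hfst.integrable_comp_of_integrable (D.hpow j).1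
  have i2 (j : ℕ) : Integrable (fun p : Eu (k+1) × Eu (k+1) => h (T p) ^ j) γ := hmix.integrable_comp_of_integrable (D.hpow j).1
  have e1 (j : ℕ) : ∫ p, h p.1 ^ j ∂γ = gmo k j * ∫ w, v w ^ j ∂(sg k) := by
    rw [← (D.hpow j).2]; exact mp_int hfst (hm.pow_const j)
  have e2 (j : ℕ) : ∫ p, h (T p) ^ j ∂γ = gmo k j * ∫ w, v w ^ j ∂(sg k) := by
    rw [← (D.hpow j).2]; exact mp_int hmix (hm.pow_const j)
  have l1 : MemLp (fun p : Eu (k+1) × Eu (k+1) => h p.1) 2 γ := hL2.comp_measurePreserving hfst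
  have l2 : MemLp (fun p : Eu (k+1) × Eu (k+1) => h (T p)) 2 γ := hL2.comp_measurePreserving hmix
  have i3 : Integrable (fun p : Eu (k+1) × Eu (k+1) => h p.1 * h (T p)) γ := l1.integrable_mul l2
  have mq : Measurable (fun p : Eu (k+1) × Eu (k+1) => (h (T p) - h p.1)/t) :=
    ((hm.comp hmix.measurable).sub (hm.comp measurable_fst)).div_const t
  have g12 := (D.gap1 hk ht).trans D.gap2
  set R := gmo k 0 * ((∫ w, ph (gr v w) ∂(sg k)) + (∫ w, v w ^ 2 ∂(sg k)) / 2) with hR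
  have hR0 : 0 ≤ R := by
    refine mul_nonneg (gmo_nonneg _ _) (add_nonneg (integral_nonneg fun w => ph_nonneg _) ?_)
    have : 0 ≤ ∫ w, v w ^ 2 ∂(sg k) := integral_nonneg fun w => sq_nonneg _
    linarith
  have iA : Integrable (fun p : Eu (k+1) × Eu (k+1) => (h (T p)^2 + h p.1 ^2)) γ := (i2 2).add (i1 2)
  have iB : Integrable (fun p : Eu (k+1) × Eu (k+1) => (h (T p)^2 + h p.1 ^2 - 2 * (h p.1 * h (T p)))) γ := iA.sub (i3.const_mul 2)
  have iC : Integrable (fun p : Eu (k+1) × Eu (k+1) => (h (T p)^4 + h p.1 ^4)) γ := (i2 4).add (i1 4)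
  have iD : Integrable (fun p : Eu (k+1) × Eu (k+1) => (h (T p)^2 + h p.1 ^2 - 2 * (h p.1 * h (T p)))/(2*t^2) - (h (T p)^4 + h p.1 ^4)/t^4) γ :=
    (iB.div_const _).sub (iC.div_const _)
  have key : ∫ p, ((h (T p)^2 + h p.1 ^2 - 2 * (h p.1 * h (T p)))/(2*t^2) - (h (T p)^4 + h p.1 ^4)/t^4) ∂γ ≤ R := by
    have hle : ∀ p : Eu (k+1) × Eu (k+1), (h (T p)^2 + h p.1 ^2 - 2 * (h p.1 * h (T p)))/(2*t^2) - (h (T p)^4 + h p.1 ^4)/t^4 ≤ ph ((h (T p) - h p.1)/t) := by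
      intro p
      refine le_trans ?_ (ph_ge _)
      have a1 : (h (T p)^2 + h p.1 ^2 - 2 * (h p.1 * h (T p)))/(2*t^2) = ((h (T p) - h p.1)/t)^2/2 := by field_simp; ring
      rw [a1]
      refine sub_le_sub_left ?_ _
      have a2 : ((h (T p) - h p.1)/t)^4/8 = ((h (T p) - h p.1)^4/8)/t^4 := by field_simp
      rw [a2]
      gcongr
      generalize h (T p) = a; generalize h p.1 = b
      nlinarith [sq_nonneg (a+b), sq_nonneg (a-b), sq_nonneg (a^2-b^2), sq_nonneg (a*b), sq_nonneg (a^2+b^2), sq_nonneg ((a+b)^2), sq_nonneg ((a-b)*(a+b)), mul_nonneg (sq_nonneg (a+b)) (sq_nonneg (a-b)), mul_nonneg (sq_nonneg (a+b)) (sq_nonneg a), mul_nonneg (sq_nonneg (a+b)) (sq_nonneg b)]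
    have iE : Integrable (fun p : Eu (k+1) × Eu (k+1) => ph ((h (T p) - h p.1)/t)) γ := by
      refine Integrable.mono' (iB.div_const (2*t^2)) (ph_cont.measurable.comp mq).aestronglyMeasurable (Eventually.of_forall fun p => ?_)
      rw [Real.norm_of_nonneg (ph_nonneg _)]
      refine (ph_le_sq _).trans (le_of_eq ?_)
      field_simp; ring
    refine (integral_mono iD iE hle).trans ?_
    rw [integral_eq_lintegral_of_nonneg_ae (Eventually.of_forall fun p => ph_nonneg _) iE.1]
    exact ENNReal.toReal_le_of_le_ofReal hR0 g12
  rw [integral_sub (iB.div_const _) (iC.div_const _), integral_div, integral_div, integral_sub iA (i3.const_mul 2), integral_add (i2 2) (i1 2),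
    integral_add (i2 4) (i1 4), integral_const_mul, e1, e1, e2, e2] at key
  have hF2 : ∫ p, h p.1 * h (T p) ∂γ ≤ 1/4 * (gmo k 2 * ∫ w, v w ^ 2 ∂(sg k)) + 3/4 * (gmo k 1 * ∫ w, v w ∂(sg k))^2 + 1/4 * ∑ i, (gmo k 2 * ∫ w, w i * v w ∂(sg k))^2 := by
    refine hF.trans (le_of_eq ?_)
    have b1 := (D.hpow 1).2
    simp only [pow_one] at b1
    rw [(D.hpow 2).2, b1]
    congr 2
    refine Finset.sum_congr rfl fun i _ => ?_
    rw [D.hmom i]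
  exact gap3_aux ht key hF2

theorem gap (hk : 1 ≤ k) : ∃ C : ℝ, 0 ≤ C ∧ ∃ M0 : ℝ, 0 < M0 ∧ ∀ (v : Eu (k+1) → ℝ) (M : ℝ), VData k v M → M ≤ M0 →
    ((k:ℝ)/2 + 1/4) * ∫ w, v w ^ 2 ∂(sg k) ≤ (∫ w, ph (gr v w) ∂(sg k)) + C * ((∫ w, v w ∂(sg k))^2 + ∑ i, (∫ w, w i * v w ∂(sg k))^2) := by
  have hc0 : 0 < gmo k 0 := gmo_zero_pos k
  have hc4 : 0 ≤ gmo k 4 := gmo_nonneg _ _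
  refine ⟨((gmo k 1)^2 + (gmo k 2)^2)/gmo k 0, by positivity, min 1 (gmo k 0/(20*(gmo k 4+1))), by positivity, ?_⟩
  intro v M D hM
  have g3 := D.gap3 hk
  have hM0 := D.M0
  have hM1 : M ≤ 1 := hM.trans (min_le_left _ _)
  have hM2 : M * (20*(gmo k 4+1)) ≤ gmo k 0 := by
    have := hM.trans (min_le_right _ _)
    rwa [le_div_iff₀ (by positivity)] at this
  have iv (j : ℕ) : Integrable (fun w => v w ^ j) (sg k) := by
    refine Integrable.of_bound (D.meas.pow_const j).aestronglyMeasurable (M^j) (Eventually.of_forall fun w => ?_)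
    rw [norm_pow]; exact pow_le_pow_left₀ (norm_nonneg _) (D.bdd w) j
  have h4 : ∫ w, v w ^ 4 ∂(sg k) ≤ M^2 * ∫ w, v w ^ 2 ∂(sg k) := by
    rw [← integral_const_mul]
    refine integral_mono (iv 4) ((iv 2).const_mul _) fun w => ?_
    show v w ^ 4 ≤ M^2 * v w ^2
    have : v w ^ 2 ≤ M^2 := sq_le_sq' (by linarith [(abs_le.1 (D.bdd w)).1]) (abs_le.1 (D.bdd w)).2
    nlinarith [sq_nonneg (v w)]
  rw [gmo_two] at g3
  have hsum : ∑ i : Fin (k+1), (((k:ℝ)+1) * gmo k 0 * ∫ w, w i * v w ∂(sg k))^2 = (gmo k 2)^2 * ∑ i : Fin (k+1), (∫ w, w i * v w ∂(sg k))^2 := by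
    rw [Finset.mul_sum, gmo_two]; exact Finset.sum_congr rfl fun i _ => by ring
  rw [hsum] at g3
  set S := ∑ i : Fin (k+1), (∫ w, w i * v w ∂(sg k))^2 with hS
  have hS0 : 0 ≤ S := Finset.sum_nonneg fun i _ => sq_nonneg _
  set V := ∫ w, v w ^ 2 ∂(sg k) with hV
  have hV0 : 0 ≤ V := integral_nonneg fun w => sq_nonneg _
  set Φ := ∫ w, ph (gr v w) ∂(sg k)
  set m := ∫ w, v w ∂(sg k)
  set Q := ∫ w, v w ^ 4 ∂(sg k) with hQ
  have hQ0 : 0 ≤ Q := integral_nonneg fun w => by positivity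
  exact gap_aux (by exact_mod_cast hk) hc0 hc4 hM0 hM1 hV0 hQ0 hS0 hM2 h4 g3
end VData

theorem four {X Y : Type*} [MeasurableSpace X] [MeasurableSpace Y] (μ : Measure X) (ν : Measure Y) [SFinite μ] [SFinite ν]
    {g : (X × Y) × (X × Y) → ℝ≥0∞} (hg : Measurable g) : ∫⁻ z, g z ∂((μ.prod ν).prod (μ.prod ν)) =
      ∫⁻ a, (∫⁻ a', (∫⁻ b, (∫⁻ b', g ((a, b), (a', b')) ∂ν) ∂ν) ∂μ) ∂μ := by
  rw [lintegral_prod _ hg.aemeasurable, lintegral_prod _ (hg.lintegral_prod_right').aemeasurable]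
  refine lintegral_congr fun a => ?_
  have h1 : ∀ b, ∫⁻ q, g ((a, b), q) ∂(μ.prod ν) = ∫⁻ a', (∫⁻ b', g ((a, b), (a', b')) ∂ν) ∂μ := fun b =>
    lintegral_prod _ (hg.comp (by fun_prop)).aemeasurable
  simp only [h1]
  rw [lintegral_lintegral_swap]
  have : Measurable (fun w : (Y × X) × Y => g ((a, w.1.1), (w.1.2, w.2))) := hg.comp (by fun_prop)
  exact this.lintegral_prod_right'.aemeasurable

/-- Exchange of the second components. -/
theorem exch {X Y : Type*} [MeasurableSpace X] [MeasurableSpace Y] (μ : Measure X) (ν : Measure Y) [SFinite μ] [SFinite ν] :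
    MeasurePreserving (fun z : (X × Y) × (X × Y) => ((z.1.1, z.2.2), (z.2.1, z.1.2))) ((μ.prod ν).prod (μ.prod ν)) ((μ.prod ν).prod (μ.prod ν)) := by
  have hm : Measurable (fun z : (X × Y) × (X × Y) => ((z.1.1, z.2.2), (z.2.1, z.1.2))) := by fun_prop
  refine ⟨hm, Measure.ext_of_lintegral _ fun f hf => ?_⟩
  rw [lintegral_map hf hm, four μ ν (g := fun z => f ((z.1.1, z.2.2), (z.2.1, z.1.2))) (hf.comp hm), four μ ν hf]
  refine lintegral_congr fun a => lintegral_congr fun a' => ?_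
  rw [lintegral_lintegral_swap]
  have : Measurable (fun w : Y × Y => f ((a, w.2), (a', w.1))) := hf.comp (by fun_prop)
  exact this.aemeasurable

/-- `1` if `r < a`. -/
def Ind (r a : ℝ) : ℝ≥0∞ := if r < a then 1 else 0

/-- indicator of the square between `a` and `b`. -/
def Lnd (r s a b : ℝ) : ℝ≥0∞ := if min a b ≤ r ∧ r < max a b ∧ min a b ≤ s ∧ s < max a b then 1 else 0

theorem Ind_meas : Measurable (fun p : ℝ × ℝ => Ind p.1 p.2) :=
  Measurable.ite (measurableSet_lt measurable_fst measurable_snd) measurable_const measurable_const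

theorem quad_id (r s a b : ℝ) : Ind r a * Ind s a + Ind r b * Ind s b = Ind r a * Ind s b + Ind r b * Ind s a + Lnd r s a b := by
  unfold Ind Lnd
  rcases le_total a b with h | h
  all_goals
    simp only [h, min_eq_left, max_eq_right, min_eq_right, max_eq_left, ← not_lt]
    by_cases h1 : r < a <;> by_cases h2 : s < a <;> by_cases h3 : r < b <;> by_cases h4 : s < b <;> simp [h1, h2, h3, h4] <;> (exfalso; linarith)

theorem rk_sph {k : ℕ} (α : ℝ) {w w' : Eu (k+1)} (h : ‖w‖ = 1) (h' : ‖w'‖ = 1) (r s : ℝ) : rk α (r • w) (s • w') = rk α (s • w) (r • w') := by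
  have : ‖r • w - s • w'‖ = ‖s • w - r • w'‖ := by
    rw [← sq_eq_sq₀ (norm_nonneg _) (norm_nonneg _), norm_sub_sq_real, norm_sub_sq_real, norm_smul, norm_smul, norm_smul, norm_smul, h, h',
      inner_smul_left, inner_smul_right, inner_smul_left, inner_smul_right]
    simp; ring
  simp only [rk, this]

/-- Riesz potential of the ball. -/
def Psi {n : ℕ} (α c : ℝ) (x : Eu n) : ℝ≥0∞ := ∫⁻ y in ball (0 : Eu n) c, rk α x y

theorem Psi_radial {n : ℕ} (α c : ℝ) {x y : Eu n} (h : ‖x‖ = ‖y‖) : Psi α c x = Psi α c y := by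
  set R := Submodule.reflection (ℝ ∙ (x - y))ᗮ with hR
  have hxy : R x = y := Submodule.reflection_sub h
  have h1 : R ⁻¹' (ball (0 : Eu n) c) = ball 0 c := by
    ext z; simp
  have h2 := R.measurePreserving.setLIntegral_comp_preimage (s := ball (0 : Eu n) c) measurableSet_ball (measurable_rk_left α y)
  rw [h1] at h2
  unfold Psi
  rw [← h2]
  refine lintegral_congr fun z => ?_
  rw [← hxy]
  simp only [rk, ← map_sub, LinearIsometryEquiv.norm_map]

def PP (k : ℕ) : Measure (Eu (k+1) × ℝ) := (sg k).prod (rho k)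

instance (k : ℕ) : SFinite (PP k) := by unfold PP; infer_instance

theorem PP_lint {k : ℕ} {f : Eu (k+1) → ℝ≥0∞} (hf : Measurable f) : ∫⁻ p, f (p.2 • p.1) ∂(PP k) = ∫⁻ x, f x :=
  (polar_map k).lintegral_comp hf

theorem ae_rho (k : ℕ) : ∀ᵐ r ∂(rho k), 0 < r := by
  unfold rho
  exact (withDensity_absolutelyContinuous _ _).ae_le (ae_restrict_mem measurableSet_Ioi)

theorem ae_PP (k : ℕ) : ∀ᵐ p ∂(PP k), ‖p.1‖ = 1 ∧ 0 < p.2 := by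
  unfold PP
  refine (Measure.quasiMeasurePreserving_fst.ae (ae_sg k)).and (Measure.quasiMeasurePreserving_snd.ae (ae_rho k))

theorem rk_lint {k : ℕ} {α : ℝ} : Measurable (fun z : (Eu (k+1) × ℝ) × (Eu (k+1) × ℝ) => rk α (z.1.2 • z.1.1) (z.2.2 • z.2.1)) := by
  unfold rk; fun_prop

theorem PP_set {k : ℕ} {a : Eu (k+1) → ℝ} (ha : Measurable a) (hh : ∀ r : ℝ, 0 < r → ∀ x, a (r • x) = a x) {f : Eu (k+1) → ℝ≥0∞} (hf : Measurable f) :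
    ∫⁻ x in {x | ‖x‖ < a x}, f x = ∫⁻ p, Ind p.2 (a p.1) * f (p.2 • p.1) ∂(PP k) := by
  have hms : MeasurableSet {x | ‖x‖ < a x} := measurableSet_lt measurable_norm ha
  rw [← lintegral_indicator hms, ← PP_lint (hf.indicator hms)]
  refine lintegral_congr_ae ?_
  filter_upwards [ae_PP k] with p hp
  simp only [Set.indicator, Set.mem_ofPred_eq, norm_smul, hp.1, Real.norm_of_nonneg hp.2.le, mul_one, hh _ hp.2, Ind]
  split_ifs <;> simp

theorem PP_ball {k : ℕ} (c : ℝ) {f : Eu (k+1) → ℝ≥0∞} (hf : Measurable f) :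
    ∫⁻ x in ball (0 : Eu (k+1)) c, f x = ∫⁻ p, Ind p.2 c * f (p.2 • p.1) ∂(PP k) := by
  rw [← PP_set (a := fun _ => c) measurable_const (fun _ _ _ => rfl) hf]
  congr 2; ext x; simp

theorem Psi_meas {n : ℕ} (α c : ℝ) : Measurable (Psi (n := n) α c) := (measurable_rk (n := n) α).lintegral_prod_right'

/-- Contribution of one ray. -/
theorem G_val {k : ℕ} (α : ℝ) {c : ℝ} (hc : 0 < c) {w : Eu (k+1)} (hw : ‖w‖ = 1) :
    sg k Set.univ * ∫⁻ r, Ind r c * Psi α c (r • w) ∂(rho k) = ENNReal.ofReal (c ^ (((k+1:ℕ):ℝ) + α)) * rieszEnergy α (unitBall (k+1)) := by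
  have h1 : c • unitBall (k+1) = ball 0 c := by
    rw [unitBall, _root_.smul_ball hc.ne', smul_zero, Real.norm_of_nonneg hc.le, mul_one]
  rw [← rieszEnergy_smul α _ hc, h1]
  have h2 : rieszEnergy α (ball (0 : Eu (k+1)) c) = ∫⁻ x in ball (0 : Eu (k+1)) c, Psi α c x := rfl
  have hI : Measurable (fun p : Eu (k+1) × ℝ => Ind p.2 c * Psi α c (p.2 • p.1)) :=
    (Ind_meas.comp (measurable_snd.prodMk measurable_const)).mul ((Psi_meas α c).comp (by fun_prop))
  rw [h2, PP_ball c (Psi_meas α c), PP, lintegral_prod _ hI.aemeasurable]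
  have h3 : ∫⁻ w', (∫⁻ r, Ind r c * Psi α c (r • w') ∂(rho k)) ∂(sg k) = ∫⁻ w', (∫⁻ r, Ind r c * Psi α c (r • w) ∂(rho k)) ∂(sg k) := by
    refine lintegral_congr_ae ?_
    filter_upwards [ae_sg k] with w' hw'
    refine lintegral_congr fun r => ?_
    rw [Psi_radial α c (x := r • w') (y := r • w) (by rw [norm_smul, norm_smul, hw, hw'])]
  rw [h3, lintegral_const, mul_comm]

/-- The remainder term. -/
def Lrem {k : ℕ} (α : ℝ) (a : Eu (k+1) → ℝ) : ℝ≥0∞ :=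
  ∫⁻ z, Lnd z.1.2 z.2.2 (a z.1.1) (a z.2.1) * rk α (z.1.2 • z.1.1) (z.2.2 • z.2.1) ∂((PP k).prod (PP k))

theorem riesz_star {k : ℕ} (α : ℝ) {a : Eu (k+1) → ℝ} (ha : Measurable a) (hh : ∀ r : ℝ, 0 < r → ∀ x, a (r • x) = a x) (hp : ∀ x, 0 < a x) :
    2 * ((∫⁻ w, ENNReal.ofReal (a w ^ (((k+1:ℕ):ℝ) + α)) ∂(sg k)) * rieszEnergy α (unitBall (k+1))) =
      sg k Set.univ * (2 * rieszEnergy α {x | ‖x‖ < a x} + Lrem α a) := by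
  set K : (Eu (k+1) × ℝ) × (Eu (k+1) × ℝ) → ℝ≥0∞ := fun z => rk α (z.1.2 • z.1.1) (z.2.2 • z.2.1) with hK
  have mK : Measurable K := rk_lint
  have mI {f g : (Eu (k+1) × ℝ) × (Eu (k+1) × ℝ) → ℝ} (hf : Measurable f) (hg : Measurable g) : Measurable (fun z => Ind (f z) (g z)) :=
    Ind_meas.comp (hf.prodMk hg)
  have m1 : Measurable (fun z : (Eu (k+1) × ℝ) × (Eu (k+1) × ℝ) => z.1.2) := by fun_prop
  have m2 : Measurable (fun z : (Eu (k+1) × ℝ) × (Eu (k+1) × ℝ) => z.2.2) := by fun_prop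
  have m3 : Measurable (fun z : (Eu (k+1) × ℝ) × (Eu (k+1) × ℝ) => a z.1.1) := ha.comp (by fun_prop)
  have m4 : Measurable (fun z : (Eu (k+1) × ℝ) × (Eu (k+1) × ℝ) => a z.2.1) := ha.comp (by fun_prop)
  set Q := (PP k).prod (PP k) with hQ
  have M1 : Measurable (fun z : (Eu (k+1) × ℝ) × (Eu (k+1) × ℝ) => Ind z.1.2 (a z.1.1) * Ind z.2.2 (a z.1.1) * K z) := ((mI m1 m3).mul (mI m2 m3)).mul mK
  have M3 : Measurable (fun z : (Eu (k+1) × ℝ) × (Eu (k+1) × ℝ) => Ind z.1.2 (a z.1.1) * Ind z.2.2 (a z.2.1) * K z) := ((mI m1 m3).mul (mI m2 m4)).mul mK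
  have M4 : Measurable (fun z : (Eu (k+1) × ℝ) × (Eu (k+1) × ℝ) => Ind z.1.2 (a z.2.1) * Ind z.2.2 (a z.1.1) * K z) := ((mI m1 m4).mul (mI m2 m3)).mul mK
  set T1 := ∫⁻ z, Ind z.1.2 (a z.1.1) * Ind z.2.2 (a z.1.1) * K z ∂Q with hT1
  have T2 : ∫⁻ z, Ind z.1.2 (a z.2.1) * Ind z.2.2 (a z.2.1) * K z ∂Q = T1 := by
    rw [hT1, ← (Measure.measurePreserving_swap (μ := PP k) (ν := PP k)).lintegral_comp M1]
    refine lintegral_congr fun z => ?_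
    simp only [Prod.swap, hK]
    rw [rk_comm, mul_comm (Ind z.1.2 _)]
  have T3 : ∫⁻ z, Ind z.1.2 (a z.1.1) * Ind z.2.2 (a z.2.1) * K z ∂Q = rieszEnergy α {x | ‖x‖ < a x} := by
    have hb : Measurable (fun x => ∫⁻ y in {x | ‖x‖ < a x}, rk α x y) := (measurable_rk (n := k+1) α).lintegral_prod_right'
    have : rieszEnergy α {x | ‖x‖ < a x} = ∫⁻ x in {x | ‖x‖ < a x}, ∫⁻ y in {x | ‖x‖ < a x}, rk α x y := rfl
    rw [this, PP_set ha hh hb, hQ, lintegral_prod _ M3.aemeasurable]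
    refine lintegral_congr fun p => ?_
    rw [PP_set ha hh (measurable_rk_left α _), ← lintegral_const_mul]
    · simp only [mul_assoc, hK]
    · exact (Ind_meas.comp (measurable_snd.prodMk (ha.comp measurable_fst))).mul ((measurable_rk_left α _).comp (by fun_prop))
  have hae : ∀ᵐ z ∂Q, (‖z.1.1‖ = 1 ∧ 0 < z.1.2) ∧ (‖z.2.1‖ = 1 ∧ 0 < z.2.2) :=
    (Measure.quasiMeasurePreserving_fst.ae (ae_PP k)).and (Measure.quasiMeasurePreserving_snd.ae (ae_PP k))
  have T4 : ∫⁻ z, Ind z.1.2 (a z.2.1) * Ind z.2.2 (a z.1.1) * K z ∂Q = rieszEnergy α {x | ‖x‖ < a x} := by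
    rw [← T3, hQ, PP, ← (exch (sg k) (rho k)).lintegral_comp M3]
    refine lintegral_congr_ae ?_
    filter_upwards [hae] with z hz
    simp only [hK]
    rw [rk_sph α hz.1.1 hz.2.1, mul_comm (Ind z.1.2 _)]
  have S1 : sg k Set.univ * T1 = (∫⁻ w, ENNReal.ofReal (a w ^ (((k+1:ℕ):ℝ) + α)) ∂(sg k)) * rieszEnergy α (unitBall (k+1)) := by
    have hm' : Measurable (fun p : Eu (k+1) × ℝ => ∫⁻ q, Ind p.2 (a p.1) * Ind q.2 (a p.1) * K (p, q) ∂(PP k)) := M1.lintegral_prod_right'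
    have hT : T1 = ∫⁻ w, (∫⁻ r, (∫⁻ q, Ind r (a w) * Ind q.2 (a w) * K ((w, r), q) ∂(PP k)) ∂(rho k)) ∂(sg k) := by
      rw [hT1, hQ, lintegral_prod _ M1.aemeasurable]
      exact lintegral_prod (μ := sg k) (ν := rho k) _ hm'.aemeasurable
    rw [hT, ← lintegral_const_mul _ hm'.lintegral_prod_right', ← lintegral_mul_const _ (ha.pow_const _).ennreal_ofReal]
    refine lintegral_congr_ae ?_
    filter_upwards [ae_sg k] with w hw
    rw [← G_val α (hp w) hw]
    congr 1
    refine lintegral_congr fun r => ?_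
    rw [Psi, PP_ball _ (measurable_rk_left α _), ← lintegral_const_mul]
    · simp only [mul_assoc, hK]
    · exact (Ind_meas.comp (measurable_snd.prodMk measurable_const)).mul ((measurable_rk_left α _).comp (by fun_prop))
  have key : T1 + T1 = rieszEnergy α {x | ‖x‖ < a x} + rieszEnergy α {x | ‖x‖ < a x} + Lrem α a := by
    have M34 : Measurable (fun z : (Eu (k+1) × ℝ) × (Eu (k+1) × ℝ) => Ind z.1.2 (a z.1.1) * Ind z.2.2 (a z.2.1) * K z + Ind z.1.2 (a z.2.1) * Ind z.2.2 (a z.1.1) * K z) := M3.add M4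
    nth_rewrite 2 [← T2]
    nth_rewrite 2 [← T4]
    rw [← T3, hT1, ← lintegral_add_left M1, ← lintegral_add_left M3, Lrem, ← lintegral_add_left M34]
    refine lintegral_congr fun z => ?_
    rw [← add_mul, ← add_mul, ← add_mul, quad_id]
  rw [two_mul (rieszEnergy _ _), ← key, ← two_mul, ← S1]
  ring

theorem Lnd_meas {X : Type*} [MeasurableSpace X] {r s a b : X → ℝ} (hr : Measurable r) (hs : Measurable s) (ha : Measurable a) (hb : Measurable b) :
    Measurable (fun z => Lnd (r z) (s z) (a z) (b z)) := by
  unfold Lnd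
  refine Measurable.ite ?_ measurable_const measurable_const
  exact (measurableSet_le (ha.min hb) hr).inter ((measurableSet_lt hr (ha.max hb)).inter ((measurableSet_le (ha.min hb) hs).inter (measurableSet_lt hs (ha.max hb))))

theorem rho_Ico {k : ℕ} {m M : ℝ} (hM : M ≤ 2) : rho k (Set.Ico m M) ≤ ENNReal.ofReal (2^k * (M - m)) := by
  unfold rho
  rw [withDensity_apply _ measurableSet_Ico, ENNReal.ofReal_mul (by positivity), ← Real.volume_Ico]
  calc _ ≤ ∫⁻ r in Set.Ico m M, ENNReal.ofReal (2^k) ∂(volume.restrict (Set.Ioi 0)) := by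
        rw [Measure.restrict_restrict measurableSet_Ico]
        refine setLIntegral_mono measurable_const fun r hr => ENNReal.ofReal_le_ofReal ?_
        exact pow_le_pow_left₀ (le_of_lt hr.2) (hr.1.2.le.trans hM) k
    _ = ENNReal.ofReal (2^k) * (volume.restrict (Set.Ioi 0)) (Set.Ico m M) := setLIntegral_const _ _
    _ ≤ _ := by gcongr; exact Measure.restrict_le_self

theorem sph_dist {k : ℕ} {w w' : Eu (k+1)} (h : ‖w‖ = 1) (h' : ‖w'‖ = 1) (r s : ℝ) : ‖r • w - s • w'‖^2 = (r-s)^2 + r*s*‖w-w'‖^2 := by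
  rw [norm_sub_sq_real, norm_sub_sq_real, norm_smul, norm_smul, h, h', inner_smul_left, inner_smul_right, Real.norm_eq_abs, Real.norm_eq_abs, mul_one, mul_one, sq_abs, sq_abs]
  simp; ring

theorem Lrem_pt {k : ℕ} {α : ℝ} (hα : α < (k+1:ℕ)) {a : Eu (k+1) → ℝ} (hb : ∀ x, 1/2 ≤ a x ∧ a x ≤ 2) {w w' : Eu (k+1)} (hw : ‖w‖ = 1) (hw' : ‖w'‖ = 1) :
    ∫⁻ r, (∫⁻ s, Lnd r s (a w) (a w') * rk α (r • w) (s • w') ∂(rho k)) ∂(rho k) ≤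
      ENNReal.ofReal ((1/2) ^ (α - ((k+1:ℕ):ℝ)) * 4^k) * ENNReal.ofReal (‖w - w'‖ ^ (α - ((k+1:ℕ):ℝ)) * (a w - a w')^2) := by
  by_cases hww : w = w'
  · subst hww
    have : ∀ r s, Lnd r s (a w) (a w) = 0 := fun r s => by
      unfold Lnd; rw [min_self, max_self, if_neg]; intro h; linarith [h.1, h.2.1]
    simp [this]
  have hd : 0 < ‖w - w'‖ := norm_pos_iff.2 (sub_ne_zero.2 hww)
  set m := min (a w) (a w') with hm0
  set M := max (a w) (a w') with hM0
  have hm1 : 1/2 ≤ m := le_min (hb w).1 (hb w').1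
  have hM1 : M ≤ 2 := max_le (hb w).2 (hb w').2
  have hMm : M - m = |a w - a w'| := by rw [hM0, hm0, max_sub_min_eq_abs]; exact abs_sub_comm _ _
  set c := ENNReal.ofReal ((1/2 * ‖w-w'‖) ^ (α - ((k+1:ℕ):ℝ))) with hc
  have hle (r s : ℝ) : Lnd r s (a w) (a w') * rk α (r • w) (s • w') ≤ (Set.Ico m M).indicator (fun _ => c) r * (Set.Ico m M).indicator (fun _ => 1) s := by
    unfold Lnd
    rw [← hm0, ← hM0]
    split_ifs with h
    · rw [Set.indicator_of_mem (show r ∈ Set.Ico m M from ⟨h.1, h.2.1⟩), Set.indicator_of_mem (show s ∈ Set.Ico m M from ⟨h.2.2.1, h.2.2.2⟩), one_mul, mul_one]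
      refine ENNReal.ofReal_le_ofReal ?_
      refine Real.rpow_le_rpow_of_nonpos (by positivity) ?_ (by linarith)
      rw [← sq_le_sq₀ (by positivity) (norm_nonneg _), sph_dist hw hw']
      have hr : 1/2 ≤ r := hm1.trans h.1
      have hs : 1/2 ≤ s := hm1.trans h.2.2.1
      have hrs : 1/4 ≤ r * s := by nlinarith
      nlinarith [sq_nonneg (r-s), mul_le_mul_of_nonneg_right hrs (sq_nonneg ‖w-w'‖)]
    · simp
  calc _ ≤ ∫⁻ r, (∫⁻ s, (Set.Ico m M).indicator (fun _ => c) r * (Set.Ico m M).indicator (fun _ => 1) s ∂(rho k)) ∂(rho k) :=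
        lintegral_mono fun r => lintegral_mono fun s => hle r s
    _ = c * rho k (Set.Ico m M) * rho k (Set.Ico m M) := by
        have : ∀ r, ∫⁻ s, (Set.Ico m M).indicator (fun _ => c) r * (Set.Ico m M).indicator (fun _ => 1) s ∂(rho k) =
            (Set.Ico m M).indicator (fun _ => c) r * rho k (Set.Ico m M) := fun r => by
          rw [lintegral_const_mul _ (measurable_const.indicator measurableSet_Ico), lintegral_indicator measurableSet_Ico]; simp
        simp only [this]
        rw [lintegral_mul_const _ (measurable_const.indicator measurableSet_Ico), lintegral_indicator measurableSet_Ico, setLIntegral_const]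
    _ ≤ c * ENNReal.ofReal (2^k * (M - m)) * ENNReal.ofReal (2^k * (M - m)) := by
        gcongr <;> exact rho_Ico hM1
    _ = _ := by
        rw [hc, ← ENNReal.ofReal_mul (by positivity), ← ENNReal.ofReal_mul (by rw [hMm]; positivity), ← ENNReal.ofReal_mul (by positivity), hMm,
          Real.mul_rpow (by positivity) (by positivity)]
        congr 1
        rw [← sq_abs (a w - a w'), show (4:ℝ) = 2 * 2 by norm_num, mul_pow]; ring

theorem Lrem_le {k : ℕ} {α : ℝ} (hα : α < (k+1:ℕ)) {a : Eu (k+1) → ℝ} (ha : Measurable a) (hb : ∀ x, 1/2 ≤ a x ∧ a x ≤ 2) :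
    Lrem α a ≤ ENNReal.ofReal ((1/2) ^ (α - ((k+1:ℕ):ℝ)) * 4^k) * ∫⁻ w : Eu (k+1), (∫⁻ w' : Eu (k+1), ENNReal.ofReal (‖w - w'‖ ^ (α - ((k+1:ℕ):ℝ)) * (a w - a w')^2) ∂(sg k)) ∂(sg k) := by
  have hm : Measurable (fun z : (Eu (k+1) × ℝ) × (Eu (k+1) × ℝ) => Lnd z.1.2 z.2.2 (a z.1.1) (a z.2.1) * rk α (z.1.2 • z.1.1) (z.2.2 • z.2.1)) :=
    (Lnd_meas (by fun_prop) (by fun_prop) (ha.comp (by fun_prop)) (ha.comp (by fun_prop))).mul rk_lint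
  have hm2 : Measurable (fun p : Eu (k+1) × Eu (k+1) => ENNReal.ofReal (‖p.1 - p.2‖ ^ (α - ((k+1:ℕ):ℝ)) * (a p.1 - a p.2)^2)) :=
    (((measurable_fst.sub measurable_snd).norm.pow_const _).mul (((ha.comp measurable_fst).sub (ha.comp measurable_snd)).pow_const 2)).ennreal_ofReal
  have hm4 : Measurable (fun w : Eu (k+1) => ∫⁻ w' : Eu (k+1), ENNReal.ofReal (‖w - w'‖ ^ (α - ((k+1:ℕ):ℝ)) * (a w - a w')^2) ∂(sg k)) := hm2.lintegral_prod_right'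
  have e1 : Lrem α a = ∫⁻ w, (∫⁻ w', (∫⁻ r, (∫⁻ s, Lnd r s (a w) (a w') * rk α (r • w) (s • w') ∂(rho k)) ∂(rho k)) ∂(sg k)) ∂(sg k) :=
    four (sg k) (rho k) hm
  set c := ENNReal.ofReal ((1/2) ^ (α - ((k+1:ℕ):ℝ)) * 4^k) with hc
  have e2 : ∀ᵐ w ∂(sg k), (∫⁻ w', (∫⁻ r, (∫⁻ s, Lnd r s (a w) (a w') * rk α (r • w) (s • w') ∂(rho k)) ∂(rho k)) ∂(sg k)) ≤
      c * ∫⁻ w' : Eu (k+1), ENNReal.ofReal (‖w - w'‖ ^ (α - ((k+1:ℕ):ℝ)) * (a w - a w')^2) ∂(sg k) := by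
    refine (ae_sg k).mono fun w hw => ?_
    have hm3 : Measurable (fun w' : Eu (k+1) => ENNReal.ofReal (‖w - w'‖ ^ (α - ((k+1:ℕ):ℝ)) * (a w - a w')^2)) := 
      (((measurable_const.sub measurable_id).norm.pow_const _).mul ((measurable_const.sub ha).pow_const 2)).ennreal_ofReal
    rw [← lintegral_const_mul _ hm3]
    exact lintegral_mono_ae ((ae_sg k).mono fun w' hw' => Lrem_pt hα hb hw hw')
  rw [e1, ← lintegral_const_mul _ hm4]
  exact lintegral_mono_ae e2

theorem ph_two (p : ℝ) : ph (2*p) ≤ 4 * ph p := by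
  unfold ph
  have h2 := Real.sq_sqrt (show 0 ≤ 1+p^2 by positivity)
  have h1 : 1 ≤ Real.sqrt (1+p^2) := by rw [Real.one_le_sqrt]; nlinarith
  have : Real.sqrt (1+(2*p)^2) ≤ 4 * Real.sqrt (1+p^2) - 3 := by
    rw [Real.sqrt_le_left (by linarith)]
    nlinarith [sq_nonneg (Real.sqrt (1+p^2) - 1)]
  linarith

theorem ph_sq {p : ℝ} (hp : 0 ≤ p) : p^2 ≤ ph p * (p + 2) := by
  unfold ph
  have h2 := Real.sq_sqrt (show 0 ≤ 1+p^2 by positivity)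
  have h1 : 1 ≤ Real.sqrt (1+p^2) := by rw [Real.one_le_sqrt]; nlinarith
  have h3 : Real.sqrt (1+p^2) ≤ 1 + p := by rw [Real.sqrt_le_left (by linarith)]; nlinarith
  nlinarith

/-- Near kernel. -/
def Nk {k : ℕ} (α : ℝ) (v : Eu (k+1) → ℝ) (x y : Eu (k+1)) : ℝ≥0∞ :=
  if ‖x - y‖ < 1/2 then ENNReal.ofReal (‖x - y‖ ^ (α - ((k+1:ℕ):ℝ) - 1) * (v x - v y)^2) else 0

theorem Nk_meas {k : ℕ} (α : ℝ) {v : Eu (k+1) → ℝ} (hv : Measurable v) : Measurable (fun p : Eu (k+1) × Eu (k+1) => Nk α v p.1 p.2) := by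
  unfold Nk
  have h : Measurable (fun p : Eu (k+1) × Eu (k+1) => ‖p.1 - p.2‖) := by fun_prop
  refine Measurable.ite (measurableSet_lt h measurable_const) ?_ measurable_const
  exact ((h.pow_const _).mul (((hv.comp measurable_fst).sub (hv.comp measurable_snd)).pow_const 2)).ennreal_ofReal

/-- Truncated gradient density. -/
def Hk {k : ℕ} (v : Eu (k+1) → ℝ) (y : Eu (k+1)) : ℝ≥0∞ :=
  if 1/2 ≤ ‖y‖ ∧ ‖y‖ ≤ 5/2 then ENNReal.ofReal (ph ‖fderiv ℝ v y‖) else 0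

theorem Hk_meas {k : ℕ} (v : Eu (k+1) → ℝ) : Measurable (Hk v) := by
  unfold Hk
  refine Measurable.ite ?_ (ph_cont.measurable.comp (measurable_fderiv ℝ v).norm).ennreal_ofReal measurable_const
  exact (measurableSet_le measurable_const measurable_norm).inter (measurableSet_le measurable_norm measurable_const)

theorem rho_fin (k : ℕ) : rho k (Set.Icc (1/2) (5/2)) ≠ ⊤ := by
  unfold rho
  rw [withDensity_apply _ measurableSet_Icc]
  refine ne_top_of_le_ne_top (b := ENNReal.ofReal ((5/2)^k) * (volume.restrict (Set.Ioi (0:ℝ))) (Set.Icc (1/2:ℝ) (5/2))) ?_ ?_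
  · refine ENNReal.mul_ne_top ENNReal.ofReal_ne_top (ne_top_of_le_ne_top ?_ (Measure.restrict_le_self _))
    simp
  · rw [← setLIntegral_const]
    refine setLIntegral_mono measurable_const fun r hr => ENNReal.ofReal_le_ofReal ?_
    exact pow_le_pow_left₀ (by linarith [hr.1]) hr.2 k

namespace VData
variable {k : ℕ} {v : Eu (k+1) → ℝ} {M : ℝ}

theorem Hk_int (D : VData k v M) : ∫⁻ y, Hk v y ≤ 4 * rho k (Set.Icc (1/2) (5/2)) * ∫⁻ w, ENNReal.ofReal (ph (gr v w)) ∂(sg k) := by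
  have hm : Measurable (fun w => ENNReal.ofReal (ph (gr v w))) := (ph_cont.measurable.comp D.gr_meas).ennreal_ofReal
  rw [polar_lint (Hk_meas v), ← lintegral_const_mul _ hm]
  refine lintegral_mono_ae ?_
  filter_upwards [ae_sg k] with w hw
  calc _ ≤ ∫⁻ r, (Set.Icc (1/2:ℝ) (5/2)).indicator (fun _ => 4 * ENNReal.ofReal (ph (gr v w))) r ∂(rho k) := by
        refine lintegral_mono_ae ?_
        filter_upwards [ae_rho k] with r hr
        unfold Hk
        rw [norm_smul, hw, mul_one, Real.norm_of_nonneg hr.le]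
        split_ifs with h
        · rw [Set.indicator_of_mem (show r ∈ Set.Icc (1/2:ℝ) (5/2) from h), D.fd_smul hr, show (4:ℝ≥0∞) = ENNReal.ofReal 4 by norm_num, ← ENNReal.ofReal_mul (by norm_num)]
          refine ENNReal.ofReal_le_ofReal ((ph_mono ?_).trans (ph_two _))
          have hr2 : r⁻¹ ≤ 2 := by rw [inv_le_comm₀ hr (by norm_num)]; linarith [h.1]
          rw [gr, hw, one_mul, norm_smul, norm_inv, Real.norm_of_nonneg hr.le]
          gcongr
        · exact zero_le
    _ = _ := by
        rw [lintegral_indicator measurableSet_Icc, setLIntegral_const]; ring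

theorem Nk_le (D : VData k v M) (hM : M ≤ 1/2) (α : ℝ) {x z : Eu (k+1)} (hx1 : 1 ≤ ‖x‖) (hx2 : ‖x‖ ≤ 2) (hz : ‖z‖ < 1/2) :
    Nk α v x (x + z) ≤ ENNReal.ofReal (3 * ‖z‖ ^ (α - ((k+1:ℕ):ℝ))) * ∫⁻ τ in Set.Ioc (0:ℝ) 1, Hk v (x + τ • z) := by
  unfold Nk
  have e1 : ‖x - (x+z)‖ = ‖z‖ := by rw [← norm_neg]; congr 1; abel
  rw [e1, if_pos hz]
  by_cases hz0 : z = 0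
  · subst hz0; simp
  have hzp : 0 < ‖z‖ := norm_pos_iff.2 hz0
  have hb : ∀ τ ∈ Set.Icc (0:ℝ) 1, 1/2 ≤ ‖x + τ • z‖ ∧ ‖x + τ • z‖ ≤ 5/2 := by
    intro τ hτ
    have h1 : ‖τ • z‖ ≤ 1/2 := by
      rw [norm_smul, Real.norm_of_nonneg hτ.1]; nlinarith [hτ.2, norm_nonneg z]
    have h2 := norm_sub_norm_le x (-(τ • z))
    rw [norm_neg, sub_neg_eq_add] at h2
    exact ⟨by linarith, (norm_add_le _ _).trans (by linarith)⟩
  have hne : ∀ τ ∈ Set.Icc (0:ℝ) 1, x + τ • z ≠ 0 := fun τ hτ h => by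
    have := (hb τ hτ).1; rw [h, norm_zero] at this; linarith
  have hI : Set.uIcc (0:ℝ) 1 = Set.Icc 0 1 := Set.uIcc_of_le zero_le_one
  have hfc : ContinuousOn (fun τ : ℝ => fderiv ℝ v (x + τ • z)) (Set.uIcc 0 1) := by
    rw [hI]
    intro τ hτ
    refine ContinuousAt.continuousWithinAt ?_
    exact ContinuousAt.comp (f := fun τ : ℝ => x + τ • z) (D.fd_contAt (hne τ hτ)) (by fun_prop)
  have hgc : ContinuousOn (fun τ : ℝ => fderiv ℝ v (x + τ • z) z / ‖z‖) (Set.uIcc 0 1) :=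
    (hfc.clm_apply continuousOn_const).div_const _
  have hftc : ∫ τ in (0:ℝ)..1, fderiv ℝ v (x + τ • z) z = v (x + z) - v x := by
    rw [intervalIntegral.integral_eq_sub_of_hasDerivAt (f := fun τ : ℝ => v (x + τ • z)) _ (hfc.clm_apply continuousOn_const).intervalIntegrable]
    · simp
    · intro τ hτ
      rw [hI] at hτ
      have hd : HasFDerivAt v (fderiv ℝ v (x + τ • z)) (x + τ • z) := ((D.cd _ (hne τ hτ)).differentiableAt one_ne_zero).hasFDerivAt
      have h2 : HasDerivAt (fun t : ℝ => x + t • z) z τ := by simpa using ((hasDerivAt_id τ).smul_const z).const_add x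
      exact hd.comp_hasDerivAt τ h2
  have hj := ph_jensen (t := 1) one_pos hgc
  rw [intervalIntegral.integral_div, hftc, div_one, div_one] at hj
  have hpc : ContinuousOn (fun τ : ℝ => ph ‖fderiv ℝ v (x + τ • z)‖) (Set.uIcc 0 1) := ph_cont.comp_continuousOn hfc.norm
  have hj2 : ∫ τ in (0:ℝ)..1, ph (fderiv ℝ v (x + τ • z) z / ‖z‖) ≤ ∫ τ in (0:ℝ)..1, ph ‖fderiv ℝ v (x + τ • z)‖ := by
    refine intervalIntegral.integral_mono_on zero_le_one (ph_cont.comp_continuousOn hgc).intervalIntegrable hpc.intervalIntegrable fun τ _ => ph_mono ?_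
    rw [sq_le_sq, abs_div, abs_norm, abs_norm, div_le_iff₀ hzp]
    exact (fderiv ℝ v (x + τ • z)).le_opNorm z
  have hL : ∫⁻ τ in Set.Ioc (0:ℝ) 1, Hk v (x + τ • z) = ENNReal.ofReal (∫ τ in (0:ℝ)..1, ph ‖fderiv ℝ v (x + τ • z)‖) := by
    rw [intervalIntegral.integral_of_le zero_le_one, ofReal_integral_eq_lintegral_ofReal
      ((intervalIntegrable_iff_integrableOn_Ioc_of_le zero_le_one).1 hpc.intervalIntegrable) (Eventually.of_forall fun _ => ph_nonneg _)]
    refine setLIntegral_congr_fun measurableSet_Ioc fun τ hτ => ?_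
    simp only [Hk]
    rw [if_pos (hb τ ⟨hτ.1.le, hτ.2⟩)]
  rw [hL, ← ENNReal.ofReal_mul (by positivity)]
  refine ENNReal.ofReal_le_ofReal ?_
  set J := ∫ τ in (0:ℝ)..1, ph ‖fderiv ℝ v (x + τ • z)‖
  set Δ := v (x+z) - v x with hΔ
  have hΔ1 : |Δ| ≤ 1 := (abs_sub _ _).trans (by linarith [D.bdd (x+z), D.bdd x])
  have hJ : ph (|Δ| / ‖z‖) ≤ J := by
    refine (ph_mono ?_).trans (hj.trans hj2)
    rw [div_pow, div_pow, sq_abs]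
  have h4 := ph_sq (p := |Δ| / ‖z‖) (by positivity)
  have e2 : ‖z‖ ^ (α - ((k+1:ℕ):ℝ) - 1) * (v x - v (x+z))^2 = ‖z‖ ^ (α - ((k+1:ℕ):ℝ)) * (‖z‖ * (|Δ| / ‖z‖)^2) := by
    rw [Real.rpow_sub_one hzp.ne', div_pow, sq_abs, hΔ]; field_simp; ring
  rw [e2, mul_comm 3, mul_assoc]
  refine mul_le_mul_of_nonneg_left ?_ (by positivity)
  have h5 : ‖z‖ * (|Δ| / ‖z‖ + 2) ≤ 3 := by
    have : ‖z‖ * (|Δ| / ‖z‖ + 2) = |Δ| + 2 * ‖z‖ := by field_simp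
    rw [this]; linarith
  calc ‖z‖ * (|Δ| / ‖z‖)^2 ≤ ‖z‖ * (ph (|Δ| / ‖z‖) * (|Δ| / ‖z‖ + 2)) := by gcongr
    _ = (‖z‖ * (|Δ| / ‖z‖ + 2)) * ph (|Δ| / ‖z‖) := by ring
    _ ≤ 3 * J := by gcongr; exact ph_nonneg _

theorem Nk_int (D : VData k v M) (hM : M ≤ 1/2) (α : ℝ) :
    ∫⁻ x in {x : Eu (k+1) | 1 ≤ ‖x‖ ∧ ‖x‖ ≤ 2}, (∫⁻ y, Nk α v x y) ≤
      (3 * ∫⁻ z in ball (0 : Eu (k+1)) (1/2), ENNReal.ofReal (‖z‖ ^ (α - ((k+1:ℕ):ℝ)))) * ∫⁻ y, Hk v y := by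
  set c : Eu (k+1) → ℝ≥0∞ := (ball (0 : Eu (k+1)) (1/2)).indicator fun z => ENNReal.ofReal (3 * ‖z‖ ^ (α - ((k+1:ℕ):ℝ))) with hc
  have hcm : Measurable c := by
    refine Measurable.indicator ?_ measurableSet_ball
    exact ((measurable_norm.pow_const _).const_mul 3).ennreal_ofReal
  have hH := Hk_meas v
  have hms : MeasurableSet {x : Eu (k+1) | 1 ≤ ‖x‖ ∧ ‖x‖ ≤ 2} :=
    (measurableSet_le measurable_const measurable_norm).inter (measurableSet_le measurable_norm measurable_const)
  have m3 : Measurable (fun q : (Eu (k+1) × Eu (k+1)) × ℝ => Hk v (q.1.1 + q.2 • q.1.2)) := hH.comp (by fun_prop)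
  have m2 : Measurable (fun q : Eu (k+1) × Eu (k+1) => ∫⁻ τ in Set.Ioc (0:ℝ) 1, Hk v (q.1 + τ • q.2)) := m3.lintegral_prod_right'
  have m4 : Measurable (fun q : Eu (k+1) × Eu (k+1) => c q.2 * ∫⁻ τ in Set.Ioc (0:ℝ) 1, Hk v (q.1 + τ • q.2)) := (hcm.comp measurable_snd).mul m2
  calc _ ≤ ∫⁻ x in {x : Eu (k+1) | 1 ≤ ‖x‖ ∧ ‖x‖ ≤ 2}, (∫⁻ z, c z * ∫⁻ τ in Set.Ioc (0:ℝ) 1, Hk v (x + τ • z)) := by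
        refine setLIntegral_mono' hms fun x hx => ?_
        rw [← lintegral_add_left_eq_self (fun y => Nk α v x y) x]
        refine lintegral_mono fun z => ?_
        by_cases hz : z ∈ ball (0 : Eu (k+1)) (1/2)
        · simp only [hc, Set.indicator_of_mem hz]
          exact D.Nk_le hM α hx.1 hx.2 (by simpa using hz)
        · simp only [hc, Set.indicator_of_notMem hz, zero_mul, nonpos_iff_eq_zero]
          unfold Nk
          rw [if_neg]
          simpa using hz
    _ ≤ ∫⁻ x, (∫⁻ z, c z * ∫⁻ τ in Set.Ioc (0:ℝ) 1, Hk v (x + τ • z)) := setLIntegral_le_lintegral _ _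
    _ = ∫⁻ z, (∫⁻ x, c z * ∫⁻ τ in Set.Ioc (0:ℝ) 1, Hk v (x + τ • z)) := lintegral_lintegral_swap m4.aemeasurable
    _ = ∫⁻ z, c z * ∫⁻ y, Hk v y := by
        refine lintegral_congr fun z => ?_
        have m5 : Measurable (fun q : Eu (k+1) × ℝ => Hk v (q.1 + q.2 • z)) := hH.comp (by fun_prop)
        have m6 : Measurable (fun x => ∫⁻ τ in Set.Ioc (0:ℝ) 1, Hk v (x + τ • z)) := m5.lintegral_prod_right'
        rw [lintegral_const_mul _ m6, lintegral_lintegral_swap m5.aemeasurable]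
        simp only [lintegral_add_right_eq_self (Hk v)]
        simp
    _ = _ := by
        rw [lintegral_mul_const _ hcm, hc, lintegral_indicator measurableSet_ball]
        simp only [ENNReal.ofReal_mul (show (0:ℝ) ≤ 3 by norm_num)]
        rw [lintegral_const_mul]
        · simp
        · exact (measurable_norm.pow_const _).ennreal_ofReal

theorem rho_ge {a b : ℝ} (ha : 1 ≤ a) : ENNReal.ofReal (b - a) ≤ rho k (Set.Icc a b) := by
  unfold rho
  rw [withDensity_apply _ measurableSet_Icc, Measure.restrict_restrict measurableSet_Icc, ← Real.volume_Icc, ← setLIntegral_one]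
  have : Set.Icc a b ∩ Set.Ioi 0 = Set.Icc a b := Set.inter_eq_left.2 fun r hr => lt_of_lt_of_le one_pos (ha.trans hr.1)
  rw [this]
  refine setLIntegral_mono' measurableSet_Icc fun r hr => ?_
  rw [← ENNReal.ofReal_one]
  exact ENNReal.ofReal_le_ofReal (one_le_pow₀ (ha.trans hr.1))

/-- annulus weighted near kernel. -/
def Gk (α : ℝ) (v : Eu (k+1) → ℝ) (x y : Eu (k+1)) : ℝ≥0∞ := {x : Eu (k+1) | 1 ≤ ‖x‖ ∧ ‖x‖ ≤ 2}.indicator (fun x => Nk α v x y) x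

theorem near_pt (D : VData k v M) {α : ℝ} (hα : α < (k+1:ℕ)) {w w' : Eu (k+1)} (hw : ‖w‖ = 1) (hw' : ‖w'‖ = 1) (hd : ‖w - w'‖ < 1/8) :
    ENNReal.ofReal (‖w - w'‖ ^ (α - ((k+1:ℕ):ℝ)) * (v w - v w')^2) ≤
      ENNReal.ofReal (3 ^ (((k+1:ℕ):ℝ) + 1 - α)) * ∫⁻ r, (∫⁻ s, Gk α v (r • w) (s • w') ∂(rho k)) ∂(rho k) := by
  by_cases hww : w = w'
  · subst hww; simp
  have hd0 : 0 < ‖w - w'‖ := norm_pos_iff.2 (sub_ne_zero.2 hww)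
  set d := ‖w - w'‖ with hdd
  set e := α - ((k+1:ℕ):ℝ) with he
  have he0 : e < 0 := by rw [he]; linarith
  set c := ENNReal.ofReal ((3*d) ^ (e - 1) * (v w - v w')^2) with hc
  have hpt : ∀ r ∈ Set.Icc (1:ℝ) 2, ∀ s ∈ Set.Icc r (r+d), c ≤ Gk α v (r • w) (s • w') := by
    intro r hr s hs
    have hr0 : 0 < r := by linarith [hr.1]
    have hs0 : 0 < s := by linarith [hs.1]
    have hn : ‖r • w‖ = r := by rw [norm_smul, hw, mul_one, Real.norm_of_nonneg hr0.le]
    have hq := sph_dist hw hw' r s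
    rw [← hdd] at hq
    have h1 : ‖r • w - s • w'‖ ≤ 3 * d := by
      rw [← sq_le_sq₀ (norm_nonneg _) (by positivity), hq]
      have a1 : (r-s)^2 ≤ d^2 := by nlinarith [hs.1, hs.2]
      have a2 : r * s ≤ 5 := by nlinarith [hs.2, hr.2]
      nlinarith [mul_le_mul_of_nonneg_right a2 (sq_nonneg d)]
    have h0 : 0 < ‖r • w - s • w'‖ := by
      have : 0 < ‖r • w - s • w'‖^2 := by rw [hq]; positivity
      exact lt_of_le_of_ne (norm_nonneg _) (fun h => by rw [← h] at this; simp at this)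
    unfold Gk Nk
    rw [Set.indicator_of_mem (show r • w ∈ {x : Eu (k+1) | 1 ≤ ‖x‖ ∧ ‖x‖ ≤ 2} from by simp only [Set.mem_ofPred_eq, hn]; exact hr), if_pos (by linarith), D.hom r hr0, D.hom s hs0]
    refine ENNReal.ofReal_le_ofReal ?_
    gcongr ?_ * _
    exact Real.rpow_le_rpow_of_nonpos h0 h1 (by linarith)
  have h2 : c * ENNReal.ofReal d ≤ ∫⁻ r, (∫⁻ s, Gk α v (r • w) (s • w') ∂(rho k)) ∂(rho k) := by
    have h3 : ∀ r ∈ Set.Icc (1:ℝ) 2, c * ENNReal.ofReal d ≤ ∫⁻ s, Gk α v (r • w) (s • w') ∂(rho k) := by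
      intro r hr
      calc c * ENNReal.ofReal d ≤ c * rho k (Set.Icc r (r+d)) := by
            gcongr; have := rho_ge (k := k) (a := r) (b := r + d) hr.1; rwa [add_sub_cancel_left] at this
        _ = ∫⁻ s in Set.Icc r (r+d), c ∂(rho k) := (setLIntegral_const _ _).symm
        _ ≤ ∫⁻ s in Set.Icc r (r+d), Gk α v (r • w) (s • w') ∂(rho k) := setLIntegral_mono' measurableSet_Icc (hpt r hr)
        _ ≤ _ := setLIntegral_le_lintegral _ _
    calc c * ENNReal.ofReal d ≤ c * ENNReal.ofReal d * rho k (Set.Icc 1 2) := by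
          refine le_mul_of_one_le_right zero_le ?_
          have := rho_ge (k := k) (a := 1) (b := 2) le_rfl; norm_num at this; exact this
      _ = ∫⁻ r in Set.Icc (1:ℝ) 2, c * ENNReal.ofReal d ∂(rho k) := (setLIntegral_const _ _).symm
      _ ≤ ∫⁻ r in Set.Icc (1:ℝ) 2, (∫⁻ s, Gk α v (r • w) (s • w') ∂(rho k)) ∂(rho k) := setLIntegral_mono' measurableSet_Icc h3
      _ ≤ _ := setLIntegral_le_lintegral _ _
  refine le_trans (le_of_eq ?_) (mul_le_mul_right h2 _)
  rw [hc, ← ENNReal.ofReal_mul (by positivity), ← ENNReal.ofReal_mul (by positivity)]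
  congr 1
  have e4 : ((k+1:ℕ):ℝ) + 1 - α = -(e-1) := by rw [he]; ring
  rw [e4, Real.mul_rpow (by norm_num) hd0.le, Real.rpow_neg (by norm_num), Real.rpow_sub_one hd0.ne']
  have : (0:ℝ) < 3 ^ (e-1) := by positivity
  field_simp

theorem Gk_int (D : VData k v M) (α : ℝ) : ∫⁻ w, (∫⁻ w', (∫⁻ r, (∫⁻ s, Gk α v (r • w) (s • w') ∂(rho k)) ∂(rho k)) ∂(sg k)) ∂(sg k) =
    ∫⁻ x in {x : Eu (k+1) | 1 ≤ ‖x‖ ∧ ‖x‖ ≤ 2}, (∫⁻ y, Nk α v x y) := by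
  have hms : MeasurableSet {x : Eu (k+1) | 1 ≤ ‖x‖ ∧ ‖x‖ ≤ 2} :=
    (measurableSet_le measurable_const measurable_norm).inter (measurableSet_le measurable_norm measurable_const)
  have hN := Nk_meas α D.meas
  have hG : Measurable (fun p : Eu (k+1) × Eu (k+1) => Gk α v p.1 p.2) := by
    have : (fun p : Eu (k+1) × Eu (k+1) => Gk α v p.1 p.2) = {p : Eu (k+1) × Eu (k+1) | 1 ≤ ‖p.1‖ ∧ ‖p.1‖ ≤ 2}.indicator (fun p => Nk α v p.1 p.2) := by
      funext p; simp only [Gk, Set.indicator, Set.mem_ofPred_eq]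
    rw [this]
    exact hN.indicator (hms.preimage measurable_fst)
  have hG1 : Measurable (fun z : (Eu (k+1) × ℝ) × (Eu (k+1) × ℝ) => Gk α v (z.1.2 • z.1.1) (z.2.2 • z.2.1)) :=
    hG.comp (g := fun p : Eu (k+1) × Eu (k+1) => Gk α v p.1 p.2) (f := fun z : (Eu (k+1) × ℝ) × (Eu (k+1) × ℝ) => (z.1.2 • z.1.1, z.2.2 • z.2.1)) (by fun_prop)
  have e1 : ∫⁻ z, Gk α v (z.1.2 • z.1.1) (z.2.2 • z.2.1) ∂((PP k).prod (PP k)) = ∫⁻ w, (∫⁻ w', (∫⁻ r, (∫⁻ s, Gk α v (r • w) (s • w') ∂(rho k)) ∂(rho k)) ∂(sg k)) ∂(sg k) :=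
    four (sg k) (rho k) hG1
  have e2 : ∀ x, ∫⁻ q, Gk α v x (q.2 • q.1) ∂(PP k) = ∫⁻ y, Gk α v x y := fun x => by
    have hx : Measurable (fun y => Gk α v x y) :=
      hG.comp (g := fun p : Eu (k+1) × Eu (k+1) => Gk α v p.1 p.2) (f := fun y => (x, y)) measurable_prodMk_left
    exact PP_lint hx
  have e3 : Measurable (fun x => ∫⁻ y, Gk α v x y) := hG.lintegral_prod_right'
  rw [← e1, lintegral_prod _ hG1.aemeasurable]
  simp only [e2]
  rw [PP_lint e3, ← lintegral_indicator hms]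
  refine lintegral_congr fun x => ?_
  unfold Gk
  by_cases hx : x ∈ {x : Eu (k+1) | 1 ≤ ‖x‖ ∧ ‖x‖ ≤ 2}
  · simp only [Set.indicator_of_mem hx]
  · simp only [Set.indicator_of_notMem hx, lintegral_zero]

theorem far_pt {α : ℝ} (hα : α < (k+1:ℕ)) {w w' : Eu (k+1)} (hd : 1/8 ≤ ‖w - w'‖) :
    ENNReal.ofReal (‖w - w'‖ ^ (α - ((k+1:ℕ):ℝ)) * (v w - v w')^2) ≤
      ENNReal.ofReal ((1/8) ^ (α - ((k+1:ℕ):ℝ)) * 2) * (ENNReal.ofReal (v w ^ 2) + ENNReal.ofReal (v w' ^ 2)) := by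
  rw [← ENNReal.ofReal_add (by positivity) (by positivity), ← ENNReal.ofReal_mul (by positivity), mul_assoc]
  refine ENNReal.ofReal_le_ofReal ?_
  have h1 := Real.rpow_le_rpow_of_nonpos (z := α - ((k+1:ℕ):ℝ)) (by norm_num) hd (by linarith)
  exact mul_le_mul h1 (by nlinarith [sq_nonneg (v w + v w')]) (sq_nonneg _) (by positivity)

theorem frac {α : ℝ} (hα0 : 0 < α) (hα : α < (k+1:ℕ)) : ∃ C : NNReal, ∀ (v : Eu (k+1) → ℝ) (M : ℝ), VData k v M → M ≤ 1/2 →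
    ∫⁻ w : Eu (k+1), (∫⁻ w' : Eu (k+1), ENNReal.ofReal (‖w - w'‖ ^ (α - ((k+1:ℕ):ℝ)) * (v w - v w')^2) ∂(sg k)) ∂(sg k) ≤
      C * (∫⁻ w, ENNReal.ofReal (v w ^ 2) ∂(sg k) + ∫⁻ w, ENNReal.ofReal (ph (gr v w)) ∂(sg k)) := by
  set c1 := ENNReal.ofReal ((1/8) ^ (α - ((k+1:ℕ):ℝ)) * 2) with hc1
  set c2 := ENNReal.ofReal (3 ^ (((k+1:ℕ):ℝ) + 1 - α)) with hc2
  set c3 := 3 * ∫⁻ z in ball (0 : Eu (k+1)) (1/2), ENNReal.ofReal (‖z‖ ^ (α - ((k+1:ℕ):ℝ))) with hc3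
  have t3 : c3 ≠ ⊤ := ENNReal.mul_ne_top (by norm_num) (pw_int (by omega) hα0 _).ne
  set c4 := 4 * rho k (Set.Icc (1/2) (5/2)) with hc4
  have t4 : c4 ≠ ⊤ := ENNReal.mul_ne_top (by norm_num) (rho_fin k)
  have tS : sg k Set.univ ≠ ⊤ := measure_ne_top _ _
  have t1 : c1 ≠ ⊤ := ENNReal.ofReal_ne_top
  have t2 : c2 ≠ ⊤ := ENNReal.ofReal_ne_top
  have tC : c1 * (2 * sg k Set.univ) + c2 * (c3 * c4) ≠ ⊤ := by finiteness
  refine ⟨(c1 * (2 * sg k Set.univ) + c2 * (c3 * c4)).toNNReal, fun v M D hM => ?_⟩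
  rw [ENNReal.coe_toNNReal tC]
  have mv : Measurable (fun w => ENNReal.ofReal (v w ^ 2)) := (D.meas.pow_const 2).ennreal_ofReal
  set I := ∫⁻ w, ENNReal.ofReal (v w ^ 2) ∂(sg k) with hI
  set P := ∫⁻ w, ENNReal.ofReal (ph (gr v w)) ∂(sg k) with hP
  have hfar : ∫⁻ w, (∫⁻ w', c1 * (ENNReal.ofReal (v w ^ 2) + ENNReal.ofReal (v w' ^ 2)) ∂(sg k)) ∂(sg k) = c1 * (2 * sg k Set.univ) * I := by
    have : ∀ w, ∫⁻ w', c1 * (ENNReal.ofReal (v w ^ 2) + ENNReal.ofReal (v w' ^ 2)) ∂(sg k) = c1 * (ENNReal.ofReal (v w ^ 2) * sg k Set.univ + I) := fun w => by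
      rw [lintegral_const_mul' _ _ t1, lintegral_add_left measurable_const, lintegral_const]
    simp only [this]
    rw [lintegral_const_mul' _ _ t1, lintegral_add_left (mv.mul_const _), lintegral_mul_const _ mv, lintegral_const, ← hI]
    ring
  have hnear : ∫⁻ w, (∫⁻ w', c2 * (∫⁻ r, (∫⁻ s, Gk α v (r • w) (s • w') ∂(rho k)) ∂(rho k)) ∂(sg k)) ∂(sg k) ≤ c2 * (c3 * c4) * P := by
    simp only [lintegral_const_mul' _ _ t2]
    rw [D.Gk_int α, mul_assoc, mul_assoc]
    gcongr
    refine (D.Nk_int hM α).trans ?_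
    gcongr
    exact D.Hk_int
  calc _ ≤ ∫⁻ w, (∫⁻ w', (c1 * (ENNReal.ofReal (v w ^ 2) + ENNReal.ofReal (v w' ^ 2)) + c2 * (∫⁻ r, (∫⁻ s, Gk α v (r • w) (s • w') ∂(rho k)) ∂(rho k))) ∂(sg k)) ∂(sg k) := by
        refine lintegral_mono_ae ((ae_sg k).mono fun w hw => lintegral_mono_ae ((ae_sg k).mono fun w' hw' => ?_))
        rcases lt_or_ge ‖w - w'‖ (1/8) with h | h
        · exact (D.near_pt hα hw hw' h).trans le_add_self
        · exact (far_pt hα h).trans le_self_add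
    _ = c1 * (2 * sg k Set.univ) * I + ∫⁻ w, (∫⁻ w', c2 * (∫⁻ r, (∫⁻ s, Gk α v (r • w) (s • w') ∂(rho k)) ∂(rho k)) ∂(sg k)) ∂(sg k) := by
        rw [← hfar, ← lintegral_add_left]
        · refine lintegral_congr fun w => ?_
          exact lintegral_add_left ((measurable_const.add mv).const_mul _) _
        · have : Measurable (fun q : Eu (k+1) × Eu (k+1) => c1 * (ENNReal.ofReal (v q.1 ^ 2) + ENNReal.ofReal (v q.2 ^ 2))) :=
            ((mv.comp measurable_fst).add (mv.comp measurable_snd)).const_mul _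
          exact this.lintegral_prod_right'
    _ ≤ c1 * (2 * sg k Set.univ) * (I + P) + c2 * (c3 * c4) * (I + P) := by
        refine add_le_add ?_ (hnear.trans ?_)
        · gcongr; exact le_self_add
        · gcongr; exact le_add_self
    _ = _ := by ring

end VData

/-- Radius of the star-shaped set with profile `v`. -/
def av {k : ℕ} (v : Eu (k+1) → ℝ) (x : Eu (k+1)) : ℝ := (1 + ((k:ℝ)+1) * v x) ^ (1 / ((k:ℝ)+1))

namespace VData
variable {k : ℕ} {v : Eu (k+1) → ℝ} {M : ℝ}

theorem b_bd (D : VData k v M) (hM : M ≤ 1/(4*((k:ℝ)+1))) (x : Eu (k+1)) : |((k:ℝ)+1) * v x| ≤ 1/4 := by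
  rw [abs_mul, abs_of_nonneg (by positivity)]
  calc ((k:ℝ)+1) * |v x| ≤ ((k:ℝ)+1) * (1/(4*((k:ℝ)+1))) := by gcongr; exact (D.bdd x).trans hM
    _ = 1/4 := by field_simp

theorem b_pos (D : VData k v M) (hM : M ≤ 1/(4*((k:ℝ)+1))) (x : Eu (k+1)) : 3/4 ≤ 1 + ((k:ℝ)+1) * v x ∧ 1 + ((k:ℝ)+1) * v x ≤ 5/4 := by
  have := abs_le.1 (D.b_bd hM x); constructor <;> linarith [this.1, this.2]

theorem av_pos (D : VData k v M) (hM : M ≤ 1/(4*((k:ℝ)+1))) (x : Eu (k+1)) : 0 < av v x :=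
  Real.rpow_pos_of_pos (by linarith [(D.b_pos hM x).1]) _

theorem av_pow (D : VData k v M) (hM : M ≤ 1/(4*((k:ℝ)+1))) (x : Eu (k+1)) : av v x ^ (k+1) = 1 + ((k:ℝ)+1) * v x := by
  have := (D.b_pos hM x).1
  rw [av, ← Real.rpow_natCast, ← Real.rpow_mul (by linarith)]
  push_cast
  rw [one_div, inv_mul_cancel₀ (by positivity), Real.rpow_one]

theorem av_bd (D : VData k v M) (hM : M ≤ 1/(4*((k:ℝ)+1))) (x : Eu (k+1)) : 1/2 ≤ av v x ∧ av v x ≤ 2 := by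
  have hp := D.av_pos hM x
  have h1 := D.av_pow hM x
  have h2 := D.b_pos hM x
  rw [pow_succ] at h1
  constructor
  · by_contra h
    push Not at h
    have : av v x ^ k ≤ 1 := pow_le_one₀ hp.le (by linarith)
    nlinarith
  · by_contra h
    push Not at h
    have : 1 ≤ av v x ^ k := one_le_pow₀ (by linarith)
    nlinarith

theorem pow_diff {a b : ℝ} (hb : 1/2 ≤ b) (hab : b ≤ a) (k : ℕ) : (1/2)^k * (a - b) ≤ a^(k+1) - b^(k+1) := by
  have h1 : b^k ≤ a^k := pow_le_pow_left₀ (by linarith) hab k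
  have h2 : (1/2)^k ≤ a^k := pow_le_pow_left₀ (by norm_num) (hb.trans hab) k
  rw [pow_succ, pow_succ]
  nlinarith [mul_nonneg (sub_nonneg.2 h1) (show 0 ≤ b by linarith), mul_nonneg (sub_nonneg.2 h2) (sub_nonneg.2 hab)]

theorem av_lip (D : VData k v M) (hM : M ≤ 1/(4*((k:ℝ)+1))) (x y : Eu (k+1)) : (av v x - av v y)^2 ≤ (2^k * ((k:ℝ)+1))^2 * (v x - v y)^2 := by
  have key : ∀ x y, av v y ≤ av v x → av v x - av v y ≤ 2^k * ((k:ℝ)+1) * (v x - v y) := by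
    intro x y h
    have := pow_diff (D.av_bd hM y).1 h k
    rw [D.av_pow hM, D.av_pow hM, one_div, inv_pow, inv_mul_le_iff₀ (by positivity)] at this
    linarith
  rw [← mul_pow, sq_le_sq]
  rcases le_total (av v y) (av v x) with h | h
  · rw [abs_of_nonneg (by linarith)]
    exact (key x y h).trans (le_abs_self _)
  · rw [abs_sub_comm, abs_of_nonneg (by linarith), ← abs_neg]
    refine (key y x h).trans (le_trans (le_of_eq ?_) (le_abs_self _)); ring

theorem av_meas (D : VData k v M) : Measurable (av v) := ((D.meas.const_mul _).const_add _).pow_const _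

theorem av_hom (D : VData k v M) (r : ℝ) (hr : 0 < r) (x : Eu (k+1)) : av v (r • x) = av v x := by
  unfold av; rw [D.hom r hr]

theorem av_bern (D : VData k v M) (hM : M ≤ 1/(4*((k:ℝ)+1))) {α : ℝ} (hα : 0 < α) (x : Eu (k+1)) :
    1 + (((k+1:ℕ):ℝ) + α) * v x ≤ av v x ^ (((k+1:ℕ):ℝ) + α) := by
  have hb := D.b_pos hM x
  rw [av, ← Real.rpow_mul (by linarith)]
  have := one_add_mul_self_le_rpow_one_add (s := ((k:ℝ)+1) * v x) (by linarith) (p := 1 / ((k:ℝ)+1) * (((k+1:ℕ):ℝ) + α)) (by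
    rw [one_div, ← div_eq_inv_mul, le_div_iff₀ (by positivity)]; push_cast; linarith)
  refine le_trans (le_of_eq ?_) this
  field_simp

theorem v_int (D : VData k v M) : Integrable v (sg k) := Integrable.of_bound D.meas.aestronglyMeasurable M (Eventually.of_forall D.bdd)

theorem v2_int (D : VData k v M) : Integrable (fun w => v w ^ 2) (sg k) :=
  Integrable.of_bound (D.meas.pow_const 2).aestronglyMeasurable (M^2) (Eventually.of_forall fun x => by
    rw [Real.norm_eq_abs, abs_pow]; exact pow_le_pow_left₀ (abs_nonneg _) (D.bdd x) 2)

theorem ph_int (D : VData k v M) : Integrable (fun w => ph (gr v w)) (sg k) := by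
  obtain ⟨G, hG⟩ := D.gr_bdd
  refine Integrable.of_bound (ph_cont.measurable.comp D.gr_meas).aestronglyMeasurable (G^2/2) (Eventually.of_forall fun x => ?_)
  rw [Real.norm_of_nonneg (ph_nonneg _)]
  refine (ph_le_sq _).trans ?_
  have := pow_le_pow_left₀ (abs_nonneg _) (hG x) 2
  rw [sq_abs] at this; linarith

theorem sg_pos (k : ℕ) : 0 < (sg k).real Set.univ := by
  rw [sg_real]
  have := unitBall_vol_pos (k+1)
  positivity

theorem riesz_arith {S V VA L T μ c : ℝ} (hS : 0 < S) (hV : 0 ≤ V) (hc : 0 ≤ c) (h : 2 * (T * V) = S * (2 * VA + L)) (hT : S + c * μ ≤ T) :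
    V ≤ VA + L/2 + c * V / S * |μ| := by
  have h1 : (S - c * |μ|) * V ≤ T * V := by
    gcongr; nlinarith [neg_abs_le μ]
  have h2 : S * (VA + L/2 + c * V / S * |μ|) = S * (2 * VA + L) / 2 + c * V * |μ| := by field_simp
  have h3 : S * V ≤ S * (VA + L/2 + c * V / S * |μ|) := by rw [h2, ← h]; nlinarith
  exact le_of_mul_le_mul_left h3 hS

theorem riesz_low {α : ℝ} (hα0 : 0 < α) (hα : α < (k+1:ℕ)) : ∃ C : ℝ, 0 ≤ C ∧ ∀ (v : Eu (k+1) → ℝ) (M : ℝ), VData k v M → M ≤ 1/(4*((k:ℝ)+1)) →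
    (rieszEnergy α (unitBall (k+1))).toReal ≤ (rieszEnergy α {x | ‖x‖ < av v x}).toReal +
      C * ((∫ w, v w ^ 2 ∂(sg k)) + (∫ w, ph (gr v w) ∂(sg k)) + |∫ w, v w ∂(sg k)|) := by
  obtain ⟨C1, hC1⟩ := frac hα0 hα
  obtain ⟨C2, hC2⟩ := pot_bound (n := k+1) (by omega) hα0 hα
  set V := (rieszEnergy α (unitBall (k+1))).toReal with hV
  set S := (sg k).real Set.univ with hS
  have hS0 : 0 < S := sg_pos k
  set c0 := (1/2 : ℝ) ^ (α - ((k+1:ℕ):ℝ)) * 4^k with hc0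
  set c1 := (2^k * ((k:ℝ)+1))^2 with hc1
  have hV0 : 0 ≤ V := ENNReal.toReal_nonneg
  have hc00 : 0 ≤ c0 := by positivity
  refine ⟨c0 * c1 * C1 / 2 + (((k+1:ℕ):ℝ) + α) * V / S, by positivity, fun v M D hM => ?_⟩
  have hVf : rieszEnergy α (unitBall (k+1)) ≠ ⊤ := riesz_ne_top hC2 (unitBall_vol_ne_top _)
  have hAf : rieszEnergy α {x | ‖x‖ < av v x} ≠ ⊤ := by
    refine riesz_ne_top hC2 (ne_top_of_le_ne_top (measure_ball_lt_top (x := (0 : Eu (k+1))) (r := 2)).ne (measure_mono fun x hx => ?_))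
    rw [mem_ball_zero_iff]
    exact lt_of_lt_of_le hx (D.av_bd hM x).2
  have hn1 : (1:ℝ) ≤ (k:ℝ)+1 := by linarith [Nat.cast_nonneg (α := ℝ) k]
  have hM2 : M ≤ 1/2 := hM.trans (by rw [div_le_div_iff₀ (by positivity) (by norm_num)]; linarith)
  set I := ∫ w, v w ^ 2 ∂(sg k) with hI
  set P := ∫ w, ph (gr v w) ∂(sg k) with hP
  have hI0 : 0 ≤ I := integral_nonneg fun w => sq_nonneg _
  have hP0 : 0 ≤ P := integral_nonneg fun w => ph_nonneg _
  have eI : ∫⁻ w, ENNReal.ofReal (v w ^ 2) ∂(sg k) = ENNReal.ofReal I :=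
    (ofReal_integral_eq_lintegral_ofReal D.v2_int (Eventually.of_forall fun _ => sq_nonneg _)).symm
  have eP : ∫⁻ w, ENNReal.ofReal (ph (gr v w)) ∂(sg k) = ENNReal.ofReal P :=
    (ofReal_integral_eq_lintegral_ofReal D.ph_int (Eventually.of_forall fun _ => ph_nonneg _)).symm
  have hf := hC1 v M D hM2
  rw [eI, eP, ← ENNReal.ofReal_add hI0 hP0] at hf
  have hL : Lrem α (av v) ≤ ENNReal.ofReal (c0 * (c1 * (C1 * (I + P)))) := by
    refine (Lrem_le hα D.av_meas (D.av_bd hM)).trans ?_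
    rw [ENNReal.ofReal_mul hc00]
    gcongr
    rw [ENNReal.ofReal_mul (by positivity), ENNReal.ofReal_mul C1.coe_nonneg, ENNReal.ofReal_coe_nnreal]
    refine le_trans ?_ (mul_le_mul_right hf _)
    rw [← lintegral_const_mul' _ _ ENNReal.ofReal_ne_top]
    refine lintegral_mono fun w => ?_
    rw [← lintegral_const_mul' _ _ ENNReal.ofReal_ne_top]
    refine lintegral_mono fun w' => ?_
    rw [← ENNReal.ofReal_mul (by positivity)]
    refine ENNReal.ofReal_le_ofReal ?_
    calc _ ≤ ‖w - w'‖ ^ (α - ((k+1:ℕ):ℝ)) * (c1 * (v w - v w')^2) := by gcongr; exact D.av_lip hM w w'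
      _ = _ := by ring
  have hLf : Lrem α (av v) ≠ ⊤ := ne_top_of_le_ne_top ENNReal.ofReal_ne_top hL
  have hLr : (Lrem α (av v)).toReal ≤ c0 * (c1 * (C1 * (I + P))) := ENNReal.toReal_le_of_le_ofReal (by positivity) hL
  have hm : Measurable (fun w => av v w ^ (((k+1:ℕ):ℝ) + α)) := D.av_meas.pow_const _
  have hTi : Integrable (fun w => av v w ^ (((k+1:ℕ):ℝ) + α)) (sg k) := by
    refine Integrable.of_bound hm.aestronglyMeasurable (2 ^ (((k+1:ℕ):ℝ) + α)) (Eventually.of_forall fun x => ?_)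
    have := D.av_pos hM x
    rw [Real.norm_of_nonneg (by positivity)]
    exact Real.rpow_le_rpow this.le (D.av_bd hM x).2 (by positivity)
  have hTe : ∫⁻ w, ENNReal.ofReal (av v w ^ (((k+1:ℕ):ℝ) + α)) ∂(sg k) = ENNReal.ofReal (∫ w, av v w ^ (((k+1:ℕ):ℝ) + α) ∂(sg k)) :=
    (ofReal_integral_eq_lintegral_ofReal hTi (Eventually.of_forall fun x => by have := D.av_pos hM x; positivity)).symm
  have hT0 : 0 ≤ ∫ w, av v w ^ (((k+1:ℕ):ℝ) + α) ∂(sg k) := integral_nonneg fun x => by have := D.av_pos hM x; positivity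
  have key := congrArg ENNReal.toReal (riesz_star α D.av_meas D.av_hom (D.av_pos hM))
  rw [hTe, ENNReal.toReal_mul, ENNReal.toReal_mul, ENNReal.toReal_ofReal hT0, ENNReal.toReal_mul, ENNReal.toReal_add (by finiteness) hLf, ENNReal.toReal_mul] at key
  have hT : S + (((k+1:ℕ):ℝ) + α) * ∫ w, v w ∂(sg k) ≤ ∫ w, av v w ^ (((k+1:ℕ):ℝ) + α) ∂(sg k) := by
    have e : ∫ w, (1 + (((k+1:ℕ):ℝ) + α) * v w) ∂(sg k) = S + (((k+1:ℕ):ℝ) + α) * ∫ w, v w ∂(sg k) := by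
      rw [integral_add (integrable_const _) (D.v_int.const_mul _), integral_const_mul]; simp [hS]
    rw [← e]
    exact integral_mono ((integrable_const _).add (D.v_int.const_mul _)) hTi (fun x => D.av_bern hM hα0 x)
  have fin := riesz_arith hS0 hV0 (by positivity) key hT
  refine fin.trans ?_
  have hμ := abs_nonneg (∫ w, v w ∂(sg k))
  have q1 : 0 ≤ (((k+1:ℕ):ℝ) + α) * V / S := by positivity
  have q2 : 0 ≤ c0 * c1 * C1 / 2 := by positivity
  nlinarith [mul_nonneg q1 (add_nonneg hI0 hP0), mul_nonneg q2 hμ]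

end VData

theorem polar_ann {k : ℕ} {f : Eu (k+1) → ℝ} {l b : ℝ} (hl : 0 ≤ l) (hlb : l ≤ b) (hf : Integrable f)
    (h1 : ∀ x, ‖x‖ < l → f x = 0) (h2 : ∀ x, b < ‖x‖ → f x = 0) :
    Integrable (fun w => ∫ r in l..b, f (r • w) * r ^ k) (sg k) ∧ ∫ x, f x = ∫ w, (∫ r in l..b, f (r • w) * r ^ k) ∂(sg k) := by
  have hae : ∀ᵐ w ∂(sg k), (∫ r, ({x : Eu (k+1) | ‖x‖ = l}ᶜ.indicator f) (r • w) ∂(rho k)) = ∫ r in l..b, f (r • w) * r ^ k := by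
    filter_upwards [ae_sg k] with w hw
    have e1 : ∫ r, ({x : Eu (k+1) | ‖x‖ = l}ᶜ.indicator f) (r • w) ∂(rho k) = ∫ r, (if r ≤ l then 0 else f (r • w)) ∂(rho k) := by
      apply integral_congr_ae
      filter_upwards [ae_rho k] with r hr
      have hn : ‖r • w‖ = r := by rw [norm_smul, hw, mul_one, Real.norm_of_nonneg hr.le]
      simp only [Set.indicator, Set.mem_compl_iff, Set.mem_ofPred_eq, hn]
      rcases lt_trichotomy r l with h | h | h
      · rw [if_pos h.ne, if_pos h.le, h1 _ (by rw [hn]; exact h)]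
      · simp [h]
      · rw [if_pos h.ne', if_neg (by linarith)]
    rw [e1, rho_Ioc hl hlb (fun r hr => if_pos hr)]
    · refine intervalIntegral.integral_congr_ae (Eventually.of_forall fun r hr => ?_)
      rw [Set.uIoc_of_le hlb] at hr
      rw [if_neg (by linarith [hr.1])]
    · intro r hr
      have hn : ‖r • w‖ = r := by rw [norm_smul, hw, mul_one, Real.norm_of_nonneg (by linarith)]
      rw [if_neg (by linarith), h2 _ (by rw [hn]; exact hr)]
  have hms : MeasurableSet {x : Eu (k+1) | ‖x‖ = l}ᶜ := (measurableSet_eq_fun measurable_norm measurable_const).compl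
  have hf' : Integrable ({x : Eu (k+1) | ‖x‖ = l}ᶜ.indicator f) := hf.indicator hms
  have e0 : ∫ x, f x = ∫ x, {x : Eu (k+1) | ‖x‖ = l}ᶜ.indicator f x := by
    apply integral_congr_ae
    have : volume {x : Eu (k+1) | ‖x‖ = l} = 0 := by
      have := Measure.addHaar_sphere (volume : Measure (Eu (k+1))) 0 l
      convert this using 2
      ext x; simp
    filter_upwards [measure_eq_zero_iff_ae_notMem.1 this] with x hx
    rw [Set.indicator_of_mem (by exact hx)]
  refine ⟨(polar_int_integrable hf').congr hae, ?_⟩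
  rw [e0, polar_int hf']
  exact integral_congr_ae hae

/-- Smallness of the annulus. -/
abbrev SmallAn (k : ℕ) (δ : ℝ) : Prop := ((1+δ)^(k+1) - (1-δ)^(k+1)) / ((k:ℝ)+1) ≤ 1/(4*((k:ℝ)+1))

namespace UData
variable {k : ℕ} {δ : ℝ} {u : Eu (k+1) → ℝ}

theorem W_bd (D : UData k δ u) (x : Eu (k+1)) : 0 ≤ Wf k δ u x ∧ Wf k δ u x ≤ ((1+δ)^(k+1) - (1-δ)^(k+1)) / ((k:ℝ)+1) := by
  have h1 := D.hδ
  have h2 := D.hδ2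
  have hc : Continuous (fun r : ℝ => u (r • x) * r ^ k) := by
    have := D.hu.continuous
    fun_prop
  constructor
  · refine intervalIntegral.integral_nonneg (by linarith) (fun r hr => ?_)
    exact mul_nonneg (D.h01 _).1 (pow_nonneg (by linarith [hr.1]) _)
  · have := intervalIntegral.integral_mono_on (μ := volume) (a := 1-δ) (b := 1+δ) (f := fun r => u (r • x) * r ^ k) (g := fun r => r ^ k) (by linarith) (hc.intervalIntegrable _ _)
      ((continuous_pow k).intervalIntegrable _ _) (fun r hr => by
        have := pow_nonneg (show (0:ℝ) ≤ r by linarith [hr.1]) k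
        have := (D.h01 (r • x)).2
        nlinarith)
    rw [integral_pow] at this
    exact this

theorem vdata (D : UData k δ u) : VData k (vh k δ u) (((1+δ)^(k+1) - (1-δ)^(k+1)) / ((k:ℝ)+1)) where
  hom r hr x := D.vh_smul hr x
  cd x hx := D.vh_contDiffAt hx
  bdd x := by
    have h1 := D.hδ
    have h2 := D.hδ2
    have hW := D.W_bd (nrm x)
    have a1 : (1:ℝ) ≤ (1+δ)^(k+1) := one_le_pow₀ (by linarith)
    have a2 : (1-δ)^(k+1) ≤ 1 := pow_le_one₀ (by linarith) (by linarith)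
    have a3 : (1 - (1-δ)^(k+1)) / ((k:ℝ)+1) ≤ ((1+δ)^(k+1) - (1-δ)^(k+1)) / ((k:ℝ)+1) := by gcongr
    have a4 : 0 ≤ (1 - (1-δ)^(k+1)) / ((k:ℝ)+1) := div_nonneg (by linarith) (by positivity)
    rw [vh, abs_le]; constructor <;> linarith [hW.1, hW.2]
  meas := (D.W_contDiff.continuous.measurable.comp measurable_nrm).sub_const _

theorem rdata (D : UData k δ u) (hM : SmallAn k δ) {w : Eu (k+1)} (hw : ‖w‖ = 1) :
    RayData k δ (av (vh k δ u) w) (fun r => u (r • w)) := by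
  have h1 := D.hδ
  have h2 := D.hδ2
  have hp := D.vdata.av_pow hM w
  have hp0 := D.vdata.av_pos hM w
  have hW := D.W_bd w
  rw [vh, nrm_unit hw] at hp
  have e : 1 + ((k:ℝ)+1) * (Wf k δ u w - (1 - (1-δ)^(k+1)) / (k+1)) = (1-δ)^(k+1) + ((k:ℝ)+1) * Wf k δ u w := by field_simp; ring
  have hk : (0:ℝ) < (k:ℝ)+1 := by positivity
  have e2 : ((k:ℝ)+1) * Wf k δ u w ≤ (1+δ)^(k+1) - (1-δ)^(k+1) := by
    have := hW.2; rw [le_div_iff₀ hk] at this; linarith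
  rw [e] at hp
  refine ⟨h1, h2, ?_, fun r => D.h01 _, ?_, ?_, ?_, ?_, ?_⟩
  · exact D.hu.comp (contDiff_id.smul contDiff_const)
  · exact D.h1 _ (by rw [norm_smul, hw, mul_one, Real.norm_of_nonneg (by linarith)])
  · exact D.h0 _ (by rw [norm_smul, hw, mul_one, Real.norm_of_nonneg (by linarith)])
  · rw [← pow_le_pow_iff_left₀ (by linarith) hp0.le (show k+1 ≠ 0 by omega), hp]
    have := mul_nonneg hk.le hW.1; linarith
  · rw [← pow_le_pow_iff_left₀ hp0.le (by linarith) (show k+1 ≠ 0 by omega), hp]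
    linarith
  · exact hp

end UData

theorem ray_alg {N P X T B b p : ℝ} (hN : 0 ≤ N) (hP : 0 ≤ P) (hX : 0 ≤ X) (hT : 0 ≤ T) (hTN : T ≤ N + X) (hTB : T ≤ B) (hB : 1 ≤ B) (hb : 1 ≤ b)
    (h : N^2 + (p/b)^2 ≤ P^2) : T + ph p / (B * b^2) ≤ P + X := by
  have hs := ph_nonneg p
  have hs2 : (1 + ph p)^2 = 1 + p^2 := by
    unfold ph; rw [add_sub_cancel, Real.sq_sqrt (by positivity)]
  set s := ph p
  have hNP : N ≤ P := by
    apply le_of_sq_le_sq _ hP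
    nlinarith [sq_nonneg (p/b)]
  set c := 1/b^2 with hc
  have hc0 : 0 < c := by positivity
  have hc1 : c ≤ 1 := by rw [hc, div_le_one (by positivity)]; exact one_le_pow₀ hb
  have e1 : (p/b)^2 = c * (2*s + s^2) := by
    have : p^2 = 2*s+s^2 := by linarith
    rw [div_pow, this, hc]; ring
  have e2 : ph p / (B*b^2) = (s/B) * c := by rw [hc]; field_simp; rfl
  have hsB : s / B ≤ s := div_le_self hs hB
  have hsB0 : 0 ≤ s/B := by positivity
  have hTs : T * (s/B) ≤ s := by
    rw [mul_div_assoc', div_le_iff₀ (by linarith)]; nlinarith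
  rw [e2]
  apply le_of_sq_le_sq _ (by linarith)
  have h3 : T^2 ≤ (N+X)^2 := pow_le_pow_left₀ hT hTN 2
  have h4 : (s/B*c)^2 ≤ c * s^2 := by
    have : (s/B)^2 ≤ s^2 := pow_le_pow_left₀ hsB0 hsB 2
    calc (s/B*c)^2 = (c * c) * (s/B)^2 := by ring
      _ ≤ (c * 1) * s^2 := by gcongr
      _ = c * s^2 := by ring
  have h5 : T * (s/B) * c ≤ s * c := by gcongr
  have h6 : N * X ≤ P * X := by gcongr
  rw [e1] at h
  nlinarith

theorem bern1 {a : ℝ} (ha : 0 ≤ a) (n : ℕ) : (n:ℝ) * (a - 1) ≤ a^n - 1 := by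
  have := one_add_mul_le_pow (a := a - 1) (by linarith) n
  rw [add_sub_cancel] at this; linarith

theorem bern2 {a : ℝ} (ha : 0 < a) (k : ℕ) : a^(k+1) - 1 ≤ ((k:ℝ)+1) * a^k * (a - 1) := by
  have := bern1 (inv_nonneg.2 ha.le) (k+1)
  have h2 := mul_le_mul_of_nonneg_left this (pow_nonneg ha.le (k+1))
  have e1 : a^(k+1) * (((k+1:ℕ):ℝ) * (a⁻¹ - 1)) = ((k:ℝ)+1) * a^k * (1 - a) := by
    push_cast; rw [pow_succ]; field_simp
  have e2 : a^(k+1) * (a⁻¹^(k+1) - 1) = 1 - a^(k+1) := by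
    rw [inv_pow, mul_sub, mul_inv_cancel₀ (by positivity)]; ring
  rw [e1, e2] at h2
  linarith

theorem apow {k : ℕ} {a l v ε : ℝ} (hk : 1 ≤ k) (hl : 0 < l) (hl1 : l ≤ 1) (hla : l ≤ a) (hε : 0 ≤ ε) (hε2 : 1 ≤ (1+ε) * l^(k+1))
    (hv : a^(k+1) = 1 + ((k:ℝ)+1) * v) : 1 + k * v - (k:ℝ)/2 * (1+ε) * v^2 ≤ a^k := by
  obtain ⟨j, rfl⟩ : ∃ j, k = j+1 := ⟨k-1, by omega⟩
  set n : ℝ := ((j+1:ℕ):ℝ)+1 with hn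
  have hn0 : 0 < n := by positivity
  set V : ℝ → ℝ := fun x => (x^(j+1+1) - 1) / n with hV
  set G : ℝ → ℝ := fun x => x^(j+1) - 1 - ((j+1:ℕ):ℝ) * V x + ((j+1:ℕ):ℝ)/2 * (1+ε) * (V x)^2 with hG
  have hVd : ∀ x, HasDerivAt V (x^(j+1)) x := fun x => by
    have := ((hasDerivAt_pow (j+1+1) x).sub_const 1).div_const n
    refine this.congr_deriv ?_
    rw [hn]; push_cast; field_simp
  have hGd : ∀ x, HasDerivAt G (((j+1:ℕ):ℝ) * x^j * (1 - x + (1+ε) * V x * x)) x := fun x => by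
    have := (((hasDerivAt_pow (j+1) x).sub_const 1).sub ((hVd x).const_mul ((j+1:ℕ):ℝ))).add (((hVd x).pow 2).const_mul (((j+1:ℕ):ℝ)/2 * (1+ε)))
    refine this.congr_deriv ?_
    simp only [Nat.add_sub_cancel, pow_one, Nat.cast_ofNat]
    push_cast; ring
  have hva : V a = v := by rw [hV]; simp only; rw [hv, hn]; field_simp; ring
  have hG1 : G 1 = 0 := by simp [hG, hV]
  suffices 0 ≤ G a by
    rw [hG] at this; simp only [hva] at this; linarith
  have hcont : Continuous G := by rw [continuous_iff_continuousAt]; exact fun x => (hGd x).continuousAt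
  rcases le_total 1 a with h | h
  · rw [← hG1]
    refine monotoneOn_of_deriv_nonneg (convex_Ici 1) hcont.continuousOn (fun x _ => (hGd x).differentiableAt.differentiableWithinAt) ?_ (Set.mem_Ici.2 le_rfl) h h
    intro x hx
    rw [interior_Ici, Set.mem_Ioi] at hx
    rw [(hGd x).deriv]
    have hV1 : x - 1 ≤ V x := by
      have := bern1 (show 0 ≤ x by linarith) (j+1+1)
      rw [hV]; simp only; rw [le_div_iff₀ hn0, hn]; push_cast at this ⊢; linarith
    have : x - 1 ≤ (1+ε) * V x * x := by
      have h1 : V x ≤ (1+ε) * V x := by nlinarith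
      nlinarith
    have h3 : (0:ℝ) ≤ x := by linarith
    exact mul_nonneg (by positivity) (by linarith)
  · rw [← hG1]
    refine antitoneOn_of_deriv_nonpos (convex_Icc l 1) hcont.continuousOn (fun x _ => (hGd x).differentiableAt.differentiableWithinAt) ?_ ⟨hla, h⟩ ⟨hl1, le_rfl⟩ h
    intro x hx
    rw [interior_Icc] at hx
    rw [(hGd x).deriv]
    have hx0 : 0 < x := hl.trans hx.1
    have hV1 : V x ≤ x^(j+1) * (x - 1) := by
      have := bern2 hx0 (j+1)
      rw [hV]; simp only; rw [div_le_iff₀ hn0, hn]; linarith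
    have h2 : 1 ≤ (1+ε) * x^(j+1+1) := hε2.trans (by gcongr; exact hx.1.le)
    have h4 : (1+ε) * V x * x ≤ (1+ε) * (x^(j+1) * (x-1)) * x := by gcongr
    have h5 : (1+ε) * (x^(j+1) * (x-1)) * x = ((1+ε) * x^(j+1+1)) * (x-1) := by ring
    refine mul_nonpos_of_nonneg_of_nonpos (by positivity) ?_
    nlinarith [hx.2]

theorem e_bound {k : ℕ} {a v : ℝ} (ha : 1/2 ≤ a) (hv : a^(k+1) = 1 + ((k:ℝ)+1) * v) :
    |(a^(k+2) - 1)/((k:ℝ)+2) - v| ≤ 2^(k+1) * ((k:ℝ)+1)^2 * v^2 := by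
  have ha0 : 0 < a := by linarith
  set n : ℝ := (k:ℝ)+1 with hn
  have hn0 : 0 < n := by positivity
  have h1 : n * (a-1) ≤ n * v := by
    have := bern1 ha0.le (k+1); rw [hv] at this; push_cast at this; linarith
  have h2 : n * v ≤ n * (a^k * (a-1)) := by
    have := bern2 ha0 k; rw [hv] at this; linarith
  have h1' := le_of_mul_le_mul_left h1 hn0
  have h2' := le_of_mul_le_mul_left h2 hn0
  have h3 : (a-1) * v ≤ 2^k * n * v^2 ∧ 0 ≤ (a-1) * v ∧ (a^k - 1) * (a-1) ≤ n * ((a-1) * v) := by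
    rcases le_total 1 a with h | h
    · have hp := VData.pow_diff (show (1:ℝ)/2 ≤ 1 by norm_num) h k
      rw [hv, one_pow, one_div, inv_pow, inv_mul_le_iff₀ (by positivity)] at hp
      have hv0 : 0 ≤ v := by linarith
      have : a^k ≤ a^(k+1) := pow_le_pow_right₀ h (by omega)
      refine ⟨by nlinarith, mul_nonneg (by linarith) hv0, by nlinarith⟩
    · have hp := VData.pow_diff ha h k
      rw [hv, one_pow, one_div, inv_pow, inv_mul_le_iff₀ (by positivity)] at hp
      have hv0 : v ≤ 0 := by nlinarith [pow_pos ha0 k]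
      have : a^(k+1) ≤ a^k := pow_le_pow_of_le_one ha0.le h (by omega)
      refine ⟨by nlinarith, mul_nonneg_of_nonpos_of_nonpos (by linarith) hv0, by nlinarith⟩
  obtain ⟨h3, h4, h5⟩ := h3
  have e : (a^(k+2) - 1)/((k:ℝ)+2) - v = ((a - 1 - v) + n * ((a-1)*v)) / (n+1) := by
    have : a^(k+2) = a * (1 + n * v) := by rw [← hv]; ring
    rw [this, hn]; field_simp; ring
  have hb : |(a - 1 - v) + n * ((a-1)*v)| ≤ n * ((a-1)*v) := by
    rw [abs_le]; constructor <;> nlinarith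
  rw [e, abs_div, abs_of_pos (show 0 < n+1 by linarith), div_le_iff₀ (by linarith)]
  have h6 : n * ((a-1)*v) ≤ n * (2^k * n * v^2) := by gcongr
  have h7 : 0 ≤ 2^k * n^2 * v^2 := by positivity
  have h8 : 0 ≤ n * (2^k * n^2 * v^2) := by positivity
  rw [pow_succ]
  nlinarith

theorem odd_int {n : ℕ} (i : Fin n) (R : ℝ) : ∫ x, (closedBall (0 : Eu n) R).indicator (fun x => x i) x = 0 := by
  have h := integral_neg_eq_self (fun x => (closedBall (0 : Eu n) R).indicator (fun x => x i) x) volume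
  have h2 : ∀ x : Eu n, (closedBall (0 : Eu n) R).indicator (fun x => x i) (-x) = - (closedBall (0 : Eu n) R).indicator (fun x => x i) x := by
    intro x
    simp only [Set.indicator, mem_closedBall_zero_iff, norm_neg]
    split_ifs <;> simp
  simp only [h2, integral_neg] at h
  linarith

theorem coord_int {n : ℕ} (i : Fin n) (R : ℝ) : Integrable ((closedBall (0 : Eu n) R).indicator (fun x => x i)) := by
  rw [integrable_indicator_iff isClosed_closedBall.measurableSet]
  have : Continuous (fun x : Eu n => x i) := by fun_prop
  exact this.continuousOn.integrableOn_compact (isCompact_closedBall _ _)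

theorem sg_coord {k : ℕ} (i : Fin (k+1)) : ∫ w, w i ∂(sg k) = 0 := by
  have h := (polar_ann (k := k) (le_refl 0) zero_le_one (coord_int i 1) (fun x hx => absurd hx (by simp)) (fun x hx => by
    rw [Set.indicator_of_notMem]; rw [mem_closedBall_zero_iff]; linarith)).2
  rw [odd_int] at h
  have h2 : ∫ w, (∫ r in (0:ℝ)..1, (closedBall (0 : Eu (k+1)) 1).indicator (fun x => x i) (r • w) * r ^ k) ∂(sg k) = ∫ w, (1/((k:ℝ)+2)) * w i ∂(sg k) := by
    apply integral_congr_ae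
    filter_upwards [ae_sg k] with w hw
    have : ∫ r in (0:ℝ)..1, (closedBall (0 : Eu (k+1)) 1).indicator (fun x => x i) (r • w) * r ^ k = ∫ r in (0:ℝ)..1, r^(k+1) * w i := by
      refine intervalIntegral.integral_congr_ae (Eventually.of_forall fun r hr => ?_)
      rw [Set.uIoc_of_le zero_le_one] at hr
      rw [Set.indicator_of_mem]
      · simp only [PiLp.smul_apply, smul_eq_mul]; ring
      · rw [mem_closedBall_zero_iff, norm_smul, hw, mul_one, Real.norm_of_nonneg hr.1.le]; exact hr.2
    rw [this, intervalIntegral.integral_mul_const, integral_pow]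
    push_cast; norm_num; left; ring
  rw [h2, integral_const_mul] at h
  rcases mul_eq_zero.1 h.symm with h | h
  · exact absurd h (by positivity)
  · exact h

/-- Radial integrals over the annulus. -/
def rI (k : ℕ) (δ : ℝ) (f : Eu (k+1) → ℝ) (w : Eu (k+1)) : ℝ := ∫ r in (1-δ)..(1+δ), f (r • w) * r ^ k

/-- The deviation of a ray from a segment. -/
def rB (k : ℕ) (δ : ℝ) (u : Eu (k+1) → ℝ) (w : Eu (k+1)) : ℝ := ∫ r in (1-δ)..(1+δ), |u (r • w) - chi (av (vh k δ u) w) r| * r ^ k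

namespace UData
variable {k : ℕ} {δ : ℝ} {u : Eu (k+1) → ℝ}

theorem ann (D : UData k δ u) {f : Eu (k+1) → ℝ} (hf : Integrable f) (h1 : ∀ x, ‖x‖ < 1-δ → f x = 0) (h2 : ∀ x, 1+δ < ‖x‖ → f x = 0) :
    Integrable (rI k δ f) (sg k) ∧ ∫ x, f x = ∫ w, rI k δ f w ∂(sg k) := by
  have := D.hδ
  have := D.hδ2
  exact polar_ann (by linarith) (by linarith) hf h1 h2

theorem ray_low (D : UData k δ u) (hM : SmallAn k δ) (hsm : (1 + 4 * δ) * (1+δ)^k ≤ 2 * (1-δ)^k)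
    {w : Eu (k+1)} (hw : ‖w‖ = 1) :
    av (vh k δ u) w ^ k + 2 * rB k δ u w + ph (VData.gr (vh k δ u) w) / (((1+4*δ)*(1+δ)^k) * (1+δ)^2) ≤
      rI k δ (fun x => ‖fderiv ℝ u x‖) w + (16+32*k) * rI k δ (fun x => u x * (1 - u x)) w := by
  have h1 := D.hδ
  have h2 := D.hδ2
  have R := D.rdata hM hw
  have hm := R.ray_main hsm
  have hb := R.bad_le
  have hb0 := R.bad_nonneg
  have hp0 := R.pen_nonneg
  have hg := D.ray_grad hw
  have hpos := D.vdata.av_pos hM w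
  have hak : av (vh k δ u) w ^ k ≤ (1+δ)^k := pow_le_pow_left₀ hpos.le R.ha2 k
  simp only [D.deriv_ray] at hm
  have hge : VData.gr (vh k δ u) w = ‖fderiv ℝ (vh k δ u) w‖ := by rw [VData.gr, hw, one_mul]
  rw [hge]
  unfold rI rB
  have hone : (1:ℝ) ≤ (1+δ)^k := one_le_pow₀ (by linarith)
  refine ray_alg ?_ ?_ (mul_nonneg (by positivity) hp0) ?_ hm ?_ ?_ (by linarith) hg
  · refine intervalIntegral.integral_nonneg (by linarith) (fun r hr => mul_nonneg (abs_nonneg _) (pow_nonneg (by linarith [hr.1]) _))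
  · refine intervalIntegral.integral_nonneg (by linarith) (fun r hr => mul_nonneg (norm_nonneg _) (pow_nonneg (by linarith [hr.1]) _))
  · positivity
  · linarith
  · nlinarith

theorem u_int (D : UData k δ u) : Integrable u := D.hu.continuous.integrable_of_hasCompactSupport D.hcs

theorem grad_ann (D : UData k δ u) : Integrable (rI k δ (fun x => ‖fderiv ℝ u x‖)) (sg k) ∧ ∫ x, ‖fderiv ℝ u x‖ = ∫ w, rI k δ (fun x => ‖fderiv ℝ u x‖) w ∂(sg k) := by
  refine D.ann ?_ (fun x hx => ?_) (fun x hx => ?_)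
  · exact (D.fd_cont.integrable_of_hasCompactSupport (D.hcs.fderiv (𝕜 := ℝ))).norm
  · rw [IsLocalMax.fderiv_eq_zero, norm_zero]
    exact Eventually.of_forall fun y => by rw [D.h1 x hx.le]; exact (D.h01 y).2
  · rw [IsLocalMin.fderiv_eq_zero, norm_zero]
    exact Eventually.of_forall fun y => by rw [D.h0 x hx.le]; exact (D.h01 y).1

theorem pen_ann (D : UData k δ u) : Integrable (rI k δ (fun x => u x * (1 - u x))) (sg k) ∧ ∫ x, u x * (1 - u x) = ∫ w, rI k δ (fun x => u x * (1 - u x)) w ∂(sg k) := by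
  have := D.hu.continuous
  refine D.ann ?_ (fun x hx => ?_) (fun x hx => ?_)
  · exact Continuous.integrable_of_hasCompactSupport (by fun_prop) (D.hcs.mul_right)
  · rw [D.h1 x hx.le]; ring
  · rw [D.h0 x hx.le]; ring

theorem av_range (D : UData k δ u) (hM : SmallAn k δ) {x : Eu (k+1)} (hx : x ≠ 0) :
    1 - δ ≤ av (vh k δ u) x ∧ av (vh k δ u) x ≤ 1 + δ := by
  have R := D.rdata hM (norm_nrm hx)
  have : av (vh k δ u) x = av (vh k δ u) (nrm x) := by
    conv_lhs => rw [← norm_smul_nrm x]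
    exact D.vdata.av_hom _ (norm_pos_iff.2 hx) _
  rw [this]; exact ⟨R.ha1, R.ha2⟩

theorem A_meas (D : UData k δ u) : MeasurableSet {x | ‖x‖ < av (vh k δ u) x} := measurableSet_lt measurable_norm D.vdata.av_meas

theorem A_sub (D : UData k δ u) (hM : SmallAn k δ) : {x | ‖x‖ < av (vh k δ u) x} ⊆ ball 0 2 := by
  intro x hx
  rw [mem_ball_zero_iff]
  exact lt_of_lt_of_le hx (D.vdata.av_bd hM x).2

theorem bad_ann (D : UData k δ u) (hM : SmallAn k δ) :
    Integrable (rB k δ u) (sg k) ∧ ∫ x, |u x - {x | ‖x‖ < av (vh k δ u) x}.indicator (fun _ => (1:ℝ)) x| = ∫ w, rB k δ u w ∂(sg k) := by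
  have h1 := D.hδ
  have h2 := D.hδ2
  have hi : Integrable ({x | ‖x‖ < av (vh k δ u) x}.indicator (fun _ => (1:ℝ))) := by
    rw [integrable_indicator_iff D.A_meas]
    exact integrableOn_const ((measure_mono (D.A_sub hM)).trans_lt measure_ball_lt_top).ne
  have h := D.ann (f := fun x => |u x - {x | ‖x‖ < av (vh k δ u) x}.indicator (fun _ => (1:ℝ)) x|) (D.u_int.sub hi).abs (fun x hx => ?_) (fun x hx => ?_)
  · have hae : ∀ᵐ w ∂(sg k), rI k δ (fun x => |u x - {x | ‖x‖ < av (vh k δ u) x}.indicator (fun _ => (1:ℝ)) x|) w = rB k δ u w := by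
      filter_upwards [ae_sg k] with w hw
      refine intervalIntegral.integral_congr_ae (Eventually.of_forall fun r hr => ?_)
      rw [Set.uIoc_of_le (by linarith)] at hr
      have hr0 : 0 < r := by linarith [hr.1]
      have hn : ‖r • w‖ = r := by rw [norm_smul, hw, mul_one, Real.norm_of_nonneg hr0.le]
      simp only [Set.indicator, Set.mem_ofPred_eq, hn, D.vdata.av_hom r hr0, chi]
    exact ⟨h.1.congr hae, h.2.trans (integral_congr_ae hae)⟩
  · have : x ∈ {x | ‖x‖ < av (vh k δ u) x} := by
      rw [Set.mem_ofPred_eq]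
      by_cases h0 : x = 0
      · rw [h0, norm_zero]; exact D.vdata.av_pos hM 0
      · exact hx.trans_le (D.av_range hM h0).1
    rw [Set.indicator_of_mem this, D.h1 x hx.le]; simp
  · have : x ∉ {x | ‖x‖ < av (vh k δ u) x} := by
      rw [Set.mem_ofPred_eq, not_lt]
      have h0 : x ≠ 0 := by rintro rfl; rw [norm_zero] at hx; linarith
      exact ((D.av_range hM h0).2.trans hx.le)
    rw [Set.indicator_of_notMem this, D.h0 x hx.le]; simp

theorem mu_eq (D : UData k δ u) : ∫ w, vh k δ u w ∂(sg k) = (∫ x, u x) - (volume (unitBall (k+1))).toReal := by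
  have h1 := D.hδ
  have h2 := D.hδ2
  have hi : Integrable ((ball (0 : Eu (k+1)) (1-δ)).indicator (fun _ => (1:ℝ))) := by
    rw [integrable_indicator_iff measurableSet_ball]
    exact integrableOn_const measure_ball_lt_top.ne
  have h := D.ann (f := fun x => u x - (ball (0 : Eu (k+1)) (1-δ)).indicator (fun _ => (1:ℝ)) x) (D.u_int.sub hi) (fun x hx => by
    rw [Set.indicator_of_mem (by rwa [mem_ball_zero_iff]), D.h1 x hx.le, sub_self]) (fun x hx => by
    rw [Set.indicator_of_notMem (by rw [mem_ball_zero_iff]; linarith), D.h0 x hx.le, sub_self])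
  have hae : ∀ᵐ w ∂(sg k), rI k δ (fun x => u x - (ball (0 : Eu (k+1)) (1-δ)).indicator (fun _ => (1:ℝ)) x) w = vh k δ u w + (1 - (1-δ)^(k+1)) / ((k:ℝ)+1) := by
    filter_upwards [ae_sg k] with w hw
    rw [vh, nrm_unit hw, sub_add_cancel]
    refine intervalIntegral.integral_congr_ae (Eventually.of_forall fun r hr => ?_)
    rw [Set.uIoc_of_le (by linarith)] at hr
    have hr0 : 0 < r := by linarith [hr.1]
    have hn : ‖r • w‖ = r := by rw [norm_smul, hw, mul_one, Real.norm_of_nonneg hr0.le]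
    beta_reduce
    rw [Set.indicator_of_notMem (by rw [mem_ball_zero_iff, hn]; linarith [hr.1]), sub_zero]
  have h' := h.2
  rw [integral_congr_ae hae, integral_sub D.u_int hi, integral_add D.vdata.v_int (integrable_const _), integral_const,
    integral_indicator_const _ measurableSet_ball, sg_real, smul_eq_mul, smul_eq_mul, measureReal_def, vol_ball_real (by linarith)] at h'
  have : ((k:ℝ)+1) * (volume (unitBall (k+1))).toReal * ((1 - (1-δ)^(k+1)) / ((k:ℝ)+1)) = (1 - (1-δ)^(k+1)) * (volume (unitBall (k+1))).toReal := by
    field_simp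
  rw [this] at h'
  linarith

theorem X_eq (D : UData k δ u) (hM : SmallAn k δ) {w : Eu (k+1)} (hw : ‖w‖ = 1) :
    |(∫ r in (1-δ)..(1+δ), u (r • w) * r ^ (k+1)) - vh k δ u w - (1 - (1-δ)^(k+2))/((k:ℝ)+2)| ≤ 2 * rB k δ u w + 2^(k+1) * ((k:ℝ)+1)^2 * vh k δ u w ^ 2 := by
  have h1 := D.hδ
  have h2 := D.hδ2
  have R := D.rdata hM hw
  have he := e_bound (D.vdata.av_bd hM w).1 (D.vdata.av_pow hM w)
  set a := av (vh k δ u) w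
  have hch : ∫ r in (1-δ)..(1+δ), chi a r * r^(k+1) = (a^(k+2) - (1-δ)^(k+2))/((k:ℝ)+2) := by
    rw [chi_int R.ha1 R.ha2, integral_pow]; push_cast; ring
  have hsub : (∫ r in (1-δ)..(1+δ), u (r • w) * r ^ (k+1)) - ∫ r in (1-δ)..(1+δ), chi a r * r^(k+1) = ∫ r in (1-δ)..(1+δ), (u (r • w) - chi a r) * r^(k+1) := by
    rw [← intervalIntegral.integral_sub (R.ii_f _ _ _) (R.ii_chi _ _ _ _)]
    congr 1; funext r; ring
  have hle : |∫ r in (1-δ)..(1+δ), (u (r • w) - chi a r) * r^(k+1)| ≤ 2 * rB k δ u w := by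
    rw [rB, ← intervalIntegral.integral_const_mul]
    refine (intervalIntegral.abs_integral_le_integral_abs (by linarith)).trans ?_
    refine intervalIntegral.integral_mono_on (by linarith) (R.ii_g _ _ _ _).abs ((R.ii_bad _ _ _ _).const_mul 2) (fun r hr => ?_)
    have hr0 : 0 ≤ r := by linarith [hr.1]
    rw [abs_mul, abs_of_nonneg (pow_nonneg hr0 _), pow_succ]
    have : 0 ≤ |u (r • w) - chi a r| * r^k := by positivity
    nlinarith [hr.2]
  have e : (∫ r in (1-δ)..(1+δ), u (r • w) * r ^ (k+1)) - vh k δ u w - (1 - (1-δ)^(k+2))/((k:ℝ)+2) =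
      (∫ r in (1-δ)..(1+δ), (u (r • w) - chi a r) * r^(k+1)) + ((a^(k+2) - 1)/((k:ℝ)+2) - vh k δ u w) := by
    rw [← hsub, hch]; ring
  rw [e]
  exact (abs_add_le _ _).trans (add_le_add hle he)

theorem mode (D : UData k δ u) (hM : SmallAn k δ) (hbar : ∫ x, u x • x = 0) (i : Fin (k+1)) :
    |∫ w, w i * vh k δ u w ∂(sg k)| ≤ 2 * (∫ w, rB k δ u w ∂(sg k)) + 2^(k+1) * ((k:ℝ)+1)^2 * ∫ w, vh k δ u w ^ 2 ∂(sg k) := by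
  have h1 := D.hδ
  have h2 := D.hδ2
  have hcu := D.hu.continuous
  have hci : Continuous (fun x : Eu (k+1) => x i) := by fun_prop
  have hix : Integrable (fun x => u x • x) := (hcu.smul continuous_id).integrable_of_hasCompactSupport D.hcs.smul_right
  have hi0 : Integrable (fun x => u x * x i) := (hcu.mul hci).integrable_of_hasCompactSupport D.hcs.mul_right
  have hz : ∫ x, u x * x i = 0 := by
    have := (EuclideanSpace.proj (𝕜 := ℝ) i).integral_comp_comm hix
    rw [hbar, map_zero] at this
    rw [← this]; simp
  have h := D.ann (f := fun x => u x * x i - (closedBall (0 : Eu (k+1)) (1-δ)).indicator (fun x => x i) x) (hi0.sub (coord_int i _)) (fun x hx => by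
    rw [Set.indicator_of_mem (by rw [mem_closedBall_zero_iff]; exact hx.le), D.h1 x hx.le, one_mul, sub_self]) (fun x hx => by
    rw [Set.indicator_of_notMem (by rw [mem_closedBall_zero_iff]; linarith), D.h0 x hx.le, zero_mul, sub_self])
  rw [integral_sub hi0 (coord_int i _), hz, odd_int, sub_zero] at h
  set c := (1 - (1-δ)^(k+2))/((k:ℝ)+2)
  have hae : ∀ᵐ w ∂(sg k), rI k δ (fun x => u x * x i - (closedBall (0 : Eu (k+1)) (1-δ)).indicator (fun x => x i) x) w = w i * (∫ r in (1-δ)..(1+δ), u (r • w) * r ^ (k+1)) := by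
    filter_upwards [ae_sg k] with w hw
    rw [← intervalIntegral.integral_const_mul]
    refine intervalIntegral.integral_congr_ae (Eventually.of_forall fun r hr => ?_)
    rw [Set.uIoc_of_le (by linarith)] at hr
    have hr0 : 0 < r := by linarith [hr.1]
    have hn : ‖r • w‖ = r := by rw [norm_smul, hw, mul_one, Real.norm_of_nonneg hr0.le]
    beta_reduce
    rw [Set.indicator_of_notMem (by rw [mem_closedBall_zero_iff, hn]; exact not_le.2 hr.1), sub_zero]
    simp only [PiLp.smul_apply, smul_eq_mul]; ring
  have hI1 := h.1.congr hae
  have hI1' := h.2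
  rw [integral_congr_ae hae] at hI1'
  have hwle : ∀ᵐ w ∂(sg k), |w i| ≤ 1 := by
    filter_upwards [ae_sg k] with w hw
    rw [← hw, ← Real.norm_eq_abs]; exact PiLp.norm_apply_le w i
  have hwi : Integrable (fun w : Eu (k+1) => w i) (sg k) := Integrable.of_bound hci.aestronglyMeasurable 1 hwle
  have hI2 : Integrable (fun w => w i * vh k δ u w) (sg k) := D.vdata.v_int.bdd_mul hci.aestronglyMeasurable hwle
  have hB := D.bad_ann hM
  have e : - ∫ w, w i * vh k δ u w ∂(sg k) = ∫ w, (w i * (∫ r in (1-δ)..(1+δ), u (r • w) * r ^ (k+1)) - w i * vh k δ u w - c * w i) ∂(sg k) := by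
    have hI12 : Integrable (fun w => w i * (∫ r in (1-δ)..(1+δ), u (r • w) * r ^ (k+1)) - w i * vh k δ u w) (sg k) := hI1.sub hI2
    rw [integral_sub hI12 (hwi.const_mul c), integral_sub hI1 hI2, integral_const_mul, sg_coord, ← hI1']; ring
  rw [← abs_neg, e, ← Real.norm_eq_abs]
  have hr : Integrable (fun w => 2 * rB k δ u w + 2^(k+1) * ((k:ℝ)+1)^2 * vh k δ u w ^ 2) (sg k) := (hB.1.const_mul 2).add (D.vdata.v2_int.const_mul _)
  refine (norm_integral_le_of_norm_le hr ?_).trans (le_of_eq ?_)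
  · filter_upwards [ae_sg k, hwle] with w hw hwl
    have hx := D.X_eq hM hw
    have e : w i * (∫ r in (1-δ)..(1+δ), u (r • w) * r ^ (k+1)) - w i * vh k δ u w - c * w i = w i * ((∫ r in (1-δ)..(1+δ), u (r • w) * r ^ (k+1)) - vh k δ u w - c) := by ring
    rw [e, Real.norm_eq_abs, abs_mul]
    exact (mul_le_of_le_one_left (abs_nonneg _) hwl).trans hx
  · rw [integral_add (hB.1.const_mul 2) (D.vdata.v2_int.const_mul _), integral_const_mul, integral_const_mul]

end UData

theorem comb_arith {K S μ I Φ Bad G X κ Cg Q Ce Sm η : ℝ} (hK : 0 ≤ K) (hI : 0 ≤ I) (hΦ : 0 ≤ Φ) (hBad : 0 ≤ Bad) (hCg : 0 ≤ Cg)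
    (hη : η = 1/(16*(K+1))) (hκ : 1 - η ≤ κ)
    (h1 : S + K*μ - K/2*(1+1/(8*(K+1)))*I + 2*Bad + κ*Φ ≤ G + X)
    (h2 : (K/2+1/4)*I ≤ Φ + Cg*(μ^2 + Sm)) (hμ : Cg*μ^2 ≤ |μ|) (hSm : Cg*Sm ≤ Q*(2*Bad+Ce*I)) (hQ : Q*2 ≤ 1) (hQ2 : Q*Ce ≤ 1/16) (hSm0 : 0 ≤ Sm) :
    S + η*Φ + 1/16*I + Bad ≤ G + X + (K+1)*|μ| := by
  have hη0 : 0 < η := by rw [hη]; positivity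
  have hη1 : η ≤ 1/16 := by rw [hη]; gcongr; linarith
  have e1 : 2*η*(K/2+1/4) ≤ 1/16 := by
    rw [hη, ← sub_nonneg]
    have : 1/16 - 2*(1/(16*(K+1)))*(K/2+1/4) = 1/(32*(K+1)) := by field_simp; ring
    rw [this]; positivity
  have e2 : K/2*(1/(8*(K+1))) ≤ 1/16 := by
    rw [← sub_nonneg]
    have : 1/16 - K/2*(1/(8*(K+1))) = 1/(16*(K+1)) := by field_simp; ring
    rw [this]; positivity
  have a1 : (1-η)*Φ ≤ κ*Φ := by gcongr
  have a2 : (1-2*η)*((K/2+1/4)*I) ≤ (1-2*η)*(Φ + Cg*(μ^2+Sm)) := by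
    apply mul_le_mul_of_nonneg_left h2; linarith
  have a3 : (1-2*η)*(Cg*(μ^2+Sm)) ≤ Cg*(μ^2+Sm) := by
    have : 0 ≤ Cg*(μ^2+Sm) := by positivity
    nlinarith
  have a4 : 2*η*(K/2+1/4)*I ≤ 1/16*I := by gcongr
  have a5 : K/2*(1/(8*(K+1)))*I ≤ 1/16*I := by gcongr
  have a6 : Q*Ce*I ≤ 1/16*I := by gcongr
  have a7 : Q*2*Bad ≤ 1*Bad := by gcongr
  have a8 : -(K*|μ|) ≤ K*μ := by nlinarith [neg_abs_le μ]
  nlinarith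

theorem fin_arith {K S η Φ I Bad G c Pen μ Cr t c0 V VA : ℝ} (hK : 0 ≤ K) (hI : 0 ≤ I) (hΦ : 0 ≤ Φ) (hCr : 0 ≤ Cr) (hη : η ≤ 1/16) (hc : 0 ≤ c) (hPen : 0 ≤ Pen)
    (h : S + η*Φ + 1/16*I + Bad ≤ G + c*Pen + (K+1)*|μ|) (hV : V ≤ VA + Cr*(I+Φ+|μ|)) (ht : 0 ≤ t) (htc : t ≤ c0) (hc0 : c0*Cr ≤ η) :
    S + t*V + Bad ≤ G + t*VA + (K+2+c)*(|μ|+Pen) := by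
  have h1 : t*V ≤ t*(VA + Cr*(I+Φ+|μ|)) := by gcongr
  have hm := abs_nonneg μ
  have h2 : t*Cr ≤ η := (mul_le_mul_of_nonneg_right htc hCr).trans hc0
  have h3 : t*Cr*(I+Φ+|μ|) ≤ η*(I+Φ+|μ|) := by gcongr
  have h4 : η*(I + |μ|) ≤ 1/16*(I+|μ|) := by gcongr
  have h5 : 0 ≤ c*|μ| := by positivity
  have h6 : 0 ≤ (K+2)*Pen := by positivity
  nlinarith

theorem exists_delta (k : ℕ) {τ ε η : ℝ} (hτ : 0 < τ) (hε : 0 < ε) (hη : 0 < η) : ∃ δ : ℝ, 0 < δ ∧ δ ≤ 1/2 ∧ (1 + 4 * δ) * (1+δ)^k ≤ 2 * (1-δ)^k ∧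
    ((1+δ)^(k+1) - (1-δ)^(k+1)) / ((k:ℝ)+1) ≤ τ ∧ 1 ≤ (1+ε) * (1-δ)^(k+1) ∧ (1-η) * (((1+4*δ)*(1+δ)^k) * (1+δ)^2) ≤ 1 := by
  have ev : ∀ (f g : ℝ → ℝ), Continuous f → Continuous g → f 0 < g 0 → ∀ᶠ δ in nhdsWithin 0 (Set.Ioi 0), f δ ≤ g δ := by
    intro f g hf hg h
    have := (isOpen_lt hf hg).mem_nhds (show (0:ℝ) ∈ {b | f b < g b} from h)
    filter_upwards [nhdsWithin_le_nhds this] with x hx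
    exact le_of_lt hx
  have h1 := ev (fun δ => δ) (fun _ => 1/2) (by fun_prop) (by fun_prop) (by norm_num)
  have h2 := ev (fun δ => (1 + 4 * δ) * (1+δ)^k) (fun δ => 2 * (1-δ)^k) (by fun_prop) (by fun_prop) (by norm_num)
  have h3 := ev (fun δ => ((1+δ)^(k+1) - (1-δ)^(k+1)) / ((k:ℝ)+1)) (fun _ => τ) (by fun_prop) (by fun_prop) (by simpa using hτ)
  have h4 := ev (fun _ => 1) (fun δ => (1+ε) * (1-δ)^(k+1)) (by fun_prop) (by fun_prop) (by simpa using hε)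
  have h5 := ev (fun δ => (1-η) * (((1+4*δ)*(1+δ)^k) * (1+δ)^2)) (fun _ => 1) (by fun_prop) (by fun_prop) (by simpa using hη)
  have h6 : ∀ᶠ δ in nhdsWithin (0:ℝ) (Set.Ioi 0), 0 < δ := self_mem_nhdsWithin
  obtain ⟨δ, h⟩ := (h6.and (h1.and (h2.and (h3.and (h4.and h5))))).exists
  exact ⟨δ, h⟩

theorem UData.low {k : ℕ} {δ : ℝ} {u : Eu (k+1) → ℝ} (hk : 1 ≤ k) {ε κ : ℝ} (D : UData k δ u) (hM : SmallAn k δ)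
    (hsm : (1 + 4 * δ) * (1+δ)^k ≤ 2 * (1-δ)^k) (hε : 0 ≤ ε) (hε2 : 1 ≤ (1+ε) * (1-δ)^(k+1)) (hκ : κ * (((1+4*δ)*(1+δ)^k) * (1+δ)^2) ≤ 1) :
    (sg k).real Set.univ + k * (∫ w, vh k δ u w ∂(sg k)) - (k:ℝ)/2*(1+ε) * (∫ w, vh k δ u w ^ 2 ∂(sg k)) + 2 * (∫ w, rB k δ u w ∂(sg k)) +
      κ * (∫ w, ph (VData.gr (vh k δ u) w) ∂(sg k)) ≤ (∫ x, ‖fderiv ℝ u x‖) + (16+32*k) * ∫ x, u x * (1 - u x) := by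
  have h1 := D.hδ
  have h2 := D.hδ2
  have hB := D.bad_ann hM
  have hG := D.grad_ann
  have hP := D.pen_ann
  have i1 := (D.vdata.v_int.const_mul (k:ℝ))
  have i2 := (D.vdata.v2_int.const_mul ((k:ℝ)/2*(1+ε)))
  have i3 := hB.1.const_mul 2
  have i4 := D.vdata.ph_int.const_mul κ
  have i0 : Integrable (fun _ : Eu (k+1) => (1:ℝ)) (sg k) := integrable_const 1
  have j1 : Integrable (fun w => 1 + (k:ℝ) * vh k δ u w) (sg k) := i0.add i1
  have j2 : Integrable (fun w => 1 + (k:ℝ) * vh k δ u w - (k:ℝ)/2*(1+ε) * vh k δ u w ^ 2) (sg k) := j1.sub i2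
  have j3 : Integrable (fun w => 1 + (k:ℝ) * vh k δ u w - (k:ℝ)/2*(1+ε) * vh k δ u w ^ 2 + 2 * rB k δ u w) (sg k) := j2.add i3
  have j4 : Integrable (fun w => 1 + (k:ℝ) * vh k δ u w - (k:ℝ)/2*(1+ε) * vh k δ u w ^ 2 + 2 * rB k δ u w + κ * ph (VData.gr (vh k δ u) w)) (sg k) := j3.add i4
  have i5 := hP.1.const_mul (16+32*(k:ℝ))
  have j5 : Integrable (fun w => rI k δ (fun x => ‖fderiv ℝ u x‖) w + (16+32*(k:ℝ)) * rI k δ (fun x => u x * (1 - u x)) w) (sg k) := hG.1.add i5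
  have := integral_mono_ae j4 j5 (by
    filter_upwards [ae_sg k] with w hw
    have hl := D.ray_low hM hsm hw
    have ha := apow hk (show 0 < 1-δ by linarith) (by linarith) (D.rdata hM hw).ha1 hε hε2 (D.vdata.av_pow hM w)
    have hb : κ * ph (VData.gr (vh k δ u) w) ≤ ph (VData.gr (vh k δ u) w) / (((1+4*δ)*(1+δ)^k) * (1+δ)^2) := by
      rw [le_div_iff₀ (by positivity)]
      have := mul_le_mul_of_nonneg_left hκ (ph_nonneg (VData.gr (vh k δ u) w))
      linarith
    beta_reduce
    linarith)
  rw [integral_add j3 i4, integral_add j2 i3, integral_sub j1 i2, integral_add i0 i1, integral_add hG.1 i5, integral_const_mul, integral_const_mul, integral_const_mul,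
    integral_const_mul, integral_const_mul, integral_const, smul_eq_mul, mul_one, ← hG.2, ← hP.2] at this
  exact this

set_option maxHeartbeats 1000000 in
theorem ana_core {k : ℕ} {α : ℝ} (hk : 1 ≤ k) (hα0 : 0 < α) (hα : α < (k+1:ℕ)) : AnaCore k α := by
  obtain ⟨Cr, hCr, hR⟩ := VData.riesz_low (k := k) hα0 hα
  obtain ⟨Cg, hCg, M0, hM0, hgap⟩ := VData.gap (k := k) hk
  set S := (sg k).real Set.univ with hS
  have hS0 : 0 < S := VData.sg_pos k
  set n : ℝ := (k:ℝ)+1 with hn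
  have hn1 : 1 ≤ n := by rw [hn]; linarith [(Nat.cast_nonneg k : (0:ℝ) ≤ k)]
  set Ce : ℝ := 2^(k+1) * n^2 with hCe
  have hCe0 : 0 < Ce := by positivity
  set η : ℝ := 1/(16*((k:ℝ)+1)) with hη
  have hη0 : 0 < η := by positivity
  set q : ℝ := Cg * n * S + 1 with hq
  have hq0 : 0 < q := by positivity
  obtain ⟨δ, hδ, hδ2, hsm, hM, hε2, hκ⟩ := exists_delta k (τ := min (1/(4*((k:ℝ)+1))) (min M0 (min (1/(2*q)) (1/(16*Ce*q))))) (ε := 1/(8*((k:ℝ)+1))) (η := η)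
    (by positivity) (by positivity) hη0
  rw [le_min_iff, le_min_iff, le_min_iff] at hM
  obtain ⟨hM1, hM2, hM3, hM4⟩ := hM
  set M := ((1+δ)^(k+1) - (1-δ)^(k+1)) / ((k:ℝ)+1) with hMdef
  refine ⟨δ, hδ, hδ2, η/(Cr+1), by positivity, (k:ℝ)+2+(16+32*k), by positivity, ?_⟩
  intro u hu h01 h1 h0 hbar
  have D : UData k δ u := ⟨hδ, hδ2, hu, h01, h1, h0⟩
  refine ⟨{x | ‖x‖ < av (vh k δ u) x}, D.A_meas, D.A_sub hM1, fun t ht htc => ?_⟩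
  have V := D.vdata
  have hMpos : 0 ≤ M := V.M0
  have hlow := D.low hk hM1 hsm (by positivity) hε2 hκ
  have hg := hgap _ _ V hM2
  have hr := hR _ _ V hM1
  have hmu := D.mu_eq
  have hB := (D.bad_ann hM1).2
  rw [hB, ← hmu, ← sg_real]
  have hI0 : 0 ≤ ∫ w, vh k δ u w ^ 2 ∂(sg k) := integral_nonneg fun w => sq_nonneg _
  have hΦ0 : 0 ≤ ∫ w, ph (VData.gr (vh k δ u) w) ∂(sg k) := integral_nonneg fun w => ph_nonneg _
  have hBad0 : 0 ≤ ∫ w, rB k δ u w ∂(sg k) := by rw [← hB]; exact integral_nonneg fun w => abs_nonneg _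
  have hPen0 : 0 ≤ ∫ x, u x * (1 - u x) := integral_nonneg fun x => mul_nonneg (h01 x).1 (by linarith [(h01 x).2])
  have hmuS : |∫ w, vh k δ u w ∂(sg k)| ≤ M * S := by
    rw [← Real.norm_eq_abs]; exact norm_integral_le_of_norm_le_const (Eventually.of_forall V.bdd)
  have hmode := fun i => D.mode hM1 hbar i
  have hmodeS : ∀ i, |∫ w, w i * vh k δ u w ∂(sg k)| ≤ M * S := fun i => by
    rw [← Real.norm_eq_abs]
    refine norm_integral_le_of_norm_le_const ?_
    filter_upwards [ae_sg k] with w hw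
    have : ‖w i‖ ≤ 1 := by rw [← hw]; exact PiLp.norm_apply_le w i
    rw [norm_mul]
    calc ‖w i‖ * ‖vh k δ u w‖ ≤ 1 * M := mul_le_mul this (V.bdd w) (norm_nonneg _) zero_le_one
      _ = M := one_mul _
  set I := ∫ w, vh k δ u w ^ 2 ∂(sg k)
  set Φ := ∫ w, ph (VData.gr (vh k δ u) w) ∂(sg k)
  set Bad := ∫ w, rB k δ u w ∂(sg k)
  set μ := ∫ w, vh k δ u w ∂(sg k)
  have hq1 : q - 1 = Cg * n * S := by rw [hq]; ring
  clear_value I Φ Bad μ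
  have hqM : q * M * 2 ≤ 1 := by
    calc q * M * 2 ≤ q * (1/(2*q)) * 2 := by gcongr
      _ = 1 := by field_simp
  have hqM2 : q * M * Ce ≤ 1/16 := by
    calc q * M * Ce ≤ q * (1/(16*Ce*q)) * Ce := by gcongr
      _ = 1/16 := by field_simp
  have hμ2 : Cg * μ^2 ≤ |μ| := by
    have a1 : Cg * (M * S) ≤ 1 := by
      have : Cg * S ≤ q := by
        have : Cg * 1 * S ≤ Cg * n * S := by gcongr
        rw [hq]; linarith
      have h3 : Cg * S * M ≤ q * M := by gcongr
      have h4 : 0 ≤ q * M := by positivity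
      have h5 : Cg * (M * S) = Cg * S * M := by ring
      rw [h5]; linarith only [h3, h4, hqM]
    calc Cg * μ^2 = Cg * |μ| * |μ| := by rw [← sq_abs]; ring
      _ ≤ Cg * (M * S) * |μ| := by gcongr
      _ ≤ 1 * |μ| := by gcongr
      _ = |μ| := one_mul _
  have hsum : Cg * ∑ i, (∫ w, w i * vh k δ u w ∂(sg k))^2 ≤ q * M * (2 * Bad + Ce * I) := by
    have a1 : ∑ i, (∫ w, w i * vh k δ u w ∂(sg k))^2 ≤ ∑ _i : Fin (k+1), M * S * (2 * Bad + Ce * I) := by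
      refine Finset.sum_le_sum fun i _ => ?_
      rw [← sq_abs, sq]
      exact mul_le_mul (hmodeS i) (hmode i) (abs_nonneg _) (by positivity)
    rw [Finset.sum_const, Finset.card_univ, Fintype.card_fin, nsmul_eq_mul, Nat.cast_add, Nat.cast_one, ← hn] at a1
    have a2 : 0 ≤ M * (2 * Bad + Ce * I) := by positivity
    calc Cg * ∑ i, (∫ w, w i * vh k δ u w ∂(sg k))^2 ≤ Cg * (n * (M * S * (2 * Bad + Ce * I))) := by gcongr
      _ = (q - 1) * (M * (2 * Bad + Ce * I)) := by rw [hq1]; ring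
      _ ≤ q * (M * (2 * Bad + Ce * I)) := mul_le_mul_of_nonneg_right (sub_le_self _ zero_le_one) a2
      _ = _ := by ring
  have hcomb := comb_arith (Nat.cast_nonneg k) hI0 hΦ0 hBad0 hCg hη le_rfl hlow hg hμ2 hsum hqM hqM2 (Finset.sum_nonneg fun i _ => sq_nonneg _)
  have hη1 : η ≤ 1/16 := by rw [hη]; gcongr; linarith
  refine fin_arith (Nat.cast_nonneg k) hI0 hΦ0 hCr hη1 (by positivity) hPen0 hcomb hr ht htc ?_
  rw [div_mul_eq_mul_div, div_le_iff₀ (by positivity)]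
  exact mul_le_mul_of_nonneg_left (le_add_of_nonneg_right zero_le_one) hη0.le

end

/-- If `α = β`, then either there is a critical mass `m⋆ > 0` below which balls are
`L¹`-local minimizers and above which they are not, or balls are `L¹`-local minimizers
for every mass. -/
theorem statement5 (n : ℕ) (hn : 2 ≤ n) (α β A : ℝ)
    (hα0 : 0 < α) (hαn : α < n) (hβ : 0 < β) (hA : 0 < A) (hαβ : α = β) :
    (∃ mstar : ℝ, 0 < mstar ∧
      (∀ m, 0 < m → m < mstar → IsL1LocalMin α β A m (ballOfVolume n m)) ∧
      (∀ m, mstar < m → ¬ IsL1LocalMin α β A m (ballOfVolume n m))) ∨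
    (∀ m : ℝ, 0 < m → IsL1LocalMin α β A m (ballOfVolume n m)) := by
  subst hαβ
  obtain ⟨k, rfl⟩ : ∃ k, n = k + 1 := ⟨n - 1, by omega⟩
  exact final_of_core hn hα0 hA (core_of_ana (by omega) hα0 (by push_cast at hαn; exact hαn) (ana_core (by omega) hα0 hαn))
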